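/- For every ε > 0 there exists a constant C_ε > 0 such that the following holds. Let β ∈ [1/3,1], let 2 ≤ p ≤ 6 + 2/β, let R ≥ 2 and r ≥ R^{max(2β,1)}, let Q_r be any cube in ℝ³ of side length r, let Ξ ⊂ [0,1] be a finite set with #Ξ ≤ R^β whose points are pairwise separated by at least R^{−β}, and let a_ξ ∈ ℂ satisfy |a_ξ| ≤ 1 for every ξ ∈ Ξ. Then |Q_r|^{−1} ∫_{Q_r} |∑_{ξ∈Ξ} a_ξ e(x·(ξ,ξ²,ξ³))|^p dx ≤ C_ε R^{βp/2 + ε}. -/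

import Mathlib

open MeasureTheory Real Complex Set Finset

noncomputable section

abbrev R3 : Type := EuclideanSpace ℝ (Fin 3)

/-- `e(t) = e^{2πit}`. -/
def e (t : ℝ) : ℂ := Complex.exp (2 * (Real.pi : ℂ) * Complex.I * (t : ℂ))

/-- The axis-parallel cube in ℝ³ with corner `c` and side length `r`. -/
def cube (c : R3) (r : ℝ) : Set R3 := {x | ∀ i, x i ∈ Set.Icc (c i) (c i + r)}

/-! ### Part 1: abstract parabola decoupling -/
section PD

variable {Ω : Type*} [MeasurableSpace Ω]

/-- bounded measurable functions -/
def BM (f : Ω → ℂ) : Prop := Measurable f ∧ ∃ C : ℝ, ∀ w, ‖f w‖ ≤ C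

theorem BM.mul {f g : Ω → ℂ} (hf : BM f) (hg : BM g) : BM (fun w => f w * g w) := by
  obtain ⟨hf, C, hC⟩ := hf
  obtain ⟨hg, D, hD⟩ := hg
  refine ⟨hf.mul hg, C * D, fun w => ?_⟩
  rw [norm_mul]
  exact mul_le_mul (hC w) (hD w) (norm_nonneg _) ((norm_nonneg _).trans (hC w))

theorem BM.conj {f : Ω → ℂ} (hf : BM f) : BM (fun w => (starRingEnd ℂ) (f w)) := by
  obtain ⟨hf, C, hC⟩ := hf
  refine ⟨Complex.continuous_conj.measurable.comp hf, C, fun w => ?_⟩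
  simpa using hC w

theorem BM.sum {ι : Type*} {s : Finset ι} {g : ι → Ω → ℂ} (h : ∀ i ∈ s, BM (g i)) :
    BM (fun w => ∑ i ∈ s, g i w) := by
  classical
  induction s using Finset.induction_on with
  | empty => exact ⟨by simp, 0, by simp⟩
  | insert a s ha ih =>
    obtain ⟨h1, C, hC⟩ := h a (Finset.mem_insert_self a s)
    obtain ⟨h2, D, hD⟩ := ih (fun i hi => h i (Finset.mem_insert_of_mem hi))
    simp only [Finset.sum_insert ha]
    exact ⟨h1.add h2, C + D, fun w => (norm_add_le _ _).trans (add_le_add (hC w) (hD w))⟩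

theorem BM.int {f : Ω → ℂ} (hf : BM f) (μ : Measure Ω) [IsFiniteMeasure μ] : Integrable f μ := by
  obtain ⟨hf, C, hC⟩ := hf
  exact Integrable.of_bound hf.aestronglyMeasurable C (Filter.Eventually.of_forall hC)

theorem BM.int_pow {f g : Ω → ℂ} (hf : BM f) (hg : BM g) (a b : ℕ) (μ : Measure Ω)
    [IsFiniteMeasure μ] : Integrable (fun w => ‖f w‖ ^ a * ‖g w‖ ^ b) μ := by
  obtain ⟨hf, C, hC⟩ := hf
  obtain ⟨hg, D, hD⟩ := hg
  refine Integrable.of_bound ((hf.norm.pow_const a).mul (hg.norm.pow_const b)).aestronglyMeasurable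
    (C ^ a * D ^ b) (Filter.Eventually.of_forall fun w => ?_)
  rw [norm_mul, norm_pow, norm_pow, norm_norm, norm_norm]
  have hC0 := (norm_nonneg _).trans (hC w)
  gcongr
  · exact hC w
  · exact hD w

theorem BM.int_pow1 {f : Ω → ℂ} (hf : BM f) (a : ℕ) (μ : Measure Ω)
    [IsFiniteMeasure μ] : Integrable (fun w => ‖f w‖ ^ a) μ := by
  simpa using hf.int_pow hf a 0 μ

theorem int_sum_zero {ι : Type*} {s : Finset ι} {g : ι → Ω → ℂ} (μ : Measure Ω) [IsFiniteMeasure μ]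
    (h : ∀ i ∈ s, BM (g i)) {k : Ω → ℂ} (hk : BM k) (hz : ∀ i ∈ s, ∫ w, k w * g i w ∂μ = 0) :
    ∫ w, k w * (∑ i ∈ s, g i w) ∂μ = 0 := by
  simp only [Finset.mul_sum]
  rw [integral_finsetSum _ (fun i hi => ((hk.mul (h i hi)).int μ))]
  exact Finset.sum_eq_zero hz

/-- dyadic index -/
def dix (y : ℝ) (l : ℕ) : ℕ := ⌊(2:ℝ) ^ l * y⌋₊

theorem dix_div (y : ℝ) (l m : ℕ) : dix y (l + m) / 2 ^ m = dix y l := by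
  unfold dix
  have := Nat.floor_div_natCast ((2:ℝ) ^ (l + m) * y) (2 ^ m)
  rw [← this]
  congr 1
  push_cast
  rw [pow_add]; field_simp

theorem dix_bounds {y : ℝ} (hy : 0 ≤ y) (l : ℕ) :
    (dix y l : ℝ) ≤ 2 ^ l * y ∧ 2 ^ l * y < dix y l + 1 :=
  ⟨Nat.floor_le (by positivity), Nat.lt_floor_add_one _⟩

variable {ι : Type*}

/-- partial sum over dyadic arc -/
def dF (s : Finset ι) (g : ι → Ω → ℂ) (y : ι → ℝ) (l j : ℕ) (w : Ω) : ℂ :=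
  ∑ i ∈ s with dix (y i) l = j, g i w

theorem dF_BM {s : Finset ι} {g : ι → Ω → ℂ} {y : ι → ℝ} (h : ∀ i ∈ s, BM (g i)) (l j : ℕ) :
    BM (dF s g y l j) :=
  BM.sum (fun i hi => h i (Finset.mem_filter.1 hi).1)

theorem dF_split (s : Finset ι) (g : ι → Ω → ℂ) (y : ι → ℝ) (l m j : ℕ) (w : Ω) :
    dF s g y l j w = ∑ i ∈ Finset.Ico (j * 2 ^ m) ((j + 1) * 2 ^ m), dF s g y (l + m) i w := by
  classical
  unfold dF
  rw [← Finset.sum_fiberwise_of_maps_to (s := s.filter (fun i => dix (y i) l = j))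
    (t := Finset.Ico (j * 2 ^ m) ((j + 1) * 2 ^ m)) (g := fun i => dix (y i) (l + m))]
  · apply Finset.sum_congr rfl
    intro i hi
    apply Finset.sum_congr _ (fun _ _ => rfl)
    ext a
    simp only [Finset.mem_filter, Finset.mem_Ico] at hi ⊢
    constructor
    · rintro ⟨⟨h1, h2⟩, h3⟩; exact ⟨h1, h3⟩
    · rintro ⟨h1, h3⟩
      refine ⟨⟨h1, ?_⟩, h3⟩
      rw [← dix_div (y a) l m, h3]
      apply Nat.div_eq_of_lt_le <;> omega
  · intro i hi
    simp only [Finset.mem_filter, Finset.mem_Ico] at hi ⊢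
    rw [← dix_div (y i) l m] at hi
    have h0 : 0 < 2 ^ m := by positivity
    rw [← hi.2]
    exact ⟨Nat.div_mul_le_self _ _, by
      have := Nat.lt_div_mul_add (a := dix (y i) (l+m)) h0
      rw [add_mul, one_mul]; exact this⟩

/-- the six-fold integral -/
def six (μ : Measure Ω) (g1 g2 g3 g4 g5 g6 : Ω → ℂ) : ℂ :=
  ∫ w, g1 w * g2 w * g3 w * (starRingEnd ℂ) (g4 w) * (starRingEnd ℂ) (g5 w)
    * (starRingEnd ℂ) (g6 w) ∂μ

/-- orthogonality hypothesis of PD -/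
def PDHyp (μ : Measure Ω) (s : Finset ι) (g : ι → Ω → ℂ) (y : ι → ℝ) (n : ℕ) : Prop :=
  ∀ i1 ∈ s, ∀ i2 ∈ s, ∀ i3 ∈ s, ∀ i4 ∈ s, ∀ i5 ∈ s, ∀ i6 ∈ s, ∀ t ∈ Set.Icc (0:ℝ) 1,
    ((4:ℝ) ^ n)⁻¹ < |(y i1 - t)^2 + (y i2 - t)^2 + (y i3 - t)^2 - (y i4 - t)^2 - (y i5 - t)^2
      - (y i6 - t)^2| →
    six μ (g i1) (g i2) (g i3) (g i4) (g i5) (g i6) = 0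

theorem six_sum_zero (μ : Measure Ω) [IsFiniteMeasure μ] {s1 s2 s3 s4 s5 s6 : Finset ι}
    {g : ι → Ω → ℂ} (h : ∀ i, BM (g i))
    (hz : ∀ i1 ∈ s1, ∀ i2 ∈ s2, ∀ i3 ∈ s3, ∀ i4 ∈ s4, ∀ i5 ∈ s5, ∀ i6 ∈ s6,
      six μ (g i1) (g i2) (g i3) (g i4) (g i5) (g i6) = 0) :
    six μ (fun w => ∑ i ∈ s1, g i w) (fun w => ∑ i ∈ s2, g i w) (fun w => ∑ i ∈ s3, g i w)
      (fun w => ∑ i ∈ s4, g i w) (fun w => ∑ i ∈ s5, g i w) (fun w => ∑ i ∈ s6, g i w) = 0 := by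
  unfold six at *
  have hS : ∀ t : Finset ι, BM (fun w => ∑ i ∈ t, g i w) := fun t => BM.sum (fun i _ => h i)
  have hc : ∀ i, BM (fun w => (starRingEnd ℂ) (g i w)) := fun i => (h i).conj
  have hT : ∀ t : Finset ι, BM (fun w => ∑ i ∈ t, (starRingEnd ℂ) (g i w)) :=
    fun t => BM.sum (fun i _ => hc i)
  simp only [map_sum]
  refine int_sum_zero μ (fun i _ => hc i)
    (((((hS _).mul (hS _)).mul (hS _)).mul (hT _)).mul (hT _)) fun i6 h6 => ?_
  simp_rw [mul_right_comm _ (∑ i ∈ s5, (starRingEnd ℂ) (g i _))]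
  refine int_sum_zero μ (fun i _ => hc i)
    (((((hS _).mul (hS _)).mul (hS _)).mul (hT _)).mul (hc _)) fun i5 h5 => ?_
  simp_rw [mul_right_comm _ (∑ i ∈ s4, (starRingEnd ℂ) (g i _))]
  refine int_sum_zero μ (fun i _ => hc i)
    (((((hS _).mul (hS _)).mul (hS _)).mul (hc _)).mul (hc _)) fun i4 h4 => ?_
  simp_rw [mul_right_comm _ (∑ i ∈ s3, (g i _))]
  refine int_sum_zero μ (fun i _ => h i)
    (((((hS _).mul (hS _)).mul (hc _)).mul (hc _)).mul (hc _)) fun i3 h3 => ?_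
  simp_rw [mul_right_comm _ (∑ i ∈ s2, (g i _))]
  refine int_sum_zero μ (fun i _ => h i)
    (((((hS _).mul (hc _)).mul (hc _)).mul (hc _)).mul (h _)) fun i2 h2 => ?_
  simp_rw [mul_comm (∑ i ∈ s1, (g i _)), mul_right_comm _ (∑ i ∈ s1, (g i _))]
  refine int_sum_zero μ (fun i _ => h i)
    (((((hc _).mul (hc _)).mul (hc _)).mul (h _)).mul (h _)) fun i1 h1 => ?_
  rw [← hz i1 h1 i2 h2 i3 h3 i4 h4 i5 h5 i6 h6]
  congr 1; ext w; ring
end PD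

section PD2
variable {Ω : Type*} [MeasurableSpace Ω]

theorem six_diag_le (μ : Measure Ω) [IsFiniteMeasure μ] {f g V : Ω → ℂ} (hf : BM f) (hg : BM g)
    (hV : BM V) {Mx : ℝ} (h1 : ∫ w, ‖f w‖^2 * ‖V w‖^4 ∂μ ≤ Mx)
    (h2 : ∫ w, ‖g w‖^2 * ‖V w‖^4 ∂μ ≤ Mx) : ‖six μ f V V g V V‖ ≤ Mx := by
  unfold six
  refine (norm_integral_le_integral_norm _).trans ?_
  have : ∫ w, ‖f w * V w * V w * (starRingEnd ℂ) (g w) * (starRingEnd ℂ) (V w)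
      * (starRingEnd ℂ) (V w)‖ ∂μ ≤ ∫ w, (1/2) * (‖f w‖^2 * ‖V w‖^4)
        + (1/2) * (‖g w‖^2 * ‖V w‖^4) ∂μ := by
    apply integral_mono
    · exact ((((((hf.mul hV).mul hV).mul hg.conj).mul hV.conj).mul hV.conj).int μ).norm
    · exact ((hf.int_pow hV 2 4 μ).const_mul _).add ((hg.int_pow hV 2 4 μ).const_mul _)
    · intro w
      simp only [norm_mul, RCLike.norm_conj]
      have h0 : 0 ≤ ‖V w‖^4 := by positivity
      nlinarith [mul_nonneg h0 (sq_nonneg (‖f w‖ - ‖g w‖))]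
  refine this.trans ?_
  rw [integral_add ((hf.int_pow hV 2 4 μ).const_mul _) ((hg.int_pow hV 2 4 μ).const_mul _),
    integral_const_mul, integral_const_mul]
  linarith

theorem near_orth (μ : Measure Ω) [IsFiniteMeasure μ] (T : Finset ℕ) {G : ℕ → Ω → ℂ} {V : Ω → ℂ}
    (hG : ∀ i, BM (G i)) (hV : BM V) (D : ℕ) {Mx : ℝ} (hMx : 0 ≤ Mx)
    (hz : ∀ i ∈ T, ∀ j ∈ T, (i + D < j ∨ j + D < i) → six μ (G i) V V (G j) V V = 0)
    (hM : ∀ i ∈ T, ∫ w, ‖G i w‖^2 * ‖V w‖^4 ∂μ ≤ Mx) :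
    ∫ w, ‖∑ i ∈ T, G i w‖^2 * ‖V w‖^4 ∂μ ≤ (2 * D + 1) * T.card * Mx := by
  have key : ((∫ w, ‖∑ i ∈ T, G i w‖^2 * ‖V w‖^4 ∂μ : ℝ) : ℂ)
      = ∑ i ∈ T, ∑ j ∈ T, six μ (G i) V V (G j) V V := by
    rw [← integral_complex_ofReal]
    unfold six
    have hb : ∀ i j, BM (fun w => G i w * V w * V w * (starRingEnd ℂ) (G j w) * (starRingEnd ℂ) (V w)
      * (starRingEnd ℂ) (V w)) := fun i j =>
        ((((((hG i).mul hV).mul hV).mul (hG j).conj).mul hV.conj).mul hV.conj)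
    simp_rw [← fun i => integral_finsetSum T (fun j _ => (hb i j).int μ)]
    rw [← integral_finsetSum T (fun i _ => (BM.sum (s := T) (fun j _ => hb i j)).int μ)]
    congr 1; ext w
    have e1 : ((‖∑ i ∈ T, G i w‖^2 * ‖V w‖^4 : ℝ) : ℂ)
      = (∑ i ∈ T, G i w) * (∑ j ∈ T, (starRingEnd ℂ) (G j w)) *
        (V w * (starRingEnd ℂ) (V w)) * (V w * (starRingEnd ℂ) (V w)) := by
      rw [← map_sum, Complex.mul_conj, Complex.mul_conj, Complex.normSq_eq_norm_sq,
        Complex.normSq_eq_norm_sq]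
      push_cast; ring
    rw [e1, Finset.sum_mul_sum]
    simp only [Finset.sum_mul]
    refine Finset.sum_congr rfl fun i _ => Finset.sum_congr rfl fun j _ => ?_
    ring
  have : ∫ w, ‖∑ i ∈ T, G i w‖^2 * ‖V w‖^4 ∂μ ≤ ‖∑ i ∈ T, ∑ j ∈ T, six μ (G i) V V (G j) V V‖ := by
    rw [← key, Complex.norm_real]; exact le_abs_self _
  refine this.trans ?_
  have h2 : ∀ i ∈ T, ‖∑ j ∈ T, six μ (G i) V V (G j) V V‖ ≤ (2 * D + 1) * Mx := by
    intro i hi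
    refine (norm_sum_le _ _).trans ?_
    have : ∑ j ∈ T, ‖six μ (G i) V V (G j) V V‖ ≤
        ∑ j ∈ T, if j ∈ Finset.Icc (i - D) (i + D) then Mx else 0 := by
      refine Finset.sum_le_sum fun j hj => ?_
      split_ifs with hc
      · exact six_diag_le μ (hG i) (hG j) hV (hM i hi) (hM j hj)
      · rw [hz i hi j hj (by rw [Finset.mem_Icc] at hc; omega), norm_zero]
    refine this.trans ?_
    rw [← Finset.sum_filter, Finset.sum_const, nsmul_eq_mul]
    gcongr
    have : #{j ∈ T | j ∈ Finset.Icc (i - D) (i + D)} ≤ 2 * D + 1 := by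
      refine (Finset.card_le_card (t := Finset.Icc (i - D) (i + D)) fun j hj =>
        (Finset.mem_filter.1 hj).2).trans ?_
      rw [Nat.card_Icc]; omega
    exact_mod_cast this
  refine (norm_sum_le_of_le _ h2).trans ?_
  rw [Finset.sum_const, nsmul_eq_mul]
  apply le_of_eq; ring

/-- Cauchy-Schwarz step -/
theorem PD_H (μ : Measure Ω) [IsFiniteMeasure μ] {f g : Ω → ℂ} (hf : BM f) (hg : BM g)
    {A x z : ℝ} (h1 : ∫ w, ‖g w‖^2 * ‖f w‖^4 ∂μ ≤ A * 2 ^ x)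
    (h2 : ∫ w, ‖g w‖^6 ∂μ ≤ A * 2 ^ z) :
    ∫ w, ‖f w‖^2 * ‖g w‖^4 ∂μ ≤ A * 2 ^ ((x + z)/2) := by
  set l : ℝ := 2 ^ ((z - x)/2) with hl
  have hl0 : 0 < l := by positivity
  have : ∫ w, ‖f w‖^2 * ‖g w‖^4 ∂μ ≤ ∫ w, (l/2) * (‖g w‖^2 * ‖f w‖^4)
        + (l⁻¹/2) * (‖g w‖^6) ∂μ := by
    apply integral_mono
    · exact hf.int_pow hg 2 4 μ
    · exact ((hg.int_pow hf 2 4 μ).const_mul _).add ((hg.int_pow1 6 μ).const_mul _)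
    · intro w
      have h0 : 0 ≤ ‖g w‖^2 * l⁻¹/2 := by positivity
      have := mul_nonneg h0 (sq_nonneg (l * ‖f w‖^2 - ‖g w‖^2))
      have hli : l * l⁻¹ = 1 := mul_inv_cancel₀ hl0.ne'
      have e1 : ‖g w‖^2 * l⁻¹/2 * (l * ‖f w‖^2 - ‖g w‖^2)^2 =
        (l/2) * (‖g w‖^2 * ‖f w‖^4) * (l * l⁻¹) + (l⁻¹/2) * (‖g w‖^6) - ‖f w‖^2 * ‖g w‖^4 * (l * l⁻¹):= by
        ring
      rw [e1, hli] at this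
      simp only
      linarith
  refine this.trans ?_
  rw [integral_add ((hg.int_pow hf 2 4 μ).const_mul _) ((hg.int_pow1 6 μ).const_mul _),
    integral_const_mul, integral_const_mul]
  have e1 : l * 2 ^ x = 2 ^ ((x+z)/2) := by
    rw [hl, ← Real.rpow_add (by norm_num)]; ring_nf
  have e2 : l⁻¹ * 2 ^ z = 2 ^ ((x+z)/2) := by
    rw [hl, ← Real.rpow_neg (by norm_num), ← Real.rpow_add (by norm_num)]; ring_nf
  have h3 := mul_le_mul_of_nonneg_left h1 (by positivity : 0 ≤ l/2)
  have h4 := mul_le_mul_of_nonneg_left h2 (by positivity : 0 ≤ l⁻¹/2)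
  have e3 : l / 2 * (A * 2 ^ x) = A * 2 ^ ((x+z)/2) / 2 := by rw [← e1]; ring
  have e4 : l⁻¹ / 2 * (A * 2 ^ z) = A * 2 ^ ((x+z)/2) / 2 := by rw [← e2]; ring
  linarith

/-- broad-narrow inequality -/
theorem PD_BN (T : Finset ℕ) (z : ℕ → ℂ) :
    ‖∑ i ∈ T, z i‖^6 ≤ 2^15 * ∑ i ∈ T, ‖z i‖^6
      + 2^5 * (T.card:ℝ)^6 * ∑ i ∈ T, ∑ j ∈ T, if (i + 1 < j ∨ j + 1 < i) then ‖z i‖^2 * ‖z j‖^4 else 0 := by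
  rcases T.eq_empty_or_nonempty with rfl | hT
  · simp
  obtain ⟨i0, hi0, hmax⟩ := T.exists_max_image (fun i => ‖z i‖) hT
  set m := ‖z i0‖
  set S := T.filter (fun j => i0 + 1 < j ∨ j + 1 < i0) with hS
  set S' := T.filter (fun j => ¬ (i0 + 1 < j ∨ j + 1 < i0)) with hS'
  have hsplit : ∑ i ∈ T, z i = ∑ i ∈ S, z i + ∑ i ∈ S', z i :=
    (Finset.sum_filter_add_sum_filter_not T _ _).symm
  have hS'b : ‖∑ i ∈ S', z i‖ ≤ 3 * m := by
    refine (norm_sum_le_of_le _ (fun i hi => hmax i (Finset.mem_filter.1 hi).1)).trans ?_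
    rw [Finset.sum_const, nsmul_eq_mul]
    gcongr
    have : S'.card ≤ 3 := by
      refine (Finset.card_le_card (t := Finset.Icc (i0 - 1) (i0 + 1)) fun j hj => ?_).trans ?_
      · have := (Finset.mem_filter.1 hj).2
        rw [Finset.mem_Icc]; omega
      · rw [Nat.card_Icc]; omega
    exact_mod_cast this
  have hnar : m^6 ≤ ∑ i ∈ T, ‖z i‖^6 :=
    Finset.single_le_sum (f := fun i => ‖z i‖^6) (fun i _ => by positivity) hi0
  have hbr : ∑ j ∈ S, ‖z j‖^6 ≤ ∑ i ∈ T, ∑ j ∈ T, if (i + 1 < j ∨ j + 1 < i) then ‖z i‖^2 * ‖z j‖^4 else 0 := by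
    refine le_trans ?_ (Finset.single_le_sum (f := fun i => ∑ j ∈ T, if (i + 1 < j ∨ j + 1 < i) then ‖z i‖^2 * ‖z j‖^4 else 0) (fun i _ => Finset.sum_nonneg fun j _ => by positivity) hi0)
    rw [← Finset.sum_filter]
    refine Finset.sum_le_sum fun j hj => ?_
    have := hmax j (Finset.mem_filter.1 hj).1
    calc ‖z j‖^6 = ‖z j‖^2 * ‖z j‖^4 := by ring
      _ ≤ _ := by gcongr
  have hSb : ‖∑ i ∈ S, z i‖^6 ≤ (T.card:ℝ)^6 * ∑ j ∈ S, ‖z j‖^6 := by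
    have h1 : ‖∑ i ∈ S, z i‖^6 ≤ (∑ i ∈ S, ‖z i‖)^6 := by gcongr; exact norm_sum_le _ _
    have h3 : (∑ i ∈ S, ‖z i‖)^6 ≤ (S.card:ℝ)^5 * ∑ j ∈ S, ‖z j‖^6 :=
      pow_sum_le_card_mul_sum_pow (fun i _ => norm_nonneg _) 5
    refine h1.trans (h3.trans ?_)
    have hc : (S.card : ℝ) ≤ T.card := by exact_mod_cast Finset.card_filter_le _ _
    have hc1 : (1:ℝ) ≤ T.card := by exact_mod_cast hT.card_pos
    have : (S.card:ℝ)^5 ≤ (T.card:ℝ)^6 := by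
      calc (S.card:ℝ)^5 ≤ (T.card:ℝ)^5 := by gcongr
        _ ≤ (T.card:ℝ)^6 := pow_le_pow_right₀ hc1 (by norm_num)
    have h0 : 0 ≤ ∑ j ∈ S, ‖z j‖^6 := Finset.sum_nonneg fun j _ => by positivity
    gcongr
  have h6 : ‖∑ i ∈ T, z i‖^6 ≤ 2^5 * (‖∑ i ∈ S, z i‖^6 + (3*m)^6) := by
    rw [hsplit]
    have h1 : ‖∑ i ∈ S, z i + ∑ i ∈ S', z i‖ ≤ ‖∑ i ∈ S, z i‖ + 3 * m :=
      (norm_add_le _ _).trans (by gcongr)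
    calc _ ≤ (‖∑ i ∈ S, z i‖ + 3 * m)^6 := by gcongr
      _ ≤ _ := by
        have := add_pow_le (a := ‖∑ i ∈ S, z i‖) (b := 3*m) (norm_nonneg _) (by positivity) 6
        simpa using this
  have h7 : (3*m)^6 = 729 * m^6 := by ring
  have h8 : 0 ≤ m^6 := by positivity
  have h9 := mul_le_mul_of_nonneg_left hbr (by positivity : 0 ≤ (T.card:ℝ)^6)
  rw [mul_assoc]
  linarith
end PD2

section PD3
variable {Ω : Type*} [MeasurableSpace Ω] {ι : Type*}

theorem sq_diff_lower {u v h d : ℝ} (hd : d ≤ |u - v|) (_ : 0 ≤ d) (hh : 0 ≤ h)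
    (hs : (h ≤ u ∧ h ≤ v) ∨ (u ≤ -h ∧ v ≤ -h)) : d * (2 * h) ≤ |u^2 - v^2| := by
  have e1 : u^2 - v^2 = (u - v) * (u + v) := by ring
  rw [e1, abs_mul]
  have : 2 * h ≤ |u + v| := by
    rcases hs with ⟨h1, h2⟩ | ⟨h1, h2⟩
    · exact le_trans (by linarith) (le_abs_self _)
    · exact le_trans (by linarith) (neg_le_abs _)
  gcongr

theorem PD_L2 (μ : Measure Ω) [IsFiniteMeasure μ] {s : Finset ι} {g : ι → Ω → ℂ} {y : ι → ℝ} {n : ℕ}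
    (hg : ∀ i, BM (g i)) (hy : ∀ i ∈ s, y i ∈ Set.Ico (0:ℝ) 1) (hyp : PDHyp μ s g y n)
    (l c a b m i j : ℕ) (hn : l + (c + b) ≤ n) (hm : 2 * (c + b) = (c + a) + m)
    (hsep : i / 2^a + 1 < j / 2^b ∨ j / 2^b + 1 < i / 2^a) {Mx : ℝ} (hMx : 0 ≤ Mx)
    (hM : ∀ i', i' / 2^m = i → ∫ w, ‖dF s g y (l + (c + a) + m) i' w‖^2 *
      ‖dF s g y (l + (c + b)) j w‖^4 ∂μ ≤ Mx) :
    ∫ w, ‖dF s g y (l + (c + a)) i w‖^2 * ‖dF s g y (l + (c + b)) j w‖^4 ∂μ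
      ≤ 2^(c+3) * 2^m * Mx := by
  have hb : ∀ l j, BM (dF s g y l j) := fun l j => dF_BM (fun i _ => hg i) l j
  simp_rw [dF_split s g y (l + (c + a)) m i]
  have hcard : (Finset.Ico (i * 2^m) ((i+1) * 2^m)).card = 2^m := by
    rw [Nat.card_Ico, add_mul, one_mul, Nat.add_sub_cancel_left]
  have hmem : ∀ i' ∈ Finset.Ico (i * 2^m) ((i+1) * 2^m), i' / 2^m = i := by
    intro i' hi'
    rw [Finset.mem_Ico] at hi'
    apply Nat.div_eq_of_lt_le <;> omega
  have := near_orth μ (Finset.Ico (i * 2^m) ((i+1) * 2^m)) (G := dF s g y (l + (c + a) + m))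
    (V := dF s g y (l + (c + b)) j) (fun _ => hb _ _) (hb _ _) (2^(c+1)) hMx ?_
    (fun i' hi' => hM i' (hmem i' hi'))
  · refine this.trans ?_
    rw [hcard]
    push_cast
    have h1 : (1:ℝ) ≤ 2^c := one_le_pow₀ (by norm_num)
    have h2 : (2 * 2^(c+1) + 1 : ℝ) ≤ 2^(c+3) := by rw [pow_add, pow_add]; linarith
    gcongr
  intro i' hi' i'' hi'' hfar
  apply six_sum_zero μ hg
  intro k1 h1 k2 h2 k3 h3 k4 h4 k5 h5 k6 h6
  rw [Finset.mem_filter] at h1 h2 h3 h4 h5 h6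
  set q : ℝ := 2^(l + (c + b)) with hq
  have hq0 : 0 < q := by positivity
  set t : ℝ := j / q with ht
  have hJ : ∀ k ∈ s, dix (y k) (l + (c+b)) = j → 0 ≤ y k - t ∧ y k - t ≤ 1/q := by
    intro k hk hkj
    have := dix_bounds (hy k hk).1 (l + (c+b))
    rw [hkj] at this
    constructor
    · rw [ht, sub_nonneg, div_le_iff₀ hq0]; linarith [this.1]
    · rw [ht, ← sub_nonneg]
      have : 1/q - (y k - j/q) = (j + 1 - q * y k)/q := by field_simp; ring
      rw [this]; apply div_nonneg _ hq0.le; linarith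
  have ht01 : t ∈ Set.Icc (0:ℝ) 1 := by
    refine ⟨by positivity, ?_⟩
    have := (hJ k2 h2.1 h2.2).1
    linarith [(hy k2 h2.1).2]
  refine hyp k1 h1.1 k2 h2.1 k3 h3.1 k4 h4.1 k5 h5.1 k6 h6.1 t ht01 ?_
  -- small squares
  have hsq : ∀ k ∈ s, dix (y k) (l + (c+b)) = j → 0 ≤ (y k - t)^2 ∧ (y k - t)^2 ≤ 1/q^2 := by
    intro k hk hkj
    obtain ⟨p1, p2⟩ := hJ k hk hkj
    refine ⟨by positivity, ?_⟩
    calc (y k - t)^2 ≤ (1/q)^2 := by gcongr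
      _ = 1/q^2 := by ring
  have s2 := hsq k2 h2.1 h2.2
  have s3 := hsq k3 h3.1 h3.2
  have s5 := hsq k5 h5.1 h5.2
  have s6 := hsq k6 h6.1 h6.2
  have hn4 : ((4:ℝ)^n)⁻¹ ≤ 1/q^2 := by
    rw [← one_div]
    apply one_div_le_one_div_of_le (by positivity)
    rw [hq, ← pow_mul, show (4:ℝ) = 2^2 by norm_num, ← pow_mul]
    apply pow_le_pow_right₀ (by norm_num); omega
  -- main difference
  set Q : ℝ := 2^(l + (c + a) + m) with hQ
  have hQ0 : 0 < Q := by positivity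
  have hdiff : (2:ℝ)^(c+1) / Q ≤ |(y k1 - t) - (y k4 - t)| := by
    have b1 := dix_bounds (hy k1 h1.1).1 (l + (c + a) + m)
    have b4 := dix_bounds (hy k4 h4.1).1 (l + (c + a) + m)
    rw [h1.2] at b1
    rw [h4.2] at b4
    rw [div_le_iff₀ hQ0]
    have e1 : |y k1 - t - (y k4 - t)| * Q = |Q * y k1 - Q * y k4| := by
      rw [← abs_of_pos hQ0, ← abs_mul, abs_of_pos hQ0]; congr 1; ring
    rw [e1]
    rcases hfar with hf | hf
    · have : (i':ℝ) + 2^(c+1) + 1 ≤ i'' := by exact_mod_cast hf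
      rw [abs_sub_comm]
      refine le_trans ?_ (le_abs_self _)
      linarith
    · have : (i'':ℝ) + 2^(c+1) + 1 ≤ i' := by exact_mod_cast hf
      refine le_trans ?_ (le_abs_self _)
      linarith
  set H : ℝ := 2^(l + c) with hH
  have hH0 : 0 < H := by positivity
  have hI : ∀ k ∈ s, ∀ i0, i0 / 2^m = i → dix (y k) (l + (c + a) + m) = i0 →
      (dix (y k) (l + c)) = i / 2^a := by
    intro k hk i0 hi0 hk0
    rw [← dix_div (y k) (l+c) a, ← hi0, ← hk0, ← dix_div (y k) (l + c + a) m]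
    simp only [add_assoc]
  have hJ2 : (j / 2^b : ℕ) ≤ t * H ∧ t * H < (j/2^b : ℕ) + 1 := by
    have e1 : t * H = j / 2^b := by
      rw [ht, hq, hH, ← add_assoc, pow_add _ (l + c) b]; field_simp
    rw [e1]
    constructor
    · have := Nat.div_mul_le_self j (2^b)
      rw [le_div_iff₀ (by positivity)]; exact_mod_cast this
    · have := Nat.lt_div_mul_add (a := j) (show 0 < 2^b by positivity)
      rw [div_lt_iff₀ (by positivity)]
      rw [add_mul, one_mul]; exact_mod_cast this
  have hside : (1/H ≤ y k1 - t ∧ 1/H ≤ y k4 - t) ∨ (y k1 - t ≤ -(1/H) ∧ y k4 - t ≤ -(1/H)) := by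
    have b1 := dix_bounds (hy k1 h1.1).1 (l + c)
    have b4 := dix_bounds (hy k4 h4.1).1 (l + c)
    rw [hI k1 h1.1 i' (hmem _ hi') h1.2] at b1
    rw [hI k4 h4.1 i'' (hmem _ hi'') h4.2] at b4
    have key : ∀ x : ℝ, (1 ≤ H * x - t * H → 1/H ≤ x - t) ∧ (H * x - t * H ≤ -1 → x - t ≤ -(1/H)) := by
      intro x
      constructor
      · intro h; rw [div_le_iff₀ hH0]; linarith
      · intro h; rw [le_neg, div_le_iff₀ hH0]; linarith
    rcases hsep with hs | hs
    · right
      have : ((i / 2^a : ℕ):ℝ) + 1 + 1 ≤ (j / 2^b : ℕ) := by exact_mod_cast hs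
      exact ⟨(key _).2 (by linarith), (key _).2 (by linarith)⟩
    · left
      have : ((j / 2^b : ℕ):ℝ) + 1 + 1 ≤ (i / 2^a : ℕ) := by exact_mod_cast hs
      exact ⟨(key _).1 (by linarith), (key _).1 (by linarith)⟩
  have hlow := sq_diff_lower hdiff (by positivity) (by positivity) hside
  have e2 : (2:ℝ)^(c+1) / Q * (2 * (1/H)) = 4 / q^2 := by
    rw [hQ, hH, hq, add_assoc l, ← hm, ← pow_mul]
    rw [div_mul_eq_mul_div, div_eq_div_iff (by positivity) (by positivity)]
    rw [show (2:ℝ)^(c+1) * (2 * (1/2^(l+c))) = 4 / 2^l by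
      rw [pow_add, pow_add]; field_simp; norm_num]
    rw [div_mul_eq_mul_div, div_eq_iff (by positivity), mul_assoc, ← pow_add]
    congr 2; ring
  rw [e2] at hlow
  have h4q : 4/q^2 = 4 * (1/q^2) := by ring
  have hpos : 0 < 1/q^2 := by positivity
  have : |(y k1 - t)^2 + (y k2 - t)^2 + (y k3 - t)^2 - (y k4 - t)^2 - (y k5 - t)^2 - (y k6 - t)^2|
     ≥ |(y k1 - t)^2 - (y k4 - t)^2| - 2 * (1/q^2) := by
    have h := abs_sub_abs_le_abs_sub ((y k1 - t)^2 - (y k4 - t)^2)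
      (-((y k2 - t)^2 + (y k3 - t)^2 - (y k5 - t)^2 - (y k6 - t)^2))
    have h' : |(-((y k2 - t)^2 + (y k3 - t)^2 - (y k5 - t)^2 - (y k6 - t)^2))| ≤ 2 * (1/q^2) := by
      rw [abs_neg, abs_le]; constructor <;> linarith
    have e3 : (y k1 - t)^2 - (y k4 - t)^2 - (-((y k2 - t)^2 + (y k3 - t)^2 - (y k5 - t)^2 - (y k6 - t)^2))
      = (y k1 - t)^2 + (y k2 - t)^2 + (y k3 - t)^2 - (y k4 - t)^2 - (y k5 - t)^2 - (y k6 - t)^2 := by ring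
    rw [e3] at h
    linarith
  linarith
end PD3

section PD4
variable {Ω : Type*} [MeasurableSpace Ω] {ι : Type*}

theorem PD_chain (μ : Measure Ω) [IsFiniteMeasure μ] {s : Finset ι} {g : ι → Ω → ℂ} {y : ι → ℝ} {n : ℕ}
    (hg : ∀ i, BM (g i)) (hy : ∀ i ∈ s, y i ∈ Set.Ico (0:ℝ) 1) (hyp : PDHyp μ s g y n)
    (l c Jm : ℕ) (hc : 1 ≤ c) {A η : ℝ} (hA : 0 ≤ A) (hη : 0 ≤ η) (hn : l + 2^(Jm+1) * c ≤ n)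
    (IH : ∀ m, 1 ≤ m → l + m ≤ n → ∀ j, ∫ w, ‖dF s g y (l + m) j w‖^6 ∂μ ≤ A * 2^(-(3+η)*m)) :
    ∀ d k, k + d = Jm → ∀ a b, c + a = 2^k * c → c + b = 2^(k+1) * c → ∀ i j,
      (i / 2^a + 1 < j / 2^b ∨ j / 2^b + 1 < i / 2^a) →
      ∫ w, ‖dF s g y (l + (c + a)) i w‖^2 * ‖dF s g y (l + (c + b)) j w‖^4 ∂μ
        ≤ A * 2 ^ ((2 * (c + 3) : ℝ) - η * c * 2^k * d) := by
  have hb : ∀ l j, BM (dF s g y l j) := fun l j => dF_BM (fun i _ => hg i) l j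
  have hlev : ∀ k, k ≤ Jm → l + 2^(k+1) * c ≤ n := by
    intro k hk
    refine le_trans ?_ hn
    have : 2^(k+1) ≤ 2^(Jm+1) := Nat.pow_le_pow_right (by norm_num) (by omega)
    have := Nat.mul_le_mul_right c this
    omega
  intro d
  induction d with
  | zero =>
    intro k hk a b ha hbb i j _
    have hlk := hlev k (by omega)
    have h2k : 2^(k+1) * c = 2 * (2^k * c) := by ring
    have i1 := IH (c + a) (by omega) (by omega) i
    have i2 := IH (c + b) (by omega) (by omega) j
    have hneg : ∀ m : ℕ, A * 2^(-(3+η)*(m:ℝ)) ≤ A := by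
      intro m
      have : (2:ℝ)^(-(3+η)*(m:ℝ)) ≤ 1 := by
        apply Real.rpow_le_one_of_one_le_of_nonpos (by norm_num)
        have : (0:ℝ) ≤ m := by positivity
        nlinarith
      exact mul_le_of_le_one_right hA this
    have : ∫ w, ‖dF s g y (l + (c + a)) i w‖^2 * ‖dF s g y (l + (c + b)) j w‖^4 ∂μ
      ≤ ∫ w, (‖dF s g y (l + (c + a)) i w‖^6 + ‖dF s g y (l + (c + b)) j w‖^6) ∂μ := by
      apply integral_mono ((hb _ _).int_pow (hb _ _) 2 4 μ)
        (((hb _ _).int_pow1 6 μ).add ((hb _ _).int_pow1 6 μ))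
      intro w
      simp only
      set u := ‖dF s g y (l + (c + a)) i w‖
      set v := ‖dF s g y (l + (c + b)) j w‖
      have hu : 0 ≤ u := norm_nonneg _
      have hv : 0 ≤ v := norm_nonneg _
      show u^2 * v^4 ≤ u^6 + v^6
      rcases le_total u v with h | h
      · calc u^2 * v^4 ≤ v^2 * v^4 := by gcongr
          _ = v^6 := by ring
          _ ≤ _ := by linarith [pow_nonneg hu 6]
      · calc u^2 * v^4 ≤ u^2 * u^4 := by gcongr
          _ = u^6 := by ring
          _ ≤ _ := by linarith [pow_nonneg hv 6]
    rw [integral_add ((hb _ _).int_pow1 6 μ) ((hb _ _).int_pow1 6 μ)] at this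
    have h3 : A * 2 ≤ A * 2 ^ ((2 * (c + 3) : ℝ) - η * c * 2^k * (0:ℕ)) := by
      gcongr
      calc (2:ℝ) = 2^(1:ℝ) := by simp
        _ ≤ _ := by
          apply Real.rpow_le_rpow_of_exponent_le (by norm_num)
          have : (0:ℝ) ≤ c := by positivity
          push_cast; linarith
    linarith [hneg (c+a), hneg (c+b)]
  | succ d ihd =>
    intro k hk a b ha hbb i j hsep
    have hlk := hlev k (by omega)
    have hlk1 := hlev (k+1) (by omega)
    have h2k : 2^(k+1) * c = 2 * (2^k * c) := by ring
    have h2k1 : 2^(k+1+1) * c = 4 * (2^k * c) := by ring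
    set m := 3 * (2^k * c) with hm
    have hH : ∀ i', i' / 2^m = i → ∫ w, ‖dF s g y (l + (c + a) + m) i' w‖^2 *
      ‖dF s g y (l + (c + b)) j w‖^4 ∂μ ≤ A * 2^((((2 * (c + 3) : ℝ) - η * c * 2^(k+1) * d)
        + (-(3+η)*((c+b : ℕ):ℝ)))/2) := by
      intro i' hi'
      apply PD_H μ (hb _ _) (hb _ _)
      · have := ihd (k+1) (by omega) b (a + m) hbb (by omega) j i' (by
          rw [Nat.add_comm a m, pow_add, ← Nat.div_div_eq_div_mul, hi']; tauto)
        rw [show l + (c + (a + m)) = l + (c + a) + m by ring] at this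
        exact this
      · exact IH (c+b) (by omega) (by omega) j
    have := PD_L2 μ hg hy hyp l c a b m i j (by omega) (by omega) hsep (by positivity) hH
    refine this.trans (le_of_eq ?_)
    rw [hbb]
    rw [← Real.rpow_natCast 2 (c+3), ← Real.rpow_natCast 2 m]
    rw [mul_left_comm, ← Real.rpow_add (by norm_num), ← Real.rpow_add (by norm_num)]
    congr 2
    rw [hm]; push_cast; ring

theorem PD_bilin (μ : Measure Ω) [IsFiniteMeasure μ] {s : Finset ι} {g : ι → Ω → ℂ} {y : ι → ℝ} {n : ℕ}
    (hg : ∀ i, BM (g i)) (hy : ∀ i ∈ s, y i ∈ Set.Ico (0:ℝ) 1) (hyp : PDHyp μ s g y n)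
    (l c Jm : ℕ) (hc : 1 ≤ c) {A η : ℝ} (hA : 0 ≤ A) (hη : 0 ≤ η) (hn : l + 2^(Jm+1) * c ≤ n)
    (IH : ∀ m, 1 ≤ m → l + m ≤ n → ∀ j, ∫ w, ‖dF s g y (l + m) j w‖^6 ∂μ ≤ A * 2^(-(3+η)*m))
    (i j : ℕ) (hsep : i + 1 < j ∨ j + 1 < i) :
      ∫ w, ‖dF s g y (l + c) i w‖^2 * ‖dF s g y (l + c) j w‖^4 ∂μ
        ≤ A * 2 ^ ((2 * (c + 3) : ℝ) + c - η * c * Jm / 2) := by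
  have hb : ∀ l j, BM (dF s g y l j) := fun l j => dF_BM (fun i _ => hg i) l j
  have h2c : l + 2 * c ≤ n := by
    refine le_trans ?_ hn
    have : 2^1 ≤ 2^(Jm+1) := Nat.pow_le_pow_right (by norm_num) (by omega)
    have := Nat.mul_le_mul_right c this
    omega
  have hH : ∀ i', i' / 2^c = i → ∫ w, ‖dF s g y (l + (c + 0) + c) i' w‖^2 *
      ‖dF s g y (l + (c + 0)) j w‖^4 ∂μ ≤ A * 2^((((2 * (c + 3) : ℝ) - η * c * 2^0 * Jm)
        + (-(3+η)*(c:ℝ)))/2) := by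
    intro i' hi'
    apply PD_H μ (hb _ _) (hb _ _)
    · have := PD_chain μ hg hy hyp l c Jm hc hA hη hn IH Jm 0 (by omega) 0 c (by omega) (by omega) j i' (by
        rw [hi']; simpa using hsep.symm)
      rw [show l + (c + c) = l + (c + 0) + c by ring] at this
      exact this
    · exact IH c hc (by omega) j
  have := PD_L2 μ hg hy hyp l c 0 0 c i j (by omega) (by omega) (by simpa using hsep) (by positivity) hH
  refine this.trans ?_
  rw [← Real.rpow_natCast 2 (c+3), ← Real.rpow_natCast 2 c]
  rw [mul_left_comm, ← Real.rpow_add (by norm_num), ← Real.rpow_add (by norm_num)]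
  gcongr
  · norm_num
  · have : (0:ℝ) ≤ c := by positivity
    have := mul_nonneg hη this
    push_cast; linarith

theorem PD_main {η : ℝ} (hη : 0 < η) : ∃ A : ℝ, 0 < A ∧ ∀ (Ω : Type) [MeasurableSpace Ω] (ι : Type)
    (μ : Measure Ω) [IsFiniteMeasure μ] (s : Finset ι) (g : ι → Ω → ℂ) (y : ι → ℝ) (n : ℕ),
    (∀ i, BM (g i)) → (∀ i ∈ s, y i ∈ Set.Ico (0:ℝ) 1) → PDHyp μ s g y n → ∀ Mx : ℝ,
    (∀ j, ∫ w, ‖∑ i ∈ s with dix (y i) n = j, g i w‖^6 ∂μ ≤ Mx) →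
    ∫ w, ‖∑ i ∈ s, g i w‖^6 ∂μ ≤ A * 2^((3+η)*n) * Mx := by
  obtain ⟨Jm, hJm⟩ := exists_nat_ge (25/η)
  have hJm' : 25 ≤ η * Jm := by rw [div_le_iff₀ hη] at hJm; linarith
  set q0 := 2^(Jm+1) * 8 with hq0
  have hq08 : 8 ≤ q0 := by
    have : 1 ≤ 2^(Jm+1) := Nat.one_le_two_pow
    omega
  refine ⟨2^(6*q0), by positivity, ?_⟩
  intro Ω _ ι μ _ s g y n hg hy hyp Mx hMx
  have hb : ∀ l j, BM (dF s g y l j) := fun l j => dF_BM (fun i _ => hg i) l j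
  have hMx0 : 0 ≤ Mx := le_trans (integral_nonneg (fun w => by positivity)) (hMx 0)
  have main : ∀ q l, l + q = n → ∀ j, ∫ w, ‖dF s g y l j w‖^6 ∂μ ≤ 2^(6*q0) * 2^((3+η)*q) * Mx := by
    intro q
    induction q using Nat.strong_induction_on with
    | _ q ihq =>
    intro l hl j
    have hη3 : ∀ m : ℕ, (1:ℝ) ≤ 2^((3+η)*m) := by
      intro m
      apply Real.one_le_rpow (by norm_num)
      positivity
    by_cases hq : q ≤ q0
    · simp_rw [dF_split s g y l q j]
      set T := Finset.Ico (j * 2^q) ((j+1) * 2^q)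
      have hcard : T.card = 2^q := by
        rw [Nat.card_Ico, add_mul, one_mul, Nat.add_sub_cancel_left]
      have h1 : ∫ w, ‖∑ i ∈ T, dF s g y (l + q) i w‖^6 ∂μ ≤
          ∫ w, (T.card:ℝ)^5 * ∑ i ∈ T, ‖dF s g y (l + q) i w‖^6 ∂μ := by
        apply integral_mono ((BM.sum (fun i _ => hb _ _)).int_pow1 6 μ)
          ((integrable_finsetSum _ fun i _ => (hb _ _).int_pow1 6 μ).const_mul _)
        intro w
        simp only
        refine le_trans ?_ (pow_sum_le_card_mul_sum_pow (fun i _ => norm_nonneg _) 5)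
        gcongr; exact norm_sum_le _ _
      refine h1.trans ?_
      rw [integral_const_mul, integral_finsetSum _ (fun i _ => (hb _ _).int_pow1 6 μ)]
      have h2 : ∑ i ∈ T, ∫ w, ‖dF s g y (l + q) i w‖^6 ∂μ ≤ T.card * Mx := by
        rw [← nsmul_eq_mul]
        apply Finset.sum_le_card_nsmul
        intro i _; rw [hl]; exact hMx i
      calc (T.card:ℝ)^5 * ∑ i ∈ T, ∫ w, ‖dF s g y (l + q) i w‖^6 ∂μ ≤ (T.card:ℝ)^5 * (T.card * Mx) := by gcongr
        _ = 2^(6*q) * 1 * Mx := by rw [hcard]; push_cast; ring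
        _ ≤ _ := by
          gcongr
          · norm_num
          · exact hη3 q
    · push Not at hq
      set A : ℝ := 2^(6*q0) * 2^((3+η)*q) * Mx with hA
      have hA0 : 0 ≤ A := by positivity
      have IH : ∀ m, 1 ≤ m → l + m ≤ n → ∀ j, ∫ w, ‖dF s g y (l + m) j w‖^6 ∂μ ≤ A * 2^(-(3+η)*m) := by
        intro m hm1 hmn j
        refine (ihq (q - m) (by omega) (l + m) (by omega) j).trans (le_of_eq ?_)
        rw [hA, mul_right_comm _ Mx, mul_assoc (2^(6*q0) : ℝ) (2^((3+η)*q)), ← Real.rpow_add (by norm_num)]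
        rw [Nat.cast_sub (by omega)]; ring_nf
      have hbil := PD_bilin μ hg hy hyp l 8 Jm (by norm_num) hA0 hη.le (by omega) IH
      simp_rw [dF_split s g y l 8 j]
      set T := Finset.Ico (j * 2^8) ((j+1) * 2^8)
      have hcard : T.card = 2^8 := by
        rw [Nat.card_Ico, add_mul, one_mul, Nat.add_sub_cancel_left]
      have hi1 : Integrable (fun w => ∑ i ∈ T, ‖dF s g y (l + 8) i w‖^6) μ :=
        integrable_finsetSum _ fun i _ => (hb _ _).int_pow1 6 μ
      have hi2' : ∀ i i', Integrable (fun w => if (i + 1 < i' ∨ i' + 1 < i) then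
          ‖dF s g y (l + 8) i w‖^2 * ‖dF s g y (l + 8) i' w‖^4 else 0) μ := by
        intro i i'
        split_ifs
        · exact (hb _ _).int_pow (hb _ _) 2 4 μ
        · exact integrable_zero _ _ _
      have hi2 : Integrable (fun w => ∑ i ∈ T, ∑ i' ∈ T, if (i + 1 < i' ∨ i' + 1 < i) then
          ‖dF s g y (l + 8) i w‖^2 * ‖dF s g y (l + 8) i' w‖^4 else 0) μ :=
        integrable_finsetSum _ fun i _ => integrable_finsetSum _ fun i' _ => hi2' i i'
      have h1 : ∫ w, ‖∑ i ∈ T, dF s g y (l + 8) i w‖^6 ∂μ ≤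
          ∫ w, (2^15 * ∑ i ∈ T, ‖dF s g y (l + 8) i w‖^6 + 2^5 * (T.card:ℝ)^6 * 
            ∑ i ∈ T, ∑ i' ∈ T, if (i + 1 < i' ∨ i' + 1 < i) then
              ‖dF s g y (l + 8) i w‖^2 * ‖dF s g y (l + 8) i' w‖^4 else 0) ∂μ := by
        apply integral_mono ((BM.sum (fun i _ => hb _ _)).int_pow1 6 μ)
          ((hi1.const_mul _).add (hi2.const_mul _))
        intro w
        exact PD_BN T _
      refine h1.trans ?_
      rw [integral_add (hi1.const_mul _) (hi2.const_mul _), integral_const_mul, integral_const_mul,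
        integral_finsetSum _ (fun i _ => (hb _ _).int_pow1 6 μ),
        integral_finsetSum _ (fun i _ => integrable_finsetSum _ fun i' _ => hi2' i i')]
      simp_rw [fun i => integral_finsetSum T (fun i' _ => hi2' i i')]
      have hnar : ∑ i ∈ T, ∫ w, ‖dF s g y (l + 8) i w‖^6 ∂μ ≤ 2^8 * (A * 2^(-24:ℝ)) := by
        have := Finset.sum_le_card_nsmul T (fun i => ∫ w, ‖dF s g y (l + 8) i w‖^6 ∂μ) (A * 2^(-24:ℝ)) (by
          intro i _
          refine (IH 8 (by norm_num) (by omega) i).trans ?_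
          gcongr
          · norm_num
          · push_cast; linarith)
        rw [nsmul_eq_mul, hcard] at this
        exact_mod_cast this
      have hbr : ∑ i ∈ T, ∑ i' ∈ T, ∫ w, (if (i + 1 < i' ∨ i' + 1 < i) then
              ‖dF s g y (l + 8) i w‖^2 * ‖dF s g y (l + 8) i' w‖^4 else 0) ∂μ ≤
            2^8 * (2^8 * (A * 2^(-70:ℝ))) := by
        have h2 : ∀ i ∈ T, ∑ i' ∈ T, ∫ w, (if (i + 1 < i' ∨ i' + 1 < i) then
              ‖dF s g y (l + 8) i w‖^2 * ‖dF s g y (l + 8) i' w‖^4 else 0) ∂μ ≤ 2^8 * (A * 2^(-70:ℝ)) := by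
          intro i _
          have := Finset.sum_le_card_nsmul T (fun i' => ∫ w, (if (i + 1 < i' ∨ i' + 1 < i) then
              ‖dF s g y (l + 8) i w‖^2 * ‖dF s g y (l + 8) i' w‖^4 else 0) ∂μ) (A * 2^(-70:ℝ)) (by
            intro i' _
            split_ifs with hs
            · refine (hbil i i' hs).trans ?_
              gcongr
              · norm_num
              · push_cast; linarith
            · simp only [integral_zero]; positivity)
          rw [nsmul_eq_mul, hcard] at this
          exact_mod_cast this
        have := Finset.sum_le_card_nsmul T _ _ h2
        rw [nsmul_eq_mul, hcard] at this
        exact_mod_cast this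
      rw [hcard]
      have e24 : (2:ℝ)^(-24:ℝ) = 1/2^24 := by
        rw [Real.rpow_neg (by norm_num)]; norm_num
      have e70 : (2:ℝ)^(-70:ℝ) = 1/2^70 := by
        rw [Real.rpow_neg (by norm_num)]; norm_num
      rw [e24] at hnar
      rw [e70] at hbr
      have h3 := mul_le_mul_of_nonneg_left hnar (by norm_num : (0:ℝ) ≤ 2^15)
      have h4 := mul_le_mul_of_nonneg_left hbr (by positivity : (0:ℝ) ≤ 2^5 * ((2^8 : ℕ):ℝ)^6)
      refine (add_le_add h3 h4).trans ?_
      push_cast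
      norm_num
      linarith
  have h0 := main n 0 (by omega) 0
  have e0 : ∀ w, dF s g y 0 0 w = ∑ i ∈ s, g i w := by
    intro w
    unfold dF
    congr 1
    apply Finset.filter_true_of_mem
    intro i hi
    unfold dix
    rw [Nat.floor_eq_zero]; simpa using (hy i hi).2
  simp_rw [e0] at h0
  exact h0
end PD4

/-! ### Part 2: kernels -/
section Kernels
open scoped FourierTransform SchwartzMap ContDiff

theorem e_eq (t : ℝ) : e t = (Real.fourierChar t : ℂ) := by
  rw [e, Real.fourierChar_apply]; congr 1; push_cast; ring

theorem norm_e (t : ℝ) : ‖e t‖ = 1 := by rw [e_eq]; exact Circle.norm_coe _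

theorem e_add (s t : ℝ) : e (s + t) = e s * e t := by
  unfold e; rw [← Complex.exp_add]; congr 1; push_cast; ring

theorem e_zero : e 0 = 1 := by simp [e]

theorem e_neg (t : ℝ) : e (-t) = (starRingEnd ℂ) (e t) := by
  unfold e; rw [← Complex.exp_conj]; congr 1; simp [Complex.conj_ofNat]

theorem continuous_e : Continuous e := by unfold e; fun_prop

theorem measurable_e : Measurable e := continuous_e.measurable

theorem e_mul_conj (s t : ℝ) : e s * (starRingEnd ℂ) (e t) = e (s - t) := by
  rw [← e_neg, ← e_add, sub_eq_add_neg]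

/-- Japanese bracket squared -/
def jb {E : Type*} [NormedAddCommGroup E] (u : E) : ℝ := 1 + ‖u‖^2

section
variable {E : Type*} [NormedAddCommGroup E]
theorem one_le_jb (u : E) : 1 ≤ jb u := by unfold jb; nlinarith [sq_nonneg ‖u‖]
theorem jb_pos (u : E) : 0 < jb u := lt_of_lt_of_le one_pos (one_le_jb u)
theorem jb_neg (u : E) : jb (-u) = jb u := by simp [jb]
theorem jb_zero : jb (0:E) = 1 := by simp [jb]
theorem jb_add_le (u v : E) : jb (u + v) ≤ 2 * jb u * jb v := by
  unfold jb
  have h := norm_add_le u v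
  have h2 : ‖u + v‖^2 ≤ (‖u‖ + ‖v‖)^2 := by gcongr
  nlinarith [sq_nonneg (‖u‖ - ‖v‖), sq_nonneg (‖u‖ * ‖v‖), norm_nonneg u, norm_nonneg v]
theorem jb_sub_le (u v : E) : jb (u - v) ≤ 2 * jb u * jb v := by
  rw [sub_eq_add_neg, ← jb_neg v]; exact jb_add_le u (-v)
theorem jb_le_sub (u v : E) : jb u ≤ 2 * jb (u - v) * jb v := by
  have := jb_add_le (u - v) v
  rwa [sub_add_cancel] at this
theorem continuous_jb : Continuous (jb : E → ℝ) := by unfold jb; fun_prop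
theorem jb_pow_pos (u : E) (A : ℕ) : 0 < (jb u)^A := pow_pos (jb_pos u) A
theorem jb_inv_sub_le (u v : E) (A : ℕ) : ((jb (u - v))^A)⁻¹ ≤ 2^A * (jb v)^A * ((jb u)^A)⁻¹ := by
  rw [← div_eq_mul_inv, le_div_iff₀ (jb_pow_pos u A), inv_mul_le_iff₀ (jb_pow_pos _ A)]
  have := pow_le_pow_left₀ (jb_pos u).le (jb_le_sub u v) A
  rw [mul_pow, mul_pow] at this
  linarith
theorem jb_inv_sub_ge (u v : E) (A : ℕ) : ((2:ℝ)^A)⁻¹ * ((jb v)^A)⁻¹ * ((jb u)^A)⁻¹ ≤ ((jb (u - v))^A)⁻¹ := by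
  rw [← mul_inv, ← mul_inv]
  apply inv_anti₀ (jb_pow_pos _ A)
  have := pow_le_pow_left₀ (jb_pos _).le (jb_sub_le u v) A
  rw [mul_pow, mul_pow] at this
  linarith
end

section
variable {E : Type*} [NormedAddCommGroup E] [InnerProductSpace ℝ E] [FiniteDimensional ℝ E]
  [MeasurableSpace E] [BorelSpace E]

theorem integrable_jb {A : ℕ} (hA : Module.finrank ℝ E < 2 * A) :
    Integrable (fun u : E => ((jb u)^A)⁻¹) := by
  have := integrable_rpow_neg_one_add_norm_sq (E := E) (μ := volume) (r := 2 * A) (by exact_mod_cast hA)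
  refine this.congr (Filter.Eventually.of_forall fun u => ?_)
  simp only
  rw [show (-(2 * (A:ℝ)) / 2) = -(A:ℝ) by ring, Real.rpow_neg (by positivity), Real.rpow_natCast]
  rfl

theorem schwartz_decay (f : 𝓢(E, ℂ)) (A : ℕ) : ∃ C, 0 ≤ C ∧ ∀ u, ‖f u‖ ≤ C * ((jb u)^A)⁻¹ := by
  refine ⟨2 ^ (2*A) * ((Finset.Iic ((2*A, 0) : ℕ × ℕ)).sup (fun m => SchwartzMap.seminorm ℝ m.1 m.2)) f, by positivity, fun u => ?_⟩
  rw [← div_eq_mul_inv, le_div_iff₀ (jb_pow_pos u A)]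
  have h := SchwartzMap.one_add_le_sup_seminorm_apply (𝕜 := ℝ) (m := (2*A, 0)) (k := 2*A) (n := 0) le_rfl le_rfl f u
  rw [norm_iteratedFDeriv_zero] at h
  refine le_trans ?_ h
  rw [mul_comm]
  gcongr
  rw [pow_mul]
  have h0 := norm_nonneg u
  apply pow_le_pow_left₀ (jb_pos u).le
  unfold jb; nlinarith

/-- reproducing kernels -/
theorem kernel_rep (ψ : E → ℂ) (h1 : HasCompactSupport ψ) (h2 : ContDiff ℝ ∞ ψ) :
    ∃ k : E → ℂ, Measurable k ∧ (∀ A : ℕ, ∃ C, 0 ≤ C ∧ ∀ u, ‖k u‖ ≤ C * ((jb u)^A)⁻¹) ∧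
      ∀ θ, ∫ u, k u * e (-(inner ℝ θ u)) = ψ θ := by
  set f : 𝓢(E, ℂ) := h1.toSchwartzMap h2
  refine ⟨(𝓕⁻ f : 𝓢(E, ℂ)), (𝓕⁻ f : 𝓢(E, ℂ)).continuous.measurable, schwartz_decay _, fun θ => ?_⟩
  have h3 : (𝓕 (𝓕⁻ f : 𝓢(E, ℂ)) : 𝓢(E, ℂ)) = f := FourierTransform.fourier_fourierInv_eq f
  have h4 : (𝓕 ((𝓕⁻ f : 𝓢(E, ℂ)) : E → ℂ)) θ = f θ := by
    rw [← SchwartzMap.fourier_coe, h3]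
  have h5 : f θ = ψ θ := rfl
  rw [← h5, ← h4, Real.fourier_eq]
  congr 1; ext u
  rw [Circle.smul_def, ← e_eq, real_inner_comm, smul_eq_mul, mul_comm]

theorem kernel_h (A : ℕ) : ∃ h : E → ℝ, Continuous h ∧ (∀ v, 0 ≤ h v) ∧ h 0 ≠ 0 ∧
    (∃ D : ℝ, ∀ v, h v ≤ D^2 * ((jb v)^(A+A))⁻¹) ∧
    ∀ θ : E, 1 ≤ ‖θ‖ → ∫ v, (h v : ℂ) * e (-(inner ℝ θ v)) = 0 := by
  let b : ContDiffBump (0:E) := ⟨1/4, 1/2, by norm_num, by norm_num⟩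
  have hb1 : HasCompactSupport (fun x => ((b x : ℝ) : ℂ)) :=
    b.hasCompactSupport.comp_left (g := fun t : ℝ => (t : ℂ)) (by simp)
  have hb2 : ContDiff ℝ ∞ (fun x => ((b x : ℝ) : ℂ)) := Complex.ofRealCLM.contDiff.comp b.contDiff
  set f : 𝓢(E, ℂ) := hb1.toSchwartzMap hb2 with hf
  have hfb : ∀ x, f x = ((b x : ℝ) : ℂ) := fun x => rfl
  set F : 𝓢(E, ℂ) := 𝓕 f with hF
  set h : E → ℝ := fun v => ‖F v‖^2 with hh
  have hF0 : h 0 ≠ 0 := by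
    have e1 : F 0 = ((∫ v, b v : ℝ) : ℂ) := by
      rw [hF, SchwartzMap.fourier_coe, Real.fourier_eq, ← integral_complex_ofReal]
      simp [hfb]
    rw [hh]; simp only
    rw [e1, Complex.norm_real]
    have := b.integral_pos (μ := volume)
    exact pow_ne_zero _ (norm_ne_zero_iff.2 this.ne')
  refine ⟨h, ?_, fun v => by positivity, hF0, ?_, ?_⟩
  · have := F.continuous
    fun_prop
  · obtain ⟨D, hD0, hD⟩ := schwartz_decay F A
    refine ⟨D, fun v => ?_⟩
    have := pow_le_pow_left₀ (norm_nonneg _) (hD v) 2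
    refine this.trans (le_of_eq ?_)
    rw [mul_pow, pow_add, mul_inv]; ring
  · intro θ hθ
    have hs1 : HasCompactSupport (fun x => f (x + (-θ))) :=
      hb1.comp_homeomorph (Homeomorph.addRight (-θ))
    have hs2 : ContDiff ℝ ∞ (fun x => f (x + (-θ))) := hb2.comp (contDiff_id.add contDiff_const)
    set g : 𝓢(E, ℂ) := hs1.toSchwartzMap hs2
    have hg : ∀ x, g x = f (x + (-θ)) := fun x => rfl
    have h3 := SchwartzMap.integral_inner_fourier_fourier f g
    have h4 : ∫ x, inner ℂ (f x) (g x) = 0 := by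
      have : ∀ x, inner ℂ (f x) (g x) = 0 := by
        intro x
        by_cases hx : ‖x‖ < 1/2
        · have : g x = 0 := by
            rw [hg, hfb, b.zero_of_le_dist]; · simp
            rw [dist_zero_right]
            have := norm_sub_norm_le θ x
            rw [norm_sub_rev, sub_eq_add_neg x θ] at this
            show (1/2:ℝ) ≤ _
            linarith
          rw [this, inner_zero_right]
        · have : f x = 0 := by
            rw [hfb, b.zero_of_le_dist]; · simp
            rw [dist_zero_right]
            show (1/2:ℝ) ≤ _
            linarith
          rw [this, inner_zero_left]
      simp only [this, integral_zero]
    rw [h4] at h3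
    rw [← h3]
    congr 1; ext v
    have h5 : (𝓕 g : 𝓢(E, ℂ)) v = e (-(inner ℝ θ v)) * F v := by
      rw [hF, SchwartzMap.fourier_coe, SchwartzMap.fourier_coe, Real.fourier_eq, Real.fourier_eq,
        ← integral_const_mul]
      rw [← integral_add_right_eq_self _ θ]
      congr 1; ext x
      rw [hg, add_neg_cancel_right, inner_add_left, neg_add, Circle.smul_def, Circle.smul_def, ← e_eq, ← e_eq, e_add]
      simp only [smul_eq_mul]; ring
    rw [h5, RCLike.inner_apply, hh]
    simp only
    rw [mul_assoc]
    change _ = e _ * (F v * (starRingEnd ℂ) (F v))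
    rw [Complex.mul_conj, Complex.normSq_eq_norm_sq, mul_comm]

theorem kernel_pos {A : ℕ} (hA : Module.finrank ℝ E < 2 * A) :
    ∃ (κ : E → ℝ) (c C : ℝ), 0 < c ∧ 0 < C ∧ Measurable κ ∧ (∀ u, c * ((jb u)^A)⁻¹ ≤ κ u) ∧
      (∀ u, κ u ≤ C * ((jb u)^A)⁻¹) ∧
      ∀ θ : E, 1 ≤ ‖θ‖ → ∫ u, (κ u : ℂ) * e (-(inner ℝ θ u)) = 0 := by
  obtain ⟨h, hcont, h0, hF0, ⟨D, hdec⟩, hpl⟩ := kernel_h (E := E) A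
  have hgint : Integrable (fun u : E => ((jb u)^A)⁻¹) := integrable_jb hA
  have hginv : Continuous (fun u : E => ((jb u)^A)⁻¹) :=
    (continuous_jb.pow A).inv₀ (fun u => (jb_pow_pos u A).ne')
  have hhA : Integrable (fun v => h v * (jb v)^A) := by
    refine (hgint.const_mul (D^2)).mono' (hcont.mul (continuous_jb.pow A)).aestronglyMeasurable
      (Filter.Eventually.of_forall fun v => ?_)
    rw [Real.norm_of_nonneg (mul_nonneg (h0 v) (jb_pow_pos v A).le)]
    calc h v * (jb v)^A ≤ D^2 * ((jb v)^(A+A))⁻¹ * (jb v)^A := by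
          have := (jb_pow_pos v A).le
          gcongr; exact hdec v
      _ = D^2 * ((jb v)^A)⁻¹ := by
          have := (jb_pow_pos v A).ne'
          rw [pow_add]; field_simp
  have hhA' : Integrable (fun v => h v * ((jb v)^A)⁻¹) := by
    refine hhA.mono' (hcont.mul hginv).aestronglyMeasurable (Filter.Eventually.of_forall fun v => ?_)
    have h1 := one_le_pow₀ (one_le_jb v) (n := A)
    have h2 := inv_le_one_of_one_le₀ h1
    rw [Real.norm_of_nonneg (mul_nonneg (h0 v) (inv_nonneg.2 (jb_pow_pos v A).le))]
    have := h0 v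
    gcongr
    linarith
  have hhint : Integrable h := by
    refine hhA.mono' hcont.aestronglyMeasurable (Filter.Eventually.of_forall fun v => ?_)
    have h1 := one_le_pow₀ (one_le_jb v) (n := A)
    rw [Real.norm_of_nonneg (h0 v)]
    exact le_mul_of_one_le_right (h0 v) h1
  set I1 := ∫ v, h v * ((jb v)^A)⁻¹ with hI1
  have hI1pos : 0 < I1 := by
    rw [hI1]
    rw [integral_pos_iff_support_of_nonneg (fun v => mul_nonneg (h0 v) (inv_nonneg.2 (jb_pow_pos v A).le)) hhA']
    refine (hcont.mul hginv).isOpen_support.measure_pos volume ⟨0, ?_⟩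
    exact mul_ne_zero hF0 (inv_ne_zero (jb_pow_pos (0:E) A).ne')
  set I2 := ∫ v, h v * (jb v)^A with hI2
  have hI2pos : 0 ≤ I2 := integral_nonneg fun v => mul_nonneg (h0 v) (jb_pow_pos v A).le
  set κ : E → ℝ := fun u => ∫ v, h v * ((jb (u - v))^A)⁻¹ with hκ
  have hm : Continuous (fun p : E × E => h p.2 * ((jb (p.1 - p.2))^A)⁻¹) :=
    (hcont.comp continuous_snd).mul (hginv.comp (continuous_fst.sub continuous_snd))
  have hgu : ∀ u : E, Continuous (fun v => ((jb (u - v))^A)⁻¹) := by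
    intro u
    have h1 : Continuous (fun v : E => u - v) := continuous_const.sub continuous_id
    exact Continuous.comp (g := fun u : E => ((jb u)^A)⁻¹) hginv h1
  have hint : ∀ u, Integrable (fun v => h v * ((jb (u - v))^A)⁻¹) := by
    intro u
    refine hhint.mono' (hcont.mul (hgu u)).aestronglyMeasurable
      (Filter.Eventually.of_forall fun v => ?_)
    have h1 := one_le_pow₀ (one_le_jb (u - v)) (n := A)
    have h2 := inv_le_one_of_one_le₀ h1
    rw [Real.norm_of_nonneg (mul_nonneg (h0 v) (inv_nonneg.2 (jb_pow_pos _ A).le))]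
    exact mul_le_of_le_one_right (h0 v) h2
  refine ⟨κ, (2^A)⁻¹ * I1, 2^A * I2 + 1, by positivity, by positivity, ?_, ?_, ?_, ?_⟩
  · exact (hm.stronglyMeasurable.integral_prod_right (ν := volume)).measurable
  · intro u
    have : (2^A)⁻¹ * I1 * ((jb u)^A)⁻¹ = ∫ v, ((2^A)⁻¹ * ((jb u)^A)⁻¹) * (h v * ((jb v)^A)⁻¹) := by
      rw [integral_const_mul]; ring
    rw [this]
    apply integral_mono (hhA'.const_mul _) (hint u)
    intro v
    have := mul_le_mul_of_nonneg_left (jb_inv_sub_ge u v A) (h0 v)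
    simp only
    linarith
  · intro u
    have : κ u ≤ ∫ v, (2^A * ((jb u)^A)⁻¹) * (h v * (jb v)^A) := by
      apply integral_mono (hint u) (hhA.const_mul _)
      intro v
      have := mul_le_mul_of_nonneg_left (jb_inv_sub_le u v A) (h0 v)
      simp only
      linarith
    rw [integral_const_mul] at this
    have h3 : 0 < ((jb u)^A)⁻¹ := inv_pos.2 (jb_pow_pos u A)
    rw [add_mul]
    linarith
  · intro θ hθ
    have hpl := hpl θ hθ
    have hi1 : Integrable (fun v => (h v : ℂ) * e (-(inner ℝ θ v))) := by
      refine hhint.ofReal.mul_bdd (c := 1) ?_ ?_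
      · exact (continuous_e.comp (by fun_prop)).aestronglyMeasurable
      · exact Filter.Eventually.of_forall fun v => (norm_e _).le
    have hi2 : Integrable (fun v : E => ((((jb v)^A)⁻¹ : ℝ) : ℂ) * e (-(inner ℝ θ v))) := by
      refine hgint.ofReal.mul_bdd (c := 1) ?_ ?_
      · exact (continuous_e.comp (by fun_prop)).aestronglyMeasurable
      · exact Filter.Eventually.of_forall fun v => (norm_e _).le
    have h6 := integral_convolution (L := ContinuousLinearMap.mul ℂ ℂ) (μ := volume) (ν := volume) hi1 hi2
    rw [hpl] at h6
    simp only [map_zero, zero_apply] at h6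
    rw [← h6]
    congr 1; ext u
    rw [convolution_def, hκ]
    simp only
    rw [← integral_complex_ofReal, ← integral_mul_const]
    congr 1; ext v
    simp only [ContinuousLinearMap.mul_apply']
    rw [show -(inner ℝ θ u) = -(inner ℝ θ v) + -(inner ℝ θ (u - v)) by rw [inner_sub_right]; ring, e_add]
    push_cast; ring
end
end Kernels

/-! ### Part 3: spectral toolkit -/
section Spectral

theorem charFun_e {μ : Measure R3} (ζ : R3) :
    charFun μ ((2 * π) • ζ) = ∫ x, e (inner ℝ ζ x) ∂μ := by
  rw [charFun_apply]
  congr 1; ext x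
  unfold e
  rw [inner_smul_right, real_inner_comm]
  congr 1; push_cast; ring

theorem measure_ext_e {μ ν : Measure R3} [IsFiniteMeasure μ] [IsFiniteMeasure ν]
    (h : ∀ ζ : R3, ∫ x, e (inner ℝ ζ x) ∂μ = ∫ x, e (inner ℝ ζ x) ∂ν) : μ = ν := by
  apply Measure.ext_of_charFun
  ext t
  have := h ((2 * π)⁻¹ • t)
  rw [← charFun_e, ← charFun_e, smul_smul, mul_inv_cancel₀ (by positivity), one_smul] at this
  exact this

theorem integrable_mul_BM {Ω : Type} [MeasurableSpace Ω] {μ : Measure Ω} {g h : Ω → ℂ}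
    (hg : Integrable g μ) (hh : BM h) : Integrable (fun w => g w * h w) μ := by
  obtain ⟨h1, C, h2⟩ := hh
  exact hg.mul_bdd (c := C) h1.aestronglyMeasurable (Filter.Eventually.of_forall h2)

theorem BM_e {Ω : Type} [MeasurableSpace Ω] {Y : Ω → R3} (hY : Measurable Y) (ζ : R3) :
    BM (fun w => e (inner ℝ ζ (Y w))) :=
  ⟨measurable_e.comp (measurable_const.inner hY), 1, fun _ => (norm_e _).le⟩

theorem real_unique {Ω : Type} [MeasurableSpace Ω] {μ : Measure Ω} {Y : Ω → R3} {g : Ω → ℝ}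
    (hY : Measurable Y) (hgm : Measurable g) (hg : Integrable g μ)
    (h0 : ∀ ζ : R3, ∫ w, (g w : ℂ) * e (inner ℝ ζ (Y w)) ∂μ = 0) (h : R3 → ℂ) (hh : BM h) :
    ∫ w, (g w : ℂ) * h (Y w) ∂μ = 0 := by
  have key : ∀ q : Ω → ℝ, Measurable q → (∀ w, 0 ≤ q w) → Integrable q μ → ∀ f : R3 → ℂ, BM f →
      ∫ x, f x ∂((μ.withDensity (fun w => ENNReal.ofReal (q w))).map Y)
        = ∫ w, (q w : ℂ) * f (Y w) ∂μ := by
    intro q hq hq0 hqi f hf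
    rw [integral_map hY.aemeasurable hf.1.aestronglyMeasurable,
      integral_withDensity_eq_integral_toReal_smul (by fun_prop)
        (Filter.Eventually.of_forall fun w => ENNReal.ofReal_lt_top)]
    congr 1; ext w
    rw [ENNReal.toReal_ofReal (hq0 w)]; simp
  have fin : ∀ q : Ω → ℝ, Integrable q μ →
      IsFiniteMeasure ((μ.withDensity (fun w => ENNReal.ofReal (q w))).map Y) := by
    intro q hqi
    have := isFiniteMeasure_withDensity_ofReal hqi.2
    infer_instance
  set p : Ω → ℝ := fun w => max (g w) 0
  set n : Ω → ℝ := fun w => max (-g w) 0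
  have hpm : Measurable p := by fun_prop
  have hnm : Measurable n := by fun_prop
  have hp : Integrable p μ := hg.pos_part
  have hn : Integrable n μ := hg.neg_part
  have hgpn : ∀ w, (g w : ℂ) = (p w : ℂ) - (n w : ℂ) := by
    intro w
    rw [← Complex.ofReal_sub]; congr 1
    exact (max_zero_sub_max_neg_zero_eq_self (g w)).symm
  have hdiff : ∀ f : R3 → ℂ, BM f → ∫ w, (g w : ℂ) * f (Y w) ∂μ =
      (∫ w, (p w : ℂ) * f (Y w) ∂μ) - ∫ w, (n w : ℂ) * f (Y w) ∂μ := by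
    intro f hf
    have hfY : BM (fun w => f (Y w)) := ⟨hf.1.comp hY, hf.2.choose, fun w => hf.2.choose_spec _⟩
    have hp' : Integrable (fun w => (p w : ℂ)) μ := hp.ofReal
    have hn' : Integrable (fun w => (n w : ℂ)) μ := hn.ofReal
    rw [← integral_sub (integrable_mul_BM hp' hfY) (integrable_mul_BM hn' hfY)]
    congr 1; ext w; rw [hgpn]; ring
  have := fin p hp
  have := fin n hn
  have heq : ((μ.withDensity (fun w => ENNReal.ofReal (p w))).map Y) =
      ((μ.withDensity (fun w => ENNReal.ofReal (n w))).map Y) := by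
    apply measure_ext_e
    intro ζ
    have hb : BM (fun x : R3 => e (inner ℝ ζ x)) := BM_e measurable_id ζ
    rw [key p hpm (fun w => le_max_right _ _) hp _ hb, key n hnm (fun w => le_max_right _ _) hn _ hb,
      ← sub_eq_zero]
    have := hdiff _ hb
    rw [← this]; exact h0 ζ
  rw [hdiff h hh, ← key p hpm (fun w => le_max_right _ _) hp _ hh,
    ← key n hnm (fun w => le_max_right _ _) hn _ hh, heq, sub_self]

/-- `Sp W S`: the bounded function `W` has spectrum contained in `S`. -/
def Sp (W : R3 → ℂ) (S : Set R3) : Prop :=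
  ∀ (Ω : Type) [MeasurableSpace Ω] (μ : Measure Ω) [SFinite μ] (Y : Ω → R3) (g : Ω → ℂ),
    Measurable Y → Measurable g → Integrable g μ →
    (∀ ζ ∈ S, ∫ w, g w * e (inner ℝ ζ (Y w)) ∂μ = 0) → ∫ w, g w * W (Y w) ∂μ = 0

theorem Sp_univ {h : R3 → ℂ} (hh : BM h) : Sp h univ := by
  intro Ω _ μ _ Y g hY hgm hg h0
  have h0' : ∀ ζ : R3, ∫ w, (starRingEnd ℂ) (g w) * e (inner ℝ ζ (Y w)) ∂μ = 0 := by
    intro ζ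
    have := congrArg (starRingEnd ℂ) (h0 (-ζ) (mem_univ _))
    rw [← integral_conj, map_zero] at this
    rw [← this]; congr 1; ext w
    rw [map_mul, inner_neg_left, e_neg, Complex.conj_conj]
  have hci : Integrable (fun w => (starRingEnd ℂ) (g w)) μ := by
    refine hg.norm.mono' (by fun_prop) (Filter.Eventually.of_forall fun w => ?_)
    simp
  have hre : ∀ ζ : R3, ∫ w, ((g w).re : ℂ) * e (inner ℝ ζ (Y w)) ∂μ = 0 := by
    intro ζ
    have h1 := h0 ζ (mem_univ _)
    have h2 := h0' ζ
    have : ∫ w, (1/2 : ℂ) * (g w * e (inner ℝ ζ (Y w)) + (starRingEnd ℂ) (g w) * e (inner ℝ ζ (Y w))) ∂μ = 0 := by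
      rw [integral_const_mul, integral_add (integrable_mul_BM hg (BM_e hY ζ)) (integrable_mul_BM hci (BM_e hY ζ)), h1, h2]
      simp
    rw [← this]; congr 1; ext w
    rw [Complex.re_eq_add_conj]; ring
  have him : ∀ ζ : R3, ∫ w, ((g w).im : ℂ) * e (inner ℝ ζ (Y w)) ∂μ = 0 := by
    intro ζ
    have h1 := h0 ζ (mem_univ _)
    have h2 := h0' ζ
    have : ∫ w, (1/(2*I) : ℂ) * (g w * e (inner ℝ ζ (Y w)) - (starRingEnd ℂ) (g w) * e (inner ℝ ζ (Y w))) ∂μ = 0 := by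
      rw [integral_const_mul, integral_sub (integrable_mul_BM hg (BM_e hY ζ)) (integrable_mul_BM hci (BM_e hY ζ)), h1, h2]
      simp
    rw [← this]; congr 1; ext w
    rw [Complex.im_eq_sub_conj]; ring
  have hre' : Integrable (fun w => (g w).re) μ := hg.re
  have him' : Integrable (fun w => (g w).im) μ := hg.im
  have r1 := real_unique hY (by fun_prop) hre' hre h hh
  have r2 := real_unique hY (by fun_prop) him' him h hh
  have hfY : BM (fun w => h (Y w)) := ⟨hh.1.comp hY, hh.2.choose, fun w => hh.2.choose_spec _⟩
  have : ∫ w, g w * h (Y w) ∂μ = (∫ w, ((g w).re : ℂ) * h (Y w) ∂μ) + I * ∫ w, ((g w).im : ℂ) * h (Y w) ∂μ := by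
    have hre2 : Integrable (fun w => ((g w).re : ℂ)) μ := hre'.ofReal
    have him2 : Integrable (fun w => ((g w).im : ℂ)) μ := him'.ofReal
    rw [← integral_const_mul, ← integral_add (integrable_mul_BM hre2 hfY)
      ((integrable_mul_BM him2 hfY).const_mul I)]
    congr 1; ext w
    conv_lhs => rw [← Complex.re_add_im (g w)]
    ring
  rw [this, r1, r2]; simp

theorem Sp.mono {W : R3 → ℂ} {S S' : Set R3} (h : Sp W S) (hS : S ⊆ S') : Sp W S' :=
  fun Ω _ μ _ Y g hY hg hgi h0 => h Ω μ Y g hY hg hgi fun ζ hζ => h0 ζ (hS hζ)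

theorem BM.comp' {Ω Ω' : Type} [MeasurableSpace Ω] [MeasurableSpace Ω'] {f : Ω → ℂ} (hf : BM f) {Y : Ω' → Ω}
    (hY : Measurable Y) : BM (fun w => f (Y w)) :=
  ⟨hf.1.comp hY, hf.2.choose, fun _ => hf.2.choose_spec _⟩

theorem Sp.mul {W1 W2 : R3 → ℂ} {S1 S2 : Set R3} (h1 : Sp W1 S1) (h2 : Sp W2 S2) (b1 : BM W1) :
    Sp (fun x => W1 x * W2 x) {ζ | ∃ a ∈ S1, ∃ b ∈ S2, ζ = a + b} := by
  intro Ω _ μ _ Y g hY hgm hg h0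
  have b1' := b1.comp' hY
  have := h2 Ω μ Y (fun w => g w * W1 (Y w)) hY (hgm.mul b1'.1) (integrable_mul_BM hg b1') ?_
  · rw [← this]; congr 1; ext w; ring
  · intro ζ2 hζ2
    have hb := BM_e hY ζ2
    have := h1 Ω μ Y (fun w => g w * e (inner ℝ ζ2 (Y w))) hY (hgm.mul hb.1) (integrable_mul_BM hg hb) ?_
    · rw [← this]; congr 1; ext w; ring
    · intro ζ1 hζ1
      have := h0 (ζ1 + ζ2) ⟨ζ1, hζ1, ζ2, hζ2, rfl⟩
      rw [← this]; congr 1; ext w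
      rw [inner_add_left, e_add]; ring

theorem Sp.conj {W : R3 → ℂ} {S : Set R3} (h : Sp W S) :
    Sp (fun x => (starRingEnd ℂ) (W x)) {ζ | -ζ ∈ S} := by
  intro Ω _ μ _ Y g hY hgm hg h0
  have hci : Integrable (fun w => (starRingEnd ℂ) (g w)) μ := by
    refine hg.norm.mono' (by fun_prop) (Filter.Eventually.of_forall fun w => ?_)
    simp
  have := h Ω μ Y (fun w => (starRingEnd ℂ) (g w)) hY (by fun_prop) hci ?_
  · have := congrArg (starRingEnd ℂ) this
    rw [← integral_conj, map_zero] at this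
    rw [← this]; congr 1; ext w
    rw [map_mul, Complex.conj_conj]
  · intro ζ hζ
    have := congrArg (starRingEnd ℂ) (h0 (-ζ) (by simpa using hζ))
    rw [← integral_conj, map_zero] at this
    rw [← this]; congr 1; ext w
    rw [map_mul, inner_neg_left, e_neg, Complex.conj_conj]

theorem Sp.eq_zero {W : R3 → ℂ} (h : Sp W ∅) (x : R3) : W x = 0 := by
  have := h Unit (Measure.dirac ()) (fun _ => x) (fun _ => 1) measurable_const measurable_const
    (integrable_const _) (by simp)
  simpa using this

/-- convolution operator -/
def cvl {E : Type} [MeasureSpace E] (L : E → R3) (k : E → ℂ) (W : R3 → ℂ) (x : R3) : ℂ :=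
  ∫ u, W (x - L u) * k u

/-- its multiplier -/
def mlt {E : Type} [MeasureSpace E] (L : E → R3) (k : E → ℂ) (ζ : R3) : ℂ :=
  ∫ u, k u * e (-(inner ℝ ζ (L u)))

section
variable {E : Type} [MeasureSpace E] [SFinite (volume : Measure E)] {L : E → R3} {k : E → ℂ}

theorem cnv_int {W : R3 → ℂ} (hW : BM W) (hL : Measurable L) (hk : Integrable k) (x : R3) :
    Integrable (fun u => W (x - L u) * k u) := by
  have := integrable_mul_BM hk (hW.comp' (measurable_const.sub hL : Measurable fun u => x - L u))
  refine this.congr (Filter.Eventually.of_forall fun u => ?_)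
  exact mul_comm _ _

theorem BM.cnv {W : R3 → ℂ} (hW : BM W) (hL : Measurable L) (hkm : Measurable k) (hk : Integrable k) :
    BM (cvl L k W) := by
  refine ⟨?_, hW.2.choose * ∫ u, ‖k u‖, fun x => ?_⟩
  · have hm : Measurable (fun p : R3 × E => W (p.1 - L p.2) * k p.2) :=
      (hW.1.comp (measurable_fst.sub (hL.comp measurable_snd))).mul (hkm.comp measurable_snd)
    exact (hm.stronglyMeasurable.integral_prod_right (ν := volume)).measurable
  · rw [← integral_const_mul]
    refine norm_integral_le_of_norm_le (hk.norm.const_mul _) (Filter.Eventually.of_forall fun u => ?_)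
    rw [norm_mul]
    gcongr
    exact hW.2.choose_spec _

theorem prod_g {Ω : Type} [MeasurableSpace Ω] {μ : Measure Ω} [SFinite μ] {Y : Ω → R3} {g : Ω → ℂ}
    (ζ : R3) : ∫ p : Ω × E, (g p.1 * k p.2) * e (inner ℝ ζ (Y p.1 - L p.2)) ∂(μ.prod volume)
      = (∫ w, g w * e (inner ℝ ζ (Y w)) ∂μ) * mlt L k ζ := by
  rw [mlt, ← integral_prod_mul]
  congr 1; ext p
  rw [inner_sub_right, sub_eq_add_neg, e_add]; ring

theorem Sp.cnv {W : R3 → ℂ} {S : Set R3} (h : Sp W S) (hW : BM W) (hL : Measurable L) (hkm : Measurable k)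
    (hk : Integrable k) : Sp (cvl L k W) {ζ | ζ ∈ S ∧ mlt L k ζ ≠ 0} := by
  intro Ω _ μ _ Y g hY hgm hg h0
  have hZ : Measurable (fun p : Ω × E => Y p.1 - L p.2) :=
    (hY.comp measurable_fst).sub (hL.comp measurable_snd)
  have hG : Integrable (fun p : Ω × E => g p.1 * k p.2) (μ.prod volume) := hg.mul_prod hk
  have := h (Ω × E) (μ.prod volume) (fun p => Y p.1 - L p.2) (fun p => g p.1 * k p.2) hZ
    ((hgm.comp measurable_fst).mul (hkm.comp measurable_snd)) hG ?_
  · rw [integral_prod _ (integrable_mul_BM hG (hW.comp' hZ))] at this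
    rw [← this]; congr 1; ext w
    simp only [cvl]
    rw [← integral_const_mul]
    congr 1; ext u; ring
  · intro ζ hζ
    rw [prod_g]
    by_cases hm : mlt L k ζ = 0
    · rw [hm, mul_zero]
    · rw [h0 ζ ⟨hζ, hm⟩, zero_mul]

theorem Sp.sub_cnv {W : R3 → ℂ} {S : Set R3} (h : Sp W S) (hW : BM W) (hL : Measurable L) (hkm : Measurable k)
    (hk : Integrable k) : Sp (fun x => W x - cvl L k W x) {ζ | ζ ∈ S ∧ mlt L k ζ ≠ 1} := by
  intro Ω _ μ _ Y g hY hgm hg h0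
  -- the measure on Option-like sum
  let ν : Measure (Ω ⊕ (Ω × E)) := μ.map Sum.inl + (μ.prod volume).map Sum.inr
  let Z : Ω ⊕ (Ω × E) → R3 := Sum.elim Y (fun p => Y p.1 - L p.2)
  let G : Ω ⊕ (Ω × E) → ℂ := Sum.elim g (fun p => - (g p.1 * k p.2))
  have hZ2 : Measurable (fun p : Ω × E => Y p.1 - L p.2) :=
    (hY.comp measurable_fst).sub (hL.comp measurable_snd)
  have hG2 : Integrable (fun p : Ω × E => g p.1 * k p.2) (μ.prod volume) := hg.mul_prod hk
  have hGm2 : Measurable (fun p : Ω × E => g p.1 * k p.2) :=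
    (hgm.comp measurable_fst).mul (hkm.comp measurable_snd)
  have hZ : Measurable Z := hY.sumElim hZ2
  have hGm : Measurable G := hgm.sumElim hGm2.neg
  have hI : Integrable G ν := by
    refine Integrable.add_measure ?_ ?_
    · rw [integrable_map_measure hGm.aestronglyMeasurable measurable_inl.aemeasurable]
      exact hg
    · rw [integrable_map_measure hGm.aestronglyMeasurable measurable_inr.aemeasurable]
      exact hG2.neg
  have split : ∀ f : R3 → ℂ, BM f → ∫ q, G q * f (Z q) ∂ν =
      (∫ w, g w * f (Y w) ∂μ) - ∫ p : Ω × E, (g p.1 * k p.2) * f (Y p.1 - L p.2) ∂(μ.prod volume) := by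
    intro f hf
    have hfZ := integrable_mul_BM hI (hf.comp' hZ)
    have hm : Measurable (fun q => G q * f (Z q)) := hGm.mul (hf.1.comp hZ)
    have hfZ2 := hfZ.mono_measure (show μ.map Sum.inl ≤ ν from Measure.le_add_right le_rfl)
    have hfZ3 := hfZ.mono_measure (show (μ.prod volume).map Sum.inr ≤ ν from Measure.le_add_left le_rfl)
    rw [integral_add_measure hfZ2 hfZ3, integral_map measurable_inl.aemeasurable hm.aestronglyMeasurable,
      integral_map measurable_inr.aemeasurable hm.aestronglyMeasurable]
    simp only [G, Z, Sum.elim_inl, Sum.elim_inr, neg_mul]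
    rw [integral_neg, sub_eq_add_neg]
  have := h _ ν Z G hZ hGm hI ?_
  · rw [split W hW, integral_prod _ (integrable_mul_BM hG2 (hW.comp' hZ2))] at this
    have hWY := hW.comp' hY
    have hcY := (hW.cnv hL hkm hk).comp' hY
    simp only [mul_sub]
    rw [integral_sub (integrable_mul_BM hg hWY) (integrable_mul_BM hg hcY), ← this]
    congr 2; ext w
    simp only [cvl]
    rw [← integral_const_mul]
    congr 1; ext u; ring
  · intro ζ hζ
    have hs := split _ (BM_e measurable_id ζ)
    simp only [id] at hs
    rw [hs, prod_g]
    by_cases hm : mlt L k ζ = 1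
    · rw [hm, mul_one, sub_self]
    · rw [h0 ζ ⟨hζ, hm⟩, zero_mul, sub_zero]
end
end Spectral

/-! ### Part 4: analytic preliminaries, windows and frames -/
section Prelim

theorem orth_bd {Ω ι : Type} [MeasurableSpace Ω] {μ : Measure Ω} [IsFiniteMeasure μ] (s : Finset ι)
    (g : ι → Ω → ℂ) (hg : ∀ i, BM (g i)) (r : ι → ι → Prop) [DecidableRel r] (D : ℕ)
    (hr : ∀ i j, r i j → r j i)
    (hD : ∀ i ∈ s, (s.filter (r i)).card ≤ D)
    (h0 : ∀ i ∈ s, ∀ j ∈ s, ¬ r i j → ∫ w, g i w * (starRingEnd ℂ) (g j w) ∂μ = 0) :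
    ∫ w, ‖∑ i ∈ s, g i w‖^2 ∂μ ≤ D * ∑ i ∈ s, ∫ w, ‖g i w‖^2 ∂μ := by
  have hint : ∀ i j, Integrable (fun w => g i w * (starRingEnd ℂ) (g j w)) μ :=
    fun i j => ((hg i).mul (hg j).conj).int μ
  have h2 : ∀ i, Integrable (fun w => ‖g i w‖^2) μ := fun i => (hg i).int_pow1 2 μ
  have e1 : ((∫ w, ‖∑ i ∈ s, g i w‖^2 ∂μ : ℝ) : ℂ)
      = ∑ i ∈ s, ∑ j ∈ s, ∫ w, g i w * (starRingEnd ℂ) (g j w) ∂μ := by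
    rw [← integral_complex_ofReal]
    simp_rw [← integral_finsetSum s (fun j _ => hint _ j)]
    rw [← integral_finsetSum s (fun i _ => integrable_finsetSum s (fun j _ => hint i j))]
    congr 1; ext w
    rw [← Finset.sum_mul_sum, ← map_sum, Complex.mul_conj, Complex.normSq_eq_norm_sq]
  have e2 : ∀ i ∈ s, ∑ j ∈ s, ∫ w, g i w * (starRingEnd ℂ) (g j w) ∂μ
      = ∑ j ∈ s with r i j, ∫ w, g i w * (starRingEnd ℂ) (g j w) ∂μ := by
    intro i hi
    rw [Finset.sum_filter]
    refine Finset.sum_congr rfl fun j hj => ?_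
    split_ifs with h
    · rfl
    · exact h0 i hi j hj h
  have e3 : ∀ i j, ‖∫ w, g i w * (starRingEnd ℂ) (g j w) ∂μ‖ ≤
      (∫ w, ‖g i w‖^2 ∂μ)/2 + (∫ w, ‖g j w‖^2 ∂μ)/2 := by
    intro i j
    rw [← integral_div, ← integral_div, ← integral_add ((h2 i).div_const 2) ((h2 j).div_const 2)]
    refine norm_integral_le_of_norm_le (((h2 i).div_const 2).add ((h2 j).div_const 2))
      (Filter.Eventually.of_forall fun w => ?_)
    rw [norm_mul, RCLike.norm_conj]
    show _ ≤ ‖g i w‖^2/2 + ‖g j w‖^2/2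
    nlinarith [sq_nonneg (‖g i w‖ - ‖g j w‖)]
  set q : ι → ℝ := fun i => ∫ w, ‖g i w‖^2 ∂μ with hq
  have hq0 : ∀ i, 0 ≤ q i := fun i => integral_nonneg fun w => by positivity
  have e4 : ∫ w, ‖∑ i ∈ s, g i w‖^2 ∂μ ≤ ∑ i ∈ s, ∑ j ∈ s with r i j, (q i/2 + q j/2) := by
    have h5 : ‖((∫ w, ‖∑ i ∈ s, g i w‖^2 ∂μ : ℝ) : ℂ)‖ = ∫ w, ‖∑ i ∈ s, g i w‖^2 ∂μ := by
      rw [Complex.norm_real, Real.norm_of_nonneg (integral_nonneg fun w => by positivity)]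
    rw [← h5, e1, Finset.sum_congr rfl e2]
    refine (norm_sum_le _ _).trans (Finset.sum_le_sum fun i _ => (norm_sum_le _ _).trans
      (Finset.sum_le_sum fun j _ => e3 i j))
  have e5 : ∑ i ∈ s, ∑ j ∈ s with r i j, q i/2 ≤ D * (∑ i ∈ s, q i) / 2 := by
    rw [Finset.mul_sum, Finset.sum_div]
    refine Finset.sum_le_sum fun i hi => ?_
    rw [Finset.sum_const, nsmul_eq_mul]
    have : (((s.filter (r i)).card : ℕ) : ℝ) ≤ D := by exact_mod_cast hD i hi
    nlinarith [mul_le_mul_of_nonneg_right this (hq0 i)]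
  have e6 : ∑ i ∈ s, ∑ j ∈ s with r i j, q j/2 = ∑ i ∈ s, ∑ j ∈ s with r i j, q i/2 := by
    simp_rw [Finset.sum_filter]
    rw [Finset.sum_comm]
    refine Finset.sum_congr rfl fun i _ => Finset.sum_congr rfl fun j _ => ?_
    by_cases h : r i j
    · rw [if_pos h, if_pos (hr _ _ h)]
    · rw [if_neg h, if_neg (fun h' => h (hr _ _ h'))]
  simp_rw [Finset.sum_add_distrib] at e4
  rw [e6] at e4
  linarith

theorem cs_int {Ω : Type} [MeasurableSpace Ω] {μ : Measure Ω} {f g : Ω → ℝ}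
    (hf : Integrable (fun w => f w^2) μ) (hg : Integrable (fun w => g w^2) μ)
    (hfg : Integrable (fun w => f w * g w) μ) :
    (∫ w, f w * g w ∂μ)^2 ≤ (∫ w, f w^2 ∂μ) * ∫ w, g w^2 ∂μ := by
  have key : ∀ t : ℝ, 0 ≤ (∫ w, f w^2 ∂μ) * (t * t) + (-(2 * ∫ w, f w * g w ∂μ)) * t + ∫ w, g w^2 ∂μ := by
    intro t
    have h1 : 0 ≤ ∫ w, ((t*t) * f w^2 - (2*t) * (f w * g w)) + g w^2 ∂μ :=
      integral_nonneg fun w => by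
        show 0 ≤ ((t*t) * f w^2 - (2*t) * (f w * g w)) + g w^2
        nlinarith [sq_nonneg (t * f w - g w)]
    have i1 : Integrable (fun w => (t*t) * f w^2) μ := hf.const_mul _
    have i2 : Integrable (fun w => (2*t) * (f w * g w)) μ := hfg.const_mul _
    have i3 : Integrable (fun w => (t*t) * f w^2 - (2*t) * (f w * g w)) μ := i1.sub i2
    rw [integral_add i3 hg, integral_sub i1 i2, integral_const_mul, integral_const_mul] at h1
    linarith
  have := discrim_le_zero key
  unfold discrim at this
  nlinarith

theorem jensen6 {Ω : Type} [MeasurableSpace Ω] {μ : Measure Ω} {a k : Ω → ℝ} (ha0 : ∀ w, 0 ≤ a w)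
    (hk0 : ∀ w, 0 ≤ k w) (hk : Integrable k μ) (hak : Integrable (fun w => a w * k w) μ)
    (ha6 : Integrable (fun w => a w^6 * k w) μ) :
    (∫ w, a w * k w ∂μ)^6 ≤ (∫ w, k w ∂μ)^5 * ∫ w, a w^6 * k w ∂μ := by
  set m := ∫ w, a w * k w ∂μ with hm
  set K := ∫ w, k w ∂μ with hK
  set J := ∫ w, a w^6 * k w ∂μ with hJ
  have hm0 : 0 ≤ m := integral_nonneg fun w => mul_nonneg (ha0 w) (hk0 w)
  have hK0 : 0 ≤ K := integral_nonneg hk0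
  have key : ∀ l : ℝ, 0 ≤ l → 6 * l^5 * m ≤ J + 5 * l^6 * K := by
    intro l hl
    rw [hm, hJ, hK, ← integral_const_mul, ← integral_const_mul, ← integral_add ha6 (hk.const_mul _)]
    refine integral_mono (hak.const_mul _) (ha6.add (hk.const_mul _)) fun w => ?_
    show 6 * l^5 * (a w * k w) ≤ a w^6 * k w + 5 * l^6 * k w
    have h1 : 6 * l^5 * a w ≤ a w^6 + 5 * l^6 := by
      have ha := ha0 w
      have : a w^6 + 5*l^6 - 6*l^5*a w = (a w - l)^2*(a w^4+2*a w^3*l+3*a w^2*l^2+4*a w*l^3+5*l^4) := by ring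
      have h2 : 0 ≤ (a w - l)^2*(a w^4+2*a w^3*l+3*a w^2*l^2+4*a w*l^3+5*l^4) := by positivity
      linarith
    nlinarith [mul_le_mul_of_nonneg_right h1 (hk0 w)]
  rcases eq_or_lt_of_le hK0 with h | h
  · -- K = 0
    have hz : k =ᵐ[μ] 0 := (integral_eq_zero_iff_of_nonneg hk0 hk).1 h.symm
    have : m = 0 := by
      rw [hm]; apply integral_eq_zero_of_ae
      filter_upwards [hz] with w hw
      rw [hw]; simp
    rw [this, ← h]; simp
  · have := key (m / K) (by positivity)
    have e1 : 6 * (m/K)^5 * m = 6 * m^6 / K^5 := by field_simp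
    have e2 : 5 * (m/K)^6 * K = 5 * m^6 / K^5 := by field_simp
    rw [e1, e2] at this
    have h3 : m^6 / K^5 ≤ J := by
      have : 6 * m^6/K^5 = 6 * (m^6/K^5) := by ring
      have : 5 * m^6/K^5 = 5 * (m^6/K^5) := by ring
      linarith
    rw [div_le_iff₀ (by positivity)] at h3
    linarith

/-- 3-vectors -/
def mk3 (a b c : ℝ) : R3 := !₂[a, b, c]
@[simp] theorem mk3_0 (a b c : ℝ) : mk3 a b c 0 = a := rfl
@[simp] theorem mk3_1 (a b c : ℝ) : mk3 a b c 1 = b := rfl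
@[simp] theorem mk3_2 (a b c : ℝ) : mk3 a b c 2 = c := rfl
theorem R3_ext {x y : R3} (h0 : x 0 = y 0) (h1 : x 1 = y 1) (h2 : x 2 = y 2) : x = y := by
  ext i; fin_cases i <;> assumption
theorem inner3 (x y : R3) : inner ℝ x y = x 0 * y 0 + x 1 * y 1 + x 2 * y 2 := by
  simp [PiLp.inner_apply, Fin.sum_univ_three]; ring
theorem norm3 (x : R3) : ‖x‖^2 = x 0^2 + x 1^2 + x 2^2 := by
  rw [EuclideanSpace.norm_sq_eq, Fin.sum_univ_three]; simp
theorem jb3 (x : R3) : jb x = 1 + (x 0^2 + x 1^2 + x 2^2) := by rw [jb, norm3]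
theorem abs_le_norm3 (x : R3) (i : Fin 3) : |x i| ≤ ‖x‖ := by
  have := EuclideanSpace.norm_eq x
  exact PiLp.norm_apply_le x i
theorem cont_mk3 {X : Type} [TopologicalSpace X] {f g h : X → ℝ} (hf : Continuous f) (hg : Continuous g)
    (hh : Continuous h) : Continuous (fun x => mk3 (f x) (g x) (h x)) := by
  unfold mk3
  refine (PiLp.continuous_toLp 2 _).comp (continuous_pi fun i => ?_)
  fin_cases i <;> assumption
theorem cont_ap (i : Fin 3) : Continuous (fun x : R3 => x i) := by fun_prop

/-- chosen kernels -/
theorem finrank_R3 : Module.finrank ℝ R3 = 3 := by simp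
def kap3 (a : ℕ) : R3 → ℝ := (kernel_pos (E := R3) (A := a + 4) (by rw [finrank_R3]; omega)).choose
theorem kap3_spec (a : ℕ) : ∃ (c C : ℝ), 0 < c ∧ 0 < C ∧ Measurable (kap3 a) ∧ (∀ u, c * ((jb u)^(a+4))⁻¹ ≤ kap3 a u) ∧
      (∀ u, kap3 a u ≤ C * ((jb u)^(a+4))⁻¹) ∧
      ∀ θ : R3, 1 ≤ ‖θ‖ → ∫ u, (kap3 a u : ℂ) * e (-(inner ℝ θ u)) = 0 :=
  (kernel_pos (E := R3) (A := a + 4) (by rw [finrank_R3]; omega)).choose_spec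
def kap1 (a : ℕ) : ℝ → ℝ := (kernel_pos (E := ℝ) (A := a + 4) (by simp; omega)).choose
theorem kap1_spec (a : ℕ) : ∃ (c C : ℝ), 0 < c ∧ 0 < C ∧ Measurable (kap1 a) ∧ (∀ u, c * ((jb u)^(a+4))⁻¹ ≤ kap1 a u) ∧
      (∀ u, kap1 a u ≤ C * ((jb u)^(a+4))⁻¹) ∧
      ∀ θ : ℝ, 1 ≤ ‖θ‖ → ∫ u, (kap1 a u : ℂ) * e (-(inner ℝ θ u)) = 0 :=
  (kernel_pos (E := ℝ) (A := a + 4) (by simp; omega)).choose_spec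

theorem kap3_meas (a : ℕ) : Measurable (kap3 a) := (kap3_spec a).choose_spec.choose_spec.2.2.1
theorem kap1_meas (a : ℕ) : Measurable (kap1 a) := (kap1_spec a).choose_spec.choose_spec.2.2.1
theorem kap3_pos (a : ℕ) (u : R3) : 0 < kap3 a u := by
  obtain ⟨c, C, hc, hC, -, h1, -⟩ := kap3_spec a
  exact lt_of_lt_of_le (mul_pos hc (inv_pos.2 (jb_pow_pos u _))) (h1 u)
theorem kap1_pos (a : ℕ) (u : ℝ) : 0 < kap1 a u := by
  obtain ⟨c, C, hc, hC, -, h1, -⟩ := kap1_spec a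
  exact lt_of_lt_of_le (mul_pos hc (inv_pos.2 (jb_pow_pos u _))) (h1 u)
theorem jb_meas {E : Type} [NormedAddCommGroup E] [MeasurableSpace E] [BorelSpace E] : Measurable (jb : E → ℝ) :=
  continuous_jb.measurable
/-- integrability of kernel times polynomial weight -/
theorem kap3_int (a : ℕ) : Integrable (fun u => kap3 a u * (jb u)^a) := by
  obtain ⟨c, C, hc, hC, hm, h1, h2, -⟩ := kap3_spec a
  refine ((integrable_jb (E := R3) (A := 4) (by rw [finrank_R3]; omega)).const_mul C).mono'
    (hm.mul (jb_meas.pow_const a)).aestronglyMeasurable (Filter.Eventually.of_forall fun u => ?_)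
  have hj := jb_pow_pos u a
  rw [Real.norm_of_nonneg (mul_nonneg (kap3_pos a u).le hj.le)]
  calc kap3 a u * (jb u)^a ≤ C * ((jb u)^(a+4))⁻¹ * (jb u)^a := by gcongr; exact h2 u
    _ = C * ((jb u)^4)⁻¹ := by
      have := (jb_pos u).ne'
      rw [pow_add]; field_simp
theorem kap1_int (a : ℕ) : Integrable (fun u => kap1 a u * (jb u)^a) := by
  obtain ⟨c, C, hc, hC, hm, h1, h2, -⟩ := kap1_spec a
  refine ((integrable_jb (E := ℝ) (A := 4) (by simp)).const_mul C).mono'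
    (hm.mul (jb_meas.pow_const a)).aestronglyMeasurable (Filter.Eventually.of_forall fun u => ?_)
  have hj := jb_pow_pos u a
  rw [Real.norm_of_nonneg (mul_nonneg (kap1_pos a u).le hj.le)]
  calc kap1 a u * (jb u)^a ≤ C * ((jb u)^(a+4))⁻¹ * (jb u)^a := by gcongr; exact h2 u
    _ = C * ((jb u)^4)⁻¹ := by
      have := (jb_pos u).ne'
      rw [pow_add]; field_simp
theorem kap3_int0 (a : ℕ) : Integrable (kap3 a) := by
  refine (kap3_int a).mono' (kap3_meas a).aestronglyMeasurable (Filter.Eventually.of_forall fun u => ?_)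
  rw [Real.norm_of_nonneg (kap3_pos a u).le]
  exact le_mul_of_one_le_right (kap3_pos a u).le (one_le_pow₀ (one_le_jb u))
theorem kap1_int0 (a : ℕ) : Integrable (kap1 a) := by
  refine (kap1_int a).mono' (kap1_meas a).aestronglyMeasurable (Filter.Eventually.of_forall fun u => ?_)
  rw [Real.norm_of_nonneg (kap1_pos a u).le]
  exact le_mul_of_one_le_right (kap1_pos a u).le (one_le_pow₀ (one_le_jb u))

/-- windows -/
def dg (r u : R3) : R3 := mk3 (r 0 * u 0) (r 1 * u 1) (r 2 * u 2)
theorem cont_dg (r : R3) : Continuous (dg r) :=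
  cont_mk3 (by fun_prop) (by fun_prop) (by fun_prop)
def win (r z : R3) : Measure R3 :=
  (volume.withDensity (fun u => ENNReal.ofReal (kap3 0 u))).map (fun u => dg r u + z)
theorem win_meas (r z : R3) : Measurable (fun u => dg r u + z) := ((cont_dg r).measurable.add_const z)
instance (r z : R3) : IsFiniteMeasure (win r z) := by
  have := isFiniteMeasure_withDensity_ofReal (kap3_int0 0).2
  unfold win; infer_instance
theorem win_int {F : Type} [NormedAddCommGroup F] [NormedSpace ℝ F] (r z : R3) (f : R3 → F) (hf : StronglyMeasurable f) :
    ∫ x, f x ∂win r z = ∫ u, kap3 0 u • f (dg r u + z) := by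
  unfold win
  rw [integral_map (win_meas r z).aemeasurable hf.aestronglyMeasurable,
      integral_withDensity_eq_integral_toReal_smul (kap3_meas 0).ennreal_ofReal
        (Filter.Eventually.of_forall fun w => ENNReal.ofReal_lt_top)]
  congr 1; ext u
  rw [ENNReal.toReal_ofReal (kap3_pos 0 u).le]
theorem win_shift {F : Type} [NormedAddCommGroup F] [NormedSpace ℝ F] (r z a : R3) (f : R3 → F) (hf : StronglyMeasurable f) :
    ∫ x, f (x - a) ∂win r z = ∫ x, f x ∂win r (z - a) := by
  rw [win_int r _ f hf, win_int r z (fun x => f (x - a)) (hf.comp_measurable (by fun_prop))]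
  congr 1; ext u
  rw [add_sub_assoc]
theorem win_ft (r z ζ : R3) (i : Fin 3) (h : 1 ≤ |r i * ζ i|) : ∫ x, e (inner ℝ ζ x) ∂win r z = 0 := by
  have hme : Measurable (fun x : R3 => e (inner ℝ ζ x)) := (BM_e measurable_id ζ).1
  rw [win_int r z _ hme.stronglyMeasurable]
  obtain ⟨c, C, hc, hC, hm, h1, h2, h3⟩ := kap3_spec 0
  have h4 := h3 (-(dg r ζ)) ?_
  · have : ∀ u, kap3 0 u • e (inner ℝ ζ (dg r u + z)) =
        ((kap3 0 u : ℂ) * e (-(inner ℝ (-(dg r ζ)) u))) * e (inner ℝ ζ z) := by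
      intro u
      rw [inner_add_right, e_add, inner_neg_left, neg_neg, inner3 ζ (dg r u), inner3 (dg r ζ) u]
      simp only [dg, mk3_0, mk3_1, mk3_2, Complex.real_smul]
      rw [show ζ 0 * (r 0 * u 0) + ζ 1 * (r 1 * u 1) + ζ 2 * (r 2 * u 2) = r 0 * ζ 0 * u 0 + r 1 * ζ 1 * u 1 + r 2 * ζ 2 * u 2 by ring]
      ring
    simp_rw [this]
    rw [integral_mul_const, h4, zero_mul]
  · rw [norm_neg]
    refine h.trans (le_trans (le_of_eq ?_) (abs_le_norm3 _ i))
    fin_cases i <;> rfl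

/-- uniform sixth moment bound -/
def UB6 (r : R3) (V : R3 → ℂ) (Q : ℝ) : Prop := ∀ z, ∫ x, ‖V x‖^6 ∂win r z ≤ Q

theorem UB6.cnv {r : R3} {V : R3 → ℂ} {Q : ℝ} (h : UB6 r V Q) (hV : BM V) {E : Type} [MeasureSpace E]
    [SFinite (volume : Measure E)] {L : E → R3} {k : E → ℂ} (hL : Measurable L) (hkm : Measurable k)
    (hk : Integrable k) : UB6 r (cvl L k V) ((∫ u, ‖k u‖)^6 * Q) := by
  intro z
  obtain ⟨C, hC⟩ := hV.2
  have hsh : ∀ x, Measurable (fun u => x - L u) := fun x => measurable_const.sub hL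
  have i1 : ∀ x, Integrable (fun u => ‖V (x - L u)‖ * ‖k u‖) := fun x => by
    have := (cnv_int hV hL hk x).norm
    simpa only [norm_mul] using this
  have hC6 : ∀ x, ‖V x‖^6 ≤ C^6 := fun x => pow_le_pow_left₀ (norm_nonneg _) (hC x) 6
  have hVm := hV.1
  have hm2 : Measurable (fun p : R3 × E => ‖V (p.1 - L p.2)‖^6 * ‖k p.2‖) :=
    ((hVm.comp (measurable_fst.sub (hL.comp measurable_snd))).norm.pow_const 6).mul
      (hkm.comp measurable_snd).norm
  have i2 : ∀ x, Integrable (fun u => ‖V (x - L u)‖^6 * ‖k u‖) := fun x => by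
    refine (hk.norm.const_mul (C^6)).mono' (hm2.comp (measurable_const.prodMk measurable_id)).aestronglyMeasurable
      (Filter.Eventually.of_forall fun u => ?_)
    rw [norm_mul, norm_pow, norm_norm, norm_norm]
    gcongr; exact hC _
  set K := ∫ u, ‖k u‖ with hK
  have hK0 : 0 ≤ K := integral_nonneg fun _ => norm_nonneg _
  have pw : ∀ x, ‖cvl L k V x‖^6 ≤ K^5 * ∫ u, ‖V (x - L u)‖^6 * ‖k u‖ := fun x => by
    have h1 : ‖cvl L k V x‖ ≤ ∫ u, ‖V (x - L u)‖ * ‖k u‖ := by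
      unfold cvl
      refine (norm_integral_le_integral_norm _).trans (le_of_eq ?_)
      simp only [norm_mul]
    exact (pow_le_pow_left₀ (norm_nonneg _) h1 6).trans
      (jensen6 (fun _ => norm_nonneg _) (fun _ => norm_nonneg _) hk.norm (i1 x) (i2 x))
  have iprod : Integrable (fun p : R3 × E => ‖V (p.1 - L p.2)‖^6 * ‖k p.2‖) ((win r z).prod volume) := by
    have : Integrable (fun p : R3 × E => (C^6) * ‖k p.2‖) ((win r z).prod volume) := by
      have := (integrable_const (μ := win r z) (C^6)).mul_prod hk.norm
      exact this
    refine this.mono' hm2.aestronglyMeasurable (Filter.Eventually.of_forall fun p => ?_)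
    rw [norm_mul, norm_pow, norm_norm, norm_norm]
    gcongr; exact hC _
  calc ∫ x, ‖cvl L k V x‖^6 ∂win r z
      ≤ ∫ x, K^5 * (∫ u, ‖V (x - L u)‖^6 * ‖k u‖) ∂win r z :=
        integral_mono ((hV.cnv hL hkm hk).int_pow1 6 _) (iprod.integral_prod_left.const_mul _) pw
    _ = K^5 * ∫ u, ∫ x, ‖V (x - L u)‖^6 * ‖k u‖ ∂win r z := by
        rw [integral_const_mul, integral_integral_swap iprod]
    _ ≤ K^5 * ∫ u, Q * ‖k u‖ := by
        refine mul_le_mul_of_nonneg_left (integral_mono iprod.integral_prod_right (hk.norm.const_mul _) fun u => ?_) (by positivity)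
        show ∫ x, ‖V (x - L u)‖^6 * ‖k u‖ ∂win r z ≤ Q * ‖k u‖
        rw [integral_mul_const]
        gcongr
        rw [win_shift r z (L u) (fun x => ‖V x‖^6) (hVm.norm.pow_const 6).stronglyMeasurable]
        exact h _
    _ = K^6 * Q := by rw [integral_const_mul]; ring

theorem UB6.sum {r : R3} {ι : Type} (s : Finset ι) {V : ι → R3 → ℂ} {Q : ℝ} (hb : ∀ i, BM (V i))
    (h : ∀ i ∈ s, UB6 r (V i) Q) : UB6 r (fun x => ∑ i ∈ s, V i x) ((s.card:ℝ)^6 * Q) := by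
  intro z
  have i6 : ∀ i, Integrable (fun x => ‖V i x‖^6) (win r z) := fun i => (hb i).int_pow1 6 _
  calc ∫ x, ‖∑ i ∈ s, V i x‖^6 ∂win r z ≤ ∫ x, (s.card:ℝ)^5 * ∑ i ∈ s, ‖V i x‖^6 ∂win r z := by
        refine integral_mono ((BM.sum (s := s) (fun i _ => hb i)).int_pow1 6 _)
          ((integrable_finsetSum s fun i _ => i6 i).const_mul _) fun x => ?_
        refine (pow_le_pow_left₀ (norm_nonneg _) (norm_sum_le _ _) 6).trans ?_
        exact pow_sum_le_card_mul_sum_pow (fun i _ => norm_nonneg _) 5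
    _ = (s.card:ℝ)^5 * ∑ i ∈ s, ∫ x, ‖V i x‖^6 ∂win r z := by
        rw [integral_const_mul, integral_finsetSum s fun i _ => i6 i]
    _ ≤ (s.card:ℝ)^5 * ∑ i ∈ s, Q := by
        gcongr with i hi
        exact h i hi z
    _ = (s.card:ℝ)^6 * Q := by rw [Finset.sum_const, nsmul_eq_mul]; ring
end Prelim

/-! ### Part 5: frames and local square functions -/
section Frames

def fb (t δ : ℝ) (u : R3) : R3 :=
  mk3 (u 0/δ - 2*t*(u 1/δ^2) + 3*t^2*(u 2/δ^3)) (u 1/δ^2 - 3*t*(u 2/δ^3)) (u 2/δ^3)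
def ft (t δ : ℝ) (ζ : R3) : R3 :=
  mk3 (ζ 0/δ) ((ζ 1 - 2*t*ζ 0)/δ^2) ((ζ 2 - 3*t*ζ 1 + 3*t^2*ζ 0)/δ^3)
def fbi (t δ : ℝ) (y : R3) : R3 :=
  mk3 (δ*(y 0 + 2*t*y 1 + 3*t^2*y 2)) (δ^2*(y 1 + 3*t*y 2)) (δ^3*y 2)

theorem cont_fb (t δ : ℝ) : Continuous (fb t δ) :=
  cont_mk3 (by fun_prop) (by fun_prop) (by fun_prop)
theorem meas_fb (t δ : ℝ) : Measurable (fb t δ) := (cont_fb t δ).measurable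
theorem fb_fbi (t : ℝ) {δ : ℝ} (hδ : δ ≠ 0) (y : R3) : fb t δ (fbi t δ y) = y := by
  apply R3_ext <;> simp only [fb, fbi, mk3_0, mk3_1, mk3_2] <;> field_simp <;> ring
theorem inner_fb (t δ : ℝ) (ζ u : R3) : inner ℝ ζ (fb t δ u) = inner ℝ (ft t δ ζ) u := by
  rw [inner3, inner3]; simp only [fb, ft, mk3_0, mk3_1, mk3_2]; ring
theorem fb_add (t δ : ℝ) (u w : R3) : fb t δ (u + w) = fb t δ u + fb t δ w := by
  apply R3_ext <;> simp only [fb, mk3_0, mk3_1, mk3_2, PiLp.add_apply] <;> ring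
theorem fb_neg (t δ : ℝ) (u : R3) : fb t δ (-u) = -fb t δ u := by
  apply R3_ext <;> simp only [fb, mk3_0, mk3_1, mk3_2, PiLp.neg_apply] <;> ring
theorem fb_sub (t δ : ℝ) (u w : R3) : fb t δ (u - w) = fb t δ u - fb t δ w := by
  rw [sub_eq_add_neg, fb_add, fb_neg, sub_eq_add_neg]
theorem fb_zero (t δ : ℝ) : fb t δ 0 = 0 := by
  have := fb_sub t δ 0 0; simpa using this
theorem ft_sub (t δ : ℝ) (u w : R3) : ft t δ (u - w) = ft t δ u - ft t δ w := by
  apply R3_ext <;> simp only [ft, mk3_0, mk3_1, mk3_2, PiLp.sub_apply] <;> ring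
theorem fb_e1 (t δ s : ℝ) : fb t δ (mk3 s 0 0) = mk3 (s/δ) 0 0 := by
  apply R3_ext <;> simp [fb]
theorem jb_e1 (s : ℝ) : jb (mk3 s 0 0) = jb s := by
  rw [jb3, jb, Real.norm_eq_abs, sq_abs]; simp

theorem jb_chg (a b r1 r2 r3 : ℝ) (ha : |a| ≤ 1) (h1 : |r1| ≤ 1) (h2 : |r2| ≤ 1) (h3 : |r3| ≤ 1) (u : R3)
    (hb : b = a^2) :
    jb (mk3 (r1*(u 0 + 2*a*u 1 + 3*b*u 2)) (r2*(u 1 + 3*a*u 2)) (r3 * u 2)) ≤ 36 * jb u := by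
  subst hb
  rw [jb3, jb3]
  simp only [mk3_0, mk3_1, mk3_2, mul_pow]
  have ha2 : a^2 ≤ 1 := by rw [← sq_abs]; exact pow_le_one₀ (abs_nonneg _) ha
  have h12 : r1^2 ≤ 1 := by rw [← sq_abs]; exact pow_le_one₀ (abs_nonneg _) h1
  have h22 : r2^2 ≤ 1 := by rw [← sq_abs]; exact pow_le_one₀ (abs_nonneg _) h2
  have h32 : r3^2 ≤ 1 := by rw [← sq_abs]; exact pow_le_one₀ (abs_nonneg _) h3
  have e1 : (u 0 + 2*a*u 1 + 3*a^2*u 2)^2 ≤ 14 * (u 0^2 + u 1^2 + u 2^2) := by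
    have : (u 0 + 2*a*u 1 + 3*a^2*u 2)^2 ≤ (1 + 4*a^2 + 9*(a^2*a^2)) * (u 0^2 + u 1^2 + u 2^2) := by
      nlinarith [sq_nonneg (u 1 - 2*a*u 0), sq_nonneg (u 2 - 3*a^2*u 0), sq_nonneg (2*a*u 2 - 3*a^2*u 1)]
    have h4 : a^2*a^2 ≤ 1 := by nlinarith [sq_nonneg a]
    nlinarith [sq_nonneg (u 0), sq_nonneg (u 1), sq_nonneg (u 2)]
  have e2 : (u 1 + 3*a*u 2)^2 ≤ 10 * (u 0^2 + u 1^2 + u 2^2) := by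
    have : (u 1 + 3*a*u 2)^2 ≤ (1 + 9*a^2) * (u 1^2 + u 2^2) := by
      nlinarith [sq_nonneg (u 2 - 3*a*u 1)]
    nlinarith [sq_nonneg (u 0), sq_nonneg (u 1), sq_nonneg (u 2)]
  have f1 := mul_le_mul h12 e1 (sq_nonneg _) zero_le_one
  have f2 := mul_le_mul h22 e2 (sq_nonneg _) zero_le_one
  have f3 := mul_le_mul_of_nonneg_right h32 (sq_nonneg (u 2))
  nlinarith [sq_nonneg (u 0), sq_nonneg (u 1), sq_nonneg (u 2)]

theorem jb_fbi_smul {t δ : ℝ} (hδ : 0 < δ) (hδ1 : δ ≤ 1) (ht : |t| ≤ 1) (y : R3) :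
    jb (fbi t δ y) ≤ 36 * jb (δ • y) := by
  have := jb_chg t (t^2) 1 δ (δ^2) ht (by simp) (by rw [abs_of_pos hδ]; exact hδ1)
    (by rw [abs_of_pos (by positivity)]; exact pow_le_one₀ hδ.le hδ1) (δ • y) rfl
  refine le_trans (le_of_eq ?_) this
  congr 1
  apply R3_ext <;> simp only [fbi, mk3_0, mk3_1, mk3_2, PiLp.smul_apply, smul_eq_mul] <;> ring

theorem jb_fbi_fb {t t0 δ l : ℝ} (hδ : 0 < δ) (hδl : δ ≤ l) (ht : |t - t0| ≤ l) (u : R3) :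
    jb (fbi t δ (fb t0 l u)) ≤ 36 * jb u := by
  have hl : 0 < l := lt_of_lt_of_le hδ hδl
  have hr0 : 0 < δ/l := by positivity
  have hr1 : δ/l ≤ 1 := (div_le_one hl).2 hδl
  have := jb_chg ((t-t0)/l) (((t-t0)/l)^2) (δ/l) ((δ/l)^2) ((δ/l)^3) (by rw [abs_div, abs_of_pos hl]; exact (div_le_one hl).2 ht)
    (by rwa [abs_of_pos hr0]) (by rw [abs_of_pos (by positivity)]; exact pow_le_one₀ hr0.le hr1)
    (by rw [abs_of_pos (by positivity)]; exact pow_le_one₀ hr0.le hr1) u rfl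
  refine le_trans (le_of_eq ?_) this
  congr 1
  apply R3_ext <;> simp only [fbi, fb, mk3_0, mk3_1, mk3_2] <;> field_simp <;> ring

/-- exponential sums -/
def om (v : ℝ → ℝ) (ξ : ℝ) : R3 := mk3 ξ (ξ^2 + v ξ) (ξ^3 + 3*ξ*v ξ)
def gam (t : ℝ) : R3 := mk3 t (t^2) (t^3)
def es (a : ℝ → ℂ) (v : ℝ → ℝ) (s : Finset ℝ) (x : R3) : ℂ := ∑ ξ ∈ s, a ξ * e (inner ℝ (om v ξ) x)
theorem BM_es (a : ℝ → ℂ) (v : ℝ → ℝ) (s : Finset ℝ) : BM (es a v s) := by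
  unfold es
  refine BM.sum fun ξ _ => ?_
  have h1 : BM (fun _ : R3 => a ξ) := ⟨measurable_const, ‖a ξ‖, fun _ => le_rfl⟩
  exact h1.mul (BM_e measurable_id (om v ξ))
theorem es_norm_le {a : ℝ → ℂ} {v : ℝ → ℝ} {s : Finset ℝ} (ha : ∀ ξ ∈ s, ‖a ξ‖ ≤ 1) (x : R3) : ‖es a v s x‖ ≤ s.card := by
  unfold es
  refine (norm_sum_le _ _).trans ?_
  have : ∀ ξ ∈ s, ‖a ξ * e (inner ℝ (om v ξ) x)‖ ≤ 1 := fun ξ hξ => by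
    rw [norm_mul, norm_e, mul_one]; exact ha ξ hξ
  refine (Finset.sum_le_sum this).trans (by simp)

def InArc (v : ℝ → ℝ) (s : Finset ℝ) (t δ : ℝ) : Prop := ∀ ξ ∈ s, t ≤ ξ ∧ ξ ≤ t + δ ∧ |v ξ| ≤ δ^2

theorem ft_om {v : ℝ → ℝ} {s : Finset ℝ} {t δ : ℝ} (hδ : 0 < δ) (h : InArc v s t δ) {ξ : ℝ} (hξ : ξ ∈ s) :
    ft t δ (om v ξ - gam t) = mk3 ((ξ-t)/δ) (((ξ-t)/δ)^2 + v ξ/δ^2) (((ξ-t)/δ)^3 + 3*((ξ-t)/δ)*(v ξ/δ^2)) := by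
  apply R3_ext <;> simp only [ft, om, gam, mk3_0, mk3_1, mk3_2, PiLp.sub_apply] <;> field_simp <;> ring

theorem ft_om_bd {v : ℝ → ℝ} {s : Finset ℝ} {t δ : ℝ} (hδ : 0 < δ) (h : InArc v s t δ) {ξ : ℝ} (hξ : ξ ∈ s) :
    |ft t δ (om v ξ - gam t) 0| ≤ 1 ∧ |ft t δ (om v ξ - gam t) 1| ≤ 2 ∧ |ft t δ (om v ξ - gam t) 2| ≤ 4 := by
  rw [ft_om hδ h hξ]
  obtain ⟨h1, h2, h3⟩ := h ξ hξ
  have hy0 : 0 ≤ (ξ-t)/δ := div_nonneg (by linarith) hδ.le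
  have hy1 : (ξ-t)/δ ≤ 1 := (div_le_one hδ).2 (by linarith)
  have hw : |v ξ/δ^2| ≤ 1 := by
    rw [abs_div, abs_of_pos (by positivity : (0:ℝ) < δ^2)]; exact (div_le_one (by positivity)).2 h3
  simp only [mk3_0, mk3_1, mk3_2]
  set y := (ξ-t)/δ
  set w := v ξ/δ^2
  have y2 : y^2 ≤ 1 := pow_le_one₀ hy0 hy1
  have y3 : y^3 ≤ 1 := pow_le_one₀ hy0 hy1
  have y20 : 0 ≤ y^2 := by positivity
  have y30 : 0 ≤ y^3 := by positivity
  obtain ⟨w1, w2⟩ := abs_le.1 hw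
  refine ⟨abs_le.2 ⟨by linarith, hy1⟩, abs_le.2 ⟨by linarith, by linarith⟩, abs_le.2 ⟨by nlinarith, by nlinarith⟩⟩

theorem ft_om_norm {v : ℝ → ℝ} {s : Finset ℝ} {t δ : ℝ} (hδ : 0 < δ) (h : InArc v s t δ) {ξ : ℝ} (hξ : ξ ∈ s) :
    ‖ft t δ (om v ξ - gam t)‖ ≤ 5 := by
  obtain ⟨h0, h1, h2⟩ := ft_om_bd hδ h hξ
  have := norm3 (ft t δ (om v ξ - gam t))
  have e0 := sq_le_sq' (abs_le.1 h0).1 (abs_le.1 h0).2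
  have e1 := sq_le_sq' (abs_le.1 h1).1 (abs_le.1 h1).2
  have e2 := sq_le_sq' (abs_le.1 h2).1 (abs_le.1 h2).2
  have h3 : ‖ft t δ (om v ξ - gam t)‖^2 ≤ 5^2 := by linarith
  exact le_of_sq_le_sq' h3
where
  le_of_sq_le_sq' {x : ℝ} (h : x^2 ≤ 5^2) : x ≤ 5 := by nlinarith

theorem krep_ex : ∃ k : R3 → ℂ, Measurable k ∧ (∀ A : ℕ, ∃ C, 0 ≤ C ∧ ∀ u, ‖k u‖ ≤ C * ((jb u)^A)⁻¹) ∧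
      ∀ θ : R3, ‖θ‖ ≤ 5 → ∫ u, k u * e (-(inner ℝ θ u)) = 1 := by
  let b : ContDiffBump (0:R3) := ⟨5, 6, by norm_num, by norm_num⟩
  have hb1 : HasCompactSupport (fun x => ((b x : ℝ) : ℂ)) :=
    b.hasCompactSupport.comp_left (g := fun t : ℝ => (t : ℂ)) (by simp)
  have hb2 : ContDiff ℝ (⊤ : ℕ∞) (fun x => ((b x : ℝ) : ℂ)) := Complex.ofRealCLM.contDiff.comp b.contDiff
  obtain ⟨k, h1, h2, h3⟩ := kernel_rep _ hb1 hb2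
  refine ⟨k, h1, h2, fun θ hθ => ?_⟩
  rw [h3, b.one_of_mem_closedBall]; · simp
  simpa using hθ

theorem cs_w {Ω : Type} [MeasurableSpace Ω] {μ : Measure Ω} {f w : Ω → ℝ} (hw0 : ∀ u, 0 ≤ w u)
    (hf : Integrable (fun u => f u^2 * w u) μ) (hw : Integrable w μ)
    (hfw : Integrable (fun u => f u * w u) μ) :
    (∫ u, f u * w u ∂μ)^2 ≤ (∫ u, f u^2 * w u ∂μ) * ∫ u, w u ∂μ := by
  have key : ∀ t : ℝ, 0 ≤ (∫ u, f u^2 * w u ∂μ) * (t * t) + (-(2 * ∫ u, f u * w u ∂μ)) * t + ∫ u, w u ∂μ := by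
    intro t
    have h1 : 0 ≤ ∫ u, ((t*t) * (f u^2 * w u) - (2*t) * (f u * w u)) + w u ∂μ :=
      integral_nonneg fun u => by
        show 0 ≤ ((t*t) * (f u^2 * w u) - (2*t) * (f u * w u)) + w u
        nlinarith [mul_nonneg (sq_nonneg (t * f u - 1)) (hw0 u)]
    have i1 : Integrable (fun u => (t*t) * (f u^2 * w u)) μ := hf.const_mul _
    have i2 : Integrable (fun u => (2*t) * (f u * w u)) μ := hfw.const_mul _
    have i3 : Integrable (fun u => (t*t) * (f u^2 * w u) - (2*t) * (f u * w u)) μ := i1.sub i2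
    rw [integral_add i3 hw, integral_sub i1 i2, integral_const_mul, integral_const_mul] at h1
    linarith
  have := discrim_le_zero key
  unfold discrim at this
  nlinarith

/-- local square function -/
def Hf (A : ℕ) (f : R3 → ℂ) (t δ : ℝ) (x : R3) : ℝ := ∫ u, ‖f (x - fb t δ u)‖^2 * ((jb u)^A)⁻¹

theorem jbi_int {A : ℕ} (hA : 4 ≤ A) : Integrable (fun u : R3 => ((jb u)^A)⁻¹) :=
  integrable_jb (by rw [finrank_R3]; omega)
theorem jbi_pos {E : Type} [NormedAddCommGroup E] (u : E) (A : ℕ) : 0 < ((jb u)^A)⁻¹ := inv_pos.2 (jb_pow_pos u A)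
theorem jbi_meas (A : ℕ) : Measurable (fun u : R3 => ((jb u)^A)⁻¹) := (jb_meas.pow_const A).inv

theorem Hf_int1 {f : R3 → ℂ} (hf : BM f) {A : ℕ} (hA : 4 ≤ A) (n : ℕ) (t δ : ℝ) (x : R3) :
    Integrable (fun u => ‖f (x - fb t δ u)‖^n * ((jb u)^A)⁻¹) := by
  obtain ⟨C, hC⟩ := hf.2
  have hm : Measurable (fun u => x - fb t δ u) := measurable_const.sub (meas_fb t δ)
  refine ((jbi_int hA).const_mul (C^n)).mono' (((hf.1.comp hm).norm.pow_const n).mul (jbi_meas A)).aestronglyMeasurable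
    (Filter.Eventually.of_forall fun u => ?_)
  rw [norm_mul, norm_pow, norm_norm, Real.norm_of_nonneg (jbi_pos u A).le]
  have := (jbi_pos u A).le
  gcongr
  exact hC _

theorem Hf_int {f : R3 → ℂ} (hf : BM f) {A : ℕ} (hA : 4 ≤ A) (t δ : ℝ) (x : R3) :
    Integrable (fun u => ‖f (x - fb t δ u)‖^2 * ((jb u)^A)⁻¹) := Hf_int1 hf hA 2 t δ x

theorem Hf_nonneg (A : ℕ) (f : R3 → ℂ) (t δ : ℝ) (x : R3) : 0 ≤ Hf A f t δ x :=
  integral_nonneg fun u => mul_nonneg (by positivity) (jbi_pos u A).le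

theorem Hf_meas {f : R3 → ℂ} (hf : BM f) (A : ℕ) (t δ : ℝ) : Measurable (Hf A f t δ) := by
  have hm : Measurable (fun p : R3 × R3 => ‖f (p.1 - fb t δ p.2)‖^2 * ((jb p.2)^A)⁻¹) :=
    ((hf.1.comp (measurable_fst.sub ((meas_fb t δ).comp measurable_snd))).norm.pow_const 2).mul
      ((jbi_meas A).comp measurable_snd)
  exact (hm.stronglyMeasurable.integral_prod_right (ν := volume)).measurable

def cjb (A : ℕ) : ℝ := ∫ u : R3, ((jb u)^A)⁻¹
theorem cjb_nonneg (A : ℕ) : 0 ≤ cjb A := integral_nonneg fun u => (jbi_pos u A).le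

theorem Hf_le {f : R3 → ℂ} (hf : BM f) {A : ℕ} (hA : 4 ≤ A) (t δ : ℝ) {C : ℝ} (hC : ∀ x, ‖f x‖ ≤ C) (x : R3) :
    Hf A f t δ x ≤ C^2 * cjb A := by
  unfold Hf cjb
  rw [← integral_const_mul]
  refine integral_mono (Hf_int hf hA t δ x) ((jbi_int hA).const_mul _) fun u => ?_
  have := (jbi_pos u A).le
  show _ ≤ C^2 * ((jb u)^A)⁻¹
  gcongr
  exact hC _

theorem Hf_sv {f : R3 → ℂ} (hf : BM f) {A : ℕ} (hA : 4 ≤ A) (t δ : ℝ) (x z : R3) :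
    Hf A f t δ (x + fb t δ z) ≤ 2^A * (jb z)^A * Hf A f t δ x := by
  have e1 : Hf A f t δ (x + fb t δ z) = ∫ u, ‖f (x - fb t δ u)‖^2 * ((jb (u - (-z)))^A)⁻¹ := by
    unfold Hf
    rw [← integral_add_right_eq_self (fun u => ‖f (x + fb t δ z - fb t δ u)‖^2 * ((jb u)^A)⁻¹) z]
    congr 1; ext u
    rw [fb_add, sub_neg_eq_add]
    congr 4; abel
  rw [e1, Hf, ← integral_const_mul]
  have hpw : ∀ u, ‖f (x - fb t δ u)‖^2 * ((jb (u - (-z)))^A)⁻¹ ≤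
      2^A * (jb z)^A * (‖f (x - fb t δ u)‖^2 * ((jb u)^A)⁻¹) := by
    intro u
    have := mul_le_mul_of_nonneg_left (jb_inv_sub_le u (-z) A) (by positivity : 0 ≤ ‖f (x - fb t δ u)‖^2)
    rw [jb_neg] at this
    linarith
  refine integral_mono_of_nonneg (Filter.Eventually.of_forall fun u => ?_) ((Hf_int hf hA t δ x).const_mul _)
    (Filter.Eventually.of_forall hpw)
  exact mul_nonneg (by positivity) (jbi_pos _ A).le

theorem Hf_rep {A : ℕ} (hA : 4 ≤ A) : ∃ C : ℝ, 0 < C ∧ ∀ (a : ℝ → ℂ) (v : ℝ → ℝ) (s : Finset ℝ) (t δ : ℝ), 0 < δ →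
    InArc v s t δ → ∀ x, ‖es a v s x‖^2 ≤ C * Hf A (es a v s) t δ x := by
  obtain ⟨k, hk1, hk2, hk3⟩ := krep_ex
  obtain ⟨D, hD0, hD⟩ := hk2 A
  refine ⟨D^2 * cjb A + 1, by have := cjb_nonneg A; positivity, fun a v s t δ hδ hs x => ?_⟩
  set f := es a v s with hf
  have hfb : BM f := BM_es a v s
  have hkint : Integrable k := ((jbi_int hA).const_mul D).mono' hk1.aestronglyMeasurable (Filter.Eventually.of_forall hD)
  have rep : f x = ∫ u, f (x - fb t δ u) * (e (inner ℝ (gam t) (fb t δ u)) * k u) := by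
    have hint : ∀ ξ ∈ s, Integrable (fun u => (a ξ * e (inner ℝ (om v ξ) x)) * (k u * e (-(inner ℝ (ft t δ (om v ξ - gam t)) u)))) := by
      intro ξ _
      refine Integrable.const_mul ?_ _
      refine integrable_mul_BM hkint ⟨measurable_e.comp (by fun_prop), 1, fun _ => (norm_e _).le⟩
    have : ∀ u, f (x - fb t δ u) * (e (inner ℝ (gam t) (fb t δ u)) * k u) =
        ∑ ξ ∈ s, (a ξ * e (inner ℝ (om v ξ) x)) * (k u * e (-(inner ℝ (ft t δ (om v ξ - gam t)) u))) := by
      intro u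
      rw [hf, es, Finset.sum_mul]
      refine Finset.sum_congr rfl fun ξ _ => ?_
      rw [← inner_fb, inner_sub_left, inner_sub_right, neg_sub, sub_eq_add_neg, e_add, sub_eq_add_neg, e_add]
      ring
    simp_rw [this]
    rw [integral_finsetSum s hint, hf, es]
    refine Finset.sum_congr rfl fun ξ hξ => ?_
    rw [integral_const_mul, hk3 _ (ft_om_norm hδ hs hξ), mul_one]
  have h1 : ‖f x‖ ≤ ∫ u, D * (‖f (x - fb t δ u)‖ * ((jb u)^A)⁻¹) := by
    rw [rep]
    have hi := Hf_int1 hfb hA 1 t δ x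
    simp only [pow_one] at hi
    refine norm_integral_le_of_norm_le (hi.const_mul D) (Filter.Eventually.of_forall fun u => ?_)
    rw [norm_mul, norm_mul, norm_e, one_mul]
    have := mul_le_mul_of_nonneg_left (hD u) (norm_nonneg (f (x - fb t δ u)))
    linarith
  rw [integral_const_mul] at h1
  have hi := Hf_int1 hfb hA 1 t δ x
  simp only [pow_one] at hi
  have h2 := cs_w (f := fun u => ‖f (x - fb t δ u)‖) (w := fun u => ((jb u)^A)⁻¹) (fun u => (jbi_pos u A).le)
    (Hf_int hfb hA t δ x) (jbi_int hA) hi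
  have h3 := pow_le_pow_left₀ (norm_nonneg _) h1 2
  rw [mul_pow] at h3
  have h4 : ‖f x‖^2 ≤ D^2 * (Hf A f t δ x * cjb A) := h3.trans (mul_le_mul_of_nonneg_left h2 (by positivity))
  have := Hf_nonneg A f t δ x
  nlinarith

/-- pointwise bound in two frames -/
theorem Hf_ptw {A : ℕ} (hA : 4 ≤ A) : ∃ C : ℝ, 0 < C ∧ ∀ (a : ℝ → ℂ) (v : ℝ → ℝ) (s : Finset ℝ) (t δ : ℝ), 0 < δ →
    InArc v s t δ → ∀ x z, ‖es a v s (x - fb t δ z)‖^2 ≤ C * (jb z)^A * Hf A (es a v s) t δ x := by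
  obtain ⟨C, hC, h⟩ := Hf_rep hA
  refine ⟨C * 2^A, by positivity, fun a v s t δ hδ hs x z => ?_⟩
  have h1 := h a v s t δ hδ hs (x - fb t δ z)
  have h2 := Hf_sv (BM_es a v s) hA t δ x (-z)
  rw [fb_neg, jb_neg, ← sub_eq_add_neg] at h2
  have := mul_le_mul_of_nonneg_left h2 hC.le
  linarith

theorem Hf_ptw2 {A : ℕ} (hA : 4 ≤ A) : ∃ C : ℝ, 0 < C ∧ ∀ (a : ℝ → ℂ) (v : ℝ → ℝ) (s : Finset ℝ) (t δ : ℝ), 0 < δ →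
    InArc v s t δ → ∀ t0 l, δ ≤ l → |t - t0| ≤ l → ∀ x z u, ‖es a v s (x - fb t δ z - fb t0 l u)‖^2 ≤
      C * (jb z)^A * (jb u)^A * Hf A (es a v s) t δ x := by
  obtain ⟨C, hC, h⟩ := Hf_ptw hA
  refine ⟨C * 72^A, by positivity, fun a v s t δ hδ hs t0 l hl ht x z u => ?_⟩
  have h1 := h a v s t δ hδ hs x (z + fbi t δ (fb t0 l u))
  rw [fb_add, fb_fbi t hδ.ne', ← sub_sub] at h1
  have h2 := jb_add_le z (fbi t δ (fb t0 l u))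
  have h3 := jb_fbi_fb hδ hl ht u
  have h4 : jb (z + fbi t δ (fb t0 l u)) ≤ 72 * jb z * jb u := by
    nlinarith [jb_pos z]
  have h5 := pow_le_pow_left₀ (jb_pos _).le h4 A
  rw [mul_pow, mul_pow] at h5
  have h6 := Hf_nonneg A (es a v s) t δ x
  calc _ ≤ _ := h1
    _ ≤ C * (72^A * (jb z)^A * (jb u)^A) * Hf A (es a v s) t δ x := by gcongr
    _ = _ := by ring

end Frames

/-! ### Part 6: arcs, children and low-pass -/
section Arcs

def arc (X : Finset ℝ) (l q : ℕ) : Finset ℝ := X.filter (fun ξ => dix ξ l = q)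

def SepN (N : ℝ) (X : Finset ℝ) : Prop := ∀ ξ ∈ X, ∀ η ∈ X, ξ ≠ η → 1 ≤ N * |ξ - η|

theorem arc_sub (X : Finset ℝ) (l q : ℕ) : arc X l q ⊆ X := Finset.filter_subset _ _

theorem SepN.mono {N : ℝ} {X Y : Finset ℝ} (h : SepN N X) (hY : Y ⊆ X) : SepN N Y :=
  fun ξ hξ η hη hne => h ξ (hY hξ) η (hY hη) hne

theorem SepN.card {N : ℝ} {X : Finset ℝ} (hN : 0 < N) (h : SepN N X) {t δ : ℝ} (hδ : 0 ≤ δ)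
    (hX : ∀ ξ ∈ X, t ≤ ξ ∧ ξ ≤ t + δ) : (X.card : ℝ) ≤ N * δ + 1 := by
  have h1 : X.card ≤ (Finset.range (⌊N*δ⌋₊ + 1)).card := by
    refine Finset.card_le_card_of_injOn (fun ξ => ⌊N*(ξ-t)⌋₊) ?_ ?_
    · intro ξ hξ
      have := hX ξ hξ
      simp only [Finset.coe_range, Set.mem_Iio]
      refine Nat.lt_succ_of_le (Nat.floor_le_floor ?_)
      exact mul_le_mul_of_nonneg_left (by linarith) hN.le
    · intro ξ hξ η hη hf
      by_contra hne
      have h2 := h ξ hξ η hη hne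
      have hf' : ⌊N*(ξ-t)⌋₊ = ⌊N*(η-t)⌋₊ := hf
      have a0 : 0 ≤ N*(ξ-t) := mul_nonneg hN.le (by linarith [(hX ξ hξ).1])
      have b0 : 0 ≤ N*(η-t) := mul_nonneg hN.le (by linarith [(hX η hη).1])
      have a1 := Nat.floor_le a0
      have a2 := Nat.lt_floor_add_one (N*(ξ-t))
      have b1 := Nat.floor_le b0
      have b2 := Nat.lt_floor_add_one (N*(η-t))
      rw [hf'] at a1 a2
      have : |N*(ξ-η)| < 1 := by rw [abs_lt]; constructor <;> linarith
      rw [abs_mul, abs_of_pos hN] at this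
      linarith
  rw [Finset.card_range] at h1
  have h3 : (X.card:ℝ) ≤ (⌊N*δ⌋₊:ℝ) + 1 := by exact_mod_cast h1
  have := Nat.floor_le (mul_nonneg hN.le hδ)
  linarith

theorem arc_mem {X : Finset ℝ} (hX : ∀ ξ ∈ X, 0 ≤ ξ) {l q : ℕ} {ξ : ℝ} (h : ξ ∈ arc X l q) :
    (q:ℝ)/2^l ≤ ξ ∧ ξ ≤ (q:ℝ)/2^l + 1/2^l := by
  obtain ⟨h1, h2⟩ := Finset.mem_filter.1 h
  have := dix_bounds (hX ξ h1) l
  rw [h2] at this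
  have hp : (0:ℝ) < 2^l := by positivity
  rw [← add_div, div_le_iff₀ hp, le_div_iff₀ hp]
  constructor <;> linarith

theorem arc_InArc {X : Finset ℝ} (hX : ∀ ξ ∈ X, 0 ≤ ξ) {v : ℝ → ℝ} {l : ℕ} (hv : ∀ ξ ∈ X, |v ξ| ≤ (1/2^l)^2) (q : ℕ) :
    InArc v (arc X l q) ((q:ℝ)/2^l) (1/2^l) := fun ξ hξ =>
  ⟨(arc_mem hX hξ).1, (arc_mem hX hξ).2, hv ξ (arc_sub _ _ _ hξ)⟩

theorem arc_card {N : ℝ} {X : Finset ℝ} (hN : 0 < N) (h : SepN N X) (hX : ∀ ξ ∈ X, 0 ≤ ξ) (l q : ℕ) :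
    ((arc X l q).card : ℝ) ≤ N * (1/2^l) + 1 :=
  (h.mono (arc_sub X l q)).card hN (by positivity) fun _ hξ => arc_mem hX hξ

def chl (m q : ℕ) : Finset ℕ := Finset.Ico (q * 2^m) ((q+1) * 2^m)

theorem chl_card (m q : ℕ) : (chl m q).card = 2^m := by
  unfold chl; rw [Nat.card_Ico, ← Nat.sub_mul]; simp

theorem es_split (a : ℝ → ℂ) (v : ℝ → ℝ) (X : Finset ℝ) (l m q : ℕ) (x : R3) :
    es a v (arc X l q) x = ∑ q' ∈ chl m q, es a v (arc X (l+m) q') x :=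
  dF_split (g := fun ξ x => a ξ * e (inner ℝ (om v ξ) x)) (y := fun ξ => ξ) (s := X) l m q x

theorem es_total (a : ℝ → ℂ) (v : ℝ → ℝ) {X : Finset ℝ} (hX : ∀ ξ ∈ X, 0 ≤ ξ ∧ ξ < 1) (l : ℕ) (x : R3) :
    es a v X x = ∑ q ∈ Finset.range (2^l), es a v (arc X l q) x := by
  have h0 : X = arc X 0 0 := by
    unfold arc; rw [Finset.filter_true_of_mem]
    intro ξ hξ
    unfold dix; simp [Nat.floor_eq_zero, (hX ξ hξ).2]
  have := es_split a v X 0 l 0 x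
  rw [← h0] at this
  rw [this, chl]
  simp

theorem chl_pos {l m q q' : ℕ} (h : q' ∈ chl m q) :
    |(q':ℝ)/2^(l+m) - (q:ℝ)/2^l| ≤ 1/2^l := by
  obtain ⟨h1, h2⟩ := Finset.mem_Ico.1 h
  have h1' : (q:ℝ)*2^m ≤ q' := by exact_mod_cast h1
  have h2' : (q':ℝ) ≤ (q+1)*2^m := by exact_mod_cast h2.le
  have : (q':ℝ)/2^(l+m) - (q:ℝ)/2^l = (q' - q*2^m)/2^(l+m) := by
    rw [pow_add]; field_simp
  rw [this, abs_of_nonneg (div_nonneg (by linarith) (by positivity)), div_le_div_iff₀ (by positivity) (by positivity), pow_add]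
  have : (0:ℝ) < 2^l := by positivity
  nlinarith

theorem es_orth {Ω : Type} [MeasurableSpace Ω] (μ : Measure Ω) [IsFiniteMeasure μ] {Y : Ω → R3} (hY : Measurable Y)
    (a : ℝ → ℂ) (v : ℝ → ℝ) (s1 s2 : Finset ℝ)
    (h : ∀ ξ ∈ s1, ∀ η ∈ s2, ∫ w, e (inner ℝ (om v ξ - om v η) (Y w)) ∂μ = 0) :
    ∫ w, es a v s1 (Y w) * (starRingEnd ℂ) (es a v s2 (Y w)) ∂μ = 0 := by
  have e1 : ∀ w, es a v s1 (Y w) * (starRingEnd ℂ) (es a v s2 (Y w)) =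
      ∑ ξ ∈ s1, ∑ η ∈ s2, (a ξ * (starRingEnd ℂ) (a η)) * e (inner ℝ (om v ξ - om v η) (Y w)) := by
    intro w
    unfold es
    rw [map_sum, Finset.sum_mul_sum]
    refine Finset.sum_congr rfl fun ξ _ => Finset.sum_congr rfl fun η _ => ?_
    rw [map_mul, inner_sub_left, sub_eq_add_neg, e_add, e_neg]; ring
  have hi : ∀ ξ η, Integrable (fun w => (a ξ * (starRingEnd ℂ) (a η)) * e (inner ℝ (om v ξ - om v η) (Y w))) μ :=
    fun ξ η => ((BM_e hY _).int μ).const_mul _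
  simp_rw [e1]
  rw [integral_finsetSum _ fun ξ _ => integrable_finsetSum _ fun η _ => hi ξ η]
  refine Finset.sum_eq_zero fun ξ hξ => ?_
  rw [integral_finsetSum _ fun η _ => hi ξ η]
  refine Finset.sum_eq_zero fun η hη => ?_
  rw [integral_const_mul, h ξ hξ η hη, mul_zero]

/-- changing the frame -/
theorem Hf_child {A : ℕ} (hA : 4 ≤ A) : ∃ C : ℝ, 0 < C ∧ ∀ (a : ℝ → ℂ) (v : ℝ → ℝ) (s : Finset ℝ) (t δ : ℝ), 0 < δ →
    InArc v s t δ → ∀ t0 l, δ ≤ l → |t - t0| ≤ l → ∀ x z : R3, Hf (A+4) (es a v s) t0 l (x - fb t δ z) ≤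
      C * (jb z)^A * Hf A (es a v s) t δ x := by
  obtain ⟨C, hC, h⟩ := Hf_ptw2 hA
  refine ⟨C * cjb 4 + 1, by have := cjb_nonneg 4; positivity, fun a v s t δ hδ hs t0 l hl ht x z => ?_⟩
  have hH := Hf_nonneg A (es a v s) t δ x
  have hz := jb_pow_pos z A
  have h1 : Hf (A+4) (es a v s) t0 l (x - fb t δ z) ≤ ∫ u : R3, (C * (jb z)^A * Hf A (es a v s) t δ x) * ((jb u)^4)⁻¹ := by
    refine integral_mono (Hf_int (BM_es a v s) (by omega) _ _ _) ((jbi_int le_rfl).const_mul _) fun u => ?_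
    show ‖es a v s (x - fb t δ z - fb t0 l u)‖^2 * ((jb u)^(A+4))⁻¹ ≤ _
    have h2 := h a v s t δ hδ hs t0 l hl ht x z u
    have h3 := jb_pow_pos u A
    have h4 := jb_pow_pos u 4
    calc _ ≤ (C * (jb z)^A * (jb u)^A * Hf A (es a v s) t δ x) * ((jb u)^(A+4))⁻¹ := mul_le_mul_of_nonneg_right h2 (jbi_pos u _).le
      _ = _ := by rw [pow_add]; field_simp
  rw [integral_const_mul] at h1
  change _ ≤ _ * cjb 4 at h1
  nlinarith [mul_nonneg hz.le hH]

def ka1 (a : ℕ) : Measure ℝ := volume.withDensity (fun s => ENNReal.ofReal (kap1 a s))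
instance (a : ℕ) : IsFiniteMeasure (ka1 a) := isFiniteMeasure_withDensity_ofReal (kap1_int0 a).2
theorem ka1_int {F : Type} [NormedAddCommGroup F] [NormedSpace ℝ F] (a : ℕ) (f : ℝ → F) :
    ∫ s, f s ∂ka1 a = ∫ s, kap1 a s • f s := by
  unfold ka1
  rw [integral_withDensity_eq_integral_toReal_smul (kap1_meas a).ennreal_ofReal
        (Filter.Eventually.of_forall fun w => ENNReal.ofReal_lt_top)]
  congr 1; ext u
  rw [ENNReal.toReal_ofReal (kap1_pos a u).le]

theorem cont_e1 (c : ℝ) : Continuous (fun s : ℝ => mk3 (s*c) 0 0) :=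
  cont_mk3 (by fun_prop) (by fun_prop) (by fun_prop)

theorem ka1_ft (a : ℕ) (c : ℝ) (ζ y : R3) (h : 1 ≤ |c * ζ 0|) :
    ∫ s, e (inner ℝ ζ (y - mk3 (s*c) 0 0)) ∂ka1 a = 0 := by
  rw [ka1_int]
  obtain ⟨_, _, _, _, _, _, _, h3⟩ := kap1_spec a
  have h4 := h3 (c * ζ 0) h
  have : ∀ s, kap1 a s • e (inner ℝ ζ (y - mk3 (s*c) 0 0)) =
      ((kap1 a s : ℂ) * e (-(inner ℝ (c * ζ 0) s))) * e (inner ℝ ζ y) := by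
    intro s
    rw [inner_sub_right, sub_eq_add_neg, e_add, inner3 ζ (mk3 _ _ _)]
    simp only [mk3_0, mk3_1, mk3_2, mul_zero, add_zero]
    rw [Complex.real_smul]
    have : inner ℝ (c * ζ 0) s = ζ 0 * (s * c) := by
      simp [inner]; ring
    rw [this]; ring
  simp_rw [this]
  rw [integral_mul_const, h4, zero_mul]

/-- low-pass bound -/
theorem lowpass {A : ℕ} (hA : 4 ≤ A) : ∃ C : ℝ, 0 < C ∧ ∀ (a : ℝ → ℂ) (v : ℝ → ℝ) (X : Finset ℝ) (l m q : ℕ),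
    (∀ ξ ∈ X, 0 ≤ ξ) → (∀ ξ ∈ X, |v ξ| ≤ (1/2^(l+m))^2) → ∀ x,
    ∫ s, kap1 A s * Hf (A+4) (es a v (arc X l q)) ((q:ℝ)/2^l) (1/2^l) (x - mk3 (s*2^(l+m)) 0 0) ≤
    C * ∑ q' ∈ chl m q, Hf A (es a v (arc X (l+m) q')) ((q':ℝ)/2^(l+m)) (1/2^(l+m)) x := by
  obtain ⟨C, hC, hch⟩ := Hf_child hA
  set I0 := ∫ s, kap1 A s * (jb s)^A with hI0
  have hI0' : 0 ≤ I0 := integral_nonneg fun s => mul_nonneg (kap1_pos A s).le (jb_pow_pos s A).le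
  refine ⟨3 * (C * I0) + 1, by positivity, fun a v X l m q hX hv x => ?_⟩
  set t := (q:ℝ)/2^l
  set δ : ℝ := 1/2^l with hδ
  set δ' : ℝ := 1/2^(l+m) with hδ'
  have hδp : 0 < δ := by positivity
  have hδ'p : 0 < δ' := by positivity
  have hle : δ' ≤ δ := by
    apply one_div_le_one_div_of_le (by positivity)
    exact pow_le_pow_right₀ (by norm_num) (by omega)
  set f := fun q' => es a v (arc X (l+m) q') with hf
  have hfB : ∀ q', BM (f q') := fun q' => BM_es a v _
  have hfin : ∀ u, ∫ s, ‖es a v (arc X l q) (x - mk3 (s*2^(l+m)) 0 0 - fb t δ u)‖^2 ∂ka1 A ≤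
      3 * ∑ q' ∈ chl m q, ∫ s, ‖f q' (x - mk3 (s*2^(l+m)) 0 0 - fb t δ u)‖^2 ∂ka1 A := by
    intro u
    have hm : Measurable (fun s : ℝ => x - mk3 (s*2^(l+m)) 0 0 - fb t δ u) :=
      (measurable_const.sub (cont_e1 _).measurable).sub_const _
    have := orth_bd (μ := ka1 A) (chl m q) (fun q' s => f q' (x - mk3 (s*2^(l+m)) 0 0 - fb t δ u))
      (fun q' => (hfB q').comp' hm) (fun i j => i ≤ j + 1 ∧ j ≤ i + 1) 3 (fun i j h => ⟨h.2, h.1⟩)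
      (fun i _ => by
        refine (Finset.card_le_card (t := Finset.Icc (i-1) (i+1)) ?_).trans ?_
        · intro j hj
          have := (Finset.mem_filter.1 hj).2
          rw [Finset.mem_Icc]; omega
        · rw [Nat.card_Icc]; omega)
      (fun i _ j _ hij => by
        refine es_orth (ka1 A) hm a v _ _ fun ξ hξ η hη => ?_
        have : ∀ s : ℝ, x - mk3 (s*2^(l+m)) 0 0 - fb t δ u = (x - fb t δ u) - mk3 (s*2^(l+m)) 0 0 := fun s => by abel
        simp_rw [this]
        refine ka1_ft A _ _ _ ?_
        have b1 := arc_mem hX hξ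
        have b2 := arc_mem hX hη
        simp only [PiLp.sub_apply, om, mk3_0]
        have hp : (0:ℝ) < 2^(l+m) := by positivity
        rw [← add_div, div_le_iff₀ hp, le_div_iff₀ hp] at b1 b2
        have hij' : i + 2 ≤ j ∨ j + 2 ≤ i := by omega
        rw [le_abs]
        rcases hij' with h | h
        · right
          have : (i:ℝ) + 2 ≤ j := by exact_mod_cast h
          nlinarith
        · left
          have : (j:ℝ) + 2 ≤ i := by exact_mod_cast h
          nlinarith)
    refine le_trans (le_of_eq ?_) this
    congr 1; ext s
    rw [es_split a v X l m q]
  -- joint integrability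
  have hjm : ∀ g : R3 → ℂ, BM g → Integrable (fun p : ℝ × R3 => ‖g (x - mk3 (p.1*2^(l+m)) 0 0 - fb t δ p.2)‖^2 * ((jb p.2)^(A+4))⁻¹)
      ((ka1 A).prod volume) := by
    intro g hg
    obtain ⟨D, hD⟩ := hg.2
    have hm : Measurable (fun p : ℝ × R3 => x - mk3 (p.1*2^(l+m)) 0 0 - fb t δ p.2) :=
      (measurable_const.sub ((cont_e1 _).measurable.comp measurable_fst)).sub ((meas_fb t δ).comp measurable_snd)
    have h1 : Integrable (fun p : ℝ × R3 => (D^2) * ((jb p.2)^(A+4))⁻¹) ((ka1 A).prod volume) :=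
      (integrable_const (D^2) : Integrable (fun _ : ℝ => D^2) (ka1 A)).mul_prod (jbi_int (A := A+4) (by omega))
    refine h1.mono' (((hg.1.comp hm).norm.pow_const 2).mul ((jbi_meas (A+4)).comp measurable_snd)).aestronglyMeasurable
      (Filter.Eventually.of_forall fun p => ?_)
    rw [norm_mul, norm_pow, norm_norm, Real.norm_of_nonneg (jbi_pos p.2 _).le]
    have := (jbi_pos p.2 (A+4)).le
    gcongr
    exact hD _
  have key : ∀ g : R3 → ℂ, BM g → ∫ s, kap1 A s * Hf (A+4) g t δ (x - mk3 (s*2^(l+m)) 0 0) =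
      ∫ u, (∫ s, ‖g (x - mk3 (s*2^(l+m)) 0 0 - fb t δ u)‖^2 ∂ka1 A) * ((jb u)^(A+4))⁻¹ := by
    intro g hg
    have h1 : ∫ s, kap1 A s * Hf (A+4) g t δ (x - mk3 (s*2^(l+m)) 0 0) = ∫ s, Hf (A+4) g t δ (x - mk3 (s*2^(l+m)) 0 0) ∂ka1 A := by
      rw [ka1_int]; rfl
    rw [h1]
    unfold Hf
    rw [integral_integral_swap (hjm g hg)]
    congr 1; ext u
    rw [integral_mul_const]
  have hui : ∀ g : R3 → ℂ, BM g → Integrable (fun u => (∫ s, ‖g (x - mk3 (s*2^(l+m)) 0 0 - fb t δ u)‖^2 ∂ka1 A) * ((jb u)^(A+4))⁻¹) := by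
    intro g hg
    have := (hjm g hg).integral_prod_right
    simpa only [integral_mul_const] using this
  rw [key _ (BM_es a v _)]
  have h1 : ∫ u, (∫ s, ‖es a v (arc X l q) (x - mk3 (s*2^(l+m)) 0 0 - fb t δ u)‖^2 ∂ka1 A) * ((jb u)^(A+4))⁻¹ ≤
      ∫ u, 3 * ∑ q' ∈ chl m q, (∫ s, ‖f q' (x - mk3 (s*2^(l+m)) 0 0 - fb t δ u)‖^2 ∂ka1 A) * ((jb u)^(A+4))⁻¹ := by
    refine integral_mono (hui _ (BM_es a v _)) ((integrable_finsetSum _ fun q' _ => hui _ (hfB q')).const_mul 3) fun u => ?_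
    show _ * _ ≤ 3 * ∑ q' ∈ chl m q, _ * _
    rw [← Finset.sum_mul, ← mul_assoc]
    exact mul_le_mul_of_nonneg_right (hfin u) (jbi_pos u _).le
  refine h1.trans ?_
  rw [integral_const_mul, integral_finsetSum _ fun q' _ => hui _ (hfB q')]
  have h2 : ∀ q' ∈ chl m q, ∫ u, (∫ s, ‖f q' (x - mk3 (s*2^(l+m)) 0 0 - fb t δ u)‖^2 ∂ka1 A) * ((jb u)^(A+4))⁻¹ ≤
      C * I0 * Hf A (f q') ((q':ℝ)/2^(l+m)) δ' x := by
    intro q' hq'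
    rw [← key _ (hfB q'), hI0, ← integral_const_mul, ← integral_mul_const]
    refine integral_mono_of_nonneg (Filter.Eventually.of_forall fun s => ?_) ?_ (Filter.Eventually.of_forall fun s => ?_)
    · exact mul_nonneg (kap1_pos A s).le (Hf_nonneg _ _ _ _ _)
    · exact ((kap1_int A).const_mul C).mul_const _
    · have := hch a v (arc X (l+m) q') _ δ' hδ'p (arc_InArc hX hv q') t δ hle (chl_pos hq') x (mk3 s 0 0)
      rw [fb_e1, jb_e1] at this
      have e1 : s/δ' = s*2^(l+m) := by rw [hδ']; field_simp
      rw [e1] at this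
      show kap1 A s * Hf (A+4) (f q') t δ _ ≤ C * (kap1 A s * (jb s)^A) * _
      have := mul_le_mul_of_nonneg_left this (kap1_pos A s).le
      calc _ ≤ _ := this
        _ = _ := by ring
  have h3 := Finset.sum_le_sum h2
  rw [← Finset.mul_sum] at h3
  have h4 : 0 ≤ ∑ q' ∈ chl m q, Hf A (f q') ((q':ℝ)/2^(l+m)) δ' x := Finset.sum_nonneg fun _ _ => Hf_nonneg _ _ _ _ _
  show 3 * _ ≤ (3 * (C * I0) + 1) * ∑ q' ∈ chl m q, Hf A (f q') ((q':ℝ)/2^(l+m)) δ' x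
  linarith

/-- square function of a parent is bounded by the children -/
theorem Hf_par {A : ℕ} (hA : 4 ≤ A) : ∃ C : ℝ, 0 < C ∧ ∀ (a : ℝ → ℂ) (v : ℝ → ℝ) (X : Finset ℝ) (l m q : ℕ),
    (∀ ξ ∈ X, 0 ≤ ξ) → (∀ ξ ∈ X, |v ξ| ≤ (1/2^(l+m))^2) → ∀ x,
    Hf (A+4) (es a v (arc X l q)) ((q:ℝ)/2^l) (1/2^l) x ≤
    C * 2^m * ∑ q' ∈ chl m q, Hf A (es a v (arc X (l+m) q')) ((q':ℝ)/2^(l+m)) (1/2^(l+m)) x := by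
  obtain ⟨C, hC, hch⟩ := Hf_child hA
  refine ⟨C, hC, fun a v X l m q hX hv x => ?_⟩
  set t := (q:ℝ)/2^l
  set δ : ℝ := 1/2^l with hδ
  have hle : (1:ℝ)/2^(l+m) ≤ δ := by
    apply one_div_le_one_div_of_le (by positivity)
    exact pow_le_pow_right₀ (by norm_num) (by omega)
  have hi := fun q' => Hf_int (BM_es a v (arc X (l+m) q')) (A := A+4) (by omega) t δ x
  calc Hf (A+4) (es a v (arc X l q)) t δ x
      ≤ ∫ u, 2^m * ∑ q' ∈ chl m q, ‖es a v (arc X (l+m) q') (x - fb t δ u)‖^2 * ((jb u)^(A+4))⁻¹ := by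
        refine integral_mono (Hf_int (BM_es a v _) (by omega) _ _ _) ((integrable_finsetSum _ fun q' _ => hi q').const_mul _) fun u => ?_
        show _ * _ ≤ 2^m * ∑ q' ∈ chl m q, _ * _
        rw [← Finset.sum_mul, ← mul_assoc, es_split a v X l m q]
        refine mul_le_mul_of_nonneg_right ?_ (jbi_pos u _).le
        refine (pow_le_pow_left₀ (norm_nonneg _) (norm_sum_le _ _) 2).trans ?_
        have := sq_sum_le_card_mul_sum_sq (s := chl m q) (f := fun q' => ‖es a v (arc X (l+m) q') (x - fb t δ u)‖)
        rw [chl_card] at this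
        exact_mod_cast this
    _ = 2^m * ∑ q' ∈ chl m q, Hf (A+4) (es a v (arc X (l+m) q')) t δ x := by
        rw [integral_const_mul, integral_finsetSum _ fun q' _ => hi q']; rfl
    _ ≤ 2^m * ∑ q' ∈ chl m q, C * Hf A (es a v (arc X (l+m) q')) ((q':ℝ)/2^(l+m)) (1/2^(l+m)) x := by
        gcongr with q' hq'
        have := hch a v (arc X (l+m) q') _ _ (by positivity) (arc_InArc hX hv q') t δ hle (chl_pos hq') x 0
        rw [fb_zero, sub_zero, jb_zero, one_pow, mul_one] at this
        exact this
    _ = _ := by rw [← Finset.mul_sum]; ring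

end Arcs

/-! ### Part 7: sixth moments of arcs and of their square functions -/
section Moments

theorem six_e (μ : Measure R3) (c1 c2 c3 c4 c5 c6 : ℂ) (z1 z2 z3 z4 z5 z6 : R3)
    (h : ∫ x, e (inner ℝ (z1 + z2 + z3 - z4 - z5 - z6) x) ∂μ = 0) :
    six μ (fun x => c1 * e (inner ℝ z1 x)) (fun x => c2 * e (inner ℝ z2 x)) (fun x => c3 * e (inner ℝ z3 x))
      (fun x => c4 * e (inner ℝ z4 x)) (fun x => c5 * e (inner ℝ z5 x)) (fun x => c6 * e (inner ℝ z6 x)) = 0 := by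
  unfold six
  have : ∀ x, c1 * e (inner ℝ z1 x) * (c2 * e (inner ℝ z2 x)) * (c3 * e (inner ℝ z3 x)) *
      (starRingEnd ℂ) (c4 * e (inner ℝ z4 x)) * (starRingEnd ℂ) (c5 * e (inner ℝ z5 x)) *
      (starRingEnd ℂ) (c6 * e (inner ℝ z6 x)) =
      (c1 * c2 * c3 * (starRingEnd ℂ) c4 * (starRingEnd ℂ) c5 * (starRingEnd ℂ) c6) *
        e (inner ℝ (z1 + z2 + z3 - z4 - z5 - z6) x) := by
    intro x
    simp only [sub_eq_add_neg, inner_add_left, inner_neg_left, e_add, e_neg, map_mul]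
    ring
  simp_rw [this]
  rw [integral_const_mul, h, mul_zero]

def wmass : ℝ := ∫ u, kap3 0 u
theorem wmass_nonneg : 0 ≤ wmass := integral_nonneg fun u => (kap3_pos 0 u).le

theorem win_le {r z : R3} {V : R3 → ℂ} (hV : BM V) {D : ℝ} (h : ∀ x, ‖V x‖ ≤ D) : ∫ x, ‖V x‖^6 ∂win r z ≤ D^6 * wmass := by
  rw [win_int r z _ (hV.1.norm.pow_const 6).stronglyMeasurable, wmass, ← integral_const_mul]
  refine integral_mono_of_nonneg (Filter.Eventually.of_forall fun u => ?_) ((kap3_int0 0).const_mul _) (Filter.Eventually.of_forall fun u => ?_)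
  · exact mul_nonneg (kap3_pos 0 u).le (by positivity)
  · show kap3 0 u * _ ≤ D^6 * kap3 0 u
    rw [mul_comm]
    have := (kap3_pos 0 u).le
    gcongr
    exact h _

set_option maxHeartbeats 1000000 in
theorem UB6_es {η : ℝ} (hη : 0 < η) : ∃ A : ℝ, 0 < A ∧ ∀ (a : ℝ → ℂ) (v : ℝ → ℝ) (s : Finset ℝ) (N t δ : ℝ) (r : R3),
    0 < N → 0 < δ → δ ≤ 1 → 0 ≤ t → t ≤ 1 → SepN N s → (∀ ξ ∈ s, t ≤ ξ ∧ ξ < t + δ) → (∀ ξ ∈ s, |v ξ| ≤ (N^2)⁻¹) →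
    (∀ ξ ∈ s, ‖a ξ‖ ≤ 1) → N^2 ≤ r 0 → N^2 ≤ r 1 → UB6 r (es a v s) (A * (N*δ+1)^(3+η)) := by
  obtain ⟨A, hA, hPD⟩ := PD_main hη
  have hw := wmass_nonneg
  refine ⟨(A + 1) * (9^6 * wmass + 1), by positivity, ?_⟩
  intro a v s N t δ r hN hδ hδ1 ht0 ht1 hsep hs hv ha hr0 hr1 z
  have hone : (1:ℝ) ≤ (N*δ+1)^(3+η) := Real.one_le_rpow (by nlinarith [mul_pos hN hδ]) (by linarith)
  by_cases hsmall : N * δ < 4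
  · have hc : (s.card:ℝ) ≤ 9 := by
      have := hsep.card hN hδ.le (fun ξ hξ => ⟨(hs ξ hξ).1, (hs ξ hξ).2.le⟩)
      linarith
    have h1 := win_le (r := r) (z := z) (BM_es a v s) (fun x => (es_norm_le ha x).trans hc)
    refine h1.trans ?_
    have h2 : 9^6 * wmass ≤ (A+1) * (9^6 * wmass + 1) := by nlinarith
    have h3 : 0 ≤ (A+1) * (9^6 * wmass + 1) := by positivity
    nlinarith
  push Not at hsmall
  set n := Nat.log 2 ⌊N*δ/4⌋₊ with hn
  have hfl : 1 ≤ ⌊N*δ/4⌋₊ := Nat.le_floor (by push_cast; linarith)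
  have hn1 : (2:ℝ)^n ≤ N*δ/4 := by
    have h1 : 2^n ≤ ⌊N*δ/4⌋₊ := Nat.pow_log_le_self 2 (by omega)
    have h2 : ((2^n : ℕ):ℝ) ≤ (⌊N*δ/4⌋₊ : ℝ) := by exact_mod_cast h1
    push_cast at h2
    exact h2.trans (Nat.floor_le (by linarith))
  have hn2 : N*δ/4 < 2*2^n := by
    have h1 : ⌊N*δ/4⌋₊ < 2^(n+1) := Nat.lt_pow_succ_log_self (by norm_num) _
    have h2 : (⌊N*δ/4⌋₊ : ℝ) + 1 ≤ ((2^(n+1) : ℕ):ℝ) := by exact_mod_cast h1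
    push_cast at h2
    have := Nat.lt_floor_add_one (N*δ/4)
    rw [pow_succ] at h2
    linarith
  have hp : (0:ℝ) < 2^n := by positivity
  have hmain := hPD R3 ℝ (win r z) s (fun ξ x => a ξ * e (inner ℝ (om v ξ) x)) (fun ξ => (ξ-t)/δ) n
    (fun ξ => by
      have h1 : BM (fun _ : R3 => a ξ) := ⟨measurable_const, ‖a ξ‖, fun _ => le_rfl⟩
      exact h1.mul (BM_e measurable_id (om v ξ)))
    (fun ξ hξ => ⟨div_nonneg (by linarith [hs ξ hξ]) hδ.le, (div_lt_one hδ).2 (by linarith [hs ξ hξ])⟩)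
    (by
      intro i1 h1 i2 h2 i3 h3 i4 h4 i5 h5 i6 h6 σ hσ hlt
      apply six_e
      by_contra hne
      have c0 : |r 0 * (om v i1 + om v i2 + om v i3 - om v i4 - om v i5 - om v i6) 0| < 1 := by
        by_contra hc; exact hne (win_ft r z _ 0 (not_lt.1 hc))
      have c1 : |r 1 * (om v i1 + om v i2 + om v i3 - om v i4 - om v i5 - om v i6) 1| < 1 := by
        by_contra hc; exact hne (win_ft r z _ 1 (not_lt.1 hc))
      simp only [PiLp.add_apply, PiLp.sub_apply, om, mk3_0, mk3_1] at c0 c1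
      set S0 := i1 + i2 + i3 - i4 - i5 - i6 with hS0
      set S1 := i1^2 + v i1 + (i2^2 + v i2) + (i3^2 + v i3) - (i4^2 + v i4) - (i5^2 + v i5) - (i6^2 + v i6) with hS1
      have hN2 : 0 < N^2 := by positivity
      have d0 : N^2 * |S0| ≤ 1 := by
        rw [abs_mul, abs_of_pos (by linarith)] at c0
        nlinarith [abs_nonneg S0]
      have d1 : N^2 * |S1| ≤ 1 := by
        rw [abs_mul, abs_of_pos (by linarith)] at c1
        nlinarith [abs_nonneg S1]
      have hvv : ∀ ξ ∈ s, N^2 * |v ξ| ≤ 1 := fun ξ hξ => by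
        have := mul_le_mul_of_nonneg_left (hv ξ hξ) hN2.le
        rwa [mul_inv_cancel₀ hN2.ne'] at this
      have w1 := hvv i1 h1
      have w2 := hvv i2 h2
      have w3 := hvv i3 h3
      have w4 := hvv i4 h4
      have w5 := hvv i5 h5
      have w6 := hvv i6 h6
      set T := t + δ * σ with hT
      have hT0 : 0 ≤ T := by have := mul_nonneg hδ.le hσ.1; linarith
      have hT2 : T ≤ 2 := by have := mul_le_mul hδ1 hσ.2 hσ.1 zero_le_one; linarith
      have ident : δ^2 * (((i1 - t)/δ - σ)^2 + ((i2 - t)/δ - σ)^2 + ((i3 - t)/δ - σ)^2 - ((i4 - t)/δ - σ)^2 - ((i5 - t)/δ - σ)^2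
          - ((i6 - t)/δ - σ)^2) = S1 - 2*T*S0 - (v i1 + v i2 + v i3 - v i4 - v i5 - v i6) := by
        rw [hS1, hS0, hT]; field_simp; ring
      set E := ((i1 - t)/δ - σ)^2 + ((i2 - t)/δ - σ)^2 + ((i3 - t)/δ - σ)^2 - ((i4 - t)/δ - σ)^2 - ((i5 - t)/δ - σ)^2
          - ((i6 - t)/δ - σ)^2 with hE
      have hb : N^2 * (δ^2 * |E|) ≤ 11 := by
        have : δ^2 * |E| = |S1 - 2*T*S0 - (v i1 + v i2 + v i3 - v i4 - v i5 - v i6)| := by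
          rw [← ident, abs_mul, abs_of_pos (by positivity : 0 < δ^2)]
        rw [this]
        have hab : |S1 - 2*T*S0 - (v i1 + v i2 + v i3 - v i4 - v i5 - v i6)| ≤
            |S1| + 4*|S0| + (|v i1| + |v i2| + |v i3| + |v i4| + |v i5| + |v i6|) := by
          have k1 : |T * S0| ≤ 2 * |S0| := by
            rw [abs_mul, abs_of_nonneg hT0]; exact mul_le_mul_of_nonneg_right hT2 (abs_nonneg _)
          have := abs_le.1 k1
          rw [abs_le]
          constructor <;> linarith [neg_abs_le S1, le_abs_self S1, neg_abs_le (v i1), le_abs_self (v i1),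
            neg_abs_le (v i2), le_abs_self (v i2), neg_abs_le (v i3), le_abs_self (v i3), neg_abs_le (v i4), le_abs_self (v i4),
            neg_abs_le (v i5), le_abs_self (v i5), neg_abs_le (v i6), le_abs_self (v i6)]
        have := mul_le_mul_of_nonneg_left hab hN2.le
        linarith
      have h4n : (4:ℝ)^n = (2^n)^2 := by rw [← pow_mul, mul_comm, pow_mul]; norm_num
      rw [h4n] at hlt
      have k1 : 1 < |E| * (2^n)^2 := by
        rw [inv_lt_iff_one_lt_mul₀ (by positivity)] at hlt; linarith
      have k2 : ((2:ℝ)^n)^2 ≤ (N*δ/4)^2 := pow_le_pow_left₀ hp.le hn1 2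
      have k3 := mul_le_mul_of_nonneg_left k2 (abs_nonneg E)
      have k4 : |E| * (N*δ/4)^2 = N^2 * (δ^2 * |E|)/16 := by ring
      linarith)
    (9^6 * wmass)
    (fun j => by
      have hb : BM (fun w : R3 => ∑ ξ ∈ s with dix ((ξ-t)/δ) n = j, a ξ * e (inner ℝ (om v ξ) w)) :=
        BM_es a v (s.filter (fun ξ => dix ((ξ-t)/δ) n = j))
      refine win_le hb fun x => ?_
      refine (es_norm_le (s := s.filter (fun ξ => dix ((ξ-t)/δ) n = j)) (fun ξ hξ => ha ξ (Finset.mem_filter.1 hξ).1) x).trans ?_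
      have := (hsep.mono (Finset.filter_subset (fun ξ => dix ((ξ-t)/δ) n = j) s)).card hN (t := t + δ*(j/2^n)) (δ := δ/2^n)
        (by positivity) (fun ξ hξ => by
          obtain ⟨k1, k2⟩ := Finset.mem_filter.1 hξ
          have := dix_bounds (y := (ξ-t)/δ) (div_nonneg (by linarith [hs ξ k1]) hδ.le) n
          rw [k2] at this
          have e1 : δ * ((ξ-t)/δ) = ξ - t := by field_simp
          have q1 : (j:ℝ)/2^n ≤ (ξ-t)/δ := by rw [div_le_iff₀ hp]; linarith
          have q2 : (ξ-t)/δ ≤ j/2^n + 1/2^n := by rw [← add_div, le_div_iff₀ hp]; linarith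
          have q3 := mul_le_mul_of_nonneg_left q1 hδ.le
          have q4 := mul_le_mul_of_nonneg_left q2 hδ.le
          rw [mul_add, mul_one_div] at q4
          constructor <;> linarith)
      have h8 : N*(δ/2^n) ≤ 8 := by
        rw [← mul_div_assoc, div_le_iff₀ hp]; linarith
      linarith)
  refine hmain.trans ?_
  have h2 : (2:ℝ)^((3+η)*(n:ℝ)) ≤ (N*δ+1)^(3+η) := by
    rw [mul_comm, Real.rpow_mul (by norm_num), Real.rpow_natCast]
    exact Real.rpow_le_rpow hp.le (by nlinarith [mul_pos hN hδ]) (by linarith)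
  have h0 : (0:ℝ) ≤ (N*δ+1)^(3+η) := by linarith
  calc A * 2^((3+η)*(n:ℝ)) * (9^6*wmass) ≤ (A+1) * (N*δ+1)^(3+η) * (9^6*wmass+1) := by gcongr <;> linarith
    _ = _ := by ring

/-- capped square function, averaged -/
def cap (A : ℕ) (f : R3 → ℂ) (t δ b : ℝ) (x : R3) : ℝ := min (Hf A f t δ x) b
def Wr (A : ℕ) (f : R3 → ℂ) (t δ b : ℝ) (x : R3) : ℝ := ∫ u, cap A f t δ b (x - fb t δ u) * kap3 A u
def Wc (A : ℕ) (f : R3 → ℂ) (t δ b : ℝ) : R3 → ℂ := cvl (fb t δ) (fun u => (kap3 A u : ℂ)) (fun x => (cap A f t δ b x : ℂ))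

theorem Wc_eq (A : ℕ) (f : R3 → ℂ) (t δ b : ℝ) (x : R3) : Wc A f t δ b x = (Wr A f t δ b x : ℂ) := by
  unfold Wc Wr cvl
  rw [← integral_complex_ofReal]
  congr 1; ext u; push_cast; rfl

theorem cap_meas {f : R3 → ℂ} (hf : BM f) (A : ℕ) (t δ b : ℝ) : Measurable (cap A f t δ b) :=
  (Hf_meas hf A t δ).min measurable_const
theorem cap_nonneg (A : ℕ) (f : R3 → ℂ) (t δ : ℝ) {b : ℝ} (hb : 0 ≤ b) (x : R3) : 0 ≤ cap A f t δ b x :=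
  le_min (Hf_nonneg _ _ _ _ _) hb
theorem cap_BM {f : R3 → ℂ} (hf : BM f) (A : ℕ) (t δ : ℝ) {b : ℝ} (hb : 0 ≤ b) : BM (fun x => (cap A f t δ b x : ℂ)) := by
  refine ⟨Complex.measurable_ofReal.comp (cap_meas hf A t δ b), b, fun x => ?_⟩
  rw [Complex.norm_real, Real.norm_of_nonneg (cap_nonneg A f t δ hb x)]
  exact min_le_right _ _

theorem kap3c_meas (A : ℕ) : Measurable (fun u => (kap3 A u : ℂ)) := Complex.measurable_ofReal.comp (kap3_meas A)
theorem kap3c_int (A : ℕ) : Integrable (fun u => (kap3 A u : ℂ)) := (kap3_int0 A).ofReal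

theorem Wc_BM {f : R3 → ℂ} (hf : BM f) (A : ℕ) (t δ : ℝ) {b : ℝ} (hb : 0 ≤ b) : BM (Wc A f t δ b) :=
  (cap_BM hf A t δ hb).cnv (meas_fb t δ) (kap3c_meas A) (kap3c_int A)

theorem Wr_int {f : R3 → ℂ} (hf : BM f) (A : ℕ) (t δ : ℝ) {b : ℝ} (hb : 0 ≤ b) (x : R3) :
    Integrable (fun u => cap A f t δ b (x - fb t δ u) * kap3 A u) := by
  have := (cnv_int (cap_BM hf A t δ hb) (meas_fb t δ) (kap3c_int A) x).norm
  refine this.congr (Filter.Eventually.of_forall fun u => ?_)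
  show ‖(cap A f t δ b (x - fb t δ u) : ℂ) * (kap3 A u : ℂ)‖ = _
  rw [norm_mul, Complex.norm_real, Complex.norm_real, Real.norm_of_nonneg (cap_nonneg A f t δ hb _), Real.norm_of_nonneg (kap3_pos A u).le]

/-- slow variation of the cap -/
theorem cap_sv {f : R3 → ℂ} (hf : BM f) {A : ℕ} (hA : 4 ≤ A) (t δ : ℝ) {b : ℝ} (hb : 0 ≤ b) (x z : R3) :
    cap A f t δ b (x + fb t δ z) ≤ 2^A * (jb z)^A * cap A f t δ b x := by
  have h1 := Hf_sv hf hA t δ x z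
  have h2 : 1 ≤ (2:ℝ)^A * (jb z)^A := one_le_mul_of_one_le_of_one_le (one_le_pow₀ (by norm_num)) (one_le_pow₀ (one_le_jb z))
  unfold cap
  rw [mul_min_of_nonneg _ _ (by linarith)]
  exact min_le_min h1 (le_mul_of_one_le_left hb h2)

theorem Wr_bds {A : ℕ} (hA : 4 ≤ A) : ∃ c C : ℝ, 0 < c ∧ 0 < C ∧ ∀ (f : R3 → ℂ), BM f → ∀ (t δ b : ℝ), 0 ≤ b → ∀ x,
    c * cap A f t δ b x ≤ Wr A f t δ b x ∧ Wr A f t δ b x ≤ C * cap A f t δ b x := by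
  set I1 := ∫ u, kap3 A u * (jb u)^A with hI1
  have ic : Integrable (fun u => kap3 A u * ((jb u)^A)⁻¹) := by
    refine (kap3_int0 A).mono' ((kap3_meas A).mul (jbi_meas A)).aestronglyMeasurable (Filter.Eventually.of_forall fun u => ?_)
    rw [Real.norm_of_nonneg (mul_nonneg (kap3_pos A u).le (jbi_pos u A).le)]
    exact mul_le_of_le_one_right (kap3_pos A u).le (inv_le_one_of_one_le₀ (one_le_pow₀ (one_le_jb u)))
  set I2 := ∫ u, kap3 A u * ((jb u)^A)⁻¹ with hI2
  have hI2p : 0 < I2 := by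
    rw [hI2, integral_pos_iff_support_of_nonneg (fun u => (mul_pos (kap3_pos A u) (jbi_pos u A)).le) ic]
    have : Function.support (fun u => kap3 A u * ((jb u)^A)⁻¹) = Set.univ := by
      ext u; simp [(kap3_pos A u).ne', (jb_pow_pos u A).ne']
    rw [this]; simp
  have hI1p : 0 ≤ I1 := integral_nonneg fun u => (mul_pos (kap3_pos A u) (jb_pow_pos u A)).le
  refine ⟨((2:ℝ)^A)⁻¹ * I2, 2^A * I1 + 1, by positivity, by positivity, fun f hf t δ b hb x => ⟨?_, ?_⟩⟩
  · have : ((2:ℝ)^A)⁻¹ * I2 * cap A f t δ b x = ∫ u, (((2:ℝ)^A)⁻¹ * cap A f t δ b x) * (kap3 A u * ((jb u)^A)⁻¹) := by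
      rw [integral_const_mul]; ring
    rw [this]
    refine integral_mono (ic.const_mul _) (Wr_int hf A t δ hb x) fun u => ?_
    show _ ≤ cap A f t δ b (x - fb t δ u) * kap3 A u
    have h1 := cap_sv hf hA t δ hb (x - fb t δ u) u
    rw [sub_add_cancel] at h1
    have h2 : ((2:ℝ)^A)⁻¹ * ((jb u)^A)⁻¹ * cap A f t δ b x ≤ cap A f t δ b (x - fb t δ u) := by
      rw [← mul_inv, inv_mul_le_iff₀ (by have := jb_pow_pos u A; positivity)]; exact h1
    have := mul_le_mul_of_nonneg_right h2 (kap3_pos A u).le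
    calc _ = _ := by ring
      _ ≤ _ := this
  · have h0 := cap_nonneg A f t δ hb x
    have : Wr A f t δ b x ≤ ∫ u, (2^A * cap A f t δ b x) * (kap3 A u * (jb u)^A) := by
      refine integral_mono (Wr_int hf A t δ hb x) ((kap3_int A).const_mul _) fun u => ?_
      show cap A f t δ b (x - fb t δ u) * kap3 A u ≤ _
      have h1 := cap_sv hf hA t δ hb x (-u)
      rw [fb_neg, jb_neg, ← sub_eq_add_neg] at h1
      have := mul_le_mul_of_nonneg_right h1 (kap3_pos A u).le
      calc _ ≤ _ := this
        _ = _ := by ring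
    rw [integral_const_mul] at this
    nlinarith

theorem jensen3 {Ω : Type} [MeasurableSpace Ω] {μ : Measure Ω} {g k : Ω → ℝ} (hg0 : ∀ w, 0 ≤ g w)
    (hk0 : ∀ w, 0 ≤ k w) (hk : Integrable k μ) (hgk : Integrable (fun w => g w * k w) μ)
    (hg3 : Integrable (fun w => g w^3 * k w) μ) :
    (∫ w, g w * k w ∂μ)^3 ≤ (∫ w, k w ∂μ)^2 * ∫ w, g w^3 * k w ∂μ := by
  set m := ∫ w, g w * k w ∂μ with hm
  set K := ∫ w, k w ∂μ with hK
  have hm0 : 0 ≤ m := integral_nonneg fun w => mul_nonneg (hg0 w) (hk0 w)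
  have hK0 : 0 ≤ K := integral_nonneg hk0
  have h1 : ∀ w, (3*m^2) * (K^2 * 0 + K^0 * (g w * k w)) * 1 ≤ (3*m^2) * (g w * k w) := fun w => by simp
  by_cases hKz : K = 0
  · have : m = 0 := by
      have := (integral_eq_zero_iff_of_nonneg hk0 hk).1 hKz
      rw [hm]
      refine integral_eq_zero_of_ae ?_
      filter_upwards [this] with w hw
      simp [hw]
    rw [this, hKz]; simp
  have hKp : 0 < K := lt_of_le_of_ne hK0 (Ne.symm hKz)
  set p := m/K with hp
  have hp0 : 0 ≤ p := by positivity
  have h2 : ∫ w, ((3*p^2) * (g w * k w) - (2*p^3) * k w) ∂μ ≤ ∫ w, g w^3 * k w ∂μ := by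
    refine integral_mono ((hgk.const_mul _).sub (hk.const_mul _)) hg3 fun w => ?_
    show (3*p^2) * (g w * k w) - (2*p^3) * k w ≤ g w^3 * k w
    have h3 : 3*p^2*g w - 2*p^3 ≤ g w^3 := by nlinarith [mul_nonneg (by linarith [hg0 w] : 0 ≤ g w + 2*p) (sq_nonneg (g w - p))]
    have := mul_le_mul_of_nonneg_right h3 (hk0 w)
    calc _ = _ := by ring
      _ ≤ _ := this
  have i1 : Integrable (fun w => (3*p^2) * (g w * k w)) μ := hgk.const_mul _
  have i2 : Integrable (fun w => (2*p^3) * k w) μ := hk.const_mul _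
  rw [integral_sub i1 i2, integral_const_mul, integral_const_mul] at h2
  have h4 : m = p * K := by rw [hp]; field_simp
  change 3*p^2 * m - 2*p^3*K ≤ _ at h2
  rw [h4] at h2 ⊢
  have := mul_le_mul_of_nonneg_left h2 (sq_nonneg K)
  calc _ = _ := by ring
    _ ≤ _ := this

theorem UB6_Wc {A : ℕ} (hA : 4 ≤ A) : ∃ C : ℝ, 0 < C ∧ ∀ (f : R3 → ℂ), BM f → ∀ (t δ b D Q : ℝ) (r : R3), 0 ≤ b → 0 ≤ D →
    (∀ x, cap A f t δ b x ≤ D) → UB6 r f Q → UB6 r (Wc A f t δ b) (C * D^3 * Q) := by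
  refine ⟨(∫ u, ‖(kap3 A u : ℂ)‖)^6 * (cjb A)^3 + 1, by
    have := cjb_nonneg A
    have : 0 ≤ ∫ u, ‖(kap3 A u : ℂ)‖ := integral_nonneg fun u => norm_nonneg _
    positivity, fun f hf t δ b D Q r hb hD hcap hQ => ?_⟩
  have hQ0 : 0 ≤ Q := le_trans (integral_nonneg fun _ => by positivity) (hQ 0)
  have h1 : UB6 r (fun x => (cap A f t δ b x : ℂ)) (D^3 * (cjb A)^3 * Q) := by
    intro z
    have hcapB := cap_BM hf A t δ hb
    obtain ⟨E, hE⟩ := hf.2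
    have hm : Measurable (fun p : R3 × R3 => p.1 - fb t δ p.2) := measurable_fst.sub ((meas_fb t δ).comp measurable_snd)
    have hj : Integrable (fun p : R3 × R3 => ‖f (p.1 - fb t δ p.2)‖^6 * ((jb p.2)^A)⁻¹) ((win r z).prod volume) := by
      have h1 : Integrable (fun p : R3 × R3 => (E^6) * ((jb p.2)^A)⁻¹) ((win r z).prod volume) :=
        (integrable_const (E^6) : Integrable (fun _ : R3 => E^6) (win r z)).mul_prod (jbi_int hA)
      refine h1.mono' (((hf.1.comp hm).norm.pow_const 6).mul ((jbi_meas A).comp measurable_snd)).aestronglyMeasurable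
        (Filter.Eventually.of_forall fun p => ?_)
      rw [norm_mul, norm_pow, norm_norm, Real.norm_of_nonneg (jbi_pos p.2 _).le]
      have := (jbi_pos p.2 A).le
      gcongr
      exact hE _
    have hpt : ∀ x, ‖(cap A f t δ b x : ℂ)‖^6 ≤ D^3 * (cjb A)^2 * ∫ u, ‖f (x - fb t δ u)‖^6 * ((jb u)^A)⁻¹ := by
      intro x
      have c0 := cap_nonneg A f t δ hb x
      rw [Complex.norm_real, Real.norm_of_nonneg c0]
      have hH : (Hf A f t δ x)^3 ≤ (cjb A)^2 * ∫ u, ‖f (x - fb t δ u)‖^6 * ((jb u)^A)⁻¹ := by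
        have := jensen3 (μ := volume) (g := fun u => ‖f (x - fb t δ u)‖^2) (k := fun u : R3 => ((jb u)^A)⁻¹) (fun u => by positivity)
          (fun u => (jbi_pos u A).le) (jbi_int hA) (Hf_int hf hA t δ x)
          (by have := Hf_int1 hf hA 6 t δ x; simpa only [← pow_mul] using this)
        simp only [← pow_mul] at this
        exact this
      calc cap A f t δ b x^6 = cap A f t δ b x^3 * cap A f t δ b x^3 := by ring
        _ ≤ D^3 * (Hf A f t δ x)^3 := by
            have : cap A f t δ b x ≤ Hf A f t δ x := min_le_left _ _
            gcongr; exact hcap x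
        _ ≤ D^3 * ((cjb A)^2 * ∫ u, ‖f (x - fb t δ u)‖^6 * ((jb u)^A)⁻¹) := by gcongr
        _ = _ := by ring
    calc ∫ x, ‖(cap A f t δ b x : ℂ)‖^6 ∂win r z
        ≤ ∫ x, D^3 * (cjb A)^2 * (∫ u, ‖f (x - fb t δ u)‖^6 * ((jb u)^A)⁻¹) ∂win r z :=
          integral_mono (hcapB.int_pow1 6 _) (hj.integral_prod_left.const_mul _) hpt
      _ = D^3 * (cjb A)^2 * ∫ u, (∫ x, ‖f (x - fb t δ u)‖^6 ∂win r z) * ((jb u)^A)⁻¹ := by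
          rw [integral_const_mul, integral_integral_swap hj]
          congr 2; ext u; rw [integral_mul_const]
      _ ≤ D^3 * (cjb A)^2 * ∫ u : R3, Q * ((jb u)^A)⁻¹ := by
          refine mul_le_mul_of_nonneg_left ?_ (by have := cjb_nonneg A; positivity)
          refine integral_mono_of_nonneg (Filter.Eventually.of_forall fun u => ?_) ((jbi_int hA).const_mul Q) (Filter.Eventually.of_forall fun u => ?_)
          · exact mul_nonneg (integral_nonneg fun _ => by positivity) (jbi_pos u A).le
          · refine mul_le_mul_of_nonneg_right ?_ (jbi_pos u A).le
            rw [win_shift r z (fb t δ u) (fun x => ‖f x‖^6) (hf.1.norm.pow_const 6).stronglyMeasurable]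
            exact hQ _
      _ = _ := by rw [integral_const_mul]; show _ * (Q * cjb A) = _; ring
  have h2 := h1.cnv (cap_BM hf A t δ hb) (meas_fb t δ) (kap3c_meas A) (kap3c_int A)
  intro z
  refine (h2 z).trans ?_
  have : 0 ≤ D^3 * Q := by positivity
  nlinarith

end Moments

/-! ### Part 8: decoupling for the cone -/
section Cone

theorem chl_iff {b p q : ℕ} : q ∈ chl b p ↔ q / 2^b = p := by
  unfold chl
  rw [Finset.mem_Ico, Nat.div_eq_iff (by positivity), Nat.add_mul]
  have : 0 < 2^b := by positivity
  omega

theorem chl_sum {β : Type} [AddCommMonoid β] (g : ℕ → β) (b m p : ℕ) :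
    ∑ q ∈ chl (b+m) p, g q = ∑ p' ∈ chl m p, ∑ q ∈ chl b p', g q := by
  rw [← Finset.sum_fiberwise_of_maps_to (s := chl (b+m) p) (t := chl m p) (g := fun q => q / 2^b)]
  · refine Finset.sum_congr rfl fun p' hp' => Finset.sum_congr ?_ fun _ _ => rfl
    ext q
    rw [Finset.mem_filter, chl_iff, chl_iff]
    rw [chl_iff] at hp'
    constructor
    · rintro ⟨_, h⟩; exact h
    · intro h
      refine ⟨?_, h⟩
      rw [pow_add, ← Nat.div_div_eq_div_mul, h, hp']
  · intro q hq
    rw [chl_iff] at hq ⊢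
    rw [pow_add, ← Nat.div_div_eq_div_mul] at hq
    exact hq

theorem dix_chl (b m p q : ℕ) : dix ((q:ℝ)/2^(b+m) - p) m = q/2^b - p*2^m := by
  unfold dix
  have : (2:ℝ)^m * ((q:ℝ)/2^(b+m) - p) = (q:ℝ)/((2^b : ℕ):ℝ) - ((p*2^m : ℕ):ℝ) := by
    push_cast; rw [pow_add]; field_simp
  rw [this, Nat.floor_sub_natCast, Nat.floor_div_eq_div]

theorem six_Sp (μ : Measure R3) [IsFiniteMeasure μ] {g1 g2 g3 g4 g5 g6 : R3 → ℂ} {S1 S2 S3 S4 S5 S6 : Set R3}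
    (b1 : BM g1) (b2 : BM g2) (b3 : BM g3) (b4 : BM g4) (b5 : BM g5)
    (h1 : Sp g1 S1) (h2 : Sp g2 S2) (h3 : Sp g3 S3) (h4 : Sp g4 S4) (h5 : Sp g5 S5) (h6 : Sp g6 S6)
    (h : ∀ z1 ∈ S1, ∀ z2 ∈ S2, ∀ z3 ∈ S3, ∀ z4 ∈ S4, ∀ z5 ∈ S5, ∀ z6 ∈ S6,
      ∫ x, e (inner ℝ (z1 + z2 + z3 - z4 - z5 - z6) x) ∂μ = 0) : six μ g1 g2 g3 g4 g5 g6 = 0 := by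
  have k := ((((h1.mul h2 b1).mul h3 (b1.mul b2)).mul h4.conj ((b1.mul b2).mul b3)).mul h5.conj
    (((b1.mul b2).mul b3).mul b4.conj)).mul h6.conj ((((b1.mul b2).mul b3).mul b4.conj).mul b5.conj)
  have k2 := k R3 μ id (fun _ => 1) measurable_id measurable_const (integrable_const _) ?_
  · unfold six
    simpa using k2
  · rintro ζ ⟨a5, ⟨a4, ⟨a3, ⟨a2, ⟨z1, hz1, z2, hz2, rfl⟩, z3, hz3, rfl⟩, z4, hz4, rfl⟩, z5, hz5, rfl⟩, z6, hz6, rfl⟩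
    have := h z1 hz1 z2 hz2 z3 hz3 _ hz4 _ hz5 _ hz6
    simpa using this

theorem cone_one {z0 z1 z2 t T c δ lam ν w : ℝ} (hl : 0 < lam) (hν : 0 ≤ ν) (h1 : |z1 - 2*t*z0| ≤ δ^2)
    (h2 : |z2 - 3*t*z1 + 3*t^2*z0| ≤ δ^3) (hw : |w| ≤ 1) (hT : t - T = lam * w) (hc : |z0 - c| ≤ ν) :
    |z2 - 3*T*z1 + 3*T^2*z0 - 3*lam^2*c*w^2| ≤ δ^3 + 3*lam*δ^2 + 3*lam^2*ν := by
  have id : z2 - 3*T*z1 + 3*T^2*z0 - 3*lam^2*c*w^2 =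
      (z2 - 3*t*z1 + 3*t^2*z0) + 3*lam*(w*(z1 - 2*t*z0)) + 3*lam^2*(w^2*(z0-c)) := by
    have : T = t - lam*w := by linarith
    rw [this]; ring
  have e1 : |w*(z1 - 2*t*z0)| ≤ δ^2 := by
    rw [abs_mul]; nlinarith [abs_nonneg w, abs_nonneg (z1 - 2*t*z0)]
  have e2 : |w^2*(z0-c)| ≤ ν := by
    rw [abs_mul, abs_pow]
    have : |w|^2 ≤ 1 := pow_le_one₀ (abs_nonneg _) hw
    nlinarith [abs_nonneg (z0-c), sq_nonneg |w|]
  rw [id]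
  have f1 := mul_le_mul_of_nonneg_left e1 (by positivity : 0 ≤ 3*lam)
  have f2 := mul_le_mul_of_nonneg_left e2 (by positivity : 0 ≤ 3*lam^2)
  calc _ ≤ |z2 - 3*t*z1 + 3*t^2*z0| + |3*lam*(w*(z1 - 2*t*z0))| + |3*lam^2*(w^2*(z0-c))| := abs_add_three _ _ _
    _ ≤ _ := by
      rw [abs_mul (3*lam), abs_mul (3*lam^2), abs_of_pos (by positivity : 0 < 3*lam), abs_of_pos (by positivity : 0 < 3*lam^2)]
      linarith

/-- the region containing the spectrum of one bin of one plank -/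
def PR (t δ d ν j : ℝ) : Set R3 :=
  {ζ | ‖ft t δ ζ‖ < 1 ∧ d/2 < |ζ 0| ∧ j*ν ≤ ζ 0 ∧ ζ 0 ≤ (j+2)*ν}

theorem PR_coord {t δ d ν j : ℝ} (hδ : 0 < δ) {ζ : R3} (h : ζ ∈ PR t δ d ν j) :
    |ζ 1 - 2*t*ζ 0| ≤ δ^2 ∧ |ζ 2 - 3*t*ζ 1 + 3*t^2*ζ 0| ≤ δ^3 ∧ |ζ 0 - (j+1)*ν| ≤ ν ∧ d/2 < |ζ 0| := by
  obtain ⟨h1, h2, h3, h4⟩ := h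
  have a1 := (abs_le_norm3 (ft t δ ζ) 1).trans h1.le
  have a2 := (abs_le_norm3 (ft t δ ζ) 2).trans h1.le
  simp only [ft, mk3_1, mk3_2] at a1 a2
  rw [abs_div, abs_of_pos (by positivity : (0:ℝ) < δ^2), div_le_one (by positivity)] at a1
  rw [abs_div, abs_of_pos (by positivity : (0:ℝ) < δ^3), div_le_one (by positivity)] at a2
  exact ⟨a1, a2, by rw [abs_le]; constructor <;> linarith, h2⟩

set_option maxHeartbeats 1000000 in
theorem cone_arith {δ d ν lam M j T t0 : ℝ} {r : R3} {z1 z2 z3 z4 z5 z6 : R3} {y1 y2 y3 y4 y5 y6 s : ℝ}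
    (hd : 0 < d) (hM : 8 ≤ M) (hδ : δ = M * d) (hν : ν * (96*M^2) = d) (hl : M^7 * d ≤ lam) (hT : T = t0 + lam * s)
    (hT0 : 0 ≤ T) (hT1 : T ≤ 1)
    (hr0 : 1 ≤ r 0 * δ^3) (hr1 : 1 ≤ r 1 * δ^3) (hr2 : r 2 * δ^3 = 1)
    (hs : 0 ≤ s ∧ s ≤ 1) (hy1 : 0 ≤ y1 ∧ y1 ≤ 1) (hy2 : 0 ≤ y2 ∧ y2 ≤ 1) (hy3 : 0 ≤ y3 ∧ y3 ≤ 1) (hy4 : 0 ≤ y4 ∧ y4 ≤ 1)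
    (hy5 : 0 ≤ y5 ∧ y5 ≤ 1) (hy6 : 0 ≤ y6 ∧ y6 ≤ 1)
    (h1 : z1 ∈ PR (t0 + lam*y1) δ d ν j) (h2 : z2 ∈ PR (t0 + lam*y2) δ d ν j) (h3 : z3 ∈ PR (t0 + lam*y3) δ d ν j)
    (h4 : z4 ∈ PR (t0 + lam*y4) δ d ν j) (h5 : z5 ∈ PR (t0 + lam*y5) δ d ν j) (h6 : z6 ∈ PR (t0 + lam*y6) δ d ν j)
    (c0 : |r 0 * (z1 + z2 + z3 - z4 - z5 - z6) 0| < 1) (c1 : |r 1 * (z1 + z2 + z3 - z4 - z5 - z6) 1| < 1)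
    (c2 : |r 2 * (z1 + z2 + z3 - z4 - z5 - z6) 2| < 1) :
    M^2 * |(y1-s)^2 + (y2-s)^2 + (y3-s)^2 - (y4-s)^2 - (y5-s)^2 - (y6-s)^2| ≤ 1 := by
  have hM0 : 0 < M := by linarith
  have hδp : 0 < δ := by rw [hδ]; positivity
  have hδ3 : 0 < δ^3 := by positivity
  have hlp : 0 < lam := lt_of_lt_of_le (by positivity) hl
  have hν0 : 0 < ν := by
    by_contra hc
    have : ν * (96*M^2) ≤ 0 := mul_nonpos_of_nonpos_of_nonneg (not_lt.1 hc) (by positivity)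
    linarith
  set Z := z1 + z2 + z3 - z4 - z5 - z6 with hZ
  have gen : ∀ (a x : ℝ), 1 ≤ a * δ^3 → |a * x| < 1 → |x| ≤ δ^3 := by
    intro a x ha hx
    have ha0 : 0 < a := by
      by_contra hc
      have := mul_nonpos_of_nonpos_of_nonneg (not_lt.1 hc) hδ3.le
      linarith
    rw [abs_mul, abs_of_pos ha0] at hx
    by_contra hc
    push Not at hc
    have := mul_lt_mul_of_pos_left hc ha0
    linarith
  have g0 := gen _ _ hr0 c0
  have g1 := gen _ _ hr1 c1
  have g2 := gen _ _ hr2.ge c2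
  obtain ⟨p11, p12, p13, p14⟩ := PR_coord hδp h1
  obtain ⟨p21, p22, p23, -⟩ := PR_coord hδp h2
  obtain ⟨p31, p32, p33, -⟩ := PR_coord hδp h3
  obtain ⟨p41, p42, p43, -⟩ := PR_coord hδp h4
  obtain ⟨p51, p52, p53, -⟩ := PR_coord hδp h5
  obtain ⟨p61, p62, p63, -⟩ := PR_coord hδp h6
  have hw : ∀ y : ℝ, 0 ≤ y ∧ y ≤ 1 → |y - s| ≤ 1 := fun y hy => by rw [abs_le]; constructor <;> linarith
  have hTT : ∀ y : ℝ, t0 + lam*y - T = lam*(y-s) := fun y => by rw [hT]; ring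
  have q1 := abs_le.1 (cone_one hlp hν0.le p11 p12 (hw y1 hy1) (hTT y1) p13)
  have q2 := abs_le.1 (cone_one hlp hν0.le p21 p22 (hw y2 hy2) (hTT y2) p23)
  have q3 := abs_le.1 (cone_one hlp hν0.le p31 p32 (hw y3 hy3) (hTT y3) p33)
  have q4 := abs_le.1 (cone_one hlp hν0.le p41 p42 (hw y4 hy4) (hTT y4) p43)
  have q5 := abs_le.1 (cone_one hlp hν0.le p51 p52 (hw y5 hy5) (hTT y5) p53)
  have q6 := abs_le.1 (cone_one hlp hν0.le p61 p62 (hw y6 hy6) (hTT y6) p63)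
  set c := (j+1)*ν with hc
  set E := (y1-s)^2 + (y2-s)^2 + (y3-s)^2 - (y4-s)^2 - (y5-s)^2 - (y6-s)^2 with hE
  have hP : |Z 2 - 3*T*Z 1 + 3*T^2*Z 0| ≤ 7*δ^3 := by
    have hT2 : T^2 ≤ 1 := pow_le_one₀ hT0 hT1
    have k1 : |T*Z 1| ≤ δ^3 := by
      rw [abs_mul, abs_of_nonneg hT0]; exact (mul_le_of_le_one_left (abs_nonneg _) hT1).trans g1
    have k0 : |T^2*Z 0| ≤ δ^3 := by
      rw [abs_mul, abs_of_nonneg (sq_nonneg T)]; exact (mul_le_of_le_one_left (abs_nonneg _) hT2).trans g0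
    obtain ⟨a1, a2⟩ := abs_le.1 k1
    obtain ⟨b1, b2⟩ := abs_le.1 k0
    obtain ⟨d1, d2⟩ := abs_le.1 g2
    rw [abs_le]
    constructor <;> linarith only [a1, a2, b1, b2, d1, d2]
  have hZ0 : Z 0 = z1 0 + z2 0 + z3 0 - z4 0 - z5 0 - z6 0 := by simp [hZ]
  have hZ1 : Z 1 = z1 1 + z2 1 + z3 1 - z4 1 - z5 1 - z6 1 := by simp [hZ]
  have hZ2 : Z 2 = z1 2 + z2 2 + z3 2 - z4 2 - z5 2 - z6 2 := by simp [hZ]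
  have hmain : |3*lam^2*c*E| ≤ 13*δ^3 + 18*lam*δ^2 + 18*lam^2*ν := by
    obtain ⟨a1, a2⟩ := abs_le.1 hP
    rw [hZ0, hZ1, hZ2] at a1 a2
    rw [abs_le, hE]
    constructor <;> linarith only [a1, a2, q1.1, q1.2, q2.1, q2.2, q3.1, q3.2, q4.1, q4.2, q5.1, q5.2, q6.1, q6.2]
  clear_value c E Z
  clear q1 q2 q3 q4 q5 q6 hP hZ0 hZ1 hZ2 g0 g1 g2 gen hw hTT p21 p22 p23 p31 p32 p33 p41 p42 p43 p51 p52 p53 p61 p62 p63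
  have hcl : d/4 ≤ |c| := by
    have : d/2 - ν ≤ |c| := by
      have := abs_sub_abs_le_abs_sub (z1 0) c
      linarith only [this, p13, p14]
    have h96 : 96*ν ≤ d := by
      have : (1:ℝ) ≤ M^2 := one_le_pow₀ (by linarith only [hM])
      have := mul_le_mul_of_nonneg_left this hν0.le
      linarith only [hν, this]
    linarith
  have hEn := abs_nonneg E
  rw [abs_mul, abs_mul, abs_of_pos (by positivity : 0 < 3*lam^2)] at hmain
  by_contra hcon
  push Not at hcon
  have s1 : 3*lam^2*(d/4) < M^2*(13*δ^3 + 18*lam*δ^2 + 18*lam^2*ν) := by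
    have l2 : 0 < 3*lam^2*(d/4) := by positivity
    calc 3*lam^2*(d/4) < 3*lam^2*(d/4) * (M^2*|E|) := lt_mul_of_one_lt_right l2 hcon
      _ ≤ 3*lam^2*|c| * (M^2*|E|) := by gcongr
      _ = M^2*(3*lam^2*|c| * |E|) := by ring
      _ ≤ _ := by gcongr
  have s2 : M^2*(13*δ^3 + 18*lam*δ^2 + 18*lam^2*ν) = d * (13*M^5*d^2 + 18*lam*(M^4*d) + 18/96*lam^2) := by
    rw [hδ]
    have : M^2*(18*lam^2*ν) = 18/96*lam^2*(ν*(96*M^2)) := by ring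
    rw [mul_add, this, hν]; ring
  rw [s2] at s1
  have s3 : 3/4*lam^2 < 13*M^5*d^2 + 18*lam*(M^4*d) + 18/96*lam^2 := by
    have : d * (3/4*lam^2) < d * (13*M^5*d^2 + 18*lam*(M^4*d) + 18/96*lam^2) := by linarith
    exact lt_of_mul_lt_mul_left this hd.le
  have s4 : 512 * (M^4*d) ≤ lam := by
    have : (512:ℝ) ≤ M^3 := by
      have := pow_le_pow_left₀ (by norm_num : (0:ℝ) ≤ 8) hM 3
      norm_num at this; exact this
    calc 512 * (M^4*d) ≤ M^3 * (M^4*d) := by gcongr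
      _ = M^7*d := by ring
      _ ≤ lam := hl
  have s5 : M^5*d^2 ≤ (M^4*d)^2 := by
    have : (1:ℝ) ≤ M^3 := one_le_pow₀ (by linarith)
    calc M^5*d^2 = M^5*d^2*1 := by ring
      _ ≤ M^5*d^2*M^3 := by gcongr
      _ = _ := by ring
  have s6 : (M^4*d)^2 ≤ (lam/512)^2 := pow_le_pow_left₀ (by positivity) (by linarith) 2
  have s7 : lam*(M^4*d) ≤ lam*(lam/512) := mul_le_mul_of_nonneg_left (by linarith) hlp.le
  have s8 : 0 < lam^2 := by positivity
  nlinarith only [s3, s5, s6, s7, s8]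

/-- bins -/
def psi0 (x : ℝ) : ℂ := ((Real.smoothTransition x - Real.smoothTransition (x-1) : ℝ) : ℂ)

theorem psi0_supp {x : ℝ} (h : psi0 x ≠ 0) : 0 ≤ x ∧ x ≤ 2 := by
  unfold psi0 at h
  constructor
  · by_contra hc
    push Not at hc
    rw [Real.smoothTransition.zero_of_nonpos hc.le, Real.smoothTransition.zero_of_nonpos (by linarith)] at h
    simp at h
  · by_contra hc
    push Not at hc
    rw [Real.smoothTransition.one_of_one_le (by linarith), Real.smoothTransition.one_of_one_le (by linarith)] at h
    simp at h

theorem psi0_sum {x : ℝ} (J : ℕ) (h1 : |x| + 1 ≤ J) : ∑ i ∈ Finset.range (2*J), psi0 (x - ((i:ℝ) - J)) = 1 := by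
  have : ∀ i ∈ Finset.range (2*J), psi0 (x - ((i:ℝ) - J)) =
      (fun i : ℕ => ((Real.smoothTransition (x + J - i) : ℝ):ℂ)) i - (fun i : ℕ => ((Real.smoothTransition (x + J - i) : ℝ):ℂ)) (i+1) := by
    intro i _
    unfold psi0
    push_cast
    congr 3 <;> ring
  rw [Finset.sum_congr rfl this, Finset.sum_range_sub']
  obtain ⟨h2, h3⟩ := abs_le.1 (show |x| ≤ J - 1 by linarith)
  simp only [Nat.cast_zero]
  rw [Real.smoothTransition.one_of_one_le (by linarith), Real.smoothTransition.zero_of_nonpos (by push_cast; linarith)]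
  simp

theorem bin_ex : ∃ k : ℝ → ℂ, Measurable k ∧ Integrable k ∧ ∀ θ : ℝ, ∫ u, k u * e (-(inner ℝ θ u)) = psi0 θ := by
  have h2 : ContDiff ℝ (⊤ : ℕ∞) psi0 := by
    unfold psi0
    refine Complex.ofRealCLM.contDiff.comp (Real.smoothTransition.contDiff.sub (Real.smoothTransition.contDiff.comp (contDiff_id.sub contDiff_const)))
  have h1 : HasCompactSupport psi0 := by
    refine HasCompactSupport.of_support_subset_isCompact (isCompact_Icc (a := (0:ℝ)) (b := 2)) ?_
    intro x hx
    exact psi0_supp hx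
  obtain ⟨k, k1, k2, k3⟩ := kernel_rep _ h1 h2
  obtain ⟨C, hC0, hC⟩ := k2 4
  exact ⟨k, k1, ((integrable_jb (E := ℝ) (A := 4) (by simp)).const_mul C).mono' k1.aestronglyMeasurable
    (Filter.Eventually.of_forall hC), k3⟩

def kb (k : ℝ → ℂ) (j : ℝ) (u : ℝ) : ℂ := k u * e (j * u)
theorem kb_norm (k : ℝ → ℂ) (j u : ℝ) : ‖kb k j u‖ = ‖k u‖ := by unfold kb; rw [norm_mul, norm_e, mul_one]
theorem kb_meas {k : ℝ → ℂ} (hk : Measurable k) (j : ℝ) : Measurable (kb k j) :=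
  hk.mul (measurable_e.comp (by fun_prop))
theorem kb_int {k : ℝ → ℂ} (hk : Measurable k) (hi : Integrable k) (j : ℝ) : Integrable (kb k j) :=
  hi.norm.mono' (kb_meas hk j).aestronglyMeasurable (Filter.Eventually.of_forall fun u => (kb_norm k j u).le)
theorem kb_mlt {k : ℝ → ℂ} {ψ : ℝ → ℂ} (h : ∀ θ : ℝ, ∫ u, k u * e (-(inner ℝ θ u)) = ψ θ) (j c : ℝ) (ζ : R3) :
    mlt (fun u : ℝ => mk3 (u*c) 0 0) (kb k j) ζ = ψ (ζ 0 * c - j) := by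
  rw [← h]
  unfold mlt kb
  congr 1; ext u
  rw [mul_assoc, ← e_add, inner3]
  congr 2
  simp [inner]; ring

end Cone

/-! ### Part 9: decoupling for the cone, conclusion -/
section Cone2

theorem cone_hyp {m l b p : ℕ} (hm : 3 ≤ m) (hb : 5*m ≤ b) (hp : (p+1)*2^(b+m) ≤ 2^l) {r z : R3} {ν j : ℝ}
    (hν : ν*(96*(2^m)^2) = 1/2^(l+m)) (hr0 : 1 ≤ r 0*(1/2^l)^3) (hr1 : 1 ≤ r 1*(1/2^l)^3) (hr2 : r 2*(1/2^l)^3 = 1)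
    {g : ℕ → R3 → ℂ} (hg : ∀ q, BM (g q))
    (hS : ∀ q, q < 2^l → Sp (g q) (PR ((q:ℝ)/2^l) (1/2^l) (1/2^(l+m)) ν j)) :
    PDHyp (win r z) (chl (b+m) p) g (fun q => (q:ℝ)/2^(b+m) - p) m := by
  intro i1 h1 i2 h2 i3 h3 i4 h4 i5 h5 i6 h6 s hs hlt
  set lam : ℝ := 2^(b+m) * (1/2^l) with hlam
  have hmem : ∀ q ∈ chl (b+m) p, (0 ≤ (q:ℝ)/2^(b+m) - p ∧ (q:ℝ)/2^(b+m) - p ≤ 1) ∧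
      Sp (g q) (PR (p*lam + lam*((q:ℝ)/2^(b+m) - p)) (1/2^l) (1/2^(l+m)) ν j) := by
    intro q hq
    have hq' := hq
    rw [chl, Finset.mem_Ico] at hq'
    obtain ⟨a1, a2⟩ := hq'
    refine ⟨⟨?_, ?_⟩, ?_⟩
    · rw [sub_nonneg, le_div_iff₀ (by positivity)]; exact_mod_cast a1
    · rw [sub_le_iff_le_add, div_le_iff₀ (by positivity)]
      have : (q:ℝ) ≤ (p+1)*2^(b+m) := by exact_mod_cast a2.le
      linarith
    · have : (p:ℝ)*lam + lam*((q:ℝ)/2^(b+m) - p) = q/2^l := by rw [hlam]; field_simp; ring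
      rw [this]
      exact hS q (lt_of_lt_of_le a2 hp)
  refine six_Sp (win r z) (hg i1) (hg i2) (hg i3) (hg i4) (hg i5) (hmem i1 h1).2 (hmem i2 h2).2 (hmem i3 h3).2
    (hmem i4 h4).2 (hmem i5 h5).2 (hmem i6 h6).2 ?_
  intro z1 e1 z2 e2 z3 e3 z4 e4 z5 e5 z6 e6
  by_contra hne
  have hc : ∀ i : Fin 3, |r i * (z1 + z2 + z3 - z4 - z5 - z6) i| < 1 := by
    intro i
    by_contra hc
    exact hne (win_ft r z _ i (not_lt.1 hc))
  have hp' : ((p:ℝ)+1)*2^(b+m) ≤ 2^l := by exact_mod_cast hp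
  have hlp : 0 < lam := by rw [hlam]; positivity
  have hpl : lam*(p+1) ≤ 1 := by
    have : lam*(p+1) = ((p:ℝ)+1)*2^(b+m)/2^l := by rw [hlam]; ring
    rw [this, div_le_one (by positivity)]; exact hp'
  have hM8 : (8:ℝ) ≤ 2^m := by
    calc (8:ℝ) = 2^3 := by norm_num
      _ ≤ 2^m := pow_le_pow_right₀ (by norm_num) hm
  have hl7 : ((2:ℝ)^m)^7 * (1/2^(l+m)) ≤ lam := by
    rw [hlam, mul_one_div, mul_one_div, div_le_div_iff₀ (by positivity) (by positivity), ← pow_mul, ← pow_add, ← pow_add]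
    exact pow_le_pow_right₀ (by norm_num) (by omega)
  have := cone_arith (δ := 1/2^l) (d := 1/2^(l+m)) (ν := ν) (lam := lam) (M := 2^m) (j := j) (T := p*lam + lam*s) (t0 := p*lam)
    (r := r) (by positivity) hM8 (by rw [pow_add]; field_simp) hν hl7 rfl
    (by have := hs.1; positivity) (by have := mul_le_mul_of_nonneg_left hs.2 hlp.le; linarith) hr0 hr1 hr2 hs
    (hmem i1 h1).1 (hmem i2 h2).1 (hmem i3 h3).1 (hmem i4 h4).1 (hmem i5 h5).1 (hmem i6 h6).1 e1 e2 e3 e4 e5 e6 (hc 0) (hc 1) (hc 2)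
  have h4 : ((4:ℝ)^m) = (2^m)^2 := by rw [← pow_mul, mul_comm, pow_mul]; norm_num
  rw [h4] at hlt
  rw [inv_lt_iff_one_lt_mul₀ (by positivity)] at hlt
  linarith

theorem cone_bin {η : ℝ} (hη : 0 < η) : ∃ A : ℝ, 1 ≤ A ∧ ∀ (m k : ℕ), 3 ≤ m → ∀ (r : R3) (ν j Q : ℝ), 0 ≤ Q →
    ν*(96*(2^m)^2) = 1/2^(m*k+m) → 1 ≤ r 0*(1/2^(m*k))^3 → 1 ≤ r 1*(1/2^(m*k))^3 → r 2*(1/2^(m*k))^3 = 1 →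
    ∀ g : ℕ → R3 → ℂ, (∀ q, BM (g q)) → (∀ q, q < 2^(m*k) → Sp (g q) (PR ((q:ℝ)/2^(m*k)) (1/2^(m*k)) (1/2^(m*k+m)) ν j)) →
    (∀ q, q < 2^(m*k) → UB6 r (g q) Q) → ∀ i p, (p+1)*2^(m*i) ≤ 2^(m*k) →
    UB6 r (fun x => ∑ q ∈ chl (m*i) p, g q x) (A^i * (2^m)^(6*min i 5) * (2^((3+η)*m))^i * Q) := by
  obtain ⟨A, hA, H⟩ := PD_main hη
  refine ⟨max A 1, le_max_right _ _, ?_⟩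
  intro m k hm r ν j Q hQ hν hr0 hr1 hr2 g hg hS hU i
  have hA1 : (1:ℝ) ≤ max A 1 := le_max_right _ _
  have hAp : 0 < max A 1 := by linarith
  have hE : (1:ℝ) ≤ 2^((3+η)*m) := Real.one_le_rpow (by norm_num) (by positivity)
  have hEp : (0:ℝ) < 2^((3+η)*m) := by positivity
  obtain ⟨E, hEq⟩ : ∃ E : ℝ, E = 2^((3+η)*m) := ⟨_, rfl⟩
  rw [← hEq] at hE hEp ⊢
  induction i with
  | zero =>
    intro p hp
    have : chl (m*0) p = {p} := by ext q; simp [chl_iff]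
    rw [this]
    simp only [Finset.sum_singleton]
    simp at hp ⊢
    exact hU p (by omega)
  | succ i ih =>
    intro p hp
    have hms : m*(i+1) = m*i + m := by ring
    rw [hms] at hp ⊢
    have hpp : ∀ p' ∈ chl m p, (p'+1)*2^(m*i) ≤ 2^(m*k) := by
      intro p' hp'
      rw [chl, Finset.mem_Ico] at hp'
      calc (p'+1)*2^(m*i) ≤ ((p+1)*2^m)*2^(m*i) := Nat.mul_le_mul_right _ hp'.2
        _ = (p+1)*2^(m*i+m) := by rw [pow_add]; ring
        _ ≤ _ := hp
    by_cases hi : i < 5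
    · have := UB6.sum (r := r) (chl m p) (V := fun p' x => ∑ q ∈ chl (m*i) p', g q x) (fun p' => BM.sum (fun q _ => hg q))
        (fun p' hp' => ih p' (hpp p' hp'))
      rw [chl_card] at this
      have hc : (fun x => ∑ q ∈ chl (m*i+m) p, g q x) = fun x => ∑ p' ∈ chl m p, ∑ q ∈ chl (m*i) p', g q x := by
        ext x; rw [chl_sum]
      rw [hc]
      intro z
      refine (this z).trans ?_
      rw [min_eq_left (by omega : i ≤ 5), min_eq_left (by omega : i+1 ≤ 5)]
      push_cast
      have e1 : ((2:ℝ)^m)^6 * (max A 1^i * (2^m)^(6*i) * E^i * Q) = 1 * ((2^m)^(6*(i+1)) * 1) * (max A 1^i*E^i * Q) := by ring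
      have e2 : max A 1^(i+1) * (2^m)^(6*(i+1)) * E^(i+1) * Q = max A 1 * ((2^m)^(6*(i+1)) * E) * (max A 1^i*E^i * Q) := by ring
      rw [e1, e2]
      gcongr
    · intro z
      have hm2 : min i 5 = 5 := by omega
      have hm3 : min (i+1) 5 = 5 := by omega
      have hb : 5*m ≤ m*i := by rw [mul_comm]; exact Nat.mul_le_mul_left m (by omega)
      have hyp := cone_hyp (z := z) (r := r) hm hb hp hν hr0 hr1 hr2 hg hS
      have hy : ∀ q ∈ chl (m*i+m) p, (q:ℝ)/2^(m*i+m) - p ∈ Set.Ico (0:ℝ) 1 := by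
        intro q hq
        rw [chl, Finset.mem_Ico] at hq
        constructor
        · rw [sub_nonneg, le_div_iff₀ (by positivity)]; exact_mod_cast hq.1
        · rw [sub_lt_iff_lt_add, div_lt_iff₀ (by positivity)]
          have : (q:ℝ) < (p+1)*2^(m*i+m) := by exact_mod_cast hq.2
          linarith
      refine (H R3 ℕ (win r z) (chl (m*i+m) p) g _ m hg hy hyp (max A 1^i * (2^m)^(6*min i 5) * E^i * Q) ?_).trans ?_
      · intro j'
        by_cases hj : j' < 2^m
        · have hf : (chl (m*i+m) p).filter (fun q : ℕ => dix ((q:ℝ)/2^(m*i+m) - p) m = j') = chl (m*i) (p*2^m + j') := by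
            ext q
            rw [Finset.mem_filter, dix_chl, chl_iff, chl_iff, pow_add, ← Nat.div_div_eq_div_mul]
            generalize q/2^(m*i) = w
            have hpos : 0 < 2^m := by positivity
            constructor
            · rintro ⟨a1, a2⟩
              have := Nat.div_mul_le_self w (2^m)
              rw [a1] at this
              omega
            · intro a
              subst a
              refine ⟨?_, by omega⟩
              rw [mul_comm, Nat.mul_add_div hpos, Nat.div_eq_of_lt hj]; rfl
          rw [hf]
          refine ih _ ?_ z
          refine hpp _ ?_
          rw [chl, Finset.mem_Ico, add_mul]; omega
        · have hf : (chl (m*i+m) p).filter (fun q : ℕ => dix ((q:ℝ)/2^(m*i+m) - p) m = j') = ∅ := by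
            rw [Finset.filter_eq_empty_iff]
            intro q hq hd
            rw [dix_chl] at hd
            rw [chl_iff, pow_add, ← Nat.div_div_eq_div_mul] at hq
            have hpos : 0 < 2^m := by positivity
            rw [Nat.div_eq_iff hpos] at hq
            omega
          rw [hf]
          simp
          positivity
      · rw [hm2, hm3]
        have e2 : max A 1^(i+1) * (2^m)^(6*5) * E^(i+1) * Q = max A 1 * E * (max A 1^i * (2^m)^(6*5) * E^i * Q) := by ring
        rw [e2, ← hEq]
        gcongr
        exact le_max_left _ _

theorem cvl_sum {E : Type} [MeasureSpace E] [SFinite (volume : Measure E)] {ι : Type} (s : Finset ι) {L : E → R3} {k : ι → E → ℂ} {W : R3 → ℂ}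
    (hW : BM W) (hL : Measurable L) (hk : ∀ i, Integrable (k i)) (x : R3) :
    cvl L (fun u => ∑ i ∈ s, k i u) W x = ∑ i ∈ s, cvl L (k i) W x := by
  unfold cvl
  rw [← integral_finsetSum _ (fun i _ => cnv_int hW hL (hk i) x)]
  simp_rw [Finset.mul_sum]

theorem mlt_sum {E : Type} [MeasureSpace E] {ι : Type} (s : Finset ι) {L : E → R3} {k : ι → E → ℂ}
    (hL : Measurable L) (hk : ∀ i, Integrable (k i)) (ζ : R3) :
    mlt L (fun u => ∑ i ∈ s, k i u) ζ = ∑ i ∈ s, mlt L (k i) ζ := by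
  unfold mlt
  have : BM (fun u => e (-(inner ℝ ζ (L u)))) := by
    have := BM_e (Y := fun u => -L u) hL.neg ζ
    simpa [inner_neg_right] using this
  rw [← integral_finsetSum _ (fun i _ => integrable_mul_BM (hk i) this)]
  simp_rw [Finset.sum_mul]

theorem cone_dec {η : ℝ} (hη : 0 < η) : ∃ A : ℝ, 1 ≤ A ∧ ∀ (m k : ℕ), 3 ≤ m → ∀ (r : R3) (Q : ℝ), 0 ≤ Q →
    1 ≤ r 0*(1/2^(m*k))^3 → 1 ≤ r 1*(1/2^(m*k))^3 → r 2*(1/2^(m*k))^3 = 1 →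
    ∀ V : ℕ → R3 → ℂ, (∀ q, BM (V q)) →
    (∀ q, q < 2^(m*k) → Sp (V q) {ζ | ‖ft ((q:ℝ)/2^(m*k)) (1/2^(m*k)) ζ‖ < 1 ∧ (1/2^(m*k+m))/2 < |ζ 0|}) →
    (∀ q, q < 2^(m*k) → UB6 r (V q) Q) →
    UB6 r (fun x => ∑ q ∈ Finset.range (2^(m*k)), V q x) (A^(k+1) * (2^m)^60 * (2^((3+η)*m))^k * Q) := by
  obtain ⟨A, hA, H⟩ := cone_bin hη
  obtain ⟨κ, hκm, hκi, hκ⟩ := bin_ex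
  set c0 : ℝ := (∫ u, ‖κ u‖)^6 with hc0
  have hc0n : 0 ≤ c0 := by positivity
  refine ⟨A * (200^6*c0+1), by nlinarith [mul_nonneg (by linarith : 0 ≤ A) hc0n], ?_⟩
  intro m k hm r Q hQ hr0 hr1 hr2 V hV hS hU
  obtain ⟨J, hJ⟩ : ∃ J : ℕ, J = 96*(2^m)^3+1 := ⟨_, rfl⟩
  obtain ⟨ν, hν⟩ : ∃ ν : ℝ, ν = 1/2^(m*k+m)/(96*(2^m)^2) := ⟨_, rfl⟩
  have hν0 : 0 < ν := by rw [hν]; positivity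
  set L : ℝ → R3 := fun u => mk3 (u*ν⁻¹) 0 0 with hLd
  have hL : Measurable L := (cont_e1 _).measurable
  have hki : ∀ i : ℕ, Integrable (kb κ ((i:ℝ)-J)) := fun i => kb_int hκm hκi _
  have hkm : ∀ i : ℕ, Measurable (kb κ ((i:ℝ)-J)) := fun i => kb_meas hκm _
  set g : ℕ → ℕ → R3 → ℂ := fun i q => cvl L (kb κ ((i:ℝ)-J)) (V q) with hg
  have hgB : ∀ i q, BM (g i q) := fun i q => (hV q).cnv hL (hkm i) (hki i)
  have hsum : ∀ q, q < 2^(m*k) → ∀ x, V q x = ∑ i ∈ Finset.range (2*J), g i q x := by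
    intro q hq x
    have h1 := (hS q hq).sub_cnv (hV q) hL (k := fun u => ∑ i ∈ Finset.range (2*J), kb κ ((i:ℝ)-J) u)
      (Finset.measurable_fun_sum _ fun i _ => hkm i) (integrable_finsetSum _ fun i _ => hki i)
    have h2 := (h1.mono (S' := ∅) ?_).eq_zero x
    · rw [cvl_sum _ (hV q) hL hki] at h2
      exact sub_eq_zero.1 h2
    · rintro ζ ⟨⟨h3, -⟩, h4⟩
      apply h4
      rw [mlt_sum _ hL hki]
      simp_rw [hLd, kb_mlt hκ]
      apply psi0_sum
      have h5 := ((abs_le_norm3 _ 0).trans h3.le)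
      simp only [ft, mk3_0] at h5
      rw [div_div_eq_mul_div, div_one, abs_mul, abs_of_pos (by positivity : (0:ℝ) < 2^(m*k))] at h5
      rw [hJ, abs_mul, abs_inv, abs_of_pos hν0, hν]
      push_cast
      have : |ζ 0| * (1/2^(m*k+m)/(96*(2^m)^2))⁻¹ = (|ζ 0| * 2^(m*k)) * (96*(2^m)^3) := by
        rw [pow_add]; field_simp
      rw [this]
      have h6 := mul_le_mul_of_nonneg_right h5 (by positivity : (0:ℝ) ≤ 96*(2^m)^3)
      linarith
  have hbin : ∀ i, UB6 r (fun x => ∑ q ∈ Finset.range (2^(m*k)), g i q x)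
      (A^k * (2^m)^30 * (2^((3+η)*m))^k * (c0*Q)) := by
    intro i
    have h := H m k hm r ν ((i:ℝ)-J) (c0*Q) (by positivity) (by rw [hν]; field_simp) hr0 hr1 hr2 (g i) (hgB i) ?_ ?_ k 0 (by simp)
    · have hc : chl (m*k) 0 = Finset.range (2^(m*k)) := by ext q; simp [chl]
      rw [hc] at h
      intro z
      refine (h z).trans ?_
      have : ((2:ℝ)^m)^(6*min k 5) ≤ (2^m)^30 := pow_le_pow_right₀ (one_le_pow₀ (by norm_num)) (by omega)
      gcongr
    · intro q hq
      refine ((hS q hq).cnv (hV q) hL (hkm i) (hki i)).mono ?_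
      rintro ζ ⟨⟨h1, h2⟩, h3⟩
      rw [hLd, kb_mlt hκ] at h3
      obtain ⟨h4, h5⟩ := psi0_supp h3
      refine ⟨h1, h2, ?_, ?_⟩
      · have := mul_le_mul_of_nonneg_right (by linarith : (i:ℝ)-J ≤ ζ 0 * ν⁻¹) hν0.le
        rwa [inv_mul_cancel_right₀ hν0.ne'] at this
      · have := mul_le_mul_of_nonneg_right (by linarith : ζ 0 * ν⁻¹ ≤ (i:ℝ)-J+2) hν0.le
        rwa [inv_mul_cancel_right₀ hν0.ne'] at this
    · intro q hq
      have := (hU q hq).cnv (hV q) hL (hkm i) (hki i)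
      simp_rw [kb_norm] at this
      exact this
  have hfin := UB6.sum (Finset.range (2*J)) (fun i => BM.sum (s := Finset.range (2^(m*k))) (fun q _ => hgB i q)) (fun i _ => hbin i)
  have hc : (fun x => ∑ q ∈ Finset.range (2^(m*k)), V q x) = fun x => ∑ i ∈ Finset.range (2*J), ∑ q ∈ Finset.range (2^(m*k)), g i q x := by
    ext x
    rw [Finset.sum_comm]
    exact Finset.sum_congr rfl fun q hq => hsum q (Finset.mem_range.1 hq) x
  rw [hc]
  intro z
  refine (hfin z).trans ?_
  rw [Finset.card_range]
  have hM1 : (1:ℝ) ≤ 2^m := one_le_pow₀ (by norm_num)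
  have hJ2 : (((2*J : ℕ)):ℝ) ≤ 200*(2^m)^3 := by
    rw [hJ]; push_cast
    have : (1:ℝ) ≤ (2^m)^3 := one_le_pow₀ hM1
    linarith
  have hA0 : 0 ≤ A := by linarith
  calc ((2*J : ℕ):ℝ)^6 * (A^k * (2^m)^30 * (2^((3+η)*m))^k * (c0*Q))
      ≤ (200*(2^m)^3)^6 * (A^k * (2^m)^30 * (2^((3+η)*m))^k * (c0*Q)) := by gcongr
    _ = (A^k * (200^6*c0)) * (2^m)^48 * (2^((3+η)*m))^k * Q := by ring
    _ ≤ (A * (200^6*c0+1))^(k+1) * (2^m)^60 * (2^((3+η)*m))^k * Q := by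
      gcongr ?_ * ?_ * _ * _
      · rw [mul_pow]
        have h1 : A^k ≤ A^(k+1) := pow_le_pow_right₀ hA (by omega)
        have h2 : 200^6*c0 ≤ (200^6*c0+1)^(k+1) := (by linarith : 200^6*c0 ≤ 200^6*c0+1).trans (le_self_pow₀ (by linarith [mul_nonneg (by norm_num : (0:ℝ) ≤ 200^6) hc0n]) (by omega))
        gcongr
      · exact pow_le_pow_right₀ hM1 (by omega)

end Cone2

/-! ### Part 10: the high part of the square function -/
section High

theorem low_ex : ∃ k : ℝ → ℂ, Measurable k ∧ Integrable k ∧ (∀ A : ℕ, ∃ C, 0 ≤ C ∧ ∀ u, ‖k u‖ ≤ C * ((jb u)^A)⁻¹) ∧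
    ∀ θ : ℝ, |θ| ≤ 1/2 → ∫ u, k u * e (-(inner ℝ θ u)) = 1 := by
  let χ : ContDiffBump (0:ℝ) := ⟨1/2, 1, by norm_num, by norm_num⟩
  have h1 : HasCompactSupport (fun θ : ℝ => ((χ θ : ℝ) : ℂ)) := by
    refine HasCompactSupport.comp_left (g := fun r : ℝ => (r:ℂ)) χ.hasCompactSupport ?_
    simp
  have h2 : ContDiff ℝ (⊤ : ℕ∞) (fun θ : ℝ => ((χ θ : ℝ) : ℂ)) := Complex.ofRealCLM.contDiff.comp χ.contDiff
  obtain ⟨k, k1, k2, k3⟩ := kernel_rep _ h1 h2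
  obtain ⟨C, hC0, hC⟩ := k2 4
  refine ⟨k, k1, ((integrable_jb (E := ℝ) (A := 4) (by simp)).const_mul C).mono' k1.aestronglyMeasurable
    (Filter.Eventually.of_forall hC), k2, ?_⟩
  intro θ hθ
  rw [k3, χ.one_of_mem_closedBall]
  · simp
  · rw [Metric.mem_closedBall, Real.dist_eq, sub_zero]; exact hθ

def kl : ℝ → ℂ := low_ex.choose
theorem kl_meas : Measurable kl := low_ex.choose_spec.1
theorem kl_int : Integrable kl := low_ex.choose_spec.2.1
theorem kl_dec (A : ℕ) : ∃ C, 0 ≤ C ∧ ∀ u, ‖kl u‖ ≤ C * ((jb u)^A)⁻¹ := low_ex.choose_spec.2.2.1 A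
theorem kl_one {θ : ℝ} (h : |θ| ≤ 1/2) : ∫ u, kl u * e (-(inner ℝ θ u)) = 1 := low_ex.choose_spec.2.2.2 θ h

theorem min_sum_le {ι : Type} (s : Finset ι) (h : ι → ℝ) (hh : ∀ i, 0 ≤ h i) {b : ℝ} (hb : 0 ≤ b) :
    min (∑ i ∈ s, h i) b ≤ ∑ i ∈ s, min (h i) b := by
  by_cases hc : ∃ i ∈ s, b ≤ h i
  · obtain ⟨i, hi, hbi⟩ := hc
    calc min (∑ i ∈ s, h i) b ≤ b := min_le_right _ _
      _ = min (h i) b := (min_eq_right hbi).symm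
      _ ≤ _ := Finset.single_le_sum (f := fun i => min (h i) b) (fun j _ => le_min (hh j) hb) hi
  · push Not at hc
    calc _ ≤ ∑ i ∈ s, h i := min_le_left _ _
      _ = _ := Finset.sum_congr rfl fun i hi => (min_eq_left (hc i hi).le).symm

theorem min_mul_le {C s b : ℝ} (hC : 1 ≤ C) (hb : 0 ≤ b) : min (C*s) b ≤ C * min s b := by
  rcases le_total s b with h | h
  · rw [min_eq_left h]; exact min_le_left _ _
  · rw [min_eq_right h]; exact (min_le_right _ _).trans (by nlinarith)

theorem low_bd {A : ℕ} (hA : 4 ≤ A) : ∃ C : ℝ, 0 < C ∧ ∀ (a : ℝ → ℂ) (v : ℝ → ℝ) (X : Finset ℝ) (l m q : ℕ) (b : ℝ), 0 ≤ b →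
    (∀ ξ ∈ X, 0 ≤ ξ) → (∀ ξ ∈ X, |v ξ| ≤ (1/2^(l+m))^2) → ∀ x,
    ‖cvl (fun u : ℝ => mk3 (u*2^(l+m)) 0 0) kl (Wc (A+4) (es a v (arc X l q)) ((q:ℝ)/2^l) (1/2^l) b) x‖ ≤
      C * ∑ q' ∈ chl m q, cap A (es a v (arc X (l+m) q')) ((q':ℝ)/2^(l+m)) (1/2^(l+m)) b x := by
  obtain ⟨C1, hC1, H1⟩ := lowpass hA
  obtain ⟨c2, C2, hc2, hC2, H2⟩ := Wr_bds (A := A+4) (by omega)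
  obtain ⟨c3, C3, hc3, hC3, k1, k2, k3, -⟩ := kap1_spec A
  obtain ⟨C4, hC4, H4⟩ := kl_dec (A+4)
  set I := ∫ s, kap1 A s with hI
  have hI0 : 0 ≤ I := integral_nonneg fun s => (kap1_pos A s).le
  set C5 := C4/c3*C2 with hC5
  have hC5' : 0 ≤ C5 := by positivity
  have hmm : (0:ℝ) < max C1 (max I 1) := lt_of_lt_of_le hC1 (le_max_left _ _)
  refine ⟨C5 * max C1 (max I 1) + 1, by positivity, ?_⟩
  intro a v X l m q b hb hX hv x
  set f := es a v (arc X l q) with hf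
  have hfB : BM f := BM_es _ _ _
  set t := (q:ℝ)/2^l
  set S := ∑ q' ∈ chl m q, Hf A (es a v (arc X (l+m) q')) ((q':ℝ)/2^(l+m)) (1/2^(l+m)) x with hSd
  set y : ℝ → R3 := fun s => x - mk3 (s*2^(l+m)) 0 0 with hy
  have hym : Measurable y := measurable_const.sub (cont_e1 _).measurable
  -- integrabilities
  have hHb : BM (fun x => ((Hf (A+4) f t (1/2^l) x : ℝ):ℂ)) := by
    obtain ⟨hm, D, hD⟩ := hfB
    refine ⟨Complex.measurable_ofReal.comp (Hf_meas ⟨hm, D, hD⟩ _ _ _), D^2 * cjb (A+4), fun w => ?_⟩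
    rw [Complex.norm_real, Real.norm_of_nonneg (Hf_nonneg _ _ _ _ _)]
    exact Hf_le ⟨hm, D, hD⟩ (by omega) _ _ hD w
  have iH : Integrable (fun s => kap1 A s * Hf (A+4) f t (1/2^l) (y s)) := by
    have := integrable_mul_BM ((kap1_int0 A).ofReal (𝕜 := ℂ)) (hHb.comp' hym)
    have := this.re
    refine this.congr (Filter.Eventually.of_forall fun s => ?_)
    simp [← Complex.ofReal_mul]
  have iC : Integrable (fun s => kap1 A s * cap (A+4) f t (1/2^l) b (y s)) := by
    have := integrable_mul_BM ((kap1_int0 A).ofReal (𝕜 := ℂ)) ((cap_BM hfB (A+4) t (1/2^l) hb).comp' hym)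
    have := this.re
    refine this.congr (Filter.Eventually.of_forall fun s => ?_)
    simp [← Complex.ofReal_mul]
  have b1 : ∫ s, kap1 A s * cap (A+4) f t (1/2^l) b (y s) ≤ C1 * S := by
    refine le_trans ?_ (H1 a v X l m q hX hv x)
    refine integral_mono iC iH fun s => ?_
    exact mul_le_mul_of_nonneg_left (min_le_left _ _) (kap1_pos A s).le
  have b2 : ∫ s, kap1 A s * cap (A+4) f t (1/2^l) b (y s) ≤ I * b := by
    rw [hI, ← integral_mul_const]
    refine integral_mono iC ((kap1_int0 A).mul_const b) fun s => ?_
    exact mul_le_mul_of_nonneg_left (min_le_right _ _) (kap1_pos A s).le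
  have hS0 : 0 ≤ S := Finset.sum_nonneg fun _ _ => Hf_nonneg _ _ _ _ _
  have b3 : ∫ s, kap1 A s * cap (A+4) f t (1/2^l) b (y s) ≤ max C1 (max I 1) * min S b := by
    rw [mul_min_of_nonneg _ _ hmm.le]
    refine le_min (b1.trans ?_) (b2.trans ?_)
    · gcongr; exact le_max_left _ _
    · gcongr; exact (le_max_left _ _).trans (le_max_right _ _)
  have b4 : ‖cvl (fun u : ℝ => mk3 (u*2^(l+m)) 0 0) kl (Wc (A+4) f t (1/2^l) b) x‖ ≤
      C5 * ∫ s, kap1 A s * cap (A+4) f t (1/2^l) b (y s) := by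
    unfold cvl
    rw [← integral_const_mul]
    refine norm_integral_le_of_norm_le (iC.const_mul C5) (Filter.Eventually.of_forall fun s => ?_)
    rw [norm_mul, Wc_eq, Complex.norm_real]
    have w1 := (H2 f hfB t (1/2^l) b hb (y s)).2
    have w0 := (H2 f hfB t (1/2^l) b hb (y s)).1
    have w2 := cap_nonneg (A+4) f t (1/2^l) hb (y s)
    rw [Real.norm_of_nonneg (le_trans (by positivity) w0)]
    have w3 : ‖kl s‖ ≤ C4/c3*kap1 A s := by
      refine (H4 s).trans ?_
      rw [div_mul_eq_mul_div, mul_div_assoc]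
      refine mul_le_mul_of_nonneg_left ?_ hC4
      rw [le_div_iff₀ hc3, mul_comm]
      exact k2 s
    have w4 := (kap1_pos A s).le
    calc Wr (A+4) f t (1/2^l) b (y s) * ‖kl s‖ ≤ (C2 * cap (A+4) f t (1/2^l) b (y s)) * (C4/c3*kap1 A s) := by gcongr
      _ = _ := by rw [hC5]; ring
  have b5 : min S b ≤ ∑ q' ∈ chl m q, cap A (es a v (arc X (l+m) q')) ((q':ℝ)/2^(l+m)) (1/2^(l+m)) b x :=
    min_sum_le _ _ (fun _ => Hf_nonneg _ _ _ _ _) hb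
  have b6 : 0 ≤ min S b := le_min hS0 hb
  calc _ ≤ C5 * (max C1 (max I 1) * min S b) := b4.trans (by gcongr)
    _ = (C5 * max C1 (max I 1)) * min S b := by ring
    _ ≤ (C5 * max C1 (max I 1) + 1) * min S b := by gcongr; linarith
    _ ≤ _ := by gcongr

/-- high part of one plank -/
def VH (A : ℕ) (f : R3 → ℂ) (t : ℝ) (l m : ℕ) (b : ℝ) (x : R3) : ℂ :=
  Wc A f t (1/2^l) b x - cvl (fun u : ℝ => mk3 (u*2^(l+m)) 0 0) kl (Wc A f t (1/2^l) b) x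

theorem VH_BM {f : R3 → ℂ} (hf : BM f) (A : ℕ) (t : ℝ) (l m : ℕ) {b : ℝ} (hb : 0 ≤ b) : BM (VH A f t l m b) := by
  obtain ⟨m1, C1, h1⟩ := Wc_BM hf A t (1/2^l) hb
  obtain ⟨m2, C2, h2⟩ := (Wc_BM hf A t (1/2^l) hb).cnv (cont_e1 (2^(l+m))).measurable kl_meas kl_int
  exact ⟨m1.sub m2, C1+C2, fun w => (norm_sub_le _ _).trans (add_le_add (h1 w) (h2 w))⟩

theorem VH_Sp {f : R3 → ℂ} (hf : BM f) (A : ℕ) (t : ℝ) (l m : ℕ) {b : ℝ} (hb : 0 ≤ b) :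
    Sp (VH A f t l m b) {ζ | ‖ft t (1/2^l) ζ‖ < 1 ∧ (1/2^(l+m))/2 < |ζ 0|} := by
  have h1 := (Sp_univ (cap_BM hf A t (1/2^l) hb)).cnv (cap_BM hf A t (1/2^l) hb) (meas_fb t (1/2^l)) (kap3c_meas A) (kap3c_int A)
  have h2 := h1.sub_cnv (Wc_BM hf A t (1/2^l) hb) (cont_e1 (2^(l+m))).measurable kl_meas kl_int
  refine h2.mono ?_
  rintro ζ ⟨⟨-, h3⟩, h4⟩
  constructor
  · by_contra hc
    apply h3
    obtain ⟨c, C, -, -, -, -, -, hk⟩ := kap3_spec A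
    rw [← hk (ft t (1/2^l) ζ) (not_lt.1 hc)]
    unfold mlt
    simp_rw [inner_fb]
  · by_contra hc
    apply h4
    have hc := not_lt.1 hc
    have : |ζ 0 * 2^(l+m)| ≤ 1/2 := by
      rw [abs_mul, abs_of_pos (by positivity : (0:ℝ) < 2^(l+m))]
      calc |ζ 0| * 2^(l+m) ≤ (1/2^(l+m))/2 * 2^(l+m) := by gcongr
        _ = 1/2 := by field_simp
    rw [← kl_one this]
    unfold mlt
    congr 1; ext u
    rw [inner3]
    congr 3
    simp [inner]; ring

theorem VH_UB {A : ℕ} (hA : 4 ≤ A) : ∃ C : ℝ, 0 < C ∧ ∀ (f : R3 → ℂ), BM f → ∀ (t : ℝ) (l m : ℕ) (b D Q : ℝ) (r : R3), 0 ≤ b → 0 ≤ D → 0 ≤ Q →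
    (∀ x, cap A f t (1/2^l) b x ≤ D) → UB6 r f Q → UB6 r (VH A f t l m b) (C * D^3 * Q) := by
  obtain ⟨C, hC, H⟩ := UB6_Wc hA
  set c := (∫ u, ‖kl u‖)^6 with hc
  have hc0 : 0 ≤ c := by positivity
  refine ⟨2^6 * ((1 + c) * C), by positivity, ?_⟩
  intro f hf t l m b D Q r hb hD hQ hcap hU
  have h1 := H f hf t (1/2^l) b D Q r hb hD hcap hU
  have h2 := h1.cnv (Wc_BM hf A t (1/2^l) hb) (cont_e1 (2^(l+m))).measurable kl_meas kl_int
  rw [← hc] at h2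
  have hB := Wc_BM hf A t (1/2^l) hb
  have hB2 := hB.cnv (cont_e1 (2^(l+m))).measurable kl_meas kl_int
  have hneg : ∀ V : R3 → ℂ, ∀ Q, UB6 r V Q → UB6 r (fun x => - V x) Q := fun V Q h z => by
    simpa [norm_neg] using h z
  have hle : ∀ V : R3 → ℂ, ∀ Q Q', Q ≤ Q' → UB6 r V Q → UB6 r V Q' := fun V Q Q' h h' z => (h' z).trans h
  have hP : 0 ≤ C*D^3*Q := by positivity
  have h3 := UB6.sum (r := r) (Finset.univ : Finset Bool) (V := fun i => bif i then Wc A f t (1/2^l) b else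
    fun x => - cvl (fun u : ℝ => mk3 (u*2^(l+m)) 0 0) kl (Wc A f t (1/2^l) b) x) (Q := (1+c)*(C*D^3*Q)) ?_ ?_
  · intro z
    have := h3 z
    simp at this
    refine le_trans (le_of_eq ?_) (this.trans (le_of_eq ?_))
    · congr 1; ext x; rw [VH, sub_eq_add_neg, one_div]
    · ring
  · intro i
    cases i
    · exact ⟨hB2.1.neg, hB2.2.imp fun C h w => by simpa using h w⟩
    · exact hB
  · intro i _
    cases i
    · exact hneg _ _ (hle _ _ _ (by nlinarith) h2)
    · exact hle _ _ _ (by nlinarith) h1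

/-- truncated square function at level `l` -/
def GG (A : ℕ) (a : ℝ → ℂ) (v : ℝ → ℝ) (X : Finset ℝ) (l : ℕ) (b : ℝ) (x : R3) : ℝ :=
  ∑ q ∈ Finset.range (2^l), cap A (es a v (arc X l q)) ((q:ℝ)/2^l) (1/2^l) b x

theorem GG_nonneg (A : ℕ) (a : ℝ → ℂ) (v : ℝ → ℝ) (X : Finset ℝ) (l : ℕ) {b : ℝ} (hb : 0 ≤ b) (x : R3) : 0 ≤ GG A a v X l b x :=
  Finset.sum_nonneg fun _ _ => cap_nonneg _ _ _ _ hb _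

theorem GG_meas (A : ℕ) (a : ℝ → ℂ) (v : ℝ → ℝ) (X : Finset ℝ) (l : ℕ) (b : ℝ) : Measurable (GG A a v X l b) :=
  Finset.measurable_fun_sum _ fun _ _ => cap_meas (BM_es _ _ _) _ _ _ _

theorem sum_chl (g : ℕ → ℝ) (l m : ℕ) : ∑ q ∈ Finset.range (2^l), ∑ q' ∈ chl m q, g q' = ∑ q ∈ Finset.range (2^(l+m)), g q := by
  have hc : ∀ l, chl l 0 = Finset.range (2^l) := fun l => by ext q; simp [chl]
  rw [add_comm l m, ← hc, ← hc, chl_sum]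

theorem arc_mem_lt {X : Finset ℝ} (hX : ∀ ξ ∈ X, 0 ≤ ξ) {l q : ℕ} {ξ : ℝ} (h : ξ ∈ arc X l q) :
    (q:ℝ)/2^l ≤ ξ ∧ ξ < (q:ℝ)/2^l + 1/2^l := by
  obtain ⟨h1, h2⟩ := Finset.mem_filter.1 h
  refine ⟨(arc_mem hX h).1, ?_⟩
  have := Nat.lt_floor_add_one ((2:ℝ)^l*ξ)
  unfold dix at h2
  rw [h2] at this
  rw [← add_div, lt_div_iff₀ (by positivity)]
  linarith

theorem high_est {η : ℝ} (hη : 0 < η) {A : ℕ} (hA : 4 ≤ A) : ∃ C : ℝ, 1 ≤ C ∧ ∀ (m k : ℕ), 3 ≤ m →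
    ∀ (a : ℝ → ℂ) (v : ℝ → ℝ) (X : Finset ℝ) (N b : ℝ) (r z : R3), 0 < N → 2^(m*k+m) ≤ N → 0 ≤ b →
    (∀ ξ ∈ X, 0 ≤ ξ ∧ ξ < 1) → SepN N X → (∀ ξ ∈ X, |v ξ| ≤ (N^2)⁻¹) → (∀ ξ ∈ X, ‖a ξ‖ ≤ 1) →
    1 ≤ r 0*(1/2^(m*k))^3 → 1 ≤ r 1*(1/2^(m*k))^3 → r 2*(1/2^(m*k))^3 = 1 → N^2 ≤ r 0 → N^2 ≤ r 1 →
    ∀ lam : ℝ, 0 < lam →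
    (win r z).real {x | lam ≤ GG (A+4) a v X (m*k) b x ∧ C * GG A a v X (m*k+m) b x ≤ GG (A+4) a v X (m*k) b x} ≤
      C^(k+2) * (2^m)^60 * N^(3+η) * (min b ((N/2^(m*k))^2))^3 / lam^6 := by
  obtain ⟨C1, hC1, H1⟩ := low_bd hA
  obtain ⟨c2, C2, hc2, hC2, H2⟩ := Wr_bds (A := A+4) (by omega)
  obtain ⟨C3, hC3, H3⟩ := VH_UB (A := A+4) (by omega)
  obtain ⟨C4, hC4, H4⟩ := UB6_es hη
  obtain ⟨C5, hC5, H5⟩ := cone_dec hη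
  set c4 := 4*cjb (A+4)+1 with hc4
  have hc4' : 0 < c4 := by have := cjb_nonneg (A+4); positivity
  set K := (2/c2)^6*C3*c4^3*C4*2^(3+η) with hK
  have hK0 : 0 < K := by positivity
  refine ⟨C5 + 2*C1/c2 + K, by have : 0 ≤ 2*C1/c2 := by positivity
                               linarith, ?_⟩
  intro m k hm a v X N b r z hN hNl hb hX hsep hv ha hr0 hr1 hr2 hN0 hN1 lam hlam
  set C := C5 + 2*C1/c2 + K with hC
  set δ : ℝ := 1/2^(m*k) with hδ
  have hX0 : ∀ ξ ∈ X, 0 ≤ ξ := fun ξ h => (hX ξ h).1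
  have hNM : (1:ℝ) ≤ N/2^(m*k) := by
    rw [le_div_iff₀ (by positivity), one_mul]
    refine le_trans ?_ hNl
    exact pow_le_pow_right₀ (by norm_num) (by omega)
  have hNδ : N*δ = N/2^(m*k) := by rw [hδ]; ring
  set D := c4 * min b ((N/2^(m*k))^2) with hD
  have hD0 : 0 ≤ D := by positivity
  have hv2 : ∀ ξ ∈ X, |v ξ| ≤ (1/2^(m*k+m))^2 := by
    intro ξ hξ
    refine (hv ξ hξ).trans ?_
    rw [one_div, inv_pow]
    gcongr
  set V : ℕ → R3 → ℂ := fun q => VH (A+4) (es a v (arc X (m*k) q)) ((q:ℝ)/2^(m*k)) (m*k) m b with hV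
  have hcap : ∀ q x, cap (A+4) (es a v (arc X (m*k) q)) ((q:ℝ)/2^(m*k)) (1/2^(m*k)) b x ≤ D := by
    intro q x
    have h1 : Hf (A+4) (es a v (arc X (m*k) q)) ((q:ℝ)/2^(m*k)) (1/2^(m*k)) x ≤ (2*(N/2^(m*k)))^2 * cjb (A+4) := by
      refine Hf_le (BM_es _ _ _) (by omega) _ _ (fun y => ?_) x
      refine (es_norm_le (fun ξ hξ => ha ξ (arc_sub _ _ _ hξ)) y).trans ?_
      refine (arc_card hN hsep hX0 _ _).trans ?_
      rw [← hδ, hNδ]; linarith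
    have hcj := cjb_nonneg (A+4)
    unfold cap
    rw [hD, mul_min_of_nonneg _ _ hc4'.le]
    refine le_min ((min_le_right _ _).trans ?_) ((min_le_left _ _).trans (h1.trans ?_))
    · rw [hc4]; nlinarith
    · rw [hc4]; nlinarith [sq_nonneg (N/2^(m*k))]
  have hQ0 : 0 ≤ C4*(N*δ+1)^(3+η) := by
    have : 0 ≤ N*δ+1 := by rw [hNδ]; linarith
    positivity
  have hU : ∀ q, q < 2^(m*k) → UB6 r (V q) (C3*D^3*(C4*(N*δ+1)^(3+η))) := by
    intro q hq
    refine H3 _ (BM_es _ _ _) _ _ _ _ _ _ _ hb hD0 hQ0 (hcap q) ?_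
    refine H4 a v (arc X (m*k) q) N ((q:ℝ)/2^(m*k)) δ r hN (by positivity) ?_ (by positivity) ?_ (hsep.mono (arc_sub _ _ _)) ?_
      (fun ξ hξ => hv ξ (arc_sub _ _ _ hξ)) (fun ξ hξ => ha ξ (arc_sub _ _ _ hξ)) hN0 hN1
    · rw [hδ, div_le_one (by positivity)]; exact one_le_pow₀ (by norm_num)
    · rw [div_le_one (by positivity)]; exact_mod_cast hq.le
    · intro ξ hξ; exact arc_mem_lt hX0 hξ
  have hmain := H5 m k hm r _ (by positivity) hr0 hr1 hr2 V (fun q => VH_BM (BM_es _ _ _) _ _ _ _ hb)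
    (fun q _ => VH_Sp (BM_es _ _ _) _ _ _ _ hb) hU z
  set S := {x | lam ≤ GG (A+4) a v X (m*k) b x ∧ C * GG A a v X (m*k+m) b x ≤ GG (A+4) a v X (m*k) b x} with hS
  have hVB : BM (fun x => ∑ q ∈ Finset.range (2^(m*k)), V q x) := BM.sum (fun q _ => VH_BM (BM_es _ _ _) _ _ _ _ hb)
  have hpt : ∀ x ∈ S, (c2/2*lam)^6 ≤ ‖∑ q ∈ Finset.range (2^(m*k)), V q x‖^6 := by
    rintro x ⟨h1, h2⟩
    refine pow_le_pow_left₀ (by positivity) ?_ 6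
    have e1 : ∑ q ∈ Finset.range (2^(m*k)), V q x = ((∑ q ∈ Finset.range (2^(m*k)), Wr (A+4) (es a v (arc X (m*k) q)) ((q:ℝ)/2^(m*k)) (1/2^(m*k)) b x : ℝ):ℂ)
      - ∑ q ∈ Finset.range (2^(m*k)), cvl (fun u : ℝ => mk3 (u*2^(m*k+m)) 0 0) kl (Wc (A+4) (es a v (arc X (m*k) q)) ((q:ℝ)/2^(m*k)) (1/2^(m*k)) b) x := by
      rw [Complex.ofReal_sum, ← Finset.sum_sub_distrib]
      refine Finset.sum_congr rfl fun q _ => ?_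
      rw [hV, ← Wc_eq]; rfl
    have e2 : c2 * GG (A+4) a v X (m*k) b x ≤ ∑ q ∈ Finset.range (2^(m*k)), Wr (A+4) (es a v (arc X (m*k) q)) ((q:ℝ)/2^(m*k)) (1/2^(m*k)) b x := by
      unfold GG
      rw [Finset.mul_sum]
      exact Finset.sum_le_sum fun q _ => (H2 _ (BM_es _ _ _) _ _ _ hb x).1
    have e3 : ‖∑ q ∈ Finset.range (2^(m*k)), cvl (fun u : ℝ => mk3 (u*2^(m*k+m)) 0 0) kl (Wc (A+4) (es a v (arc X (m*k) q)) ((q:ℝ)/2^(m*k)) (1/2^(m*k)) b) x‖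
        ≤ C1 * GG A a v X (m*k+m) b x := by
      unfold GG
      rw [← sum_chl, Finset.mul_sum]
      exact (norm_sum_le _ _).trans (Finset.sum_le_sum fun q _ => H1 a v X (m*k) m q b hb hX0 hv2 x)
    have e4 : C1 * GG A a v X (m*k+m) b x ≤ c2/2*GG (A+4) a v X (m*k) b x := by
      have g0 := GG_nonneg A a v X (m*k+m) hb x
      have : 2*C1/c2 * GG A a v X (m*k+m) b x ≤ GG (A+4) a v X (m*k) b x := by
        refine le_trans ?_ h2
        gcongr
        linarith
      calc C1 * GG A a v X (m*k+m) b x = c2/2*(2*C1/c2 * GG A a v X (m*k+m) b x) := by field_simp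
        _ ≤ _ := by gcongr
    have e5 := norm_sub_norm_le ((∑ q ∈ Finset.range (2^(m*k)), Wr (A+4) (es a v (arc X (m*k) q)) ((q:ℝ)/2^(m*k)) (1/2^(m*k)) b x : ℝ):ℂ)
      (∑ q ∈ Finset.range (2^(m*k)), cvl (fun u : ℝ => mk3 (u*2^(m*k+m)) 0 0) kl (Wc (A+4) (es a v (arc X (m*k) q)) ((q:ℝ)/2^(m*k)) (1/2^(m*k)) b) x)
    rw [← e1, Complex.norm_real] at e5
    have e6 := Real.le_norm_self (∑ q ∈ Finset.range (2^(m*k)), Wr (A+4) (es a v (arc X (m*k) q)) ((q:ℝ)/2^(m*k)) (1/2^(m*k)) b x)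
    have e7 := mul_le_mul_of_nonneg_left h1 (by positivity : 0 ≤ c2/2)
    linarith
  have hMk := mul_meas_ge_le_integral_of_nonneg (μ := win r z) (f := fun x => ‖∑ q ∈ Finset.range (2^(m*k)), V q x‖^6)
    (Filter.Eventually.of_forall fun x => by positivity) (hVB.int_pow1 6 (win r z)) ((c2/2*lam)^6)
  have hSle : (win r z).real S ≤ (win r z).real {x | (c2/2*lam)^6 ≤ ‖∑ q ∈ Finset.range (2^(m*k)), V q x‖^6} :=
    measureReal_mono hpt
  have h7 : (c2/2*lam)^6 * (win r z).real S ≤ _ := (mul_le_mul_of_nonneg_left hSle (by positivity)).trans (hMk.trans hmain)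
  rw [le_div_iff₀ (by positivity)]
  have hpow : ((2:ℝ)^((3+η)*m))^k * (N*δ+1)^(3+η) ≤ 2^(3+η) * N^(3+η) := by
    have h1 : ((2:ℝ)^((3+η)*m))^k = (2^(m*k))^(3+η) := by
      rw [← Real.rpow_natCast, ← Real.rpow_mul (by norm_num), ← Real.rpow_natCast, ← Real.rpow_mul (by norm_num)]
      push_cast; ring_nf
    have hp : 0 ≤ N*δ+1 := by rw [hNδ]; linarith
    rw [h1, ← Real.mul_rpow (by positivity) hp, ← Real.mul_rpow (by norm_num) hN.le]
    refine Real.rpow_le_rpow (by positivity) ?_ (by positivity)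
    calc (2:ℝ)^(m*k) * (N*δ+1) ≤ 2^(m*k) * (2*(N*δ)) := by rw [hNδ]; gcongr; linarith
      _ = 2*N := by rw [hδ]; field_simp
  have hC5C : C5 ≤ C := by rw [hC]; have : 0 ≤ 2*C1/c2 := by positivity
                           linarith
  have hKC : K ≤ C := by rw [hC]; have : 0 ≤ 2*C1/c2 := by positivity
                         linarith
  calc (win r z).real S * lam^6 = (2/c2)^6 * ((c2/2*lam)^6 * (win r z).real S) := by field_simp
    _ ≤ (2/c2)^6 * (C5^(k+1) * (2^m)^60 * (2^((3+η)*m))^k * (C3*D^3*(C4*(N*δ+1)^(3+η)))) := by gcongr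
    _ = (2/c2)^6*C3*C4*C5^(k+1)*(2^m)^60*D^3 * ((2^((3+η)*m))^k * (N*δ+1)^(3+η)) := by ring
    _ ≤ (2/c2)^6*C3*C4*C5^(k+1)*(2^m)^60*D^3 * (2^(3+η) * N^(3+η)) := by gcongr
    _ = C5^(k+1) * K * (2^m)^60 * N^(3+η) * (min b ((N/2^(m*k))^2))^3 := by rw [hK, hD]; ring
    _ ≤ C^(k+1) * C * (2^m)^60 * N^(3+η) * (min b ((N/2^(m*k))^2))^3 := by gcongr
    _ = _ := by ring

end High

theorem unif {P : ℕ → ℝ → Prop} (hm : ∀ j C C', C ≤ C' → P j C → P j C') (h : ∀ j, ∃ C, P j C) (n : ℕ) :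
    ∃ C : ℝ, 1 ≤ C ∧ ∀ j ≤ n, P j C := by
  choose c hc using h
  refine ⟨1 + ∑ j ∈ Finset.range (n+1), |c j|, ?_, ?_⟩
  · have : 0 ≤ ∑ j ∈ Finset.range (n+1), |c j| := Finset.sum_nonneg (fun _ _ => abs_nonneg _)
    linarith
  · intro j hj
    refine hm j _ _ ?_ (hc j)
    have := Finset.single_le_sum (f := fun j => |c j|) (fun i _ => abs_nonneg _) (Finset.mem_range.2 (by omega : j < n+1))
    have h2 := le_abs_self (c j)
    linarith

/-- wave envelope of the arc `q` at level `l` -/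
def HH (A : ℕ) (a : ℝ → ℂ) (v : ℝ → ℝ) (X : Finset ℝ) (l q : ℕ) (x : R3) : ℝ :=
  Hf A (es a v (arc X l q)) ((q:ℝ)/2^l) (1/2^l) x

theorem GG_eq (A : ℕ) (a : ℝ → ℂ) (v : ℝ → ℝ) (X : Finset ℝ) (l : ℕ) (b : ℝ) (x : R3) :
    GG A a v X l b x = ∑ q ∈ Finset.range (2^l), min (HH A a v X l q x) b := rfl

theorem HH_nonneg (A : ℕ) (a : ℝ → ℂ) (v : ℝ → ℝ) (X : Finset ℝ) (l q : ℕ) (x : R3) : 0 ≤ HH A a v X l q x :=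
  Hf_nonneg _ _ _ _ _

theorem HH_meas (A : ℕ) (a : ℝ → ℂ) (v : ℝ → ℝ) (X : Finset ℝ) (l q : ℕ) : Measurable (HH A a v X l q) :=
  Hf_meas (BM_es _ _ _) _ _ _

def cmv (A : ℕ) : ℝ := 2^A * 72^A
theorem cmv_one (A : ℕ) : 1 ≤ cmv A := by
  unfold cmv
  have h1 : (1:ℝ) ≤ 2^A := one_le_pow₀ (by norm_num)
  have h2 : (1:ℝ) ≤ 72^A := one_le_pow₀ (by norm_num)
  nlinarith

theorem jb_fbi_le {l q : ℕ} (hq : q ≤ 2^l) {w : R3} (hw : ‖w‖ ≤ 2^l) :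
    jb (fbi ((q:ℝ)/2^l) (1/2^l) w) ≤ 72 := by
  have h2 : (0:ℝ) < 2^l := by positivity
  have h1 : (1:ℝ) ≤ 2^l := one_le_pow₀ (by norm_num)
  have hq' : (q:ℝ) ≤ 2^l := by exact_mod_cast hq
  have := jb_fbi_smul (t := (q:ℝ)/2^l) (δ := 1/2^l) (by positivity) ((div_le_one h2).2 h1)
    (by rw [abs_of_nonneg (by positivity)]; exact (div_le_one h2).2 hq') w
  have h3 : jb ((1/2^l : ℝ) • w) ≤ 2 := by
    unfold jb
    rw [norm_smul, Real.norm_of_nonneg (by positivity)]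
    have : 1/2^l * ‖w‖ ≤ 1 := by rw [one_div, inv_mul_le_iff₀ h2]; linarith
    have h0 : 0 ≤ 1/2^l * ‖w‖ := by positivity
    nlinarith
  linarith

theorem HH_move {A : ℕ} (hA : 4 ≤ A) (a : ℝ → ℂ) (v : ℝ → ℝ) (X : Finset ℝ) {l q : ℕ} (hq : q ≤ 2^l) (x : R3) {w : R3}
    (hw : ‖w‖ ≤ 2^l) : HH A a v X l q (x + w) ≤ cmv A * HH A a v X l q x := by
  have h := Hf_sv (BM_es a v (arc X l q)) hA ((q:ℝ)/2^l) (1/2^l) x (fbi ((q:ℝ)/2^l) (1/2^l) w)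
  rw [fb_fbi _ (by positivity)] at h
  refine h.trans ?_
  unfold cmv
  have h72 := jb_fbi_le hq hw
  have h0 := jb_pos (fbi ((q:ℝ)/2^l) (1/2^l) w)
  have : jb (fbi ((q:ℝ)/2^l) (1/2^l) w)^A ≤ 72^A := pow_le_pow_left₀ h0.le h72 A
  have h3 := HH_nonneg A a v X l q x
  unfold HH at h3 ⊢
  gcongr

theorem GG_move {A : ℕ} (hA : 4 ≤ A) (a : ℝ → ℂ) (v : ℝ → ℝ) (X : Finset ℝ) {l : ℕ} {b : ℝ} (hb : 0 ≤ b) (x : R3) {w : R3}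
    (hw : ‖w‖ ≤ 2^l) : GG A a v X l b (x + w) ≤ cmv A * GG A a v X l b x := by
  rw [GG_eq, GG_eq, Finset.mul_sum]
  refine Finset.sum_le_sum (fun q hq => ?_)
  have hq' : q ≤ 2^l := (Finset.mem_range.1 hq).le
  exact (min_le_min_right b (HH_move hA a v X hq' x hw)).trans (min_mul_le (cmv_one A) hb)

theorem GG_par {A : ℕ} (hA : 4 ≤ A) : ∃ C : ℝ, ∀ C' : ℝ, C ≤ C' → ∀ (a : ℝ → ℂ) (v : ℝ → ℝ) (X : Finset ℝ) (l m : ℕ) (b : ℝ),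
    0 ≤ b → (∀ ξ ∈ X, 0 ≤ ξ) → (∀ ξ ∈ X, |v ξ| ≤ (1/2^(l+m))^2) → ∀ x,
    GG (A+4) a v X l b x ≤ C' * 2^m * GG A a v X (l+m) b x := by
  obtain ⟨C, hC, h⟩ := Hf_par hA
  refine ⟨max C 1, fun C' hC' a v X l m b hb hX hv x => ?_⟩
  have hC1 : 1 ≤ C' := (le_max_right _ _).trans hC'
  have hCC : C ≤ C' := (le_max_left _ _).trans hC'
  have h2m : (1:ℝ) ≤ 2^m := one_le_pow₀ (by norm_num)
  rw [GG_eq, GG_eq, ← sum_chl (fun q => min (HH A a v X (l+m) q x) b), Finset.mul_sum]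
  refine Finset.sum_le_sum (fun q hq => ?_)
  have h1 := h a v X l m q hX hv x
  have hs : 0 ≤ ∑ q' ∈ chl m q, HH A a v X (l+m) q' x := Finset.sum_nonneg (fun _ _ => HH_nonneg _ _ _ _ _ _ _)
  have h3 : HH (A+4) a v X l q x ≤ (C' * 2^m) * ∑ q' ∈ chl m q, HH A a v X (l+m) q' x := by
    refine h1.trans ?_
    have : C * 2^m ≤ C' * 2^m := by gcongr
    exact mul_le_mul_of_nonneg_right this hs
  refine (min_le_min_right b h3).trans ((min_mul_le (by nlinarith) hb).trans ?_)
  exact mul_le_mul_of_nonneg_left (min_sum_le _ _ (fun i => HH_nonneg _ _ _ _ _ _ _) hb) (by positivity)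

/-- sum over spiky arcs -/
def SS (A : ℕ) (a : ℝ → ℂ) (v : ℝ → ℝ) (X : Finset ℝ) (l : ℕ) (b : ℝ) (x : R3) : ℝ :=
  ∑ q ∈ Finset.range (2^l), if b < HH A a v X l q x then ‖es a v (arc X l q) x‖ else 0

theorem SS_step {A A' : ℕ} {C : ℝ} (hC : 0 < C) {a : ℝ → ℂ} {v : ℝ → ℝ} {X : Finset ℝ} {l m : ℕ} {b : ℝ}
    (hb : 0 < b) {x : R3} (hr : ∀ q, ‖es a v (arc X (l+m) q) x‖^2 ≤ C * HH A a v X (l+m) q x) :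
    SS A' a v X l b x ≤ SS A a v X (l+m) b x + GG A' a v X l b x / b * 2^m * √(C*b) := by
  unfold SS
  rw [← sum_chl (fun q => if b < HH A a v X (l+m) q x then ‖es a v (arc X (l+m) q) x‖ else 0), GG_eq,
    Finset.sum_div, Finset.sum_mul, Finset.sum_mul, ← Finset.sum_add_distrib]
  refine Finset.sum_le_sum (fun q hq => ?_)
  have hs : ∀ q' ∈ chl m q, ‖es a v (arc X (l+m) q') x‖ ≤
      (if b < HH A a v X (l+m) q' x then ‖es a v (arc X (l+m) q') x‖ else 0) + √(C*b) := by
    intro q' _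
    split_ifs with h
    · linarith [Real.sqrt_nonneg (C*b)]
    · rw [zero_add]
      refine Real.le_sqrt_of_sq_le ((hr q').trans ?_)
      push Not at h
      gcongr
  have h0 : 0 ≤ ∑ q' ∈ chl m q, (if b < HH A a v X (l+m) q' x then ‖es a v (arc X (l+m) q') x‖ else 0) := by
    refine Finset.sum_nonneg (fun q' _ => ?_)
    split_ifs
    · exact norm_nonneg _
    · exact le_rfl
  split_ifs with h
  · rw [min_eq_right h.le, div_self hb.ne', one_mul, es_split a v X l m q x]
    refine (norm_sum_le _ _).trans ((Finset.sum_le_sum hs).trans ?_)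
    rw [Finset.sum_add_distrib, Finset.sum_const, chl_card, nsmul_eq_mul]
    push_cast
    exact le_rfl
  · have h3 := HH_nonneg A' a v X l q x
    have : 0 ≤ min (HH A' a v X l q x) b := le_min h3 hb.le
    positivity

/-- level parameter -/
def Al (n k : ℕ) : ℕ := 4*(n-k)+4

theorem Al_four (n k : ℕ) : 4 ≤ Al n k := by unfold Al; omega
theorem Al_succ {n k : ℕ} (h : k < n) : Al n k = Al n (k+1) + 4 := by unfold Al; omega

theorem tree {C : ℝ} (hC : 0 < C) {a : ℝ → ℂ} {v : ℝ → ℝ} {X : Finset ℝ} {m n : ℕ} {b T : ℝ}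
    (hb : 0 < b) {x : R3} (hr : ∀ k ≤ n, ∀ q, ‖es a v (arc X (m*k) q) x‖^2 ≤ C * HH (Al n k) a v X (m*k) q x)
    (hend : ∀ q, HH (Al n n) a v X (m*n) q x ≤ b) :
    ∀ j ≤ n, (∀ i, n - j ≤ i → i ≤ n → GG (Al n i) a v X (m*i) b x ≤ T) →
    SS (Al n (n-j)) a v X (m*(n-j)) b x ≤ j * (T / b * 2^m * √(C*b)) := by
  intro j
  induction j with
  | zero =>
    intro _ _
    simp only [Nat.sub_zero, Nat.cast_zero, zero_mul]
    unfold SS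
    refine Finset.sum_nonpos (fun q _ => ?_)
    rw [if_neg (not_lt.2 (hend q))]
  | succ j ih =>
    intro hj h
    have h1 := ih (by omega) (fun i hi => h i (by omega))
    have e1 : n - (j+1) + 1 = n - j := by omega
    have h2 := SS_step (A := Al n (n-j)) (A' := Al n (n-(j+1))) (l := m*(n-(j+1))) (m := m) (x := x) (v := v) (a := a) (X := X) hC hb
      (by
        intro q
        have := hr (n-j) (by omega) q
        rw [← e1] at this ⊢
        exact this)
    have e2 : m*(n-(j+1)) + m = m*(n-j) := by rw [← e1]; ring
    rw [e2] at h2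
    have h3 := h (n-(j+1)) le_rfl (by omega)
    have h4 : GG (Al n (n-(j+1))) a v X (m*(n-(j+1))) b x / b * 2^m * √(C*b) ≤ T / b * 2^m * √(C*b) := by gcongr
    push_cast
    linarith

theorem tv_aux {d w g : ℝ} (hg : 0 ≤ g) (h : (0 ≤ d ∧ g ≤ w) ∨ (d ≤ 0 ∧ w ≤ -g)) : g * |d| ≤ w * d := by
  rcases h with ⟨h1, h2⟩ | ⟨h1, h2⟩
  · rw [abs_of_nonneg h1]; gcongr
  · rw [abs_of_nonpos h1]; nlinarith

theorem tv_sum {x1 x2 x3 y1 y2 y3 g σ c0 c1 c2 : ℝ} (hg : 0 < g)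
    (h1 : |(x1-y1)+(x2-y2)+(x3-y3)| ≤ σ) (h2 : |(x1^2-y1^2)+(x2^2-y2^2)+(x3^2-y3^2)| ≤ 7*σ)
    (h3 : |(x1^3-y1^3)+(x2^3-y2^3)+(x3^3-y3^3)| ≤ 19*σ) (hc0 : |c0| ≤ 1) (hc1 : |c1| ≤ 2) (hc2 : |c2| ≤ 1)
    (k1 : g*|x1-y1| ≤ (c0 + c1*(x1+y1)/2 + c2*(x1^2+x1*y1+y1^2)/3) * (x1-y1))
    (k2 : g*|x2-y2| ≤ (c0 + c1*(x2+y2)/2 + c2*(x2^2+x2*y2+y2^2)/3) * (x2-y2))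
    (k3 : g*|x3-y3| ≤ (c0 + c1*(x3+y3)/2 + c2*(x3^2+x3*y3+y3^2)/3) * (x3-y3)) :
    g*|x1-y1| ≤ 15*σ ∧ g*|x2-y2| ≤ 15*σ ∧ g*|x3-y3| ≤ 15*σ := by
  have hs : 0 ≤ σ := (abs_nonneg _).trans h1
  have b0 : c0 * ((x1-y1)+(x2-y2)+(x3-y3)) ≤ 1*σ := by
    refine (le_abs_self _).trans ?_
    rw [abs_mul]; gcongr
  have b1 : c1 * ((x1^2-y1^2)+(x2^2-y2^2)+(x3^2-y3^2)) ≤ 2*(7*σ) := by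
    refine (le_abs_self _).trans ?_
    rw [abs_mul]; gcongr
  have b2 : c2 * ((x1^3-y1^3)+(x2^3-y2^3)+(x3^3-y3^3)) ≤ 1*(19*σ) := by
    refine (le_abs_self _).trans ?_
    rw [abs_mul]; gcongr
  have e1 : 0 ≤ g*|x1-y1| := by positivity
  have e2 : 0 ≤ g*|x2-y2| := by positivity
  have e3 : 0 ≤ g*|x3-y3| := by positivity
  have key : g*|x1-y1| + g*|x2-y2| + g*|x3-y3| ≤ 15*σ := by
    have : (c0 + c1*(x1+y1)/2 + c2*(x1^2+x1*y1+y1^2)/3) * (x1-y1) + (c0 + c1*(x2+y2)/2 + c2*(x2^2+x2*y2+y2^2)/3) * (x2-y2)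
      + (c0 + c1*(x3+y3)/2 + c2*(x3^2+x3*y3+y3^2)/3) * (x3-y3) = c0 * ((x1-y1)+(x2-y2)+(x3-y3)) +
      c1 * ((x1^2-y1^2)+(x2^2-y2^2)+(x3^2-y3^2))/2 + c2 * ((x1^3-y1^3)+(x2^3-y2^3)+(x3^3-y3^3))/3 := by ring
    linarith
  exact ⟨by linarith, by linarith, by linarith⟩

/-- transversality -/
theorem tv {x1 x2 x3 y1 y2 y3 g σ r1 r2 : ℝ} (hg : 0 < g) (hg1 : g ≤ 1) (hr1 : 0 ≤ r1) (hr1' : r1 ≤ 1) (hr2 : 0 ≤ r2)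
    (hr2' : r2 ≤ 1)
    (a1 : x1 ≤ r1 - g) (b1 : y1 ≤ r1 - g) (a2 : r1 + g ≤ x2) (b2 : r1 + g ≤ y2) (a2' : x2 ≤ r2 - g) (b2' : y2 ≤ r2 - g)
    (a3 : r2 + g ≤ x3) (b3 : r2 + g ≤ y3)
    (h1 : |(x1-y1)+(x2-y2)+(x3-y3)| ≤ σ) (h2 : |(x1^2-y1^2)+(x2^2-y2^2)+(x3^2-y3^2)| ≤ 7*σ)
    (h3 : |(x1^3-y1^3)+(x2^3-y2^3)+(x3^3-y3^3)| ≤ 19*σ) :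
    g^2*|x1-y1| ≤ 15*σ ∧ g^2*|x2-y2| ≤ 15*σ ∧ g^2*|x3-y3| ≤ 15*σ := by
  have hgg : g^2 ≤ g := by nlinarith
  have hg2 : 0 < g^2 := by positivity
  have q1 : g^2 ≤ r1*r2 + -(r1+r2)*(x1+y1)/2 + 1*(x1^2+x1*y1+y1^2)/3 := by
    have : r1*r2 + -(r1+r2)*(x1+y1)/2 + 1*(x1^2+x1*y1+y1^2)/3 =
      ((r1-x1)^2 + (r1-x1)*(r1-y1) + (r1-y1)^2)/3 + (r2-r1)*((r1-x1)+(r1-y1))/2 := by ring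
    rw [this]
    have i1 : g*g ≤ (r1-x1)*(r1-x1) := mul_le_mul (by linarith) (by linarith) hg.le (by linarith)
    have i2 : g*g ≤ (r1-x1)*(r1-y1) := mul_le_mul (by linarith) (by linarith) hg.le (by linarith)
    have i3 : g*g ≤ (r1-y1)*(r1-y1) := mul_le_mul (by linarith) (by linarith) hg.le (by linarith)
    have i4 : 0 ≤ (r2-r1)*((r1-x1)+(r1-y1)) := mul_nonneg (by linarith) (by linarith)
    nlinarith only [i1, i2, i3, i4]
  have q3 : g^2 ≤ r1*r2 + -(r1+r2)*(x3+y3)/2 + 1*(x3^2+x3*y3+y3^2)/3 := by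
    have : r1*r2 + -(r1+r2)*(x3+y3)/2 + 1*(x3^2+x3*y3+y3^2)/3 =
      ((x3-r2)^2 + (x3-r2)*(y3-r2) + (y3-r2)^2)/3 + (r2-r1)*((x3-r2)+(y3-r2))/2 := by ring
    rw [this]
    have i1 : g*g ≤ (x3-r2)*(x3-r2) := mul_le_mul (by linarith) (by linarith) hg.le (by linarith)
    have i2 : g*g ≤ (x3-r2)*(y3-r2) := mul_le_mul (by linarith) (by linarith) hg.le (by linarith)
    have i3 : g*g ≤ (y3-r2)*(y3-r2) := mul_le_mul (by linarith) (by linarith) hg.le (by linarith)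
    have i4 : 0 ≤ (r2-r1)*((x3-r2)+(y3-r2)) := mul_nonneg (by linarith) (by linarith)
    nlinarith only [i1, i2, i3, i4]
  have q2 : r1*r2 + -(r1+r2)*(x2+y2)/2 + 1*(x2^2+x2*y2+y2^2)/3 ≤ -g^2 := by
    have : r1*r2 + -(r1+r2)*(x2+y2)/2 + 1*(x2^2+x2*y2+y2^2)/3 =
      -((2*((x2-r1)*(r2-x2)) + 2*((y2-r1)*(r2-y2)) + (x2-r1)*(r2-y2) + (y2-r1)*(r2-x2))/6) := by ring
    rw [this]
    have i1 : g*g ≤ (x2-r1)*(r2-x2) := mul_le_mul (by linarith) (by linarith) hg.le (by linarith)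
    have i2 : g*g ≤ (y2-r1)*(r2-y2) := mul_le_mul (by linarith) (by linarith) hg.le (by linarith)
    have i3 : g*g ≤ (x2-r1)*(r2-y2) := mul_le_mul (by linarith) (by linarith) hg.le (by linarith)
    have i4 : g*g ≤ (y2-r1)*(r2-x2) := mul_le_mul (by linarith) (by linarith) hg.le (by linarith)
    nlinarith only [i1, i2, i3, i4]
  have o1 : |r1*r2| ≤ 1 := by rw [abs_of_nonneg (by positivity)]; nlinarith
  have o2 : |-(r1*r2)| ≤ 1 := by rw [abs_neg]; exact o1
  have o3 : |-(r1+r2)| ≤ 2 := by rw [abs_neg, abs_of_nonneg (by positivity)]; linarith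
  have o4 : |r1+r2| ≤ 2 := by rw [abs_of_nonneg (by positivity)]; linarith
  have o5 : |r1| ≤ 1 := by rw [abs_of_nonneg (by positivity)]; linarith
  have o6 : |r2| ≤ 1 := by rw [abs_of_nonneg (by positivity)]; linarith
  have o7 : |-r1| ≤ 1 := by rwa [abs_neg]
  have o8 : |-r2| ≤ 1 := by rwa [abs_neg]
  rcases le_total 0 (x1-y1) with d1 | d1 <;> rcases le_total 0 (x2-y2) with d2 | d2 <;> rcases le_total 0 (x3-y3) with d3 | d3
  · exact tv_sum hg2 h1 h2 h3 (c0 := 1) (c1 := 0) (c2 := 0) (by norm_num) (by norm_num) (by norm_num)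
      (tv_aux hg2.le (Or.inl ⟨d1, by linarith⟩)) (tv_aux hg2.le (Or.inl ⟨d2, by linarith⟩)) (tv_aux hg2.le (Or.inl ⟨d3, by linarith⟩))
  · exact tv_sum hg2 h1 h2 h3 (c0 := r2) (c1 := -1) (c2 := 0) o6 (by norm_num) (by norm_num)
      (tv_aux hg2.le (Or.inl ⟨d1, by linarith⟩)) (tv_aux hg2.le (Or.inl ⟨d2, by linarith⟩)) (tv_aux hg2.le (Or.inr ⟨d3, by linarith⟩))
  · exact tv_sum hg2 h1 h2 h3 (c0 := r1*r2) (c1 := -(r1+r2)) (c2 := 1) o1 o3 (by norm_num)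
      (tv_aux hg2.le (Or.inl ⟨d1, by linarith⟩)) (tv_aux hg2.le (Or.inr ⟨d2, by linarith⟩)) (tv_aux hg2.le (Or.inl ⟨d3, by linarith⟩))
  · exact tv_sum hg2 h1 h2 h3 (c0 := r1) (c1 := -1) (c2 := 0) o5 (by norm_num) (by norm_num)
      (tv_aux hg2.le (Or.inl ⟨d1, by linarith⟩)) (tv_aux hg2.le (Or.inr ⟨d2, by linarith⟩)) (tv_aux hg2.le (Or.inr ⟨d3, by linarith⟩))
  · exact tv_sum hg2 h1 h2 h3 (c0 := -r1) (c1 := 1) (c2 := 0) o7 (by norm_num) (by norm_num)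
      (tv_aux hg2.le (Or.inr ⟨d1, by linarith⟩)) (tv_aux hg2.le (Or.inl ⟨d2, by linarith⟩)) (tv_aux hg2.le (Or.inl ⟨d3, by linarith⟩))
  · exact tv_sum hg2 h1 h2 h3 (c0 := -(r1*r2)) (c1 := r1+r2) (c2 := -1) o2 o4 (by norm_num)
      (tv_aux hg2.le (Or.inr ⟨d1, by linarith⟩)) (tv_aux hg2.le (Or.inl ⟨d2, by linarith⟩)) (tv_aux hg2.le (Or.inr ⟨d3, by linarith⟩))
  · exact tv_sum hg2 h1 h2 h3 (c0 := -r2) (c1 := 1) (c2 := 0) o8 (by norm_num) (by norm_num)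
      (tv_aux hg2.le (Or.inr ⟨d1, by linarith⟩)) (tv_aux hg2.le (Or.inr ⟨d2, by linarith⟩)) (tv_aux hg2.le (Or.inl ⟨d3, by linarith⟩))
  · exact tv_sum hg2 h1 h2 h3 (c0 := -1) (c1 := 0) (c2 := 0) (by norm_num) (by norm_num) (by norm_num)
      (tv_aux hg2.le (Or.inr ⟨d1, by linarith⟩)) (tv_aux hg2.le (Or.inr ⟨d2, by linarith⟩)) (tv_aux hg2.le (Or.inr ⟨d3, by linarith⟩))

theorem tv_om {v : ℝ → ℝ} {x1 x2 x3 y1 y2 y3 g σ r1 r2 : ℝ} (hg : 0 < g) (hg1 : g ≤ 1) (hr1 : 0 ≤ r1) (hr1' : r1 ≤ 1) (hr2 : 0 ≤ r2)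
    (hr2' : r2 ≤ 1) (hσ : ∀ t ∈ ({x1, x2, x3, y1, y2, y3} : Set ℝ), |v t| ≤ σ ∧ 0 ≤ t ∧ t ≤ 1)
    (a1 : x1 ≤ r1 - g) (b1 : y1 ≤ r1 - g) (a2 : r1 + g ≤ x2) (b2 : r1 + g ≤ y2) (a2' : x2 ≤ r2 - g) (b2' : y2 ≤ r2 - g)
    (a3 : r2 + g ≤ x3) (b3 : r2 + g ≤ y3)
    (h : ‖om v x1 + om v x2 + om v x3 - om v y1 - om v y2 - om v y3‖ ≤ σ) :
    g^2*|x1-y1| ≤ 15*σ ∧ g^2*|x2-y2| ≤ 15*σ ∧ g^2*|x3-y3| ≤ 15*σ := by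
  have n0 := (abs_le_norm3 _ 0).trans h
  have n1 := (abs_le_norm3 _ 1).trans h
  have n2 := (abs_le_norm3 _ 2).trans h
  simp only [PiLp.add_apply, PiLp.sub_apply, om, mk3_0, mk3_1, mk3_2] at n0 n1 n2
  have w1 := abs_le.1 (hσ x1 (by simp)).1
  have w2 := abs_le.1 (hσ x2 (by simp)).1
  have w3 := abs_le.1 (hσ x3 (by simp)).1
  have w4 := abs_le.1 (hσ y1 (by simp)).1
  have w5 := abs_le.1 (hσ y2 (by simp)).1
  have w6 := abs_le.1 (hσ y3 (by simp)).1
  have hm : ∀ t ∈ ({x1, x2, x3, y1, y2, y3} : Set ℝ), -σ ≤ t * v t ∧ t * v t ≤ σ := by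
    intro t ht
    obtain ⟨k1, k2, k3⟩ := hσ t ht
    rw [← abs_le, abs_mul, abs_of_nonneg k2]
    nlinarith [abs_nonneg (v t)]
  have u1 := hm x1 (by simp)
  have u2 := hm x2 (by simp)
  have u3 := hm x3 (by simp)
  have u4 := hm y1 (by simp)
  have u5 := hm y2 (by simp)
  have u6 := hm y3 (by simp)
  rw [abs_le] at n0 n1 n2
  refine tv hg hg1 hr1 hr1' hr2 hr2' a1 b1 a2 b2 a2' b2' a3 b3 ?_ ?_ ?_
  · rw [abs_le]; constructor <;> linarith
  · rw [abs_le]; constructor <;> linarith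
  · rw [abs_le]; constructor <;> linarith

/-- weighted measure around `x` at scale `L` -/
def k3 (a : ℕ) : Measure R3 := volume.withDensity (fun u => ENNReal.ofReal (kap3 a u))
instance (a : ℕ) : IsFiniteMeasure (k3 a) := by
  unfold k3
  exact isFiniteMeasure_withDensity_ofReal (kap3_int0 a).2
theorem k3_int {F : Type} [NormedAddCommGroup F] [NormedSpace ℝ F] (a : ℕ) (f : R3 → F) :
    ∫ s, f s ∂k3 a = ∫ s, kap3 a s • f s := by
  unfold k3
  rw [integral_withDensity_eq_integral_toReal_smul]
  · refine integral_congr_ae (Filter.Eventually.of_forall fun s => ?_)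
    simp only
    rw [ENNReal.toReal_ofReal (kap3_pos a s).le]
  · exact (kap3_meas a).ennreal_ofReal
  · exact Filter.Eventually.of_forall fun s => ENNReal.ofReal_lt_top

def wk (a : ℕ) (L : ℝ) (x : R3) : Measure R3 := (k3 a).map (fun u => x + L • u)
theorem wk_meas (L : ℝ) (x : R3) : Measurable (fun u : R3 => x + L • u) := by fun_prop
instance (a : ℕ) (L : ℝ) (x : R3) : IsFiniteMeasure (wk a L x) := by unfold wk; infer_instance
theorem wk_int {F : Type} [NormedAddCommGroup F] [NormedSpace ℝ F] (a : ℕ) (L : ℝ) (x : R3) (f : R3 → F) (hf : StronglyMeasurable f) :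
    ∫ y, f y ∂wk a L x = ∫ u, kap3 a u • f (x + L • u) := by
  unfold wk
  rw [integral_map (wk_meas L x).aemeasurable hf.aestronglyMeasurable, k3_int]

theorem wk_ft (a : ℕ) {L : ℝ} (hL : 0 ≤ L) (x ζ : R3) (h : 1 ≤ L * ‖ζ‖) : ∫ y, e (inner ℝ ζ y) ∂wk a L x = 0 := by
  rw [wk_int a L x (fun y => e (inner ℝ ζ y)) (continuous_e.comp (by fun_prop)).stronglyMeasurable]
  obtain ⟨c, C, _, _, _, _, _, h0⟩ := kap3_spec a
  have h1 := h0 (-(L • ζ)) (by rw [norm_neg, norm_smul, Real.norm_of_nonneg hL]; exact h)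
  have : ∀ u, kap3 a u • e (inner ℝ ζ (x + L • u)) = e (inner ℝ ζ x) * ((kap3 a u : ℂ) * e (-(inner ℝ (-(L • ζ)) u))) := by
    intro u
    rw [inner_add_right, e_add, inner_neg_left, neg_neg, real_inner_smul_left, real_inner_smul_right, Complex.real_smul]
    ring
  simp_rw [this]
  rw [integral_const_mul, h1, mul_zero]

theorem es_Sp (a : ℝ → ℂ) (v : ℝ → ℝ) (s : Finset ℝ) : Sp (es a v s) {ζ | ∃ ξ ∈ s, ζ = om v ξ} := by
  intro Ω _ μ _ Y g hY hg hi h0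
  unfold es
  simp_rw [Finset.mul_sum]
  have i1 : ∀ ξ, Integrable (fun w => g w * (a ξ * e (inner ℝ (om v ξ) (Y w)))) μ := by
    intro ξ
    have := (integrable_mul_BM hi (BM_e hY (om v ξ))).const_mul (a ξ)
    refine this.congr (Filter.Eventually.of_forall fun w => ?_)
    simp only; ring
  rw [integral_finsetSum _ fun ξ _ => i1 ξ]
  refine Finset.sum_eq_zero fun ξ hξ => ?_
  have : ∀ w, g w * (a ξ * e (inner ℝ (om v ξ) (Y w))) = a ξ * (g w * e (inner ℝ (om v ξ) (Y w))) := fun w => by ring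
  simp_rw [this]
  rw [integral_const_mul, h0 _ ⟨ξ, hξ, rfl⟩, mul_zero]

theorem arc16 {X : Finset ℝ} (hX : ∀ ξ ∈ X, 0 ≤ ξ) {l q p : ℕ} (hl : 16 ≤ l) (hq : q / 2^(l-16) = p) {ξ : ℝ}
    (h : ξ ∈ arc X l q) : (p:ℝ)/2^16 ≤ ξ ∧ ξ ≤ ((p:ℝ)+1)/2^16 := by
  unfold arc at h
  rw [Finset.mem_filter] at h
  have h1 := dix_div ξ 16 (l-16)
  rw [show 16 + (l-16) = l by omega, h.2, hq] at h1
  have h2 := dix_bounds (hX ξ h.1) 16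
  rw [← h1] at h2
  constructor
  · rw [div_le_iff₀ (by positivity)]; linarith [h2.1]
  · rw [le_div_iff₀ (by positivity)]; linarith [h2.2]

theorem q_close {X : Finset ℝ} (hX : ∀ ξ ∈ X, 0 ≤ ξ) {l q q' : ℕ} {ξ η : ℝ} (h : ξ ∈ arc X l q) (h' : η ∈ arc X l q')
    (hc : (1/2^17:ℝ)^2*|ξ-η| ≤ 15*(1/2^l)) : q ≤ q' + 2^38 ∧ q' ≤ q + 2^38 := by
  unfold arc at h h'
  rw [Finset.mem_filter] at h h'
  have h2 := dix_bounds (hX ξ h.1) l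
  have h3 := dix_bounds (hX η h'.1) l
  rw [h.2] at h2
  rw [h'.2] at h3
  have hp : (0:ℝ) < 2^l := by positivity
  have h4 : 2^l*|ξ-η| ≤ 15*2^34 := by
    have : (2^34*2^l)*((1/2^17:ℝ)^2*|ξ-η|) ≤ (2^34*2^l)*(15*(1/2^l)) := by gcongr
    have e1 : (2^34*2^l)*((1/2^17:ℝ)^2*|ξ-η|) = 2^l*|ξ-η| := by ring
    have e2 : (2^34*2^l)*(15*(1/2^l) : ℝ) = 15*2^34 := by field_simp
    rw [e1, e2] at this; exact this
  rw [← abs_of_pos hp, ← abs_mul, abs_le] at h4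
  constructor
  · have : (q:ℝ) ≤ q' + 2^38 := by nlinarith only [h2.1, h3.2, h4.2]
    exact_mod_cast this
  · have : (q':ℝ) ≤ q + 2^38 := by nlinarith only [h2.2, h3.1, h4.1]
    exact_mod_cast this

def rel3 (i j : ℕ × ℕ × ℕ) : Prop := (i.1 ≤ j.1 + 2^38 ∧ j.1 ≤ i.1 + 2^38) ∧ (i.2.1 ≤ j.2.1 + 2^38 ∧ j.2.1 ≤ i.2.1 + 2^38) ∧
  (i.2.2 ≤ j.2.2 + 2^38 ∧ j.2.2 ≤ i.2.2 + 2^38)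
instance : DecidableRel rel3 := fun i j => by unfold rel3; infer_instance

theorem rel3_card (s : Finset (ℕ × ℕ × ℕ)) (i : ℕ × ℕ × ℕ) : (s.filter (rel3 i)).card ≤ (2^40)^3 := by
  have hsub : s.filter (rel3 i) ⊆ (Finset.Icc (i.1 - 2^38) (i.1 + 2^38)) ×ˢ ((Finset.Icc (i.2.1 - 2^38) (i.2.1 + 2^38)) ×ˢ
      (Finset.Icc (i.2.2 - 2^38) (i.2.2 + 2^38))) := by
    intro j hj
    have := (Finset.mem_filter.1 hj).2
    unfold rel3 at this
    simp only [Finset.mem_product, Finset.mem_Icc]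
    omega
  have hc : ∀ k : ℕ, (Finset.Icc (k - 2^38) (k + 2^38)).card ≤ 2^40 := by
    intro k; rw [Nat.card_Icc]; omega
  refine (Finset.card_le_card hsub).trans ?_
  rw [Finset.card_product, Finset.card_product]
  exact (Nat.mul_le_mul (hc _) (Nat.mul_le_mul (hc _) (hc _))).trans (by norm_num)

set_option maxHeartbeats 1000000 in
theorem trilin_orth {a : ℝ → ℂ} {v : ℝ → ℝ} {X : Finset ℝ} {l : ℕ} (hl : 16 ≤ l) (hX : ∀ ξ ∈ X, 0 ≤ ξ ∧ ξ < 1)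
    (hv : ∀ ξ ∈ X, |v ξ| ≤ (1/2^l)^2) {p1 p2 p3 : ℕ} (h12 : p1 + 1 < p2) (h23 : p2 + 1 < p3) (B : ℕ) (x : R3)
    {q1 q2 q3 q1' q2' q3' : ℕ} (e1 : q1/2^(l-16) = p1) (e2 : q2/2^(l-16) = p2) (e3 : q3/2^(l-16) = p3)
    (e1' : q1'/2^(l-16) = p1) (e2' : q2'/2^(l-16) = p2) (e3' : q3'/2^(l-16) = p3)
    (hr : ¬ rel3 (q1,q2,q3) (q1',q2',q3')) :
    six (wk B (2^l) x) (es a v (arc X l q1)) (es a v (arc X l q2)) (es a v (arc X l q3)) (es a v (arc X l q1'))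
      (es a v (arc X l q2')) (es a v (arc X l q3')) = 0 := by
  have hX0 : ∀ ξ ∈ X, 0 ≤ ξ := fun ξ h => (hX ξ h).1
  have hp : (0:ℝ) < 2^l := by positivity
  have hp1 : (1:ℝ) ≤ 2^l := one_le_pow₀ (by norm_num)
  refine six_Sp _ (BM_es _ _ _) (BM_es _ _ _) (BM_es _ _ _) (BM_es _ _ _) (BM_es _ _ _) (es_Sp _ _ _) (es_Sp _ _ _) (es_Sp _ _ _)
    (es_Sp _ _ _) (es_Sp _ _ _) (es_Sp _ _ _) ?_
  rintro z1 ⟨x1, m1, rfl⟩ z2 ⟨x2, m2, rfl⟩ z3 ⟨x3, m3, rfl⟩ z4 ⟨y1, n1, rfl⟩ z5 ⟨y2, n2, rfl⟩ z6 ⟨y3, n3, rfl⟩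
  by_contra hne
  have hz : ‖om v x1 + om v x2 + om v x3 - om v y1 - om v y2 - om v y3‖ ≤ 1/2^l := by
    by_contra hc
    push Not at hc
    refine hne (wk_ft B hp.le x _ ?_)
    rw [div_lt_iff₀ hp] at hc
    linarith
  have hσ : ∀ t ∈ ({x1, x2, x3, y1, y2, y3} : Set ℝ), |v t| ≤ 1/2^l ∧ 0 ≤ t ∧ t ≤ 1 := by
    intro t ht
    have htX : t ∈ X := by
      simp only [Set.mem_insert_iff, Set.mem_singleton_iff] at ht
      rcases ht with rfl | rfl | rfl | rfl | rfl | rfl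
      exacts [arc_sub _ _ _ m1, arc_sub _ _ _ m2, arc_sub _ _ _ m3, arc_sub _ _ _ n1, arc_sub _ _ _ n2, arc_sub _ _ _ n3]
    refine ⟨(hv t htX).trans ?_, (hX t htX).1, (hX t htX).2.le⟩
    have h1 : (1/2^l:ℝ) ≤ 1 := (div_le_one hp).2 hp1
    have h0 : (0:ℝ) ≤ 1/2^l := by positivity
    nlinarith
  have a1 := arc16 hX0 hl e1 m1
  have a2 := arc16 hX0 hl e2 m2
  have a3 := arc16 hX0 hl e3 m3
  have b1 := arc16 hX0 hl e1' n1
  have b2 := arc16 hX0 hl e2' n2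
  have b3 := arc16 hX0 hl e3' n3
  have c12 : (p1:ℝ) + 2 ≤ p2 := by exact_mod_cast h12
  have c23 : (p2:ℝ) + 2 ≤ p3 := by exact_mod_cast h23
  have cp1 : (0:ℝ) ≤ p1 := Nat.cast_nonneg _
  have cx3 := (hσ x3 (by simp)).2.2
  have ht := tv_om (v := v) (g := 1/2^17) (σ := 1/2^l) (r1 := (p2:ℝ)/2^16 - 1/2^17) (r2 := (p3:ℝ)/2^16 - 1/2^17)
    (by positivity) (by norm_num) (by linarith) (by linarith) (by linarith) (by linarith) hσ
    (by linarith) (by linarith) (by linarith) (by linarith) (by linarith) (by linarith) (by linarith) (by linarith) hz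
  exact hr ⟨q_close hX0 m1 n1 ht.1, q_close hX0 m2 n2 ht.2.1, q_close hX0 m3 n3 ht.2.2⟩

set_option maxHeartbeats 1000000 in
theorem trilin {A : ℕ} (hA : 4 ≤ A) : ∃ C : ℝ, 0 < C ∧ ∀ (a : ℝ → ℂ) (v : ℝ → ℝ) (X : Finset ℝ) (l : ℕ), 16 ≤ l →
    (∀ ξ ∈ X, 0 ≤ ξ ∧ ξ < 1) → (∀ ξ ∈ X, |v ξ| ≤ (1/2^l)^2) → ∀ p1 p2 p3 : ℕ, p1 + 1 < p2 → p2 + 1 < p3 →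
    ∀ s1 s2 s3 : Finset ℕ, (∀ q ∈ s1, q/2^(l-16) = p1 ∧ q ≤ 2^l) → (∀ q ∈ s2, q/2^(l-16) = p2 ∧ q ≤ 2^l) →
    (∀ q ∈ s3, q/2^(l-16) = p3 ∧ q ≤ 2^l) → ∀ x,
    ∫ y, ‖(∑ q ∈ s1, es a v (arc X l q) y) * (∑ q ∈ s2, es a v (arc X l q) y) * (∑ q ∈ s3, es a v (arc X l q) y)‖^2
      ∂wk (3*A) (2^l) x ≤
    C * ((∑ q ∈ s1, HH A a v X l q x) * (∑ q ∈ s2, HH A a v X l q x) * (∑ q ∈ s3, HH A a v X l q x)) := by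
  obtain ⟨C, hC, h⟩ := Hf_ptw hA
  set I := ∫ u : R3, kap3 (3*A) u * (jb u)^(3*A) with hI
  have hI0 : 0 ≤ I := integral_nonneg fun u => mul_nonneg (kap3_pos _ u).le (jb_pow_pos u _).le
  refine ⟨(2^40)^3 * ((C*36^A)^3 * I) + 1, by positivity, ?_⟩
  intro a v X l hl hX hv p1 p2 p3 h12 h23 s1 s2 s3 hs1 hs2 hs3 x
  have hp : (0:ℝ) < 2^l := by positivity
  have hp1 : (1:ℝ) ≤ 2^l := one_le_pow₀ (by norm_num)
  set f : ℕ → R3 → ℂ := fun q => es a v (arc X l q) with hf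
  have hfB : ∀ q, BM (f q) := fun q => BM_es _ _ _
  set g : ℕ × ℕ × ℕ → R3 → ℂ := fun i y => f i.1 y * (f i.2.1 y * f i.2.2 y) with hg
  have hgB : ∀ i, BM (g i) := fun i => (hfB _).mul ((hfB _).mul (hfB _))
  have e1 : ∀ y, (∑ q ∈ s1, es a v (arc X l q) y) * (∑ q ∈ s2, es a v (arc X l q) y) * (∑ q ∈ s3, es a v (arc X l q) y) =
      ∑ i ∈ s1 ×ˢ (s2 ×ˢ s3), g i y := by
    intro y
    rw [Finset.sum_product, mul_assoc, Finset.sum_mul]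
    refine Finset.sum_congr rfl fun q1 _ => ?_
    rw [Finset.sum_product, Finset.sum_mul_sum, Finset.mul_sum]
    refine Finset.sum_congr rfl fun q2 _ => ?_
    rw [Finset.mul_sum]
  simp_rw [e1]
  have ho := orth_bd (μ := wk (3*A) (2^l) x) (s1 ×ˢ (s2 ×ˢ s3)) g hgB rel3 ((2^40)^3)
    (fun i j hij => by unfold rel3 at hij ⊢; omega) (fun i _ => rel3_card _ i)
    (by
      rintro ⟨q1, q2, q3⟩ hi ⟨q1', q2', q3'⟩ hj hr
      simp only [Finset.mem_product] at hi hj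
      have := trilin_orth (a := a) hl hX hv h12 h23 (3*A) x (hs1 _ hi.1).1 (hs2 _ hi.2.1).1 (hs3 _ hi.2.2).1
        (hs1 _ hj.1).1 (hs2 _ hj.2.1).1 (hs3 _ hj.2.2).1 hr
      rw [← this]
      unfold six
      refine integral_congr_ae (Filter.Eventually.of_forall fun w => ?_)
      simp only [hg, hf, map_mul]
      ring)
  refine ho.trans ?_
  have hpt : ∀ q ≤ 2^l, ∀ u : R3, ‖f q (x + (2^l:ℝ) • u)‖^2 ≤ (C*36^A) * (jb u)^A * HH A a v X l q x := by
    intro q hq u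
    have hq' : (q:ℝ) ≤ 2^l := by exact_mod_cast hq
    have hia := arc_InArc (fun ξ hξ => (hX ξ hξ).1) hv q
    have h1 := h a v (arc X l q) ((q:ℝ)/2^l) (1/2^l) (by positivity) hia x (fbi ((q:ℝ)/2^l) (1/2^l) (-((2^l:ℝ) • u)))
    rw [fb_fbi _ (by positivity), sub_neg_eq_add] at h1
    refine h1.trans ?_
    have h2 := jb_fbi_smul (t := (q:ℝ)/2^l) (δ := 1/2^l) (by positivity) ((div_le_one hp).2 hp1)
      (by rw [abs_of_nonneg (by positivity)]; exact (div_le_one hp).2 hq') (-((2^l:ℝ) • u))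
    rw [smul_neg, jb_neg, smul_smul, one_div, inv_mul_cancel₀ hp.ne', one_smul] at h2
    have h3 : jb (fbi ((q:ℝ)/2^l) (1/2^l) (-((2^l:ℝ) • u)))^A ≤ (36 * jb u)^A :=
      pow_le_pow_left₀ (jb_pos _).le (by rw [one_div]; exact h2) A
    have h4 := HH_nonneg A a v X l q x
    have : C * jb (fbi ((q:ℝ)/2^l) (1/2^l) (-((2^l:ℝ) • u)))^A ≤ (C*36^A) * (jb u)^A := by
      rw [mul_assoc, ← mul_pow]; gcongr
    exact mul_le_mul_of_nonneg_right this h4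
  have hd : ∀ i ∈ s1 ×ˢ (s2 ×ˢ s3), ∫ w, ‖g i w‖^2 ∂wk (3*A) (2^l) x ≤
      ((C*36^A)^3 * I) * (HH A a v X l i.1 x * (HH A a v X l i.2.1 x * HH A a v X l i.2.2 x)) := by
    rintro ⟨q1, q2, q3⟩ hi
    simp only [Finset.mem_product] at hi
    rw [wk_int _ _ _ (fun w => ‖g (q1,q2,q3) w‖^2) ((hgB (q1,q2,q3)).1.norm.pow_const 2).stronglyMeasurable]
    rw [show ((C*36^A)^3 * I) * (HH A a v X l q1 x * (HH A a v X l q2 x * HH A a v X l q3 x)) =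
      ((C*36^A)^3 * (HH A a v X l q1 x * (HH A a v X l q2 x * HH A a v X l q3 x))) * I by ring, hI, ← integral_const_mul]
    have hint : Integrable (fun u => (C*36^A)^3 * (HH A a v X l q1 x * (HH A a v X l q2 x * HH A a v X l q3 x)) * (kap3 (3*A) u * (jb u)^(3*A))) :=
      (kap3_int (3*A)).const_mul _
    refine integral_mono_of_nonneg (Filter.Eventually.of_forall fun u => ?_) hint (Filter.Eventually.of_forall fun u => ?_)
    · exact smul_nonneg (kap3_pos _ u).le (by positivity)
    · show kap3 (3*A) u * ‖f q1 (x + (2^l:ℝ) • u) * (f q2 (x + (2^l:ℝ) • u) * f q3 (x + (2^l:ℝ) • u))‖^2 ≤ _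
      have t1 := hpt q1 (hs1 _ hi.1).2 u
      have t2 := hpt q2 (hs2 _ hi.2.1).2 u
      have t3 := hpt q3 (hs3 _ hi.2.2).2 u
      have hk := kap3_pos (3*A) u
      rw [norm_mul, norm_mul, mul_pow, mul_pow]
      have hj := jb_pow_pos u A
      have H1 := HH_nonneg A a v X l q1 x
      have H2 := HH_nonneg A a v X l q2 x
      have H3 := HH_nonneg A a v X l q3 x
      calc kap3 (3*A) u * (‖f q1 (x + (2^l:ℝ) • u)‖^2 * (‖f q2 (x + (2^l:ℝ) • u)‖^2 * ‖f q3 (x + (2^l:ℝ) • u)‖^2))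
          ≤ kap3 (3*A) u * (((C*36^A) * (jb u)^A * HH A a v X l q1 x) * (((C*36^A) * (jb u)^A * HH A a v X l q2 x) * ((C*36^A) * (jb u)^A * HH A a v X l q3 x))) := by
            gcongr
        _ = _ := by
            have e0 : (jb u)^(3*A) = ((jb u)^A)^3 := by rw [← pow_mul, mul_comm 3 A]
            beta_reduce; rw [e0]; ring
  have h5 := Finset.sum_le_sum hd
  rw [← Finset.mul_sum] at h5
  have e2 : ∑ i ∈ s1 ×ˢ (s2 ×ˢ s3), (HH A a v X l i.1 x * (HH A a v X l i.2.1 x * HH A a v X l i.2.2 x)) =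
      (∑ q ∈ s1, HH A a v X l q x) * (∑ q ∈ s2, HH A a v X l q x) * (∑ q ∈ s3, HH A a v X l q x) := by
    rw [Finset.sum_product, mul_assoc, Finset.sum_mul]
    refine Finset.sum_congr rfl fun q1 _ => ?_
    rw [Finset.sum_product, Finset.sum_mul_sum, Finset.mul_sum]
    refine Finset.sum_congr rfl fun q2 _ => ?_
    rw [Finset.mul_sum]
  rw [e2] at h5
  set P := (∑ q ∈ s1, HH A a v X l q x) * (∑ q ∈ s2, HH A a v X l q x) * (∑ q ∈ s3, HH A a v X l q x) with hP
  have hP0 : 0 ≤ P := by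
    have : ∀ s : Finset ℕ, 0 ≤ ∑ q ∈ s, HH A a v X l q x := fun s => Finset.sum_nonneg fun _ _ => HH_nonneg _ _ _ _ _ _ _
    exact mul_nonneg (mul_nonneg (this _) (this _)) (this _)
  have hcc : (((2^40)^3 : ℕ):ℝ) = ((2:ℝ)^40)^3 := by norm_num
  rw [hcc]
  calc ((2:ℝ)^40)^3 * ∑ i ∈ s1 ×ˢ (s2 ×ˢ s3), ∫ w, ‖g i w‖^2 ∂wk (3*A) (2^l) x
      ≤ ((2:ℝ)^40)^3 * (((C*36^A)^3 * I) * P) := by gcongr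
    _ ≤ ((2^40)^3 * ((C*36^A)^3 * I) + 1) * P := by rw [add_mul, ← mul_assoc]; linarith

/-- density set -/
def Dn (U : Set R3) (L : ℝ) (x : R3) : Set R3 := {u | ‖u‖ ≤ 1 ∧ x + L • u ∈ U}
theorem Dn_meas {U : Set R3} (hU : MeasurableSet U) (L : ℝ) (x : R3) : MeasurableSet (Dn U L x) := by
  unfold Dn
  have h1 : MeasurableSet {u : R3 | ‖u‖ ≤ 1} := measurableSet_le measurable_norm measurable_const
  exact h1.inter ((wk_meas L x) hU)
theorem Dn_fin (U : Set R3) (L : ℝ) (x : R3) : volume (Dn U L x) < ⊤ := by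
  refine (measure_mono (t := Metric.closedBall 0 1) ?_).trans_lt measure_closedBall_lt_top
  intro u hu
  simpa using hu.1

theorem part_low {a : ℝ → ℂ} {v : ℝ → ℝ} {X : Finset ℝ} {A l : ℕ} (hl : 16 ≤ l) {p : ℕ} (hp : p < 2^16) {b c τ : ℝ}
    {x y : R3} (hxy : ∀ q ≤ 2^l, HH A a v X l q x ≤ c * HH A a v X l q y) (hc : 0 < c)
    (h1 : τ ≤ ‖es a v (arc X 16 p) y‖) (h2 : SS A a v X l b y ≤ τ/2) :
    τ/2 ≤ ‖∑ q ∈ (chl (l-16) p).filter (fun q => HH A a v X l q x ≤ c*b), es a v (arc X l q) y‖ := by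
  have e1 := es_split a v X 16 (l-16) p y
  rw [show 16 + (l-16) = l by omega] at e1
  have hsub : ∀ q ∈ chl (l-16) p, q < 2^l := by
    intro q hq
    unfold chl at hq
    have h3 := (Finset.mem_Ico.1 hq).2
    have h4 : (p+1) * 2^(l-16) ≤ 2^16 * 2^(l-16) := Nat.mul_le_mul_right _ hp
    rw [← pow_add, show 16 + (l-16) = l by omega] at h4
    omega
  rw [← Finset.sum_filter_add_sum_filter_not _ (fun q => HH A a v X l q x ≤ c*b)] at e1
  have h5 : ‖∑ q ∈ (chl (l-16) p).filter (fun q => ¬ HH A a v X l q x ≤ c*b), es a v (arc X l q) y‖ ≤ SS A a v X l b y := by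
    refine (norm_sum_le _ _).trans ?_
    unfold SS
    rw [← Finset.sum_filter]
    refine Finset.sum_le_sum_of_subset_of_nonneg ?_ (fun _ _ _ => norm_nonneg _)
    intro q hq
    rw [Finset.mem_filter] at hq ⊢
    have hq2 := hsub q hq.1
    refine ⟨Finset.mem_range.2 hq2, ?_⟩
    have h6 := hxy q hq2.le
    have h7 := hq.2
    push Not at h7
    exact lt_of_mul_lt_mul_left (h7.trans_le h6) hc.le
  have h8 := norm_add_le (∑ q ∈ (chl (l-16) p).filter (fun q => HH A a v X l q x ≤ c*b), es a v (arc X l q) y)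
    (∑ q ∈ (chl (l-16) p).filter (fun q => ¬ HH A a v X l q x ≤ c*b), es a v (arc X l q) y)
  rw [← e1] at h8
  linarith

set_option maxHeartbeats 1000000 in
theorem dlem {A : ℕ} (hA : 4 ≤ A) : ∃ C : ℝ, 0 < C ∧ ∀ (a : ℝ → ℂ) (v : ℝ → ℝ) (X : Finset ℝ) (l : ℕ), 16 ≤ l →
    (∀ ξ ∈ X, 0 ≤ ξ ∧ ξ < 1) → (∀ ξ ∈ X, |v ξ| ≤ (1/2^l)^2) → ∀ p1 p2 p3 : ℕ, p1 + 1 < p2 → p2 + 1 < p3 → p3 < 2^16 →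
    ∀ (U : Set R3) (b τ G0 : ℝ), MeasurableSet U → 0 < b → 0 < τ → 0 ≤ G0 →
    (∀ y ∈ U, τ ≤ ‖es a v (arc X 16 p1) y‖ ∧ τ ≤ ‖es a v (arc X 16 p2) y‖ ∧ τ ≤ ‖es a v (arc X 16 p3) y‖ ∧
      SS A a v X l b y ≤ τ/2 ∧ GG A a v X l b y ≤ G0) →
    ∀ x, volume.real (Dn U (2^l) x) ≤ C * G0^3 / τ^6 := by
  obtain ⟨C, hC, h⟩ := trilin hA
  obtain ⟨c, _, hc, _, _, hk, _, _⟩ := kap3_spec (3*A)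
  have hcm := cmv_one A
  have hcm0 : 0 < cmv A := by linarith
  refine ⟨C * (cmv A^2)^3 * (2^(3*A+4) * c⁻¹ * 64), by positivity, ?_⟩
  intro a v X l hl hX hv p1 p2 p3 h12 h23 hp3 U b τ G0 hU hb hτ hG0 hy x
  rcases (Dn U (2^l) x).eq_empty_or_nonempty with hemp | ⟨u0, hu0⟩
  · rw [hemp, measureReal_empty]; positivity
  have hp : (0:ℝ) < 2^l := by positivity
  have hnm : ∀ u : R3, ‖u‖ ≤ 1 → ‖-((2^l:ℝ) • u)‖ ≤ 2^l := by
    intro u hu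
    rw [norm_neg, norm_smul, Real.norm_of_nonneg hp.le]
    nlinarith
  set s : ℕ → Finset ℕ := fun p => (chl (l-16) p).filter (fun q => HH A a v X l q x ≤ cmv A*b) with hs
  have hsp : ∀ p < 2^16, ∀ q ∈ s p, q/2^(l-16) = p ∧ q < 2^l := by
    intro p hp q hq
    have hq1 := (Finset.mem_filter.1 hq).1
    refine ⟨(chl_iff).1 hq1, ?_⟩
    unfold chl at hq1
    have h3 := (Finset.mem_Ico.1 hq1).2
    have h4 : (p+1) * 2^(l-16) ≤ 2^16 * 2^(l-16) := Nat.mul_le_mul_right _ hp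
    rw [← pow_add, show 16 + (l-16) = l by omega] at h4
    omega
  have hsum : ∀ p < 2^16, ∑ q ∈ s p, HH A a v X l q x ≤ cmv A^2 * G0 := by
    intro p hp'
    have i1 : ∑ q ∈ s p, HH A a v X l q x ≤ ∑ q ∈ s p, cmv A * min (HH A a v X l q x) b := by
      refine Finset.sum_le_sum fun q hq => ?_
      have := (Finset.mem_filter.1 hq).2
      have h0 := HH_nonneg A a v X l q x
      rcases le_total (HH A a v X l q x) b with h1 | h1
      · rw [min_eq_left h1]; nlinarith
      · rw [min_eq_right h1]; exact this
    have i2 : ∑ q ∈ s p, cmv A * min (HH A a v X l q x) b ≤ cmv A * GG A a v X l b x := by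
      rw [← Finset.mul_sum, GG_eq]
      refine mul_le_mul_of_nonneg_left ?_ hcm0.le
      refine Finset.sum_le_sum_of_subset_of_nonneg (fun q hq => Finset.mem_range.2 (hsp p hp' q hq).2) ?_
      intro q _ _
      exact le_min (HH_nonneg _ _ _ _ _ _ _) hb.le
    have i3 := GG_move hA a v X hb.le (x + (2^l:ℝ) • u0) (hnm u0 hu0.1)
    rw [add_neg_cancel_right] at i3
    have i4 := (hy _ hu0.2).2.2.2.2
    have i5 : cmv A * GG A a v X l b x ≤ cmv A * (cmv A * G0) :=
      mul_le_mul_of_nonneg_left (i3.trans (mul_le_mul_of_nonneg_left i4 hcm0.le)) hcm0.le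
    linarith
  have ht := h a v X l hl hX hv p1 p2 p3 h12 h23 (s p1) (s p2) (s p3)
    (fun q hq => ⟨(hsp p1 (by omega) q hq).1, (hsp p1 (by omega) q hq).2.le⟩)
    (fun q hq => ⟨(hsp p2 (by omega) q hq).1, (hsp p2 (by omega) q hq).2.le⟩)
    (fun q hq => ⟨(hsp p3 (by omega) q hq).1, (hsp p3 (by omega) q hq).2.le⟩) x
  set W : R3 → ℂ := fun y => (∑ q ∈ s p1, es a v (arc X l q) y) * (∑ q ∈ s p2, es a v (arc X l q) y) * (∑ q ∈ s p3, es a v (arc X l q) y) with hW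
  have hWB : BM W := ((BM.sum (s := s p1) (fun i _ => BM_es _ _ _)).mul (BM.sum (s := s p2) (fun i _ => BM_es _ _ _))).mul
    (BM.sum (s := s p3) (fun i _ => BM_es _ _ _))
  have hR : (∑ q ∈ s p1, HH A a v X l q x) * (∑ q ∈ s p2, HH A a v X l q x) * (∑ q ∈ s p3, HH A a v X l q x) ≤ (cmv A^2 * G0)^3 := by
    have hn : ∀ s : Finset ℕ, 0 ≤ ∑ q ∈ s, HH A a v X l q x := fun s => Finset.sum_nonneg fun _ _ => HH_nonneg _ _ _ _ _ _ _
    rw [pow_succ, pow_two]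
    exact mul_le_mul (mul_le_mul (hsum p1 (by omega)) (hsum p2 (by omega)) (hn _) (by positivity)) (hsum p3 (by omega)) (hn _) (by positivity)
  have hint : Integrable (fun u => kap3 (3*A) u • ‖W (x + (2^l:ℝ) • u)‖^2) := by
    obtain ⟨D, hD⟩ := hWB.2
    have := (kap3_int0 (3*A)).mul_const (D^2)
    refine this.mono' ?_ (Filter.Eventually.of_forall fun u => ?_)
    · exact ((kap3_meas _).smul (((hWB.1.comp (wk_meas (2^l) x)).norm).pow_const 2)).aestronglyMeasurable
    · rw [norm_smul, Real.norm_of_nonneg (kap3_pos _ u).le, Real.norm_of_nonneg (by positivity)]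
      exact mul_le_mul_of_nonneg_left (pow_le_pow_left₀ (norm_nonneg _) (hD _) 2) (kap3_pos _ u).le
  rw [wk_int _ _ _ (fun w => ‖W w‖^2) (hWB.1.norm.pow_const 2).stronglyMeasurable] at ht
  set K := c * ((2:ℝ)^(3*A+4))⁻¹ * ((τ/2)^3)^2 with hK
  have hK0 : 0 < K := by positivity
  have hlow : ∀ u ∈ Dn U (2^l) x, K ≤ kap3 (3*A) u • ‖W (x + (2^l:ℝ) • u)‖^2 := by
    intro u hu
    have k1 : c * ((2:ℝ)^(3*A+4))⁻¹ ≤ kap3 (3*A) u := by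
      refine le_trans ?_ (hk u)
      have j1 : jb u ≤ 2 := by unfold jb; nlinarith [hu.1, norm_nonneg u]
      have j2 := jb_pow_pos u (3*A+4)
      have j3 : (jb u)^(3*A+4) ≤ 2^(3*A+4) := pow_le_pow_left₀ (jb_pos u).le j1 _
      gcongr
    have hxy : ∀ q ≤ 2^l, HH A a v X l q x ≤ cmv A * HH A a v X l q (x + (2^l:ℝ) • u) := by
      intro q hq
      have := HH_move hA a v X hq (x + (2^l:ℝ) • u) (hnm u hu.1)
      rwa [add_neg_cancel_right] at this
    obtain ⟨t1, t2, t3, t4, _⟩ := hy _ hu.2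
    have w1 := part_low hl (by omega : p1 < 2^16) hxy hcm0 t1 t4
    have w2 := part_low hl (by omega : p2 < 2^16) hxy hcm0 t2 t4
    have w3 := part_low hl (by omega : p3 < 2^16) hxy hcm0 t3 t4
    have hW3 : (τ/2)^3 ≤ ‖W (x + (2^l:ℝ) • u)‖ := by
      rw [hW]
      simp only
      rw [norm_mul, norm_mul, pow_succ, pow_two]
      have : 0 ≤ τ/2 := by positivity
      exact mul_le_mul (mul_le_mul w1 w2 this (norm_nonneg _)) w3 this (by positivity)
    rw [smul_eq_mul, hK]
    exact mul_le_mul k1 (pow_le_pow_left₀ (by positivity) hW3 2) (by positivity) (kap3_pos _ u).le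
  have h6 : K * volume.real (Dn U (2^l) x) ≤ ∫ u, kap3 (3*A) u • ‖W (x + (2^l:ℝ) • u)‖^2 := by
    have g1 : ∫ u in Dn U (2^l) x, K ≤ ∫ u in Dn U (2^l) x, kap3 (3*A) u • ‖W (x + (2^l:ℝ) • u)‖^2 :=
      setIntegral_mono_on (integrableOn_const (Dn_fin _ _ _).ne) hint.integrableOn (Dn_meas hU _ _) hlow
    have g2 := setIntegral_le_integral (s := Dn U (2^l) x) hint
      (Filter.Eventually.of_forall fun u => smul_nonneg (kap3_pos _ u).le (by positivity))
    rw [setIntegral_const, smul_eq_mul, mul_comm] at g1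
    exact g1.trans g2
  have h7 : K * volume.real (Dn U (2^l) x) ≤ C * (cmv A^2 * G0)^3 := h6.trans (ht.trans (mul_le_mul_of_nonneg_left hR hC.le))
  rw [← le_div_iff₀' hK0] at h7
  refine h7.trans (le_of_eq ?_)
  rw [hK]
  field_simp
  norm_num

/-! ### Linear changes of variable and the density argument -/
theorem vol_tri {p0 p1 p2 p3 p4 p5 : ℝ} (h : p0 * p3 * p5 ≠ 0) (s : Set R3) :
    volume ((fun u : R3 => mk3 (p0 * u 0 + p1 * u 1 + p2 * u 2) (p3 * u 1 + p4 * u 2) (p5 * u 2)) ⁻¹' s) =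
      ENNReal.ofReal |(p0 * p3 * p5)⁻¹| * volume s := by
  set b := (EuclideanSpace.basisFun (Fin 3) ℝ).toBasis with hb
  set M : Matrix (Fin 3) (Fin 3) ℝ := !![p0, p1, p2; 0, p3, p4; 0, 0, p5] with hM
  have hf : (fun u : R3 => mk3 (p0 * u 0 + p1 * u 1 + p2 * u 2) (p3 * u 1 + p4 * u 2) (p5 * u 2)) = ⇑(Matrix.toLin b b M) := by
    funext u
    have h1 : ∀ i, (Matrix.toLin b b M u) i = M.mulVec (fun j => u j) i := by
      intro i
      have := congrFun (Matrix.toLin_apply b b M u ▸ rfl : (fun i => (Matrix.toLin b b M u) i) = fun i => (∑ j, (M.mulVec (b.repr u)) j • b j : R3) i) i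
      rw [this]
      simp only [Fin.sum_univ_three, hb]
      fin_cases i <;> simp <;> rfl
    refine R3_ext ?_ ?_ ?_
    · rw [h1]; simp [hM, Matrix.mulVec, dotProduct, Fin.sum_univ_three]
    · rw [h1]; simp [hM, Matrix.mulVec, dotProduct, Fin.sum_univ_three]
    · rw [h1]; simp [hM, Matrix.mulVec, dotProduct, Fin.sum_univ_three]
  have hd : LinearMap.det (Matrix.toLin b b M) = p0 * p3 * p5 := by
    rw [LinearMap.det_toLin, Matrix.det_fin_three]; simp [hM]
  rw [hf, Measure.addHaar_preimage_linearMap _ (by rw [hd]; exact h), hd]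

def bx (z r : R3) : Set R3 := {x | ∀ i, |x i - z i| ≤ r i}
theorem bx_meas (z r : R3) : MeasurableSet (bx z r) := by
  unfold bx
  rw [Set.ofPred_forall]
  refine MeasurableSet.iInter fun i => ?_
  exact measurableSet_le (by fun_prop) measurable_const

theorem win_low : ∃ c : ℝ, 0 < c ∧ ∀ (r z : R3), (∀ i, 0 < r i) → ∀ S : Set R3, MeasurableSet S →
    S ⊆ bx z ((2:ℝ) • r) → ENNReal.ofReal (c / (r 0 * r 1 * r 2)) * volume S ≤ win r z S := by
  obtain ⟨c, _, hc, _, _, hk, _, _⟩ := kap3_spec 0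
  refine ⟨c * ((13:ℝ)^4)⁻¹, by positivity, ?_⟩
  intro r z hr S hS hsub
  have hr0 := hr 0
  have hr1 := hr 1
  have hr2 := hr 2
  unfold win
  rw [Measure.map_apply (win_meas r z) hS, withDensity_apply _ (win_meas r z hS)]
  have hv : volume ((fun u => dg r u + z) ⁻¹' S) = ENNReal.ofReal ((r 0 * r 1 * r 2)⁻¹) * volume S := by
    have h1 := vol_tri (p0 := r 0) (p1 := 0) (p2 := 0) (p3 := r 1) (p4 := 0) (p5 := r 2) (by positivity) ((fun x => x + z) ⁻¹' S)
    rw [measure_preimage_add_right, abs_of_pos (by positivity)] at h1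
    rw [← h1]
    congr 1
    ext u
    simp [dg]
  calc ENNReal.ofReal (c * ((13:ℝ)^4)⁻¹ / (r 0 * r 1 * r 2)) * volume S
      = ∫⁻ u in (fun u => dg r u + z) ⁻¹' S, ENNReal.ofReal (c * ((13:ℝ)^4)⁻¹) := by
        rw [setLIntegral_const, hv, ← mul_assoc, ← ENNReal.ofReal_mul (by positivity), div_eq_mul_inv]
    _ ≤ _ := by
        refine setLIntegral_mono' (win_meas r z hS) fun u hu => ENNReal.ofReal_le_ofReal ?_
        refine le_trans ?_ (hk u)
        have hb := hsub hu
        have hui : ∀ i, (u i)^2 ≤ 4 := by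
          intro i
          have h2 := hb i
          have h3 : (dg r u + z) i - z i = r i * u i := by
            fin_cases i <;> simp [dg]
          rw [h3, abs_mul, abs_of_pos (hr i)] at h2
          have h4 : ((2:ℝ) • r) i = 2 * r i := by simp
          rw [h4, mul_comm] at h2
          have h5 := le_of_mul_le_mul_right h2 (hr i)
          rw [← sq_abs]
          nlinarith [abs_nonneg (u i)]
        have hj : jb u ≤ 13 := by
          rw [jb3]; linarith [hui 0, hui 1, hui 2]
        have hj0 : 0 < jb u := by unfold jb; positivity
        gcongr

theorem fub : ∃ C : ℝ, 0 < C ∧ ∀ (r z : R3) (L D : ℝ) (U E : Set R3), (∀ i, 0 < r i) → 0 < L → (∀ i, L ≤ r i) → 0 ≤ D →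
    MeasurableSet U → MeasurableSet E → (∀ x, volume.real (Dn U L x) ≤ D) → (∀ x, (Dn U L x).Nonempty → x ∈ E) →
    volume.real (U ∩ bx z r) ≤ C * (r 0 * r 1 * r 2) * D * (win r z).real E := by
  obtain ⟨c, hc, hw⟩ := win_low
  set B : Set R3 := Metric.closedBall 0 1
  have hB : 0 < volume.real B := by
    rw [measureReal_def]
    exact ENNReal.toReal_pos (Metric.measure_closedBall_pos _ _ one_pos).ne' measure_closedBall_lt_top.ne
  have hBt : volume B < ⊤ := measure_closedBall_lt_top
  refine ⟨(c * volume.real B)⁻¹, by positivity, ?_⟩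
  intro r z L D U E hr hL hLr hD hU hE hd hn
  have hr0 := hr 0
  have hr1 := hr 1
  have hr2 := hr 2
  have hms : MeasurableSet {q : R3 × R3 | q.1 + L • q.2 ∈ U} := by
    have : Measurable (fun q : R3 × R3 => q.1 + L • q.2) := by fun_prop
    exact this hU
  haveI : IsFiniteMeasure (volume.restrict B) := ⟨by rw [Measure.restrict_apply_univ]; exact hBt⟩
  have h1 := Measure.prod_apply (μ := win r z) (ν := volume.restrict B) hms
  have h2 := Measure.prod_apply_symm (μ := win r z) (ν := volume.restrict B) hms
  have hup : ∫⁻ x, (volume.restrict B) (Prod.mk x ⁻¹' {q : R3 × R3 | q.1 + L • q.2 ∈ U}) ∂(win r z) ≤ ENNReal.ofReal D * win r z E := by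
    rw [← lintegral_indicator_const hE]
    refine lintegral_mono fun x => ?_
    have hx : (volume.restrict B) (Prod.mk x ⁻¹' {q : R3 × R3 | q.1 + L • q.2 ∈ U}) = volume (Dn U L x) := by
      rw [Measure.restrict_apply (measurable_prodMk_left hms)]
      congr 1
      ext u
      simp only [Dn, B, Set.mem_inter_iff, Set.mem_preimage, Set.mem_ofPred_eq, mem_closedBall_zero_iff]
      tauto
    rw [hx]
    by_cases hxE : x ∈ E
    · rw [indicator_of_mem hxE]
      have := hd x
      rw [measureReal_def] at this
      exact (ENNReal.le_ofReal_iff_toReal_le (Dn_fin U L x).ne hD).2 this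
    · have : Dn U L x = ∅ := by
        by_contra hne
        exact hxE (hn x (nonempty_iff_ne_empty.2 hne))
      rw [this]; simp
  have hlo : ENNReal.ofReal (c / (r 0 * r 1 * r 2)) * volume (U ∩ bx z r) * volume B ≤
      ∫⁻ u, (win r z) ((fun x => (x, u)) ⁻¹' {q : R3 × R3 | q.1 + L • q.2 ∈ U}) ∂(volume.restrict B) := by
    rw [← setLIntegral_const]
    refine setLIntegral_mono' measurableSet_closedBall fun u hu => ?_
    have hu1 : ‖u‖ ≤ 1 := by simpa [B] using hu
    have hm2 : Measurable (fun x : R3 => x + L • u) := by fun_prop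
    have h3 : volume (U ∩ bx z r) = volume ((fun x => x + L • u) ⁻¹' (U ∩ bx z r)) := by
      rw [measure_preimage_add_right]
    rw [h3]
    refine (hw r z hr _ (hm2 (hU.inter (bx_meas z r))) ?_).trans (measure_mono ?_)
    · intro x hx i
      have h4 := hx.2 i
      have h5 := abs_le_norm3 u i
      have h6 : (x + L • u) i = x i + L * u i := by simp
      have h7 : ((2:ℝ) • r) i = 2 * r i := by simp
      rw [h6] at h4
      rw [h7]
      have h8 : |x i - z i| ≤ |x i + L * u i - z i| + |L * u i| := by
        have := abs_sub (x i + L * u i - z i) (L * u i)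
        rw [show x i + L * u i - z i - L * u i = x i - z i by ring] at this
        exact this
      rw [abs_mul, abs_of_pos hL] at h8
      have := hLr i
      nlinarith
    · intro x hx
      exact hx.1
  have hall := hlo.trans (h2.symm.trans h1 ▸ hup)
  have hbt : (ENNReal.ofReal D * win r z E) ≠ ⊤ := ENNReal.mul_ne_top ENNReal.ofReal_ne_top (measure_ne_top _ _)
  have h9 := ENNReal.toReal_mono hbt hall
  simp only [ENNReal.toReal_mul] at h9
  rw [ENNReal.toReal_ofReal (by positivity), ENNReal.toReal_ofReal hD] at h9
  simp only [← measureReal_def] at h9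
  have h10 : volume.real (U ∩ bx z r) = (c * volume.real B)⁻¹ * (r 0 * r 1 * r 2) * (c / (r 0 * r 1 * r 2) * volume.real (U ∩ bx z r) * volume.real B) := by
    field_simp
  rw [h10, mul_assoc _ D]
  gcongr
theorem bx_vol (z r : R3) (hr : ∀ i, 0 ≤ r i) : volume (bx z r) = ENNReal.ofReal (8 * (r 0 * r 1 * r 2)) := by
  have h := (EuclideanSpace.volume_preserving_symm_measurableEquiv_toLp (Fin 3)).measure_preimage_equiv
    (Set.Icc (fun i => z i - r i) (fun i => z i + r i))
  rw [Real.volume_Icc_pi] at h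
  have h2 : bx z r = (MeasurableEquiv.toLp 2 (Fin 3 → ℝ)).symm ⁻¹' (Set.Icc (fun i => z i - r i) (fun i => z i + r i)) := by
    ext x
    constructor
    · intro hx
      refine ⟨fun i => ?_, fun i => ?_⟩
      · have := abs_le.1 (hx i); show z i - r i ≤ x i; linarith
      · have := abs_le.1 (hx i); show x i ≤ z i + r i; linarith
    · intro hx i
      have h1 : z i - r i ≤ x i := hx.1 i
      have h2 : x i ≤ z i + r i := hx.2 i
      rw [abs_le]; constructor <;> linarith
  have h0 := hr 0
  have h1 := hr 1
  have h3 := hr 2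
  rw [h2, h, Fin.prod_univ_three, ← ENNReal.ofReal_mul (by linarith), ← ENNReal.ofReal_mul (by apply mul_nonneg <;> linarith)]
  congr 1; ring
theorem bx_fin (z r : R3) : volume (bx z r) < ⊤ := by
  refine (measure_mono (t := bx z (mk3 |r 0| |r 1| |r 2|)) ?_).trans_lt ?_
  · intro x hx i
    have := hx i
    fin_cases i <;> exact this.trans (le_abs_self _)
  · rw [bx_vol]
    · exact ENNReal.ofReal_lt_top
    · intro i; fin_cases i <;> simp
theorem bx_volr (z r : R3) (hr : ∀ i, 0 ≤ r i) : volume.real (bx z r) = 8 * (r 0 * r 1 * r 2) := by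
  rw [measureReal_def, bx_vol z r hr, ENNReal.toReal_ofReal]
  have h0 := hr 0
  have h1 := hr 1
  have h3 := hr 2
  positivity

/-! ### One level of the pruning argument -/
theorem bx_cover (R1 R2 Z W : ℝ) (hW : 0 < W) (hZ : 0 ≤ Z) :
    ∃ s : Finset ℤ, (s.card : ℝ) ≤ Z / W + 2 ∧
      bx 0 (mk3 R1 R2 Z) ⊆ ⋃ j ∈ s, bx (mk3 0 0 (j * (2*W))) (mk3 R1 R2 W) := by
  refine ⟨Finset.Icc (⌊(W-Z)/(2*W)⌋) (⌊(Z+W)/(2*W)⌋), ?_, ?_⟩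
  · rw [Int.card_Icc]
    have h1 : ⌊(W-Z)/(2*W)⌋ ≤ ⌊(Z+W)/(2*W)⌋ := Int.floor_le_floor (by gcongr; linarith)
    have h2 : ((⌊(Z+W)/(2*W)⌋ + 1 - ⌊(W-Z)/(2*W)⌋).toNat : ℝ) = (⌊(Z+W)/(2*W)⌋ + 1 - ⌊(W-Z)/(2*W)⌋ : ℝ) := by
      have : ((⌊(Z+W)/(2*W)⌋ + 1 - ⌊(W-Z)/(2*W)⌋).toNat : ℤ) = ⌊(Z+W)/(2*W)⌋ + 1 - ⌊(W-Z)/(2*W)⌋ := Int.toNat_of_nonneg (by linarith)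
      exact_mod_cast this
    rw [h2]
    have h3 := Int.floor_le ((Z+W)/(2*W))
    have h4 := Int.lt_floor_add_one ((W-Z)/(2*W))
    have h5 : (Z+W)/(2*W) - (W-Z)/(2*W) = Z/W := by field_simp; ring
    linarith
  · intro x hx
    have h0 := hx 0
    have h1 := hx 1
    have h2 := hx 2
    simp at h0 h1 h2
    simp only [mem_iUnion]
    refine ⟨⌊(x 2+W)/(2*W)⌋, ?_, ?_⟩
    · rw [Finset.mem_Icc]
      have := abs_le.1 h2
      exact ⟨Int.floor_le_floor (by gcongr; linarith), Int.floor_le_floor (by gcongr; linarith)⟩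
    · intro i
      fin_cases i
      · simpa using h0
      · simpa using h1
      · have h3 := Int.floor_le ((x 2+W)/(2*W))
        have h4 := Int.lt_floor_add_one ((x 2+W)/(2*W))
        rw [le_div_iff₀ (by positivity)] at h3
        rw [div_lt_iff₀ (by positivity)] at h4
        simp
        rw [abs_le]
        constructor <;> linarith

set_option maxHeartbeats 1000000 in
theorem lev {η : ℝ} (hη : 0 < η) {A : ℕ} (hA : 4 ≤ A) : ∃ C : ℝ, 1 ≤ C ∧ ∀ m k : ℕ, 16 ≤ m → 1 ≤ k →
    ∀ (a : ℝ → ℂ) (v : ℝ → ℝ) (X : Finset ℝ) (N b : ℝ), 0 < N → 2^(m*k+m) ≤ N → 0 < b →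
    (∀ ξ ∈ X, 0 ≤ ξ ∧ ξ < 1) → SepN N X → (∀ ξ ∈ X, |v ξ| ≤ (N^2)⁻¹) → (∀ ξ ∈ X, ‖a ξ‖ ≤ 1) →
    ∀ p1 p2 p3 : ℕ, p1 + 1 < p2 → p2 + 1 < p3 → p3 < 2^16 →
    ∀ (U : Set R3) (τ G0 lam Θ R1 R2 Z : ℝ), MeasurableSet U → 0 < τ → 0 ≤ G0 → 0 < lam → C ≤ Θ → N^3 ≤ R1 → N^3 ≤ R2 → 0 ≤ Z →
    (∀ y ∈ U, τ ≤ ‖es a v (arc X 16 p1) y‖ ∧ τ ≤ ‖es a v (arc X 16 p2) y‖ ∧ τ ≤ ‖es a v (arc X 16 p3) y‖ ∧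
      SS (A+4) a v X (m*k) b y ≤ τ/2 ∧ GG (A+4) a v X (m*k) b y ≤ G0 ∧ lam ≤ GG (A+4) a v X (m*k) b y ∧
      Θ * GG A a v X (m*k+m) b y ≤ GG (A+4) a v X (m*k) b y) →
    volume.real (U ∩ bx 0 (mk3 R1 R2 Z)) ≤ C^(k+3) * ((2^m)^60*N^(3+η)*(min b ((N/2^(m*k))^2))^3/lam^6) * (G0^3/τ^6) *
      (R1 * R2 * (Z + 2 * (2^(m*k))^3)) := by
  obtain ⟨Ch, hCh, hh⟩ := high_est hη hA
  obtain ⟨Cd, hCd, hd⟩ := dlem (A := A+4) (by omega)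
  obtain ⟨Cf, hCf, hf⟩ := fub
  have c1 := cmv_one A
  have c2 := cmv_one (A+4)
  set c3 := cmv A with hc3
  set c4 := cmv (A+4) with hc4
  set C := Ch * (c3 * c4^6) * ((1+Cd) * (1+Cf)) with hC
  have g1 : 1 ≤ c3 * c4^6 := one_le_mul_of_one_le_of_one_le c1 (one_le_pow₀ c2)
  have g2 : 1 ≤ (1+Cd) * (1+Cf) := one_le_mul_of_one_le_of_one_le (by linarith) (by linarith)
  have g4 : c3 * c4 ≤ c3 * c4^6 := by
    have := le_self_pow₀ c2 (by norm_num : 6 ≠ 0)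
    gcongr
  have hChC : Ch ≤ C := by
    rw [hC, mul_assoc]
    exact le_mul_of_one_le_right (by linarith) (one_le_mul_of_one_le_of_one_le g1 g2)
  have hC2 : Ch * (c3 * c4) ≤ C := by
    rw [hC]
    exact (mul_le_mul_of_nonneg_left g4 (by linarith)).trans (le_mul_of_one_le_right (by positivity) g2)
  have hC3 : c4^6 * (Cd * Cf) ≤ C := by
    have t1 : c4^6 ≤ Ch * (c3 * c4^6) := by
      have : c4^6 ≤ c3 * c4^6 := le_mul_of_one_le_left (by positivity) c1
      exact this.trans (le_mul_of_one_le_left (by positivity) hCh)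
    have t2 : Cd * Cf ≤ (1+Cd)*(1+Cf) := by nlinarith
    rw [hC]; gcongr
  clear_value C
  refine ⟨C, by linarith, ?_⟩
  intro m k hm hk a v X N b hN hNk hb hX hsep hv ha p1 p2 p3 h12 h23 hp3 U τ G0 lam Θ R1 R2 Z hU hτ hG0 hlam hΘ hR1 hR2 hZ hy
  have hC0 : 0 < C := by linarith
  set l := m*k with hl
  have hl16 : 16 ≤ l := by nlinarith
  set W : ℝ := (2^l)^3 with hW
  have hp1 : (1:ℝ) ≤ 2^l := one_le_pow₀ (by norm_num)
  have hp0 : (0:ℝ) < 2^l := by positivity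
  have hlN : (2:ℝ)^l ≤ N := (pow_le_pow_right₀ (by norm_num) (by omega)).trans hNk
  have hN1 : 1 ≤ N := hp1.trans hlN
  have hW3 : W ≤ N^3 := by rw [hW]; gcongr
  have hLW : (2:ℝ)^l ≤ W := le_self_pow₀ hp1 (by norm_num)
  have hW0 : 0 < W := by positivity
  have hN23 : N^2 ≤ N^3 := pow_le_pow_right₀ hN1 (by norm_num)
  have hR10 : 0 < R1 := lt_of_lt_of_le (by positivity) hR1
  have hR20 : 0 < R2 := lt_of_lt_of_le (by positivity) hR2
  have hvl : ∀ ξ ∈ X, |v ξ| ≤ (1/2^l)^2 := by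
    intro ξ hξ
    refine (hv ξ hξ).trans ?_
    rw [one_div, inv_pow]
    gcongr
  have hD := hd a v X l hl16 hX hvl p1 p2 p3 h12 h23 hp3 U b τ G0 hU hb hτ hG0
    (fun y hyU => ⟨(hy y hyU).1, (hy y hyU).2.1, (hy y hyU).2.2.1, (hy y hyU).2.2.2.1, (hy y hyU).2.2.2.2.1⟩)
  set E : Set R3 := {x | lam/c4 ≤ GG (A+4) a v X l b x ∧ Ch*GG A a v X (l+m) b x ≤ GG (A+4) a v X l b x} with hE
  have hEm : MeasurableSet E :=
    (measurableSet_le measurable_const (GG_meas _ a v X l b)).inter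
      (measurableSet_le ((GG_meas A a v X (l+m) b).const_mul Ch) (GG_meas _ a v X l b))
  have hDE : ∀ x, (Dn U (2^l) x).Nonempty → x ∈ E := by
    rintro x ⟨u, hu1, huU⟩
    obtain ⟨-, -, -, -, -, k1, k2⟩ := hy _ huU
    have hnu : ‖(2^l:ℝ) • u‖ ≤ 2^l := by
      rw [norm_smul, Real.norm_of_nonneg hp0.le]; nlinarith
    have m1 := GG_move (A := A+4) (by omega) a v X hb.le x (l := l) hnu
    have m2 := GG_move (A := A) hA a v X hb.le (x + (2^l:ℝ) • u) (l := l+m) (w := -((2^l:ℝ) • u)) (by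
      rw [norm_neg]; exact hnu.trans (pow_le_pow_right₀ (by norm_num) (by omega)))
    rw [add_neg_cancel_right] at m2
    rw [← hc4] at m1
    rw [← hc3] at m2
    have n1 := GG_nonneg A a v X (l+m) hb.le (x + (2^l:ℝ) • u)
    refine ⟨?_, ?_⟩
    · rw [div_le_iff₀ (by linarith)]; linarith
    · have : c4 * (Ch*GG A a v X (l+m) b x) ≤ c4 * GG (A+4) a v X l b x := by
        calc c4 * (Ch*GG A a v X (l+m) b x) ≤ c4 * (Ch * (c3 * GG A a v X (l+m) b (x + (2^l:ℝ) • u))) := by gcongr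
          _ = (Ch * (c3 * c4)) * GG A a v X (l+m) b (x + (2^l:ℝ) • u) := by ring
          _ ≤ Θ * GG A a v X (l+m) b (x + (2^l:ℝ) • u) := by
            apply mul_le_mul_of_nonneg_right _ n1; linarith
          _ ≤ _ := k2.trans m1
      exact le_of_mul_le_mul_left this (by linarith)
  obtain ⟨s, hs1, hs2⟩ := bx_cover R1 R2 Z W hW0 hZ
  set H := (2^m)^60*N^(3+η)*(min b ((N/2^l)^2))^3/lam^6 with hH
  have hH0 : 0 ≤ H := by positivity
  have hpiece : ∀ j : ℤ, volume.real (U ∩ bx (mk3 0 0 (j * (2*W))) (mk3 R1 R2 W)) ≤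
      C^(k+3) * H * (G0^3/τ^6) * (R1 * R2 * W) := by
    intro j
    set z := mk3 0 0 (j * (2*W))
    set r := mk3 R1 R2 W with hr
    have hrp : ∀ i, 0 < r i := by intro i; fin_cases i <;> simp [hr, *]
    have hone : (1/2^l:ℝ)^3 = W⁻¹ := by rw [hW, one_div, inv_pow]
    have f1 := hf r z (2^l) (Cd * G0^3/τ^6) U E hrp hp0 (by
        intro i; fin_cases i
        · show (2:ℝ)^l ≤ R1; linarith
        · show (2:ℝ)^l ≤ R2; linarith
        · exact hLW) (by positivity) hU hEm hD hDE
    have f2 := hh m k (by omega) a v X N b r z hN hNk hb.le hX hsep hv ha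
      (by rw [← hl, hone, ← div_eq_mul_inv, le_div_iff₀ hW0]; show 1 * W ≤ R1; linarith)
      (by rw [← hl, hone, ← div_eq_mul_inv, le_div_iff₀ hW0]; show 1 * W ≤ R2; linarith)
      (by rw [← hl, hone]; exact mul_inv_cancel₀ hW0.ne')
      (by show N^2 ≤ R1; linarith) (by show N^2 ≤ R2; linarith) (lam/c4) (by positivity)
    have f3 : (win r z).real E ≤ C^(k+2) * (c4^6 * H) := by
      refine f2.trans ?_
      rw [← hl]
      have : Ch^(k+2)*(2^m)^60*N^(3+η)*(min b ((N/2^l)^2))^3/(lam/c4)^6 = Ch^(k+2) * (c4^6 * H) := by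
        rw [hH]; field_simp
      rw [this]
      gcongr
    refine f1.trans ?_
    calc Cf * (r 0 * r 1 * r 2) * (Cd * G0^3/τ^6) * (win r z).real E
        ≤ Cf * (R1 * R2 * W) * (Cd * G0^3/τ^6) * (C^(k+2) * (c4^6 * H)) := by
          apply mul_le_mul_of_nonneg_left f3; positivity
      _ = (c4^6 * (Cd * Cf)) * (C^(k+2) * H * (G0^3/τ^6) * (R1 * R2 * W)) := by ring
      _ ≤ C * (C^(k+2) * H * (G0^3/τ^6) * (R1 * R2 * W)) := by
          apply mul_le_mul_of_nonneg_right hC3; positivity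
      _ = _ := by ring
  have hfin : ∀ j : ℤ, volume (U ∩ bx (mk3 0 0 (j * (2*W))) (mk3 R1 R2 W)) ≠ ⊤ := by
    intro j
    exact ((measure_mono inter_subset_right).trans_lt (bx_fin _ _)).ne
  calc volume.real (U ∩ bx 0 (mk3 R1 R2 Z)) ≤ volume.real (⋃ j ∈ s, (U ∩ bx (mk3 0 0 (j * (2*W))) (mk3 R1 R2 W))) := by
        refine measureReal_mono ?_ ?_
        · intro x hx
          have := hs2 hx.2
          simp only [mem_iUnion] at this ⊢
          obtain ⟨j, hj, hj2⟩ := this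
          exact ⟨j, hj, hx.1, hj2⟩
        · exact (measure_biUnion_lt_top s.finite_toSet (fun j _ => (hfin j).lt_top)).ne
    _ ≤ ∑ j ∈ s, volume.real (U ∩ bx (mk3 0 0 (j * (2*W))) (mk3 R1 R2 W)) := measureReal_biUnion_finset_le _ _
    _ ≤ ∑ j ∈ s, C^(k+3) * H * (G0^3/τ^6) * (R1 * R2 * W) := Finset.sum_le_sum fun j _ => hpiece j
    _ = s.card * (C^(k+3) * H * (G0^3/τ^6) * (R1 * R2 * W)) := by rw [Finset.sum_const, nsmul_eq_mul]
    _ ≤ (Z/W + 2) * (C^(k+3) * H * (G0^3/τ^6) * (R1 * R2 * W)) := by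
        apply mul_le_mul_of_nonneg_right hs1; positivity
    _ = _ := by field_simp

/-! ### The broad estimate -/
theorem arc_zero {X : Finset ℝ} (hX : ∀ ξ ∈ X, 0 ≤ ξ ∧ ξ < 1) : arc X 0 0 = X := by
  unfold arc dix
  rw [Finset.filter_true_of_mem]
  intro ξ hξ
  have := hX ξ hξ
  rw [pow_zero, one_mul, Nat.floor_eq_zero]
  exact this.2

theorem core_SS {Θ M N α b : ℝ} {m n : ℕ} (hM : M = 2^m) (hM16 : 2^16 ≤ M) (hN : 0 < N) (hα : 0 < α) (hΘ : 1 ≤ Θ)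
    (hnΘ : n * Θ ≤ M) (hb : b = (M^10*N/α)^2) {a : ℝ → ℂ} {v : ℝ → ℝ} {X : Finset ℝ} {y : R3}
    (hrep : ∀ k ≤ n, ∀ q, ‖es a v (arc X (m*k) q) y‖^2 ≤ Θ * HH (Al n k) a v X (m*k) q y)
    (hend : ∀ q, HH (Al n n) a v X (m*n) q y ≤ b) {k : ℕ} (hk : k ≤ n)
    (hG : ∀ i, k ≤ i → i ≤ n → GG (Al n i) a v X (m*i) b y ≤ M^6*N) :
    SS (Al n k) a v X (m*k) b y ≤ α/2^21 := by
  have hM0 : 0 < M := lt_of_lt_of_le (by norm_num) hM16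
  have hb0 : 0 < b := by rw [hb]; positivity
  have h := tree (by linarith) hb0 hrep hend (n-k) (by omega) (T := M^6*N) (by
    intro i hi hin
    exact hG i (by omega) hin)
  rw [show n - (n-k) = k by omega] at h
  refine h.trans ?_
  have h1 : √(Θ*b) ≤ Θ * (M^10*N/α) := by
    apply Real.sqrt_le_iff.2
    refine ⟨by positivity, ?_⟩
    rw [mul_pow, ← hb]
    have : Θ ≤ Θ^2 := le_self_pow₀ hΘ (by norm_num)
    gcongr
  have h2 : ((n-k:ℕ):ℝ) ≤ n := by exact_mod_cast Nat.sub_le _ _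
  calc ((n-k:ℕ):ℝ) * (M^6*N/b*2^m*√(Θ*b)) ≤ n * (M^6*N/b*M*(Θ * (M^10*N/α))) := by
        rw [← hM]; gcongr
    _ = (n*Θ) * (α/M^3) := by rw [hb]; field_simp
    _ ≤ M * (α/M^3) := by gcongr
    _ = α / M^2 := by field_simp
    _ ≤ α / 2^21 := by
        have : (2^21:ℝ) ≤ M^2 := by
          calc (2^21:ℝ) ≤ (2^16)^2 := by norm_num
            _ ≤ M^2 := by gcongr
        gcongr

set_option maxHeartbeats 1000000 in
theorem core_pt {Θ Λ M N α b : ℝ} {m n : ℕ} (hM : M = 2^m) (hM16 : 2^16 ≤ M) (hN : 0 < N) (hα : 0 < α) (hΘ : 1 ≤ Θ)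
    (hnΘ : n * Θ ≤ M) (hΘM : Θ ≤ M) (hΛ : 1 ≤ Λ) (hΛM : Λ^n ≤ M) (hb : b = (M^10*N/α)^2) (hαN : M^20*N ≤ α^2)
    {a : ℝ → ℂ} {v : ℝ → ℝ} {X : Finset ℝ} {y : R3} (hX : ∀ ξ ∈ X, 0 ≤ ξ ∧ ξ < 1)
    (hrep : ∀ k ≤ n, ∀ q, ‖es a v (arc X (m*k) q) y‖^2 ≤ Θ * HH (Al n k) a v X (m*k) q y)
    (hend : ∀ q, HH (Al n n) a v X (m*n) q y ≤ b) (hGn : GG (Al n n) a v X (m*n) b y ≤ M^3*N)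
    (hpar : ∀ k < n, GG (Al n k) a v X (m*k) b y ≤ Θ * M * GG (Al n (k+1)) a v X (m*(k+1)) b y)
    (hy : α ≤ ‖es a v X y‖) :
    ∃ k, 1 ≤ k ∧ k < n ∧ SS (Al n k) a v X (m*k) b y ≤ α/2^21 ∧ GG (Al n k) a v X (m*k) b y ≤ M^6*N ∧
      N ≤ GG (Al n k) a v X (m*k) b y ∧
      Λ * GG (Al n (k+1)) a v X (m*(k+1)) b y ≤ GG (Al n k) a v X (m*k) b y := by
  have hM1 : 1 ≤ M := le_trans (by norm_num) hM16
  have hb0 : 0 < b := by rw [hb]; positivity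
  set G : ℕ → ℝ := fun i => GG (Al n i) a v X (m*i) b y with hGd
  set T : ℕ → ℝ := fun i => Λ^(n-i) * (M^3*N) with hT
  have hT4 : ∀ i, T i ≤ M^4*N := by
    intro i
    have : Λ^(n-i) ≤ M := (pow_le_pow_right₀ hΛ (Nat.sub_le _ _)).trans hΛM
    calc T i ≤ M * (M^3*N) := by simp only [hT]; gcongr
      _ = _ := by ring
  have h46 : M^4*N ≤ M^6*N := by gcongr <;> norm_num
  have hTN : ∀ i, M^3*N ≤ T i := fun i => le_mul_of_one_le_left (by positivity) (one_le_pow₀ hΛ)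
  have hN3 : N < M^3*N := by
    have h3 : 1 < M^3 := one_lt_pow₀ (lt_of_lt_of_le (by norm_num) hM16) (by norm_num)
    exact lt_mul_of_one_lt_left hN h3
  have hbN : b ≤ N := by
    rw [hb, div_pow, div_le_iff₀ (by positivity)]
    calc (M^10*N)^2 = N * (M^20*N) := by ring
      _ ≤ N * α^2 := by gcongr
  have hex : ∃ i, i ≤ n ∧ T i < G i := by
    by_contra hcon
    push Not at hcon
    have hs := core_SS hM hM16 hN hα hΘ hnΘ hb hrep hend (Nat.zero_le n)
      (fun i _ hi => ((hcon i hi).trans (hT4 i)).trans h46)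
    have hr := hrep 0 (Nat.zero_le n) 0
    unfold SS at hs
    rw [mul_zero, pow_zero, Finset.sum_range_one] at hs
    rw [mul_zero] at hr
    rw [arc_zero hX] at hr hs
    split_ifs at hs with hif
    · have : α/2^21 < α := by
        rw [div_lt_iff₀ (by norm_num)]; linarith
      linarith
    · push Not at hif
      have h5 : ‖es a v X y‖^2 ≤ Θ * b := hr.trans (by gcongr)
      have h6 : α^2 ≤ ‖es a v X y‖^2 := by gcongr
      have h7 : Θ * b ≤ M * N := by gcongr
      have h8 : M * N < M^20 * N := by
        have : M < M^20 := lt_self_pow₀ (lt_of_lt_of_le (by norm_num) hM16) (by norm_num)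
        gcongr
      linarith
  classical
  obtain ⟨i0, hi0, hi0T⟩ := hex
  set P : ℕ → Prop := fun i => T i < G i with hP
  set k := Nat.findGreatest P n with hkd
  have hk1 : P k := Nat.findGreatest_spec (P := P) hi0 hi0T
  have hk2 : k ≤ n := Nat.findGreatest_le n
  have hk3 : ∀ i, k < i → i ≤ n → G i ≤ T i := by
    intro i hi hin
    have := Nat.findGreatest_is_greatest (P := P) hi hin
    simp only [hP] at this
    exact not_lt.1 this
  have hkn : k < n := by
    rcases hk2.lt_or_eq with h | h
    · exact h
    · exfalso
      simp only [hP, hT, hGd] at hk1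
      rw [h, Nat.sub_self, pow_zero, one_mul] at hk1
      linarith
  have hk0 : 1 ≤ k := by
    rcases Nat.eq_zero_or_pos k with h | h
    · exfalso
      have h1 : G 0 ≤ b := by
        simp only [hGd]
        rw [GG_eq, mul_zero, pow_zero, Finset.sum_range_one]
        exact min_le_right _ _
      have h2 : T k < G k := hk1
      rw [h] at h2
      have := hTN 0
      linarith
    · exact h
  have hTk : T k < G k := hk1
  have hGk : G k ≤ M^6*N := by
    have h1 := hpar k hkn
    have h2 := (hk3 (k+1) (by omega) (by omega)).trans (hT4 (k+1))
    calc G k ≤ Θ * M * G (k+1) := h1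
      _ ≤ M * M * (M^4*N) := by
        have : 0 ≤ G (k+1) := GG_nonneg _ a v X _ hb0.le y
        gcongr
      _ = _ := by ring
  have hTs : T k = Λ * T (k+1) := by
    simp only [hT]
    rw [show n - k = (n-(k+1)) + 1 by omega, pow_succ]; ring
  refine ⟨k, hk0, hkn, ?_, hGk, ?_, ?_⟩
  · refine core_SS hM hM16 hN hα hΘ hnΘ hb hrep hend hk2 ?_
    intro i hi hin
    rcases hi.eq_or_lt with h | h
    · rw [← h]; exact hGk
    · exact ((hk3 i h hin).trans (hT4 i)).trans h46
  · have := hTN k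
    show N ≤ G k
    linarith
  · have h3 : G (k+1) ≤ T (k+1) := hk3 (k+1) (by omega) (by omega)
    show Λ * G (k+1) ≤ G k
    have : Λ * G (k+1) ≤ Λ * T (k+1) := by gcongr
    linarith

theorem core_arith {M N α Q Z b : ℝ} (hM : 1 ≤ M) (hN : 0 < N) (hα : 0 < α) (hQ : 0 < Q) (hZ : 0 ≤ Z) (hb : b = (M^10*N/α)^2) :
    (min b ((N/Q)^2))^3 * (Z + 2*Q^3) ≤ M^60 * (N^6/α^6*Z + 2*(N^6/α^3)) := by
  have h0 : 0 ≤ min b ((N/Q)^2) := by rw [hb]; positivity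
  have h1 : (min b ((N/Q)^2))^3 ≤ M^60 * (N^6/α^6) := by
    calc (min b ((N/Q)^2))^3 ≤ b^3 := by gcongr; exact min_le_left _ _
      _ = _ := by rw [hb]; field_simp
  have h2 : min b ((N/Q)^2) ≤ M^10*N/α*(N/Q) := by
    refine (sq_le_sq₀ h0 (by positivity)).1 ?_
    rw [mul_pow, ← hb, pow_two]
    gcongr
    · rw [hb]; positivity
    · exact min_le_left _ _
    · exact min_le_right _ _
  have h3 : (min b ((N/Q)^2))^3 * Q^3 ≤ M^60 * (N^6/α^3) := by
    calc (min b ((N/Q)^2))^3 * Q^3 ≤ (M^10*N/α*(N/Q))^3 * Q^3 := by gcongr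
      _ = M^30 * (N^6/α^3) := by field_simp
      _ ≤ _ := by gcongr <;> norm_num
  have h4 := mul_le_mul_of_nonneg_right h1 hZ
  linarith

set_option maxHeartbeats 1000000 in
theorem core {η : ℝ} (hη : 0 < η) (Kb : ℕ) : ∃ C : ℝ, 1 ≤ C ∧ ∀ m n : ℕ, 16 ≤ m → n ≤ Kb → C ≤ 2^m →
    ∀ (a : ℝ → ℂ) (v : ℝ → ℝ) (X : Finset ℝ) (N : ℝ), 2^(m*n) ≤ N → N < 2^(m*n+m) →
    (∀ ξ ∈ X, 0 ≤ ξ ∧ ξ < 1) → SepN N X → (∀ ξ ∈ X, |v ξ| ≤ (N^2)⁻¹) → (∀ ξ ∈ X, ‖a ξ‖ ≤ 1) →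
    ∀ p1 p2 p3 : ℕ, p1 + 1 < p2 → p2 + 1 < p3 → p3 < 2^16 →
    ∀ (α R1 R2 Z : ℝ), 0 < α → (2^m)^20*N ≤ α^2 → N^3 ≤ R1 → N^3 ≤ R2 → 0 ≤ Z →
    volume.real ({y | α ≤ ‖es a v X y‖ ∧ α/2^20 ≤ ‖es a v (arc X 16 p1) y‖ ∧ α/2^20 ≤ ‖es a v (arc X 16 p2) y‖ ∧
      α/2^20 ≤ ‖es a v (arc X 16 p3) y‖} ∩ bx 0 (mk3 R1 R2 Z)) ≤
      C * (2^m)^140 * N^η * (N^6/α^12*Z + N^6/α^9) * (R1 * R2) := by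
  choose C1 hC1 hrep0 using fun j : ℕ => Hf_rep (A := 4*j+4) (by omega)
  choose C2 hpar0 using fun j : ℕ => GG_par (A := 4*j+4) (by omega)
  choose C3 hC3 hlev using fun j : ℕ => lev hη (A := 4*j+4) (by omega)
  set Θ : ℝ := 1 + ∑ j ∈ Finset.range (Kb+1), (|C1 j| + |C2 j| + |C3 j|) + cjb 4 with hΘd
  have hsum : ∀ j ≤ Kb, |C1 j| + |C2 j| + |C3 j| ≤ ∑ j ∈ Finset.range (Kb+1), (|C1 j| + |C2 j| + |C3 j|) := by
    intro j hj
    exact Finset.single_le_sum (f := fun j => |C1 j| + |C2 j| + |C3 j|) (fun i _ => by positivity) (Finset.mem_range.2 (by omega))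
  have hsum0 : 0 ≤ ∑ j ∈ Finset.range (Kb+1), (|C1 j| + |C2 j| + |C3 j|) := Finset.sum_nonneg fun i _ => by positivity
  have hcj := cjb_nonneg 4
  have hΘ1 : 1 ≤ Θ := by linarith
  have k1 : ∀ j ≤ Kb, C1 j ≤ Θ := fun j hj => by
    linarith [hsum j hj, le_abs_self (C1 j), abs_nonneg (C2 j), abs_nonneg (C3 j)]
  have k2 : ∀ j ≤ Kb, C2 j ≤ Θ := fun j hj => by
    linarith [hsum j hj, le_abs_self (C2 j), abs_nonneg (C1 j), abs_nonneg (C3 j)]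
  have k3 : ∀ j ≤ Kb, C3 j ≤ Θ := fun j hj => by
    linarith [hsum j hj, le_abs_self (C3 j), abs_nonneg (C2 j), abs_nonneg (C1 j)]
  have k4 : cjb 4 ≤ Θ := by linarith
  clear_value Θ
  have hΘ0 : 0 < Θ := by linarith
  refine ⟨(Kb+1) * Θ^(Kb+3) * 2^121 , ?_, ?_⟩
  · have : 1 ≤ Θ^(Kb+3) := one_le_pow₀ hΘ1
    have h2 : (0:ℝ) ≤ Kb := by positivity
    nlinarith
  intro m n hm hn hCM a v X N hNn hNn2 hX hsep hv ha p1 p2 p3 h12 h23 hp3 α R1 R2 Z hα hαN hR1 hR2 hZ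
  set M : ℝ := 2^m with hM
  have hM16 : 2^16 ≤ M := pow_le_pow_right₀ (by norm_num) hm
  have hM1 : 1 ≤ M := le_trans (by norm_num) hM16
  have hp1 : (1:ℝ) ≤ 2^(m*n) := one_le_pow₀ (by norm_num)
  have hN1 : 1 ≤ N := hp1.trans hNn
  have hN0 : 0 < N := by linarith
  have hΘK : 1 ≤ Θ^(Kb+3) := one_le_pow₀ hΘ1
  have hKb0 : (0:ℝ) ≤ Kb := by positivity
  have hnK : (n:ℝ) ≤ Kb := by exact_mod_cast hn
  have hbig : (Kb+1) * Θ^(Kb+3) ≤ M := by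
    have : 0 ≤ (Kb+1) * Θ^(Kb+3) := by positivity
    linarith
  have hbig4 : 4*Θ ≤ M := by
    have q1 : Θ ≤ Θ^(Kb+3) := le_self_pow₀ hΘ1 (by omega)
    have q2 : Θ^(Kb+3) ≤ (Kb+1) * Θ^(Kb+3) := le_mul_of_one_le_left (by positivity) (by linarith)
    linarith
  have hΘle : Θ ≤ Θ^(Kb+3) := le_self_pow₀ hΘ1 (by omega)
  have hnΘ : n * Θ ≤ M := by
    calc n * Θ ≤ (Kb+1) * Θ^(Kb+3) := by gcongr; linarith
      _ ≤ M := hbig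
  have hΘK2 : Θ^(Kb+3) ≤ M := (le_mul_of_one_le_left (by positivity) (by linarith)).trans hbig
  have hΘM : Θ ≤ M := hΘle.trans hΘK2
  have hΛM : Θ^n ≤ M := (pow_le_pow_right₀ hΘ1 (by omega)).trans hΘK2
  have hR10 : 0 < R1 := lt_of_lt_of_le (by positivity) hR1
  have hR20 : 0 < R2 := lt_of_lt_of_le (by positivity) hR2
  set BR : Set R3 := {y | α ≤ ‖es a v X y‖ ∧ α/2^20 ≤ ‖es a v (arc X 16 p1) y‖ ∧ α/2^20 ≤ ‖es a v (arc X 16 p2) y‖ ∧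
      α/2^20 ≤ ‖es a v (arc X 16 p3) y‖} with hBR
  have hcard : (X.card : ℝ) ≤ 2 * N := by
    have := SepN.card hN0 hsep (t := 0) (δ := 1) (by norm_num) (fun ξ hξ => ⟨(hX ξ hξ).1, by linarith [(hX ξ hξ).2]⟩)
    linarith
  rcases lt_or_ge (2*N) α with hα2 | hα2
  · have : BR = ∅ := by
      ext y
      simp only [Set.mem_empty_iff_false, iff_false]
      intro hy
      have := es_norm_le (v := v) ha y
      have h1 := hy.1
      linarith
    rw [this, Set.empty_inter, measureReal_empty]
    positivity
  set b : ℝ := (M^10*N/α)^2 with hb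
  have hb0 : 0 < b := by positivity
  have hbM : M^20/4 ≤ b := by
    have : M^10/2 ≤ M^10*N/α := by
      rw [div_le_div_iff₀ (by norm_num) hα]
      calc M^10*α ≤ M^10*(2*N) := by gcongr
        _ = _ := by ring
    calc M^20/4 = (M^10/2)^2 := by ring
      _ ≤ b := by rw [hb]; gcongr
  have hX0 : ∀ ξ ∈ X, 0 ≤ ξ := fun ξ hξ => (hX ξ hξ).1
  have hvk : ∀ k ≤ n, ∀ ξ ∈ X, |v ξ| ≤ (1/2^(m*k))^2 := by
    intro k hk ξ hξ
    refine (hv ξ hξ).trans ?_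
    rw [one_div, inv_pow]
    have : (2:ℝ)^(m*k) ≤ N := (pow_le_pow_right₀ (by norm_num) (Nat.mul_le_mul_left m hk)).trans hNn
    gcongr
  have hrep : ∀ y, ∀ k ≤ n, ∀ q, ‖es a v (arc X (m*k) q) y‖^2 ≤ Θ * HH (Al n k) a v X (m*k) q y := by
    intro y k hk q
    have h1 := hrep0 (n-k) a v (arc X (m*k) q) ((q:ℝ)/2^(m*k)) (1/2^(m*k)) (by positivity) (arc_InArc hX0 (hvk k hk) q) y
    refine h1.trans ?_
    have h2 := HH_nonneg (Al n k) a v X (m*k) q y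
    exact mul_le_mul_of_nonneg_right (k1 (n-k) (by omega)) h2
  have hAln : Al n n = 4 := by unfold Al; omega
  have hHn : ∀ y q, HH (Al n n) a v X (m*n) q y ≤ M^3 := by
    intro y q
    have c1 := arc_card hN0 hsep hX0 (m*n) q
    have c2 : N * (1/2^(m*n)) ≤ M := by
      rw [mul_one_div, div_le_iff₀ (by positivity)]
      rw [pow_add] at hNn2
      linarith
    rw [hAln]
    have := Hf_le (BM_es a v (arc X (m*n) q)) (A := 4) (le_refl _) ((q:ℝ)/2^(m*n)) (1/2^(m*n)) (C := 2*M)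
      (fun x => (es_norm_le (fun ξ hξ => ha ξ (arc_sub _ _ _ hξ)) x).trans (by linarith)) y
    refine this.trans ?_
    calc (2*M)^2 * cjb 4 = M^2 * (4 * cjb 4) := by ring
      _ ≤ M^2 * M := by gcongr; linarith
      _ = _ := by ring
  have h320 : 16 * M^3 ≤ M^20 := by
    have : (16:ℝ) ≤ M^17 := by
      calc (16:ℝ) ≤ M := le_trans (by norm_num) hM16
        _ ≤ M^17 := le_self_pow₀ hM1 (by norm_num)
    calc 16*M^3 ≤ M^17*M^3 := by gcongr
      _ = _ := by ring
  have hend : ∀ y q, HH (Al n n) a v X (m*n) q y ≤ b := fun y q => (hHn y q).trans (by linarith)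
  have hGn : ∀ y, GG (Al n n) a v X (m*n) b y ≤ M^3*N := by
    intro y
    rw [GG_eq]
    calc ∑ q ∈ Finset.range (2^(m*n)), min (HH (Al n n) a v X (m*n) q y) b ≤ ∑ q ∈ Finset.range (2^(m*n)), M^3 :=
          Finset.sum_le_sum fun q _ => (min_le_left _ _).trans (hHn y q)
      _ = 2^(m*n) * (M^3) := by rw [Finset.sum_const, nsmul_eq_mul, Finset.card_range]; push_cast; ring
      _ ≤ N * (M^3) := by gcongr
      _ = _ := by ring
  have hpar : ∀ y, ∀ k < n, GG (Al n k) a v X (m*k) b y ≤ Θ * M * GG (Al n (k+1)) a v X (m*(k+1)) b y := by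
    intro y k hk
    have h1 := hpar0 (n-(k+1)) Θ (k2 _ (by omega)) a v X (m*k) m b hb0.le hX0 (hvk (k+1) (by omega)) y
    rw [Al_succ hk]
    exact h1
  set U : ℕ → Set R3 := fun k => {y | y ∈ BR ∧ (SS (Al n k) a v X (m*k) b y ≤ α/2^21 ∧ GG (Al n k) a v X (m*k) b y ≤ M^6*N ∧
      N ≤ GG (Al n k) a v X (m*k) b y ∧
      Θ * GG (Al n (k+1)) a v X (m*(k+1)) b y ≤ GG (Al n k) a v X (m*k) b y)} with hU
  have hnm : ∀ s : Finset ℝ, Measurable (fun y => ‖es a v s y‖) := fun s => (BM_es a v s).1.norm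
  have hBRm : MeasurableSet BR :=
    (measurableSet_le measurable_const (hnm _)).inter ((measurableSet_le measurable_const (hnm _)).inter
      ((measurableSet_le measurable_const (hnm _)).inter (measurableSet_le measurable_const (hnm _))))
  have hSSm : ∀ k, Measurable (fun y => SS (Al n k) a v X (m*k) b y) := by
    intro k
    unfold SS
    refine Finset.measurable_fun_sum _ fun q _ => ?_
    exact Measurable.ite (measurableSet_lt measurable_const (HH_meas _ _ _ _ _ _)) (hnm _) measurable_const
  have hUm : ∀ k, MeasurableSet (U k) := by
    intro k
    refine hBRm.inter ((measurableSet_le (hSSm k) measurable_const).inter ((measurableSet_le (GG_meas _ _ _ _ _ _) measurable_const).inter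
      ((measurableSet_le measurable_const (GG_meas _ _ _ _ _ _)).inter (measurableSet_le ((GG_meas _ _ _ _ _ _).const_mul _) (GG_meas _ _ _ _ _ _)))))
  have hcov : BR ∩ bx 0 (mk3 R1 R2 Z) ⊆ ⋃ k ∈ Finset.Ico 1 n, (U k ∩ bx 0 (mk3 R1 R2 Z)) := by
    rintro y ⟨hyB, hyb⟩
    obtain ⟨k, hk1, hkn, hk⟩ := core_pt hM hM16 hN0 hα hΘ1 hnΘ hΘM hΘ1 hΛM hb hαN hX (hrep y) (hend y) (hGn y) (hpar y) hyB.1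
    simp only [mem_iUnion]
    exact ⟨k, Finset.mem_Ico.2 ⟨hk1, hkn⟩, ⟨hyB, hk⟩, hyb⟩
  have hone : ∀ k ∈ Finset.Ico 1 n, volume.real (U k ∩ bx 0 (mk3 R1 R2 Z)) ≤
      Θ^(Kb+3) * 2^121 * M^140 * N^η * (N^6/α^12*Z + N^6/α^9) * (R1 * R2) := by
    intro k hk
    rw [Finset.mem_Ico] at hk
    have hA4 : Al n k = (4*(n-(k+1))+4) + 4 := by unfold Al; omega
    have hlk := hlev (n-(k+1)) m k hm hk.1 a v X N b hN0 ((pow_le_pow_right₀ (by norm_num) (by nlinarith)).trans hNn) hb0 hX hsep hv ha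
      p1 p2 p3 h12 h23 hp3 (U k) (α/2^20) (M^6*N) N Θ R1 R2 Z (hUm k) (by positivity) (by positivity) hN0 (k3 _ (by omega)) hR1 hR2 hZ (by
        rintro y ⟨hyB, h1, h2, h3, h4⟩
        rw [hA4] at h1 h2 h3 h4
        exact ⟨hyB.2.1, hyB.2.2.1, hyB.2.2.2, h1.trans (by rw [div_div]; norm_num), h2, h3, h4⟩)
    refine hlk.trans ?_
    have hc1 := hC3 (n-(k+1))
    have hc2 := k3 (n-(k+1)) (by omega)
    have hCk : C3 (n-(k+1))^(k+3) ≤ Θ^(Kb+3) := by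
      calc C3 (n-(k+1))^(k+3) ≤ Θ^(k+3) := by gcongr
        _ ≤ Θ^(Kb+3) := pow_le_pow_right₀ hΘ1 (by omega)
    have har := core_arith hM1 hN0 hα (Q := 2^(m*k)) (by positivity) hZ hb
    set mn := (min b ((N/2^(m*k))^2))^3 with hmn
    have hmn0 : 0 ≤ mn := by positivity
    have hNη : N^(3+η) = N^3 * N^η := by
      rw [Real.rpow_add hN0]; norm_cast
    calc C3 (n-(k+1))^(k+3) * ((2^m)^60*N^(3+η)*mn/N^6) * ((M^6*N)^3/(α/2^20)^6) * (R1 * R2 * (Z + 2 * (2^(m*k))^3))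
        ≤ Θ^(Kb+3) * ((2^m)^60*N^(3+η)*mn/N^6) * ((M^6*N)^3/(α/2^20)^6) * (R1 * R2 * (Z + 2 * (2^(m*k))^3)) := by
          gcongr
      _ = Θ^(Kb+3) * M^78 * N^η * 2^120 / α^6 * (R1 * R2) * (mn * (Z + 2 * (2^(m*k))^3)) := by
          rw [hNη, ← hM]; field_simp
      _ ≤ Θ^(Kb+3) * M^78 * N^η * 2^120 / α^6 * (R1 * R2) * (M^60 * (N^6/α^6*Z + 2*(N^6/α^3))) := by
          gcongr
      _ = Θ^(Kb+3) * 2^120 * M^138 * N^η * (N^6/α^12*Z + 2*(N^6/α^9)) * (R1 * R2) := by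
          field_simp
      _ ≤ Θ^(Kb+3) * 2^120 * M^140 * N^η * (2*(N^6/α^12*Z + N^6/α^9)) * (R1 * R2) := by
          have e1 : M^138 ≤ M^140 := pow_le_pow_right₀ hM1 (by norm_num)
          have e2 : N^6/α^12*Z + 2*(N^6/α^9) ≤ 2*(N^6/α^12*Z + N^6/α^9) := by
            have : 0 ≤ N^6/α^12*Z := by positivity
            linarith
          gcongr
      _ = _ := by ring
  calc volume.real (BR ∩ bx 0 (mk3 R1 R2 Z)) ≤ volume.real (⋃ k ∈ Finset.Ico 1 n, (U k ∩ bx 0 (mk3 R1 R2 Z))) := by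
        refine measureReal_mono hcov ?_
        exact (measure_biUnion_lt_top (Finset.finite_toSet _) (fun j _ => (measure_mono inter_subset_right).trans_lt (bx_fin _ _))).ne
    _ ≤ ∑ k ∈ Finset.Ico 1 n, volume.real (U k ∩ bx 0 (mk3 R1 R2 Z)) := measureReal_biUnion_finset_le _ _
    _ ≤ ∑ k ∈ Finset.Ico 1 n, Θ^(Kb+3) * 2^121 * M^140 * N^η * (N^6/α^12*Z + N^6/α^9) * (R1 * R2) := Finset.sum_le_sum hone
    _ = ((n-1:ℕ):ℝ) * (Θ^(Kb+3) * 2^121 * M^140 * N^η * (N^6/α^12*Z + N^6/α^9) * (R1 * R2)) := by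
        rw [Finset.sum_const, nsmul_eq_mul, Nat.card_Ico]
    _ ≤ (Kb+1) * (Θ^(Kb+3) * 2^121 * M^140 * N^η * (N^6/α^12*Z + N^6/α^9) * (R1 * R2)) := by
        have : ((n-1:ℕ):ℝ) ≤ n := by exact_mod_cast Nat.sub_le _ _
        have h0 : 0 ≤ (Θ^(Kb+3) * 2^121 * M^140 * N^η * (N^6/α^12*Z + N^6/α^9) * (R1 * R2)) := by positivity
        exact mul_le_mul_of_nonneg_right (by linarith) h0
    _ = _ := by ring

/-! ### Rescaling of arcs and the narrow/broad decomposition -/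
def rsc (t lam : ℝ) (x : R3) : R3 :=
  mk3 (lam * x 0 + (2*t*lam) * x 1 + (3*t^2*lam) * x 2) (lam^2 * x 1 + (3*t*lam^2) * x 2) (lam^3 * x 2)

theorem rsc_om (v v' : ℝ → ℝ) {t lam ξ y : ℝ} (hξ : ξ = t + lam * y) (hv : v ξ = lam^2 * v' y) (x : R3) :
    inner ℝ (om v ξ) x = inner ℝ (gam t) x + inner ℝ (om v' y) (rsc t lam x) := by
  simp only [inner3, om, gam, rsc, mk3_0, mk3_1, mk3_2, hv]
  rw [hξ]; ring

def rX (s : Finset ℝ) (l q : ℕ) : Finset ℝ := s.image (fun ξ => 2^l * ξ - q)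
def rA (a : ℝ → ℂ) (l q : ℕ) (y : ℝ) : ℂ := a ((y + q)/2^l)
def rV (v : ℝ → ℝ) (l q : ℕ) (y : ℝ) : ℝ := v ((y + q)/2^l) * (2^l)^2

theorem rback (l q : ℕ) (ξ : ℝ) : (2^l * ξ - q + q)/2^l = ξ := by
  have : (2:ℝ)^l ≠ 0 := by positivity
  field_simp; ring

theorem es_rsc (a : ℝ → ℂ) (v : ℝ → ℝ) (s : Finset ℝ) (l q : ℕ) (x : R3) :
    es a v s x = e (inner ℝ (gam ((q:ℝ)/2^l)) x) * es (rA a l q) (rV v l q) (rX s l q) (rsc ((q:ℝ)/2^l) (1/2^l) x) := by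
  have hp : (2:ℝ)^l ≠ 0 := by positivity
  unfold es rX
  rw [Finset.sum_image, Finset.mul_sum]
  · refine Finset.sum_congr rfl fun ξ hξ => ?_
    rw [rsc_om v (rV v l q) (t := (q:ℝ)/2^l) (lam := 1/2^l) (ξ := ξ) (y := 2^l*ξ-q), e_add]
    · unfold rA; rw [rback]; ring
    · field_simp; ring
    · unfold rV; rw [rback]; field_simp
  · intro ξ _ η _ h
    have h1 : (2:ℝ)^l * ξ = 2^l * η := by
      have : (2:ℝ)^l * ξ - q = 2^l * η - q := h
      linarith
    exact mul_left_cancel₀ hp h1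

theorem es_rsc_norm (a : ℝ → ℂ) (v : ℝ → ℝ) (s : Finset ℝ) (l q : ℕ) (x : R3) :
    ‖es a v s x‖ = ‖es (rA a l q) (rV v l q) (rX s l q) (rsc ((q:ℝ)/2^l) (1/2^l) x)‖ := by
  rw [es_rsc a v s l q x, norm_mul, norm_e, one_mul]

theorem rX_mem {X : Finset ℝ} (hX : ∀ ξ ∈ X, 0 ≤ ξ) {l q : ℕ} : ∀ y ∈ rX (arc X l q) l q, 0 ≤ y ∧ y < 1 := by
  intro y hy
  obtain ⟨ξ, hξ, rfl⟩ := Finset.mem_image.1 hy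
  have h := (Finset.mem_filter.1 hξ).2
  have h0 := hX ξ (Finset.mem_filter.1 hξ).1
  unfold dix at h
  have h1 := Nat.floor_le (a := 2^l*ξ) (by positivity)
  have h2 := Nat.lt_floor_add_one (2^l*ξ)
  rw [h] at h1 h2
  constructor <;> linarith

theorem rX_sep {N : ℝ} {X : Finset ℝ} (h : SepN N X) (l q : ℕ) : SepN (N/2^l) (rX X l q) := by
  intro y hy y' hy' hne
  obtain ⟨ξ, hξ, rfl⟩ := Finset.mem_image.1 hy
  obtain ⟨ξ', hξ', rfl⟩ := Finset.mem_image.1 hy'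
  have := h ξ hξ ξ' hξ' (by rintro rfl; exact hne rfl)
  have e1 : (2^l*ξ - (q:ℝ)) - (2^l*ξ' - q) = 2^l * (ξ - ξ') := by ring
  rw [e1, abs_mul, abs_of_pos (by positivity : (0:ℝ) < 2^l)]
  refine this.trans (le_of_eq ?_)
  field_simp

theorem rX_arc {X : Finset ℝ} (hX : ∀ ξ ∈ X, 0 ≤ ξ) (l q p : ℕ) (hp : p < 2^16) :
    rX (arc X (l+16) (q*2^16+p)) l q = arc (rX (arc X l q) l q) 16 p := by
  have key : ∀ ξ ∈ X, (dix ξ (l+16) = q*2^16+p ↔ dix ξ l = q ∧ dix (2^l*ξ-q) 16 = p) := by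
    intro ξ hξ
    have h0 := hX ξ hξ
    have hd : dix (2^l*ξ-(q:ℝ)) 16 = dix ξ (l+16) - q*2^16 := by
      unfold dix
      rw [← Nat.floor_sub_natCast]
      congr 1
      push_cast
      ring
    have hdiv := dix_div ξ l 16
    rw [hd]
    constructor
    · intro h
      rw [h] at hdiv ⊢
      constructor
      · rw [← hdiv]; omega
      · omega
    · rintro ⟨h1, h2⟩
      rw [h1] at hdiv
      omega
  ext y
  constructor
  · intro hy
    obtain ⟨ξ, hξ, rfl⟩ := Finset.mem_image.1 hy
    obtain ⟨h1, h2⟩ := Finset.mem_filter.1 hξ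
    obtain ⟨h3, h4⟩ := (key ξ h1).1 h2
    exact Finset.mem_filter.2 ⟨Finset.mem_image.2 ⟨ξ, Finset.mem_filter.2 ⟨h1, h3⟩, rfl⟩, h4⟩
  · intro hy
    obtain ⟨h5, h4⟩ := Finset.mem_filter.1 hy
    obtain ⟨ξ, hξ, rfl⟩ := Finset.mem_image.1 h5
    obtain ⟨h1, h3⟩ := Finset.mem_filter.1 hξ
    exact Finset.mem_image.2 ⟨ξ, Finset.mem_filter.2 ⟨h1, (key ξ h1).2 ⟨h3, h4⟩⟩, rfl⟩

theorem three_of_five (S : Finset ℕ) (h : 5 ≤ S.card) : ∃ p1 ∈ S, ∃ p2 ∈ S, ∃ p3 ∈ S, p1 + 1 < p2 ∧ p2 + 1 < p3 := by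
  set f := S.orderEmbOfFin rfl
  have hm : ∀ i, f i ∈ S := fun i => Finset.orderEmbOfFin_mem _ _ _
  have hlt : ∀ i j : Fin S.card, i < j → f i < f j := fun i j hij => f.strictMono hij
  refine ⟨f ⟨0, by omega⟩, hm _, f ⟨2, by omega⟩, hm _, f ⟨4, by omega⟩, hm _, ?_, ?_⟩
  · have h1 := hlt ⟨0, by omega⟩ ⟨1, by omega⟩ (by simp)
    have h2 := hlt ⟨1, by omega⟩ ⟨2, by omega⟩ (by simp)
    omega
  · have h1 := hlt ⟨2, by omega⟩ ⟨3, by omega⟩ (by simp)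
    have h2 := hlt ⟨3, by omega⟩ ⟨4, by omega⟩ (by simp)
    omega

/-- the broad set at an arc -/
def brd (a : ℝ → ℂ) (v : ℝ → ℝ) (X : Finset ℝ) (l q : ℕ) (α : ℝ) (p1 p2 p3 : ℕ) : Set R3 :=
  {y | α ≤ ‖es a v (arc X l q) y‖ ∧ α/2^20 ≤ ‖es a v (arc X (l+16) (q*2^16+p1)) y‖ ∧
    α/2^20 ≤ ‖es a v (arc X (l+16) (q*2^16+p2)) y‖ ∧ α/2^20 ≤ ‖es a v (arc X (l+16) (q*2^16+p3)) y‖}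

theorem broad_step (a : ℝ → ℂ) (v : ℝ → ℝ) (X : Finset ℝ) (l q : ℕ) {α : ℝ} (hα : 0 < α) {x : R3}
    (h1 : α ≤ ‖es a v (arc X l q) x‖) (h2 : ∀ p < 2^16, ‖es a v (arc X (l+16) (q*2^16+p)) x‖ < α/10) :
    ∃ p1 p2 p3 : ℕ, p1 + 1 < p2 ∧ p2 + 1 < p3 ∧ p3 < 2^16 ∧ x ∈ brd a v X l q α p1 p2 p3 := by
  set g : ℕ → ℝ := fun p => ‖es a v (arc X (l+16) (q*2^16+p)) x‖ with hg
  have hsp : ‖es a v (arc X l q) x‖ ≤ ∑ p ∈ Finset.range (2^16), g p := by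
    rw [es_split a v X l 16 q x]
    refine (norm_sum_le _ _).trans (le_of_eq ?_)
    unfold chl
    rw [Finset.sum_Ico_eq_sum_range]
    rw [show (q+1)*2^16 - q*2^16 = 2^16 by rw [Nat.add_mul]; omega]
  set S := (Finset.range (2^16)).filter (fun p => α/2^20 ≤ g p) with hS
  have hcard : 5 ≤ S.card := by
    by_contra hc
    push Not at hc
    rw [← Finset.sum_filter_add_sum_filter_not _ (fun p => α/2^20 ≤ g p)] at hsp
    have b1 : ∑ p ∈ S, g p ≤ S.card * (α/10) := by
      rw [← nsmul_eq_mul]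
      refine Finset.sum_le_card_nsmul _ _ _ fun p hp => ?_
      exact (h2 p (Finset.mem_range.1 (Finset.mem_filter.1 hp).1)).le
    have b2 : ∑ p ∈ (Finset.range (2^16)).filter (fun p => ¬ α/2^20 ≤ g p), g p ≤ (2^16:ℕ) * (α/2^20) := by
      refine (Finset.sum_le_card_nsmul _ _ (α/2^20) fun p hp => (not_le.1 (Finset.mem_filter.1 hp).2).le).trans ?_
      rw [nsmul_eq_mul]
      gcongr
      refine (Finset.card_filter_le _ _).trans ?_
      simp
    have b3 : (S.card : ℝ) ≤ 4 := by exact_mod_cast (by omega : S.card ≤ 4)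
    have b4 : (S.card : ℝ) * (α/10) ≤ 4 * (α/10) := by gcongr
    have b5 : ((2^16:ℕ):ℝ) * (α/2^20) = α/16 := by norm_num; ring
    rw [b5] at b2
    rw [← hS] at hsp
    linarith only [hsp, b1, b2, b4, h1, hα]
  obtain ⟨p1, hp1, p2, hp2, p3, hp3, h12, h23⟩ := three_of_five S hcard
  have m1 := Finset.mem_filter.1 hp1
  have m2 := Finset.mem_filter.1 hp2
  have m3 := Finset.mem_filter.1 hp3
  exact ⟨p1, p2, p3, h12, h23, Finset.mem_range.1 m3.1, h1, m1.2, m2.2, m3.2⟩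

set_option maxHeartbeats 1000000 in
theorem arc_bd {η : ℝ} (hη : 0 < η) (Kb : ℕ) : ∃ C : ℝ, 1 ≤ C ∧ ∀ m : ℕ, 16 ≤ m → C ≤ 2^m →
    ∀ (a : ℝ → ℂ) (v : ℝ → ℝ) (X : Finset ℝ) (N : ℝ), 0 < N → N < 2^(m*(Kb+1)) →
    (∀ ξ ∈ X, 0 ≤ ξ ∧ ξ < 1) → SepN N X → (∀ ξ ∈ X, |v ξ| ≤ (N^2)⁻¹) → (∀ ξ ∈ X, ‖a ξ‖ ≤ 1) →
    ∀ l q p1 p2 p3 : ℕ, q < 2^l → 2^l ≤ N → p1 + 1 < p2 → p2 + 1 < p3 → p3 < 2^16 →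
    ∀ (α R1 R2 Z : ℝ), 0 < α → (2^m)^20*(N/2^l) ≤ α^2 → N^3 ≤ R2 → R2 ≤ R1 → 0 ≤ Z → Z ≤ R2 →
    volume.real (brd a v X l q α p1 p2 p3 ∩ bx 0 (mk3 R1 R2 Z)) ≤
      C * (2^m)^140 * N^η * (N^6/α^12*Z*(1/2^l)^6 + N^6/α^9*(1/2^l)^3) * (R1 * R2) := by
  obtain ⟨C, hC, hcore⟩ := core hη Kb
  refine ⟨24 * C, by linarith, ?_⟩
  intro m hm hCm a v X N hN hNK hX hsep hv ha l q p1 p2 p3 hq hlN h12 h23 hp3 α R1 R2 Z hα hαN hR2 hR1 hZ hZ2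
  have hX0 : ∀ ξ ∈ X, 0 ≤ ξ := fun ξ hξ => (hX ξ hξ).1
  set Lp : ℝ := 2^l with hLp
  have hL1 : 1 ≤ Lp := one_le_pow₀ (by norm_num)
  have hL0 : 0 < Lp := by linarith
  set N' : ℝ := N/Lp with hN'
  have hN'1 : 1 ≤ N' := by rw [hN', le_div_iff₀ hL0]; linarith
  have hN'0 : 0 < N' := by linarith
  have hN'N : N' ≤ N := div_le_self hN.le hL1
  have hR20 : 0 < R2 := lt_of_lt_of_le (by positivity) hR2
  have hR10 : 0 < R1 := by linarith
  obtain ⟨n, hn1, hn2⟩ : ∃ n : ℕ, (2^m:ℝ)^n ≤ N' ∧ N' < (2^m)^(n+1) :=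
    exists_nat_pow_near hN'1 (one_lt_pow₀ (by norm_num) (by omega))
  rw [← pow_mul] at hn1 hn2
  have hnK : n ≤ Kb := by
    have h1 : (2:ℝ)^(m*n) < 2^(m*(Kb+1)) := lt_of_le_of_lt (hn1.trans hN'N) hNK
    have h2 := (pow_lt_pow_iff_right₀ (by norm_num : (1:ℝ) < 2)).1 h1
    have := Nat.lt_of_mul_lt_mul_left h2
    omega
  set t : ℝ := (q:ℝ)/2^l with ht
  set s : Finset ℝ := rX (arc X l q) l q with hs
  have ht0 : 0 ≤ t := by positivity
  have ht1 : t ≤ 1 := by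
    rw [ht, div_le_one (by positivity)]
    exact_mod_cast hq.le
  set lam : ℝ := 1/2^l with hlam
  have hlam0 : 0 < lam := by positivity
  have hlam1 : lam ≤ 1 := by rw [hlam, div_le_one (by positivity)]; exact hL1
  have hNl : N' = N * lam := by rw [hN', hlam]; ring
  have hc := hcore m n hm hnK (by linarith) (rA a l q) (rV v l q) s N' hn1 (by rw [Nat.mul_succ] at hn2; exact hn2)
    (rX_mem hX0) (rX_sep (hsep.mono (arc_sub _ _ _)) l q) (by
      intro y hy
      obtain ⟨ξ, hξ, rfl⟩ := Finset.mem_image.1 hy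
      unfold rV
      rw [rback, abs_mul, abs_of_pos (by positivity : (0:ℝ) < (2^l)^2)]
      have := hv ξ (arc_sub _ _ _ hξ)
      calc |v ξ| * (2^l)^2 ≤ (N^2)⁻¹ * (2^l)^2 := by gcongr
        _ = _ := by rw [hN', hLp]; field_simp) (by
      intro y hy
      obtain ⟨ξ, hξ, rfl⟩ := Finset.mem_image.1 hy
      unfold rA
      rw [rback]
      exact ha ξ (arc_sub _ _ _ hξ)) p1 p2 p3 h12 h23 hp3 α (6*lam*R1) (4*lam^2*R2) (lam^3*Z) hα hαN (by
        rw [hNl]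
        have : lam^3 ≤ lam := pow_le_of_le_one hlam0.le hlam1 (by norm_num)
        calc (N*lam)^3 = N^3 * lam^3 := by ring
          _ ≤ R1 * lam := by gcongr; linarith
          _ ≤ 6*lam*R1 := by nlinarith [mul_pos hlam0 hR10]) (by
        rw [hNl]
        have : lam^3 ≤ lam^2 := pow_le_pow_of_le_one hlam0.le hlam1 (by norm_num)
        calc (N*lam)^3 = N^3 * lam^3 := by ring
          _ ≤ R2 * lam^2 := by gcongr
          _ ≤ 4*lam^2*R2 := by nlinarith [mul_pos (pow_pos hlam0 2) hR20]) (by positivity)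
  set V := {y | α ≤ ‖es (rA a l q) (rV v l q) s y‖ ∧ α/2^20 ≤ ‖es (rA a l q) (rV v l q) (arc s 16 p1) y‖ ∧
      α/2^20 ≤ ‖es (rA a l q) (rV v l q) (arc s 16 p2) y‖ ∧
      α/2^20 ≤ ‖es (rA a l q) (rV v l q) (arc s 16 p3) y‖} ∩ bx 0 (mk3 (6*lam*R1) (4*lam^2*R2) (lam^3*Z)) with hV
  have hsub : brd a v X l q α p1 p2 p3 ∩ bx 0 (mk3 R1 R2 Z) ⊆ (rsc t lam) ⁻¹' V := by
    rintro x ⟨⟨e0, e1, e2, e3⟩, hb⟩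
    rw [es_rsc_norm a v _ l q x] at e0 e1 e2 e3
    rw [rX_arc hX0 l q _ (by omega)] at e1 e2 e3
    refine ⟨⟨e0, e1, e2, e3⟩, ?_⟩
    have b0 := hb 0
    have b1 := hb 1
    have b2 := hb 2
    simp at b0 b1 b2
    have t1 : |t * x 1| ≤ R1 := by
      rw [abs_mul, abs_of_nonneg ht0]
      nlinarith [abs_nonneg (x 1)]
    have t2 : |t * x 2| ≤ R2 := by
      rw [abs_mul, abs_of_nonneg ht0]
      nlinarith [abs_nonneg (x 2)]
    have t3 : |t^2 * x 2| ≤ R1 := by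
      rw [abs_mul, abs_of_nonneg (by positivity)]
      have : t^2 ≤ 1 := pow_le_one₀ ht0 ht1
      nlinarith [abs_nonneg (x 2)]
    intro i
    fin_cases i
    · simp [rsc]
      have : lam * x 0 + 2*t*lam * x 1 + 3*t^2*lam * x 2 = lam * (x 0 + 2*(t * x 1) + 3*(t^2 * x 2)) := by ring
      rw [this, abs_mul, abs_of_pos hlam0]
      have h3 : |x 0 + 2*(t * x 1) + 3*(t^2 * x 2)| ≤ 6*R1 := by
        rw [abs_le] at *
        constructor <;> linarith [b0.1, b0.2, t1.1, t1.2, t3.1, t3.2]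
      nlinarith
    · simp [rsc]
      have : lam^2 * x 1 + 3*t*lam^2 * x 2 = lam^2 * (x 1 + 3*(t * x 2)) := by ring
      rw [this, abs_mul, abs_of_pos (by positivity : 0 < lam^2)]
      have h3 : |x 1 + 3*(t * x 2)| ≤ 4*R2 := by
        rw [abs_le] at *
        constructor <;> linarith [b1.1, b1.2, t2.1, t2.2]
      nlinarith [pow_pos hlam0 2]
    · simp [rsc]
      rw [abs_of_pos hlam0]
      gcongr
  have hvt := vol_tri (p0 := lam) (p1 := 2*t*lam) (p2 := 3*t^2*lam) (p3 := lam^2) (p4 := 3*t*lam^2) (p5 := lam^3) (by positivity) V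
  have hvt2 : volume ((rsc t lam) ⁻¹' V) = ENNReal.ofReal |(lam*lam^2*lam^3)⁻¹| * volume V := hvt
  have hvf : volume V < ⊤ := (measure_mono Set.inter_subset_right).trans_lt (bx_fin _ _)
  have hvr : volume.real ((rsc t lam) ⁻¹' V) = (lam^6)⁻¹ * volume.real V := by
    rw [measureReal_def, hvt2, ENNReal.toReal_mul, ENNReal.toReal_ofReal (abs_nonneg _), abs_of_pos (by positivity), measureReal_def]
    congr 2; ring
  calc volume.real (brd a v X l q α p1 p2 p3 ∩ bx 0 (mk3 R1 R2 Z)) ≤ volume.real ((rsc t lam) ⁻¹' V) := by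
        refine measureReal_mono hsub ?_
        rw [hvt2]
        exact ENNReal.mul_ne_top ENNReal.ofReal_ne_top hvf.ne
    _ = (lam^6)⁻¹ * volume.real V := hvr
    _ ≤ (lam^6)⁻¹ * (C * (2^m)^140 * N'^η * (N'^6/α^12*(lam^3*Z) + N'^6/α^9) * (6*lam*R1 * (4*lam^2*R2))) := by gcongr
    _ ≤ (lam^6)⁻¹ * (C * (2^m)^140 * N^η * (N'^6/α^12*(lam^3*Z) + N'^6/α^9) * (6*lam*R1 * (4*lam^2*R2))) := by gcongr
    _ = _ := by rw [hNl]; field_simp; ring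

theorem nb_pt {a : ℝ → ℂ} {v : ℝ → ℝ} {X : Finset ℝ} {N α : ℝ} (hN : 1 ≤ N) (hX : ∀ ξ ∈ X, 0 ≤ ξ ∧ ξ < 1) (hsep : SepN N X)
    (ha : ∀ ξ ∈ X, ‖a ξ‖ ≤ 1) (hα : 0 < α) (hαN : 2^20*N ≤ α^2) {i : ℕ} (hi : N < (2^16)^(i+1)) (hi2 : (2^16)^i ≤ N)
    {x : R3} (hx : α ≤ ‖es a v X x‖) :
    ∃ j ≤ i, ∃ q < 2^(16*j), ∃ p1 p2 p3 : ℕ, p1 + 1 < p2 ∧ p2 + 1 < p3 ∧ p3 < 2^16 ∧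
      x ∈ brd a v X (16*j) q (α/10^j) p1 p2 p3 := by
  set P : ℕ → Prop := fun j => ∃ q < 2^(16*j), α/10^j ≤ ‖es a v (arc X (16*j) q) x‖ with hP
  have h0 : P 0 := ⟨0, by norm_num, by rw [mul_zero, arc_zero hX, pow_zero, div_one]; exact hx⟩
  have hend : ¬ P (i+1) := by
    rintro ⟨q, hq, h⟩
    have h1 := es_norm_le (v := v) (s := arc X (16*(i+1)) q) (fun ξ hξ => ha ξ (arc_sub _ _ _ hξ)) x
    have h2 := arc_card (by linarith) hsep (fun ξ hξ => (hX ξ hξ).1) (16*(i+1)) q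
    have h3 : N * (1/2^(16*(i+1))) ≤ 1 := by
      rw [mul_one_div, div_le_one (by positivity), pow_mul]; exact hi.le
    have h4 : α ≤ 2 * 10^(i+1) := by
      have : α/10^(i+1) ≤ 2 := by linarith
      rwa [div_le_iff₀ (by positivity)] at this
    have h5 : α^2 ≤ 4 * 100^(i+1) := by
      calc α^2 ≤ (2*10^(i+1))^2 := by gcongr
        _ = 4 * 100^(i+1) := by rw [mul_pow, ← pow_mul, mul_comm (i+1) 2, pow_mul]; norm_num
    have h6 : (100:ℝ)^(i+1) ≤ 2^16 * N := by
      calc (100:ℝ)^(i+1) ≤ (2^16)^(i+1) := by gcongr; norm_num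
        _ = 2^16 * (2^16)^i := by ring
        _ ≤ 2^16 * N := by gcongr
    linarith
  have : ∃ j ≤ i, P j ∧ ¬ P (j+1) := by
    by_contra hcon
    push Not at hcon
    have : ∀ j, j ≤ i+1 → P j := by
      intro j
      induction j with
      | zero => intro _; exact h0
      | succ j ih => intro hj; exact hcon j (by omega) (ih (by omega))
    exact hend (this _ le_rfl)
  obtain ⟨j, hj, ⟨q, hq, hqx⟩, hnot⟩ := this
  refine ⟨j, hj, q, hq, ?_⟩
  refine broad_step a v X (16*j) q (by positivity) hqx ?_
  intro p hp
  by_contra hc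
  push Not at hc
  refine hnot ⟨q*2^16+p, ?_, ?_⟩
  · have : (q+1)*2^16 ≤ 2^(16*j)*2^16 := Nat.mul_le_mul_right _ hq
    rw [Nat.mul_succ, pow_add]
    omega
  · rw [div_div, ← pow_succ] at hc
    exact hc

theorem mrU {ι : Type} (s : Finset ι) (f : ι → Set R3) (S : Set R3) (hS : volume S < ⊤) (hf : ∀ i ∈ s, f i ⊆ S) {V : Set R3}
    (hV : ∀ x ∈ V, ∃ i ∈ s, x ∈ f i) {B : ℝ} (hB : ∀ i ∈ s, volume.real (f i) ≤ B) : volume.real V ≤ s.card * B := by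
  calc volume.real V ≤ volume.real (⋃ i ∈ s, f i) := by
        refine measureReal_mono (fun x hx => ?_) ?_
        · simp only [mem_iUnion]
          obtain ⟨i, hi, h⟩ := hV x hx
          exact ⟨i, hi, h⟩
        · exact ((measure_mono (iUnion₂_subset hf)).trans_lt hS).ne
    _ ≤ ∑ i ∈ s, volume.real (f i) := measureReal_biUnion_finset_le _ _
    _ ≤ ∑ i ∈ s, B := Finset.sum_le_sum hB
    _ = _ := by rw [Finset.sum_const, nsmul_eq_mul]

theorem tr_exK (K : ℕ) : ∃ tr : Finset (ℕ × ℕ × ℕ), tr.card ≤ K*(K*K) ∧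
    ∀ p1 p2 p3, (p1,p2,p3) ∈ tr ↔ (p1+1<p2 ∧ p2+1<p3 ∧ p3<K) := by
  refine ⟨((Finset.range K) ×ˢ (Finset.range K) ×ˢ (Finset.range K)).filter
    (fun p => p.1 + 1 < p.2.1 ∧ p.2.1 + 1 < p.2.2), ?_, ?_⟩
  · refine (Finset.card_filter_le _ _).trans ?_
    rw [Finset.card_product, Finset.card_product, Finset.card_range]
  · intro p1 p2 p3
    rw [Finset.mem_filter, Finset.mem_product, Finset.mem_product, Finset.mem_range, Finset.mem_range, Finset.mem_range]
    simp only
    omega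

theorem tr_ex : ∃ tr : Finset (ℕ × ℕ × ℕ), (tr.card:ℝ) ≤ 2^48 ∧
    ∀ p1 p2 p3, (p1,p2,p3) ∈ tr ↔ (p1+1<p2 ∧ p2+1<p3 ∧ p3<2^16) := by
  obtain ⟨tr, h1, h2⟩ := tr_exK (2^16)
  refine ⟨tr, ?_, h2⟩
  have h3 : (tr.card : ℝ) ≤ ((2^16 * (2^16 * 2^16) : ℕ) : ℝ) := by exact_mod_cast h1
  refine h3.trans (by norm_num)

set_option maxHeartbeats 1000000 in
theorem thmB0 {η : ℝ} (hη : 0 < η) (Kb : ℕ) : ∃ C : ℝ, 1 ≤ C ∧ ∀ m : ℕ, 16 ≤ m → C ≤ 2^m →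
    ∀ (a : ℝ → ℂ) (v : ℝ → ℝ) (X : Finset ℝ) (N : ℝ), 1 ≤ N → N < 2^(m*(Kb+1)) →
    (∀ ξ ∈ X, 0 ≤ ξ ∧ ξ < 1) → SepN N X → (∀ ξ ∈ X, |v ξ| ≤ (N^2)⁻¹) → (∀ ξ ∈ X, ‖a ξ‖ ≤ 1) →
    ∀ (α R1 R2 Z : ℝ), 0 < α → (2^m)^20*N ≤ α^2 → N^3 ≤ R2 → R2 ≤ R1 → 0 ≤ Z → Z ≤ R2 →
    volume.real ({y | α ≤ ‖es a v X y‖} ∩ bx 0 (mk3 R1 R2 Z)) ≤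
      C * (2^m)^140 * N^η * (N^6/α^12*Z + N^6/α^9) * (R1 * R2) := by
  obtain ⟨C, hC, hc⟩ := arc_bd hη Kb
  refine ⟨2^49 * C, by linarith, ?_⟩
  intro m hm hCm a v X N hN hNK hX hsep hv ha α R1 R2 Z hα hαN hR2 hR1 hZ hZ2
  have hR20 : 0 < R2 := lt_of_lt_of_le (by positivity) hR2
  have hR10 : 0 < R1 := by linarith
  obtain ⟨i, hi1, hi2⟩ : ∃ n : ℕ, (2^16:ℝ)^n ≤ N ∧ N < (2^16)^(n+1) :=
    exists_nat_pow_near hN (by norm_num)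
  have hM16 : (2:ℝ)^16 ≤ 2^m := pow_le_pow_right₀ (by norm_num) hm
  have hM1 : (1:ℝ) ≤ 2^m := one_le_pow₀ (by norm_num)
  have hα20 : 2^20*N ≤ α^2 := by
    refine le_trans ?_ hαN
    have : (2:ℝ)^20 ≤ (2^m)^20 := by
      refine pow_le_pow_left₀ (by norm_num) ?_ _
      exact le_trans (by norm_num) hM16
    gcongr
  set D : ℝ := C * (2^m)^140 * N^η * (N^6/α^12*Z + N^6/α^9) * (R1 * R2) with hD
  have hD0 : 0 ≤ D := by positivity
  set S : Set R3 := bx 0 (mk3 R1 R2 Z) with hS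
  obtain ⟨tr, htrc, htri⟩ := tr_ex
  have hone : ∀ j ≤ i, volume.real (⋃ q ∈ Finset.range (2^(16*j)), ⋃ p ∈ tr, (brd a v X (16*j) q (α/10^j) p.1 p.2.1 p.2.2 ∩ S)) ≤
      2^48 * (1/2)^j * D := by
    intro j hj
    have hjN : (2:ℝ)^(16*j) ≤ N := by
      rw [pow_mul]
      exact (pow_le_pow_right₀ (by norm_num) hj).trans hi1
    set B : ℝ := C * (2^m)^140 * N^η * (N^6/(α/10^j)^12*Z*(1/2^(16*j))^6 + N^6/(α/10^j)^9*(1/2^(16*j))^3) * (R1 * R2) with hB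
    have hB0 : 0 ≤ B := by positivity
    have hαj : (2^m)^20*(N/2^(16*j)) ≤ (α/10^j)^2 := by
      rw [div_pow, mul_div_assoc', div_le_div_iff₀ (by positivity) (by positivity)]
      have : ((10:ℝ)^j)^2 ≤ 2^(16*j) := by
        rw [← pow_mul, mul_comm j 2, pow_mul, pow_mul]
        gcongr; norm_num
      gcongr
    have hq : ∀ q ∈ Finset.range (2^(16*j)), volume.real (⋃ p ∈ tr, (brd a v X (16*j) q (α/10^j) p.1 p.2.1 p.2.2 ∩ S)) ≤ tr.card * B := by
      intro q hq
      refine mrU tr (fun p => brd a v X (16*j) q (α/10^j) p.1 p.2.1 p.2.2 ∩ S) S (bx_fin _ _) (fun _ _ => Set.inter_subset_right) ?_ ?_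
      · intro x hx
        simp only [mem_iUnion] at hx
        obtain ⟨p, hp, hx⟩ := hx
        exact ⟨p, hp, hx⟩
      · intro p hp
        obtain ⟨hp2, hp3, hp4⟩ := (htri p.1 p.2.1 p.2.2).1 hp
        exact hc m hm (by linarith) a v X N (by linarith) hNK hX hsep hv ha (16*j) q p.1 p.2.1 p.2.2 (Finset.mem_range.1 hq) hjN hp2 hp3
          hp4 (α/10^j) R1 R2 Z (by positivity) hαj hR2 hR1 hZ hZ2
    have hall := mrU (Finset.range (2^(16*j))) (fun q => ⋃ p ∈ tr, (brd a v X (16*j) q (α/10^j) p.1 p.2.1 p.2.2 ∩ S)) S (bx_fin _ _)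
      (fun q _ => iUnion₂_subset fun _ _ => Set.inter_subset_right)
      (V := ⋃ q ∈ Finset.range (2^(16*j)), ⋃ p ∈ tr, (brd a v X (16*j) q (α/10^j) p.1 p.2.1 p.2.2 ∩ S)) (by
        intro x hx
        rw [mem_iUnion₂] at hx
        obtain ⟨q, hq, hx⟩ := hx
        exact ⟨q, hq, hx⟩) hq
    refine hall.trans ?_
    rw [Finset.card_range]
    have hBD : (2:ℝ)^(16*j) * B ≤ (1/2)^j * D := by
      have e1 : (2:ℝ)^(16*j) * B = C * (2^m)^140 * N^η * (N^6/α^12*Z*(2^16*10^12*(1/2^16)^6)^j + N^6/α^9*(2^16*10^9*(1/2^16)^3)^j) * (R1*R2) := by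
        rw [hB]
        have x1 : ((10:ℝ)^12)^j = (10^j)^12 := by rw [← pow_mul, ← pow_mul, mul_comm]
        have x2 : ((10:ℝ)^9)^j = (10^j)^9 := by rw [← pow_mul, ← pow_mul, mul_comm]
        have x3 : ((1/2^16:ℝ)^6)^j = (1/2^(16*j))^6 := by rw [pow_mul 2 16 j, ← pow_mul, mul_comm 6 j, pow_mul, div_pow, one_pow]
        have x4 : ((1/2^16:ℝ)^3)^j = (1/2^(16*j))^3 := by rw [pow_mul 2 16 j, ← pow_mul, mul_comm 3 j, pow_mul, div_pow, one_pow]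
        rw [mul_pow, mul_pow, mul_pow, mul_pow, x1, x2, x3, x4, ← pow_mul]
        field_simp
        rw [pow_mul]
      have e2 : (2^16*10^12*(1/2^16)^6:ℝ)^j ≤ (1/2)^j := pow_le_pow_left₀ (by positivity) (by norm_num) _
      have e3 : (2^16*10^9*(1/2^16)^3:ℝ)^j ≤ (1/2)^j := pow_le_pow_left₀ (by positivity) (by norm_num) _
      rw [e1, hD]
      calc C * (2^m)^140 * N^η * (N^6/α^12*Z*(2^16*10^12*(1/2^16)^6)^j + N^6/α^9*(2^16*10^9*(1/2^16)^3)^j) * (R1*R2)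
          ≤ C * (2^m)^140 * N^η * (N^6/α^12*Z*(1/2)^j + N^6/α^9*(1/2)^j) * (R1*R2) := by gcongr
        _ = _ := by ring
    calc ((2^(16*j):ℕ):ℝ) * (tr.card * B) = tr.card * (2^(16*j) * B) := by push_cast; ring
      _ ≤ 2^48 * ((1/2)^j * D) := by gcongr
      _ = _ := by ring
  have hcov : {y | α ≤ ‖es a v X y‖} ∩ S ⊆ ⋃ j ∈ Finset.range (i+1), ⋃ q ∈ Finset.range (2^(16*j)), ⋃ p ∈ tr, (brd a v X (16*j) q (α/10^j) p.1 p.2.1 p.2.2 ∩ S) := by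
    rintro x ⟨hx, hxS⟩
    obtain ⟨j, hj, q, hq, p1, p2, p3, h12, h23, hp3, hxb⟩ := nb_pt hN hX hsep ha hα hα20 hi2 hi1 hx
    rw [mem_iUnion₂]
    refine ⟨j, Finset.mem_range.2 (by omega), ?_⟩
    rw [mem_iUnion₂]
    refine ⟨q, Finset.mem_range.2 hq, ?_⟩
    rw [mem_iUnion₂]
    refine ⟨(p1, p2, p3), ?_, hxb, hxS⟩
    exact (htri p1 p2 p3).2 ⟨h12, h23, hp3⟩
  calc volume.real ({y | α ≤ ‖es a v X y‖} ∩ S)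
      ≤ volume.real (⋃ j ∈ Finset.range (i+1), ⋃ q ∈ Finset.range (2^(16*j)), ⋃ p ∈ tr, (brd a v X (16*j) q (α/10^j) p.1 p.2.1 p.2.2 ∩ S)) := by
        refine measureReal_mono hcov ?_
        refine ((measure_mono ?_).trans_lt (bx_fin 0 (mk3 R1 R2 Z))).ne
        exact iUnion₂_subset fun _ _ => iUnion₂_subset fun _ _ => iUnion₂_subset fun _ _ => Set.inter_subset_right
    _ ≤ ∑ j ∈ Finset.range (i+1), volume.real (⋃ q ∈ Finset.range (2^(16*j)), ⋃ p ∈ tr, (brd a v X (16*j) q (α/10^j) p.1 p.2.1 p.2.2 ∩ S)) :=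
        measureReal_biUnion_finset_le _ _
    _ ≤ ∑ j ∈ Finset.range (i+1), 2^48 * (1/2)^j * D :=
        Finset.sum_le_sum fun j hj => hone j (by have := Finset.mem_range.1 hj; omega)
    _ = 2^48 * D * ∑ j ∈ Finset.range (i+1), (1/2:ℝ)^j := by
        rw [Finset.mul_sum]; refine Finset.sum_congr rfl fun j _ => ?_; ring
    _ ≤ 2^48 * D * 2 := by
        gcongr
        exact sum_geometric_two_le _
    _ = _ := by rw [hD]; ring

/-! ### P23: level set theorem with `N^ε` losses -/
set_option maxHeartbeats 1000000 in
theorem thmB {ε : ℝ} (hε : 0 < ε) : ∃ C N0 : ℝ, 1 ≤ C ∧ 1 ≤ N0 ∧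
    ∀ (a : ℝ → ℂ) (v : ℝ → ℝ) (X : Finset ℝ) (N : ℝ), N0 ≤ N →
    (∀ ξ ∈ X, 0 ≤ ξ ∧ ξ < 1) → SepN N X → (∀ ξ ∈ X, |v ξ| ≤ (N^2)⁻¹) → (∀ ξ ∈ X, ‖a ξ‖ ≤ 1) →
    ∀ (α R1 R2 Z : ℝ), N^(1/2+ε) ≤ α → N^3 ≤ R2 → R2 ≤ R1 → 0 ≤ Z → Z ≤ R2 →
    volume.real ({y | α ≤ ‖es a v X y‖} ∩ bx 0 (mk3 R1 R2 Z)) ≤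
      C * N^ε * (N^6/α^12*Z + N^6/α^9) * (R1 * R2) := by
  set δ : ℝ := ε/200 with hδ
  have hδ0 : 0 < δ := by positivity
  obtain ⟨Kb, hKb⟩ := exists_nat_gt (2/δ)
  have hK2 : 2 ≤ δ*(Kb+1) := by
    rw [div_lt_iff₀ hδ0] at hKb; nlinarith
  obtain ⟨C, hC, hc⟩ := thmB0 hδ0 Kb
  set D : ℝ := C + 2^20 with hD
  have hD1 : 1 ≤ D := by rw [hD]; norm_num; linarith
  refine ⟨C * 2^140, D^(1/δ) + 1, by linarith, ?_, ?_⟩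
  · have : 0 ≤ D^(1/δ) := by positivity
    linarith
  intro a v X N hN0 hX hsep hv ha α R1 R2 Z hα hR2 hR1 hZ hZ2
  have hN1 : 1 < N := by
    have : 1 ≤ D^(1/δ) := Real.one_le_rpow hD1 (by positivity)
    linarith
  have hNp : 0 < N := by linarith
  have hDN : D ≤ N^δ := by
    have h1 : D = (D^(1/δ))^δ := by
      rw [← Real.rpow_mul (by linarith), one_div, inv_mul_cancel₀ hδ0.ne', Real.rpow_one]
    rw [h1]
    exact Real.rpow_le_rpow (by positivity) (by linarith) hδ0.le
  obtain ⟨m, hm1, hm2⟩ : ∃ m : ℕ, (2:ℝ)^m ≤ 2*N^δ ∧ N^δ ≤ 2^m := by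
    obtain ⟨n, h1, h2⟩ := exists_nat_pow_near (show 1 ≤ N^δ by linarith) (show (1:ℝ) < 2 by norm_num)
    exact ⟨n+1, by rw [pow_succ]; linarith, h2.le⟩
  have hm16 : 16 ≤ m := by
    by_contra h
    have : (2:ℝ)^m ≤ 2^16 := pow_le_pow_right₀ (by norm_num) (by omega)
    have : D ≥ 2^20 := by rw [hD]; linarith
    norm_num at *; linarith
  have hCm : C ≤ 2^m := by
    have : C ≤ D := by rw [hD]; norm_num
    linarith
  have hNK : N < 2^(m*(Kb+1)) := by
    calc N < N^2 := by nlinarith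
      _ = N^(2:ℝ) := by norm_num
      _ ≤ N^(δ*((Kb+1:ℕ):ℝ)) := Real.rpow_le_rpow_of_exponent_le hN1.le (by push_cast; exact hK2)
      _ = (N^δ)^(Kb+1) := by rw [Real.rpow_mul hNp.le, Real.rpow_natCast]
      _ ≤ (2^m)^(Kb+1) := by gcongr
      _ = _ := by rw [pow_mul]
  have hα0 : 0 < α := lt_of_lt_of_le (by positivity) hα
  have h20 : (2:ℝ)^20 ≤ N^δ := by
    refine le_trans ?_ hDN
    rw [hD]; linarith
  have hαN : (2^m)^20*N ≤ α^2 := by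
    calc ((2:ℝ)^m)^20*N ≤ (2*N^δ)^20*N := by gcongr
      _ = 2^20 * ((N^δ)^20 * N) := by ring
      _ ≤ N^δ * ((N^δ)^20 * N) := by gcongr
      _ = N^(21*δ+1) := by
          rw [Real.rpow_add hNp, Real.rpow_one, mul_comm 21 δ, Real.rpow_mul hNp.le]
          norm_cast
          ring
      _ ≤ N^((1/2+ε)*2) := Real.rpow_le_rpow_of_exponent_le hN1.le (by rw [hδ]; linarith)
      _ = (N^(1/2+ε))^2 := by rw [Real.rpow_mul hNp.le]; norm_cast
      _ ≤ α^2 := by gcongr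
  refine (hc m hm16 hCm a v X N hN1.le hNK hX hsep hv ha α R1 R2 Z hα0 hαN hR2 hR1 hZ hZ2).trans ?_
  have hR20 : 0 < R2 := lt_of_lt_of_le (by positivity) hR2
  have hR10 : 0 < R1 := by linarith
  have : C * (2^m)^140 * N^δ ≤ C * 2^140 * N^ε := by
    calc C * (2^m)^140 * N^δ ≤ C * (2*N^δ)^140 * N^δ := by gcongr
      _ = C * 2^140 * ((N^δ)^140 * N^δ) := by ring
      _ = C * 2^140 * N^(141*δ) := by
          congr 1
          rw [← pow_succ, mul_comm 141 δ, Real.rpow_mul hNp.le]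
          norm_cast
      _ ≤ C * 2^140 * N^ε := by
          gcongr
          · exact hN1.le
          · rw [hδ]; linarith
  gcongr

/-! ### P24: transference tools -/
theorem cube_bx (c : R3) (r : ℝ) : cube c r = bx (mk3 (c 0 + r/2) (c 1 + r/2) (c 2 + r/2)) (mk3 (r/2) (r/2) (r/2)) := by
  ext x
  simp only [cube, bx, Set.mem_ofPred_eq, Fin.forall_fin_succ, Fin.forall_fin_zero, Set.mem_Icc, abs_le]
  simp only [Fin.isValue, Fin.succ_zero_eq_one, Fin.succ_one_eq_two, mk3_0, mk3_1, mk3_2, and_true]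
  constructor
  · rintro ⟨⟨h1, h2⟩, ⟨h3, h4⟩, h5, h6⟩
    refine ⟨⟨by linarith, by linarith⟩, ⟨by linarith, by linarith⟩, by linarith, by linarith⟩
  · rintro ⟨⟨h1, h2⟩, ⟨h3, h4⟩, h5, h6⟩
    refine ⟨⟨by linarith, by linarith⟩, ⟨by linarith, by linarith⟩, by linarith, by linarith⟩

theorem cube_meas (c : R3) (r : ℝ) : MeasurableSet (cube c r) := by
  rw [cube_bx]; exact bx_meas _ _

theorem cube_fin (c : R3) (r : ℝ) : volume (cube c r) < ⊤ := by
  rw [cube_bx]; exact bx_fin _ _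

theorem cube_vol (c : R3) {r : ℝ} (hr : 0 ≤ r) : volume.real (cube c r) = r^3 := by
  rw [cube_bx, bx_volr]
  · simp only [mk3_0, mk3_1, mk3_2]; ring
  · intro i; fin_cases i <;> simp [mk3] <;> linarith

theorem int_bdd {Q : Set R3} (hQ : volume Q < ⊤) {f : R3 → ℂ} (hf : Measurable f) {B : ℝ} (hB : ∀ x ∈ Q, ‖f x‖ ≤ B)
    (hQm : MeasurableSet Q) {p : ℝ} (hp : 0 ≤ p) : IntegrableOn (fun x => ‖f x‖^p) Q := by
  refine Measure.integrableOn_of_bounded (M := B^p) hQ.ne ?_ ?_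
  · exact (hf.norm.pow_const p).aestronglyMeasurable
  · filter_upwards [ae_restrict_mem hQm] with x hx
    rw [Real.norm_of_nonneg (by positivity)]
    exact Real.rpow_le_rpow (norm_nonneg _) (hB x hx) hp

theorem e_hasSum (t : ℝ) : HasSum (fun k : ℕ => (2 * (Real.pi : ℂ) * Complex.I * (t : ℂ))^k / (k.factorial : ℂ)) (e t) := by
  unfold e
  rw [Complex.exp_eq_exp_ℂ]
  exact NormedSpace.expSeries_div_hasSum_exp _

set_option maxHeartbeats 1000000 in
theorem pert {Q : Set R3} (hQm : MeasurableSet Q) (hQ : volume Q < ⊤) {Ξ : Finset ℝ} {g : ℝ → R3 → ℂ}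
    (hgm : ∀ ξ, Measurable (g ξ)) (hg : ∀ ξ x, ‖g ξ x‖ ≤ 1) {y : R3 → ℝ} (hym : Measurable y)
    (hy : ∀ x ∈ Q, |y x| ≤ 1) {d : ℝ → ℝ} (hd : ∀ ξ ∈ Ξ, |d ξ| ≤ 1) {p A : ℝ} (hp : 1 ≤ p)
    (hA : ∀ a : ℝ → ℂ, (∀ ξ ∈ Ξ, ‖a ξ‖ ≤ 1) → ∫ x in Q, ‖∑ ξ ∈ Ξ, a ξ * g ξ x‖^p ≤ A)
    (a : ℝ → ℂ) (ha : ∀ ξ ∈ Ξ, ‖a ξ‖ ≤ 1) :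
    ∫ x in Q, ‖∑ ξ ∈ Ξ, a ξ * (g ξ x * e (d ξ * y x))‖^p ≤ (Real.exp (2*π))^p * A := by
  set W : ℝ := Real.exp (2*π) with hW
  have hW0 : 0 < W := Real.exp_pos _
  have hπ : 0 < π := Real.pi_pos
  have hp0 : 0 < p := by linarith
  set w : ℕ → ℝ := fun k => (2*π)^k / (k.factorial:ℝ) with hw
  have hw0 : ∀ k, 0 ≤ w k := fun k => by positivity
  have hwW : ∀ n, ∑ k ∈ Finset.range n, w k ≤ W := fun n => Real.sum_le_exp_of_nonneg (by positivity) n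
  set Fk : ℕ → R3 → ℂ := fun k x => ∑ ξ ∈ Ξ, (a ξ * (d ξ:ℂ)^k) * g ξ x with hFk
  have hak : ∀ k, ∀ ξ ∈ Ξ, ‖a ξ * (d ξ:ℂ)^k‖ ≤ 1 := by
    intro k ξ hξ
    rw [norm_mul, norm_pow, Complex.norm_real, Real.norm_eq_abs]
    exact mul_le_one₀ (ha ξ hξ) (by positivity) (pow_le_one₀ (abs_nonneg _) (hd ξ hξ))
  have hFkm : ∀ k, Measurable (Fk k) := fun k => Finset.measurable_sum _ fun ξ _ => (hgm ξ).const_mul _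
  have hFkb : ∀ k x, ‖Fk k x‖ ≤ Ξ.card := by
    intro k x
    refine (norm_sum_le _ _).trans ?_
    rw [← nsmul_one, ← Finset.sum_const]
    refine Finset.sum_le_sum fun ξ hξ => ?_
    rw [norm_mul]
    exact mul_le_one₀ (hak k ξ hξ) (norm_nonneg _) (hg ξ x)
  have hFki : ∀ k, IntegrableOn (fun x => ‖Fk k x‖^p) Q := fun k => int_bdd hQ (hFkm k) (fun x _ => hFkb k x) hQm hp0.le
  have hFkA : ∀ k, ∫ x in Q, ‖Fk k x‖^p ≤ A := fun k => hA _ (hak k)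
  have hA0 : 0 ≤ A := le_trans (integral_nonneg fun x => by positivity) (hFkA 0)
  set c : ℕ → R3 → ℂ := fun k x => (2 * (Real.pi : ℂ) * Complex.I * (y x : ℂ))^k / (k.factorial : ℂ) with hcdef
  have hcm : ∀ k, Measurable (c k) := by
    intro k
    exact (((Complex.measurable_ofReal.comp hym).const_mul _).pow_const k).div_const _
  have hcb : ∀ k, ∀ x ∈ Q, ‖c k x‖ ≤ w k := by
    intro k x hx
    simp only [hcdef, hw, norm_div, norm_pow, norm_mul, Complex.norm_I, Complex.norm_real, Complex.norm_natCast, Real.norm_eq_abs, abs_of_pos hπ, mul_one, Complex.norm_ofNat]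
    have := hy x hx
    have h3 : 2*π*|y x| ≤ 2*π := by nlinarith [abs_nonneg (y x)]
    gcongr
  set S : ℕ → R3 → ℂ := fun n x => ∑ k ∈ Finset.range n, c k x * Fk k x with hS
  have hSm : ∀ n, Measurable (S n) := fun n => Finset.measurable_sum _ fun k _ => (hcm k).mul (hFkm k)
  have hSb : ∀ n, ∀ x ∈ Q, ‖S n x‖ ≤ ∑ k ∈ Finset.range n, w k * ‖Fk k x‖ := by
    intro n x hx
    refine (norm_sum_le _ _).trans (Finset.sum_le_sum fun k _ => ?_)
    rw [norm_mul]
    exact mul_le_mul_of_nonneg_right (hcb k x hx) (norm_nonneg _)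
  have hSB : ∀ n, ∀ x ∈ Q, ‖S n x‖ ≤ W * Ξ.card := by
    intro n x hx
    refine (hSb n x hx).trans ?_
    calc ∑ k ∈ Finset.range n, w k * ‖Fk k x‖ ≤ ∑ k ∈ Finset.range n, w k * Ξ.card :=
          Finset.sum_le_sum fun k _ => mul_le_mul_of_nonneg_left (hFkb k x) (hw0 k)
      _ = (∑ k ∈ Finset.range n, w k) * Ξ.card := by rw [Finset.sum_mul]
      _ ≤ _ := by gcongr; exact hwW n
  have hSp : ∀ n, ∀ x ∈ Q, ‖S n x‖^p ≤ ∑ k ∈ Finset.range n, W^(p-1) * w k * ‖Fk k x‖^p := by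
    intro n x hx
    have h1 := Real.inner_le_weight_mul_Lp_of_nonneg (Finset.range n) hp w (fun k => ‖Fk k x‖) hw0 (fun k => norm_nonneg _)
    have h0 : 0 ≤ ∑ k ∈ Finset.range n, w k * ‖Fk k x‖^p := Finset.sum_nonneg fun k _ => mul_nonneg (hw0 k) (by positivity)
    have hs0 : 0 ≤ ∑ k ∈ Finset.range n, w k := Finset.sum_nonneg fun k _ => hw0 k
    calc ‖S n x‖^p ≤ ((∑ k ∈ Finset.range n, w k)^(1-p⁻¹) * (∑ k ∈ Finset.range n, w k * ‖Fk k x‖^p)^p⁻¹)^p :=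
          Real.rpow_le_rpow (norm_nonneg _) ((hSb n x hx).trans h1) hp0.le
      _ ≤ (W^(1-p⁻¹) * (∑ k ∈ Finset.range n, w k * ‖Fk k x‖^p)^p⁻¹)^p := by
          have : 0 ≤ 1 - p⁻¹ := by
            have := inv_le_one_of_one_le₀ hp
            linarith
          gcongr
          exact hwW n
      _ = W^(p-1) * ∑ k ∈ Finset.range n, w k * ‖Fk k x‖^p := by
          rw [Real.mul_rpow (by positivity) (by positivity), ← Real.rpow_mul hW0.le, ← Real.rpow_mul h0,
            inv_mul_cancel₀ hp0.ne', Real.rpow_one, sub_mul, inv_mul_cancel₀ hp0.ne', one_mul]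
      _ = _ := by rw [Finset.mul_sum]; refine Finset.sum_congr rfl fun k _ => ?_; ring
  have hint : ∀ n, ∫ x in Q, ‖S n x‖^p ≤ W^p * A := by
    intro n
    calc ∫ x in Q, ‖S n x‖^p ≤ ∫ x in Q, ∑ k ∈ Finset.range n, W^(p-1) * w k * ‖Fk k x‖^p := by
          refine setIntegral_mono_on (int_bdd hQ (hSm n) (hSB n) hQm hp0.le) ?_ hQm (hSp n)
          exact integrable_finsetSum _ fun k _ => (hFki k).const_mul _
      _ = ∑ k ∈ Finset.range n, W^(p-1) * w k * ∫ x in Q, ‖Fk k x‖^p := by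
          rw [integral_finsetSum _ fun k _ => (hFki k).const_mul _]
          refine Finset.sum_congr rfl fun k _ => ?_
          rw [integral_const_mul]
      _ ≤ ∑ k ∈ Finset.range n, W^(p-1) * w k * A := Finset.sum_le_sum fun k _ =>
          mul_le_mul_of_nonneg_left (hFkA k) (mul_nonneg (by positivity) (hw0 k))
      _ = W^(p-1) * (∑ k ∈ Finset.range n, w k) * A := by rw [Finset.mul_sum, Finset.sum_mul]
      _ ≤ W^(p-1) * W * A := by gcongr; exact hwW n
      _ = W^p * A := by
          rw [Real.rpow_sub_one hW0.ne']; field_simp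
  have hlim : ∀ x, Filter.Tendsto (fun n => S n x) Filter.atTop (nhds (∑ ξ ∈ Ξ, a ξ * (g ξ x * e (d ξ * y x)))) := by
    intro x
    have h1 : ∀ n, S n x = ∑ ξ ∈ Ξ, a ξ * (g ξ x * ∑ k ∈ Finset.range n, (2 * (Real.pi : ℂ) * Complex.I * ((d ξ * y x : ℝ) : ℂ))^k / (k.factorial : ℂ)) := by
      intro n
      simp only [hS, hcdef, hFk, Finset.mul_sum]
      rw [Finset.sum_comm]
      refine Finset.sum_congr rfl fun ξ _ => Finset.sum_congr rfl fun k _ => ?_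
      rw [Complex.ofReal_mul, show 2 * (Real.pi : ℂ) * Complex.I * ((d ξ:ℂ) * (y x:ℂ)) = (d ξ:ℂ) * (2 * (Real.pi : ℂ) * Complex.I * (y x:ℂ)) by ring, mul_pow]
      ring
    simp only [h1]
    refine tendsto_finsetSum _ fun ξ _ => ?_
    exact ((e_hasSum (d ξ * y x)).tendsto_sum_nat.const_mul _).const_mul _
  have hT : Filter.Tendsto (fun n => ∫ x in Q, ‖S n x‖^p) Filter.atTop (nhds (∫ x in Q, ‖∑ ξ ∈ Ξ, a ξ * (g ξ x * e (d ξ * y x))‖^p)) := by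
    refine tendsto_integral_of_dominated_convergence (fun _ => (W * Ξ.card)^p) ?_ ?_ ?_ ?_
    · intro n; exact ((hSm n).norm.pow_const p).aestronglyMeasurable
    · exact integrableOn_const hQ.ne
    · intro n
      filter_upwards [ae_restrict_mem hQm] with x hx
      rw [Real.norm_of_nonneg (by positivity)]
      exact Real.rpow_le_rpow (norm_nonneg _) (hSB n x hx) hp0.le
    · refine Filter.Eventually.of_forall fun x => ?_
      exact (Real.continuous_rpow_const hp0.le).continuousAt.tendsto.comp (hlim x).norm
  exact le_of_tendsto' hT hint

/-! ### P25: periodic packing, layer cake -/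
theorem tr_vol (V : Set R3) (t : R3) : volume.real ((fun x => x - t) ⁻¹' V) = volume.real V := by
  unfold Measure.real
  congr 1
  simp only [sub_eq_add_neg]
  exact measure_preimage_add_right _ _ _

theorem pack {G : R3 → ℂ} (hG : Measurable G) {L ρ : ℝ} (hρ : 0 < ρ) (hL : ρ < L)
    (hper : ∀ (i j : ℕ) x, G (x - mk3 (i*L) (j*L) 0) = G x) (α : ℝ) (k : ℕ) :
    (k:ℝ)^2 * volume.real ({y | α ≤ ‖G y‖} ∩ cube 0 ρ) ≤ volume.real ({y | α ≤ ‖G y‖} ∩ bx 0 (mk3 (k*L) (k*L) ρ)) := by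
  set V : Set R3 := {y | α ≤ ‖G y‖} ∩ cube 0 ρ with hV
  have hVm : MeasurableSet V := (measurableSet_le measurable_const hG.norm).inter (cube_meas _ _)
  set T : ℕ × ℕ → Set R3 := fun q => (fun x => x - mk3 (q.1*L) (q.2*L) 0) ⁻¹' V with hT
  have hTm : ∀ q, MeasurableSet (T q) := fun q => hVm.preimage (measurable_id.sub_const _)
  have hmem : ∀ q x, x ∈ T q → α ≤ ‖G x‖ ∧ (q.1*L ≤ x 0 ∧ x 0 ≤ q.1*L+ρ) ∧ (q.2*L ≤ x 1 ∧ x 1 ≤ q.2*L+ρ) ∧ (0 ≤ x 2 ∧ x 2 ≤ ρ) := by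
    rintro ⟨i, j⟩ x ⟨h1, h2⟩
    have h0 := h2 0
    have h3 := h2 1
    have h4 := h2 2
    simp only [PiLp.sub_apply, mk3_0, mk3_1, mk3_2, PiLp.zero_apply, Set.mem_Icc] at h0 h3 h4
    have h1' : α ≤ ‖G (x - mk3 (i*L) (j*L) 0)‖ := h1
    rw [hper] at h1'
    refine ⟨h1', ⟨by simp only; linarith, by simp only; linarith⟩, ⟨by simp only; linarith, by simp only; linarith⟩, by linarith, by linarith⟩
  have hone : ∀ (i j : ℕ) (z : ℝ), i*L ≤ z → z ≤ i*L+ρ → j*L ≤ z → z ≤ j*L+ρ → i ≤ j := by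
    intro i j z h1 h2 h3 h4
    by_contra h
    have : (j:ℝ)+1 ≤ i := by exact_mod_cast (show j+1 ≤ i by omega)
    nlinarith
  have hdis : Set.PairwiseDisjoint (↑((Finset.range k) ×ˢ (Finset.range k)) : Set (ℕ × ℕ)) T := by
    intro q _ q' _ hne
    rw [Function.onFun, Set.disjoint_left]
    intro x hx hx'
    obtain ⟨-, ⟨a1, a2⟩, ⟨a3, a4⟩, -⟩ := hmem q x hx
    obtain ⟨-, ⟨b1, b2⟩, ⟨b3, b4⟩, -⟩ := hmem q' x hx'
    apply hne
    refine Prod.ext ?_ ?_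
    · exact le_antisymm (hone _ _ _ a1 a2 b1 b2) (hone _ _ _ b1 b2 a1 a2)
    · exact le_antisymm (hone _ _ _ a3 a4 b3 b4) (hone _ _ _ b3 b4 a3 a4)
  have hVf : volume V < ⊤ := (measure_mono Set.inter_subset_right).trans_lt (cube_fin 0 ρ)
  have hTf : ∀ q, volume (T q) ≠ ⊤ := by
    intro q
    simp only [hT, sub_eq_add_neg]
    rw [measure_preimage_add_right]
    exact hVf.ne
  have hsum : volume.real (⋃ q ∈ (Finset.range k) ×ˢ (Finset.range k), T q) = (k:ℝ)^2 * volume.real V := by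
    rw [measureReal_biUnion_finset hdis (fun q _ => hTm q) (fun q _ => hTf q)]
    simp only [hT, tr_vol]
    rw [Finset.sum_const, Finset.card_product, Finset.card_range, nsmul_eq_mul]
    push_cast; ring
  rw [← hsum]
  refine measureReal_mono ?_ ((measure_mono Set.inter_subset_right).trans_lt (bx_fin _ _)).ne
  refine iUnion₂_subset fun q hq x hx => ?_
  obtain ⟨a0, ⟨a1, a2⟩, ⟨a3, a4⟩, a5, a6⟩ := hmem q x hx
  have hq1 := Finset.mem_range.1 (Finset.mem_product.1 hq).1
  have hq2 := Finset.mem_range.1 (Finset.mem_product.1 hq).2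
  have hq1' : (q.1:ℝ)+1 ≤ k := by exact_mod_cast hq1
  have hq2' : (q.2:ℝ)+1 ≤ k := by exact_mod_cast hq2
  have hL0 : 0 < L := by linarith
  have c1 : 0 ≤ (q.1:ℝ)*L := by positivity
  have c2 : 0 ≤ (q.2:ℝ)*L := by positivity
  refine ⟨a0, ?_⟩
  intro i
  fin_cases i
  · simp only [Fin.zero_eta, Fin.isValue, PiLp.zero_apply, mk3_0, sub_zero, abs_le]
    constructor <;> nlinarith
  · simp only [Fin.mk_one, Fin.isValue, PiLp.zero_apply, mk3_1, sub_zero, abs_le]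
    constructor <;> nlinarith
  · simp only [Fin.reduceFinMk, Fin.isValue, PiLp.zero_apply, mk3_2, sub_zero, abs_le]
    constructor <;> linarith

theorem layer {Q : Set R3} (hQm : MeasurableSet Q) (hQ : volume Q < ⊤) {G : R3 → ℂ} (hG : Measurable G) {α0 : ℝ} (hα : 0 < α0)
    {J : ℕ} (hJ : ∀ x ∈ Q, ‖G x‖ < 2^J * α0) {p : ℝ} (hp : 0 ≤ p) :
    ∫ x in Q, ‖G x‖^p ≤ α0^p * volume.real Q + ∑ j ∈ Finset.range J, (2*(2^j*α0))^p * volume.real ({y | 2^j*α0 ≤ ‖G y‖} ∩ Q) := by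
  have hEm : ∀ j : ℕ, MeasurableSet {y | 2^j*α0 ≤ ‖G y‖} := fun j => measurableSet_le measurable_const hG.norm
  have hii : ∀ j : ℕ, IntegrableOn (fun x => Set.indicator {y | 2^j*α0 ≤ ‖G y‖} (fun _ => (2*(2^j*α0))^p) x) Q := fun j =>
    (integrableOn_const hQ.ne).indicator (hEm j)
  calc ∫ x in Q, ‖G x‖^p ≤ ∫ x in Q, (α0^p + ∑ j ∈ Finset.range J, Set.indicator {y | 2^j*α0 ≤ ‖G y‖} (fun _ => (2*(2^j*α0))^p) x) := by
        refine setIntegral_mono_on (int_bdd hQ hG (fun x hx => (hJ x hx).le) hQm hp) ?_ hQm ?_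
        · exact (integrableOn_const hQ.ne).add (integrable_finsetSum _ fun j _ => hii j)
        · intro x hx
          have hn : ∀ j ∈ Finset.range J, 0 ≤ Set.indicator {y | 2^j*α0 ≤ ‖G y‖} (fun _ => (2*(2^j*α0))^p) x :=
            fun j _ => Set.indicator_nonneg (fun _ _ => by positivity) x
          by_cases hx0 : ‖G x‖ < α0
          · have := Finset.sum_nonneg hn
            have h2 := Real.rpow_le_rpow (norm_nonneg (G x)) hx0.le hp
            linarith
          · push Not at hx0
            obtain ⟨j, h1, h2⟩ := exists_nat_pow_near (show 1 ≤ ‖G x‖/α0 by rwa [le_div_iff₀ hα, one_mul]) (show (1:ℝ) < 2 by norm_num)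
            rw [le_div_iff₀ hα] at h1
            rw [div_lt_iff₀ hα, pow_succ] at h2
            have hjJ : j < J := by
              by_contra h
              push Not at h
              have h3 : (2:ℝ)^J ≤ 2^j := pow_le_pow_right₀ (by norm_num) h
              have := hJ x hx
              nlinarith
            have h4 := Finset.single_le_sum hn (Finset.mem_range.2 hjJ)
            rw [Set.indicator_of_mem (show x ∈ {y | 2^j*α0 ≤ ‖G y‖} from h1)] at h4
            have h5 : ‖G x‖^p ≤ (2*(2^j*α0))^p := Real.rpow_le_rpow (norm_nonneg _) (by linarith) hp
            have : 0 ≤ α0^p := by positivity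
            linarith
    _ = _ := by
        have hc0 : Integrable (fun _ : R3 => α0^p) (volume.restrict Q) := integrableOn_const hQ.ne
        rw [integral_add hc0 (integrable_finsetSum _ fun j _ => hii j), integral_finsetSum _ fun j _ => hii j]
        congr 1
        · rw [setIntegral_const, smul_eq_mul, mul_comm]
        · refine Finset.sum_congr rfl fun j _ => ?_
          rw [setIntegral_indicator (hEm j), setIntegral_const, smul_eq_mul, mul_comm, Set.inter_comm]

theorem arith1 {N α p : ℝ} (hN : 1 ≤ N) (hα : N^(1/2:ℝ) ≤ α) (hp : p ≤ 12) : α^p * (N^6/α^12) ≤ N^(p/2) := by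
  have hN0 : 0 < N := by linarith
  have hα0 : 0 < α := lt_of_lt_of_le (by positivity) hα
  have h1 : α^p * (N^6/α^12) = α^(p-12) * N^6 := by
    rw [Real.rpow_sub hα0]; norm_cast; ring
  rw [h1]
  calc α^(p-12) * N^6 ≤ (N^(1/2:ℝ))^(p-12) * N^6 :=
        mul_le_mul_of_nonneg_right (Real.rpow_le_rpow_of_nonpos (by positivity) hα (by linarith)) (by positivity)
    _ = N^(p/2) := by
        rw [← Real.rpow_mul hN0.le, ← Real.rpow_natCast N 6, ← Real.rpow_add hN0]
        congr 1; push_cast; ring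

theorem arith2 {N α p ρ : ℝ} (hN : 1 ≤ N) (hα : N^(1/2:ℝ) ≤ α) (hα2 : α ≤ 2*N) (hp : p ≤ 12) (hρ : N^2 ≤ ρ) (hρ2 : N^(p/2-3) ≤ ρ) :
    α^p * (N^6/α^9) ≤ 8 * N^(p/2) * ρ := by
  have hN0 : 0 < N := by linarith
  have hρ0 : 0 < ρ := lt_of_lt_of_le (by positivity) hρ
  have hα0 : 0 < α := lt_of_lt_of_le (by positivity) hα
  have h1 : α^p * (N^6/α^9) = α^(p-9) * N^6 := by
    rw [Real.rpow_sub hα0]; norm_cast; ring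
  rw [h1]
  rcases le_total p 9 with h9 | h9
  · calc α^(p-9) * N^6 ≤ (N^(1/2:ℝ))^(p-9) * N^6 :=
        mul_le_mul_of_nonneg_right (Real.rpow_le_rpow_of_nonpos (by positivity) hα (by linarith)) (by positivity)
      _ = N^(p/2+3/2) := by
          rw [← Real.rpow_mul hN0.le, ← Real.rpow_natCast N 6, ← Real.rpow_add hN0]
          congr 1; push_cast; ring
      _ ≤ N^(p/2+2) := Real.rpow_le_rpow_of_exponent_le hN (by linarith)
      _ = N^(p/2) * N^2 := by rw [Real.rpow_add hN0]; norm_cast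
      _ ≤ N^(p/2) * ρ := by gcongr
      _ ≤ _ := by
        have : 0 ≤ N^(p/2) * ρ := by positivity
        linarith
  · calc α^(p-9) * N^6 ≤ (2*N)^(p-9) * N^6 := by gcongr
      _ = 2^(p-9) * (N^(p-9) * N^6) := by rw [Real.mul_rpow (by norm_num) hN0.le]; ring
      _ ≤ 2^(3:ℝ) * (N^(p-9) * N^6) := by gcongr <;> linarith
      _ = 8 * (N^(p/2) * N^(p/2-3)) := by
          rw [← Real.rpow_natCast N 6, ← Real.rpow_add hN0, ← Real.rpow_add hN0]
          congr 1
          · norm_num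
          · congr 1; push_cast; ring
      _ ≤ 8 * (N^(p/2) * ρ) := by gcongr
      _ = _ := by ring

/-! ### P26: base estimate for periodic sums -/
theorem e_int (n : ℤ) : e n = 1 := by
  unfold e
  rw [Complex.exp_eq_one_iff]
  exact ⟨n, by push_cast; ring⟩

theorem es_per {a : ℝ → ℂ} {v : ℝ → ℝ} {X : Finset ℝ} {L : ℝ}
    (hX : ∀ ξ ∈ X, ∃ n1 n2 : ℤ, ξ*L = n1 ∧ (ξ^2+v ξ)*L = n2) (i j : ℕ) (x : R3) :
    es a v X (x - mk3 (i*L) (j*L) 0) = es a v X x := by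
  unfold es
  refine Finset.sum_congr rfl fun ξ hξ => ?_
  obtain ⟨n1, n2, h1, h2⟩ := hX ξ hξ
  have h3 : inner ℝ (om v ξ) x = inner ℝ (om v ξ) (x - mk3 (i*L) (j*L) 0) + ((i*n1+j*n2 : ℤ):ℝ) := by
    rw [inner_sub_right, inner3 (om v ξ) (mk3 _ _ _)]
    simp only [om, mk3_0, mk3_1, mk3_2]
    push_cast
    rw [← h1, ← h2]; ring
  rw [h3, e_add, e_int, mul_one]

set_option maxHeartbeats 1000000 in
theorem base {ε : ℝ} (hε : 0 < ε) : ∃ C N0 : ℝ, 1 ≤ C ∧ 1 ≤ N0 ∧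
    ∀ (v : ℝ → ℝ) (X : Finset ℝ) (N ρ L p : ℝ), N0 ≤ N → 1 ≤ ρ → N^2 ≤ 4*ρ → N^(p/2-3) ≤ 8 * ρ → 0 ≤ p → p ≤ 12 → 6*ρ ≤ L → L ≤ 7*ρ →
    (∀ ξ ∈ X, 0 ≤ ξ ∧ ξ < 1) → SepN N X → (∀ ξ ∈ X, |v ξ| ≤ (N^2)⁻¹) →
    (∀ ξ ∈ X, ∃ n1 n2 : ℤ, ξ*L = n1 ∧ (ξ^2+v ξ)*L = n2) →
    ∀ a : ℝ → ℂ, (∀ ξ ∈ X, ‖a ξ‖ ≤ 1) →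
    ∫ x in cube 0 ρ, ‖es a v X x‖^p ≤ C * N^(p/2+ε) * ρ^3 := by
  set δ : ℝ := ε/20 with hδ
  have hδ0 : 0 < δ := by positivity
  obtain ⟨C, N0, hC, hN0, hB⟩ := thmB hδ0
  set D : ℝ := 2*2^δ/δ+1 with hD
  have hD0 : 1 ≤ D := by
    have : 0 ≤ 2*2^δ/δ := by positivity
    rw [hD]; linarith
  refine ⟨1 + D * (2^12*C*65*49), N0, ?_, hN0, ?_⟩
  · have : 0 ≤ D * (2^12*C*65*49) := by positivity
    linarith
  intro v X N ρ L p hN hρ1 hρ hρp hp0 hp hL1 hL2 hX hsep hv hper a ha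
  have hN1 : 1 ≤ N := by linarith
  have hNp : 0 < N := by linarith
  have hG := (BM_es a v X).1
  set α0 : ℝ := N^(1/2+δ) with hα0
  have hα1 : 1 ≤ α0 := Real.one_le_rpow hN1 (by linarith)
  have hcard : ∀ x, ‖es a v X x‖ ≤ 2*N := by
    intro x
    have h1 := es_norm_le (v := v) ha x
    have h2 : (X.card:ℝ) ≤ N*1+1 := SepN.card (δ := 1) (t := 0) hNp hsep (by norm_num) (fun ξ hξ => by have := hX ξ hξ; constructor <;> linarith)
    linarith
  obtain ⟨n, hn1, hn2⟩ := exists_nat_pow_near (show 1 ≤ 2*N by linarith) (show (1:ℝ) < 2 by norm_num)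
  have hJ : ((n+1:ℕ):ℝ) ≤ D * N^δ := by
    have h1 : n * Real.log 2 ≤ Real.log (2*N) := by
      rw [← Real.log_pow]
      exact Real.log_le_log (by positivity) hn1
    have h2 : Real.log (2*N) ≤ (2*N)^δ/δ := Real.log_le_rpow_div (by positivity) hδ0
    have h3 : 1/2 ≤ Real.log 2 := by have := Real.log_two_gt_d9; linarith
    have h4 : (n:ℝ) * (1/2) ≤ n * Real.log 2 := by gcongr
    have h5 : 1 ≤ N^δ := Real.one_le_rpow hN1 hδ0.le
    rw [Real.mul_rpow (by norm_num) hNp.le] at h2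
    push_cast
    rw [hD]
    have h6 : (2*2^δ/δ+1) * N^δ = 2*(2^δ*N^δ/δ) + N^δ := by ring
    rw [h6]; linarith
  have hlay := layer (J := n+1) (cube_meas 0 ρ) (cube_fin 0 ρ) hG (α0 := α0) (by linarith) (p := p) (by
    intro x _
    have := hcard x
    have h2 : (2:ℝ)^(n+1) * 1 ≤ 2^(n+1)*α0 := by gcongr
    linarith) hp0
  refine hlay.trans ?_
  rw [cube_vol 0 (by linarith)]
  have hfirst : α0^p * ρ^3 ≤ N^(p/2+ε) * ρ^3 := by
    gcongr
    rw [hα0, ← Real.rpow_mul hNp.le]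
    refine Real.rpow_le_rpow_of_exponent_le hN1 ?_
    rw [hδ]; nlinarith
  have hterm : ∀ j ∈ Finset.range (n+1), (2*(2^j*α0))^p * volume.real ({y | 2^j*α0 ≤ ‖es a v X y‖} ∩ cube 0 ρ) ≤
      2^12*C*65*49 * N^(p/2+δ) * ρ^3 := by
    intro j _
    set α : ℝ := 2^j*α0 with hα
    have hα0α : α0 ≤ α := by
      have : (1:ℝ) ≤ 2^j := one_le_pow₀ (by norm_num)
      rw [hα]; nlinarith
    have hαp : 0 < α := by linarith
    by_cases h2N : α ≤ 2*N
    · have hk1 : N^3 ≤ ⌈N^3⌉₊ := Nat.le_ceil _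
      set k : ℕ := ⌈N^3⌉₊ with hk
      have hN3 : 1 ≤ N^3 := one_le_pow₀ hN1
      have hk0 : (0:ℝ) < k := by linarith
      have hpk := pack hG (show 0 < ρ by linarith) (show ρ < L by linarith) (es_per hper) α k
      have hL0 : 1 ≤ L := by linarith
      have hkL : N^3 ≤ k*L := by nlinarith
      have hkL2 : ρ ≤ k*L := by nlinarith
      have hvol := hB a v X N hN hX hsep hv ha α (k*L) (k*L) ρ hα0α hkL le_rfl (by linarith) hkL2
      have hv2 : volume.real ({y | α ≤ ‖es a v X y‖} ∩ cube 0 ρ) ≤ C * N^δ * (N^6/α^12*ρ + N^6/α^9) * (7*ρ)^2 := by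
        have h1 := hpk.trans hvol
        have h2 : (k:ℝ)^2 * volume.real ({y | α ≤ ‖es a v X y‖} ∩ cube 0 ρ) ≤ (k:ℝ)^2 * (C * N^δ * (N^6/α^12*ρ + N^6/α^9) * L^2) := by
          refine h1.trans (le_of_eq ?_); ring
        have h3 := le_of_mul_le_mul_left h2 (by positivity)
        refine h3.trans ?_
        gcongr
      have hα12 : N^(1/2:ℝ) ≤ α := by
        refine le_trans ?_ hα0α
        exact Real.rpow_le_rpow_of_exponent_le hN1 (by linarith)
      have a1 := arith1 hN1 hα12 hp
      have a2 := arith2 (ρ := 8*ρ) hN1 hα12 h2N hp (by linarith) hρp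
      calc (2*α)^p * volume.real ({y | α ≤ ‖es a v X y‖} ∩ cube 0 ρ)
          ≤ (2*α)^p * (C * N^δ * (N^6/α^12*ρ + N^6/α^9) * (7*ρ)^2) := by gcongr
        _ = 2^p * (C * N^δ * (α^p*(N^6/α^12)*ρ + α^p*(N^6/α^9)) * (7*ρ)^2) := by
            rw [Real.mul_rpow (by norm_num) hαp.le]; ring
        _ ≤ 2^(12:ℝ) * (C * N^δ * (N^(p/2)*ρ + 8 * N^(p/2) * (8*ρ)) * (7*ρ)^2) := by
            gcongr
            norm_num
        _ = 2^12*C*65*49 * (N^(p/2)*N^δ) * ρ^3 := by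
            norm_cast; ring
        _ = _ := by rw [← Real.rpow_add hNp]
    · have : {y | α ≤ ‖es a v X y‖} ∩ cube 0 ρ = ∅ := by
        rw [Set.eq_empty_iff_forall_notMem]
        rintro x ⟨hx, -⟩
        exact h2N (le_trans hx (hcard x))
      rw [this, measureReal_empty, mul_zero]
      positivity
  have hsum := Finset.sum_le_sum hterm
  rw [Finset.sum_const, Finset.card_range, nsmul_eq_mul] at hsum
  have hlast : ((n+1:ℕ):ℝ) * (2^12*C*65*49 * N^(p/2+δ) * ρ^3) ≤ D * (2^12*C*65*49) * N^(p/2+ε) * ρ^3 := by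
    calc ((n+1:ℕ):ℝ) * (2^12*C*65*49 * N^(p/2+δ) * ρ^3) ≤ (D*N^δ) * (2^12*C*65*49 * N^(p/2+δ) * ρ^3) := by gcongr
      _ = D * (2^12*C*65*49) * (N^δ*N^(p/2+δ)) * ρ^3 := by ring
      _ = D * (2^12*C*65*49) * N^(δ+(p/2+δ)) * ρ^3 := by rw [← Real.rpow_add hNp]
      _ ≤ _ := by
        have hexp : N^(δ+(p/2+δ)) ≤ N^(p/2+ε) := Real.rpow_le_rpow_of_exponent_le hN1 (by rw [hδ]; linarith)
        gcongr
  have hfin : (1 + D * (2^12*C*65*49)) * N^(p/2+ε) * ρ^3 = N^(p/2+ε) * ρ^3 + D * (2^12*C*65*49) * N^(p/2+ε) * ρ^3 := by ring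
  rw [hfin]
  linarith

/-! ### P27: one cube -/
theorem tau_ex {ρ : ℝ} (hρ : 1 ≤ ρ) : ∃ (L : ℝ) (τ : ℝ → ℝ) (v : ℝ → ℝ), 6*ρ ≤ L ∧ L ≤ 7*ρ ∧
    (∀ t, |v t| ≤ L⁻¹ ∧ ∃ n : ℤ, (t^2+v t)*L = n) ∧
    (∀ ξ, 0 ≤ ξ → ξ ≤ 1 → 0 ≤ τ ξ ∧ τ ξ < 1 ∧ |ξ - τ ξ| ≤ L⁻¹ ∧ ∃ n : ℤ, τ ξ * L = n) := by
  set L : ℕ := ⌈6*ρ⌉₊ with hL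
  have h1 : 6*ρ ≤ L := Nat.le_ceil _
  have h2 : (L:ℝ) < 6*ρ+1 := Nat.ceil_lt_add_one (by linarith)
  have hL0 : (0:ℝ) < L := by linarith
  refine ⟨L, fun ξ => ((min ⌊L*ξ⌋ ((L:ℤ)-1) : ℤ):ℝ)/L, fun t => (⌊L*t^2⌋:ℝ)/L - t^2, h1, by linarith, ?_, ?_⟩
  · intro t
    constructor
    · have h3 := Int.floor_le (L*t^2)
      have h4 := Int.lt_floor_add_one (L*t^2)
      have h5 : (⌊L*t^2⌋:ℝ)/L - t^2 = (⌊L*t^2⌋ - L*t^2) * (L:ℝ)⁻¹ := by field_simp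
      show |(⌊L*t^2⌋:ℝ)/L - t^2| ≤ _
      rw [h5, abs_mul, abs_of_pos (inv_pos.2 hL0)]
      have : |(⌊L*t^2⌋:ℝ) - L*t^2| ≤ 1 := by rw [abs_le]; constructor <;> linarith
      have h6 := inv_pos.2 hL0
      nlinarith
    · exact ⟨⌊L*t^2⌋, by field_simp; ring⟩
  · intro ξ hξ0 hξ1
    have h3 := Int.floor_le (L*ξ)
    have h4 := Int.lt_floor_add_one (L*ξ)
    have h30 : 0 ≤ ⌊(L:ℝ)*ξ⌋ := Int.floor_nonneg.2 (by positivity)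
    have hL1 : (1:ℤ) ≤ L := by
      have : (0:ℤ) < L := by exact_mod_cast hL0
      omega
    set n : ℤ := min ⌊L*ξ⌋ ((L:ℤ)-1) with hn
    have hn0 : 0 ≤ n := by rw [hn]; omega
    have hn1 : n + 1 ≤ L := by rw [hn]; omega
    have hn0' : (0:ℝ) ≤ n := by exact_mod_cast hn0
    have hn1' : (n:ℝ)+1 ≤ L := by exact_mod_cast hn1
    have hnξ : (n:ℝ) ≤ L*ξ := by
      have : (n:ℝ) ≤ ⌊L*ξ⌋ := by exact_mod_cast min_le_left _ _
      linarith
    have hξn : L*ξ ≤ n+1 := by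
      rcases min_choice ⌊(L:ℝ)*ξ⌋ ((L:ℤ)-1) with h | h
      · rw [← hn] at h; rw [h]; linarith
      · rw [← hn] at h; rw [h]; push_cast; nlinarith
    show 0 ≤ (n:ℝ)/L ∧ (n:ℝ)/L < 1 ∧ |ξ - (n:ℝ)/L| ≤ _ ∧ ∃ k : ℤ, (n:ℝ)/L * L = k
    refine ⟨by positivity, by rw [div_lt_one hL0]; linarith, ?_, n, by field_simp⟩
    have h5 : ξ - n/L = (L*ξ-n)*(L:ℝ)⁻¹ := by field_simp
    rw [h5, abs_mul, abs_of_pos (inv_pos.2 hL0), abs_of_nonneg (by linarith)]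
    have h6 := inv_pos.2 hL0
    nlinarith

set_option maxHeartbeats 1000000 in
theorem onecube {ε : ℝ} (hε : 0 < ε) : ∃ C N0 : ℝ, 1 ≤ C ∧ 1 ≤ N0 ∧
    ∀ (Ξ : Finset ℝ) (N ρ p : ℝ), N0 ≤ N → N^2 ≤ ρ → N^(p/2-3) ≤ ρ → 1 ≤ p → p ≤ 12 →
    (∀ ξ ∈ Ξ, 0 ≤ ξ ∧ ξ ≤ 1) → SepN N Ξ →
    ∀ a : ℝ → ℂ, (∀ ξ ∈ Ξ, ‖a ξ‖ ≤ 1) →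
    ∫ x in cube 0 ρ, ‖∑ ξ ∈ Ξ, a ξ * e (x 0 * ξ + x 1 * ξ^2 + x 2 * ξ^3)‖^p ≤ C * N^(p/2+ε) * ρ^3 := by
  obtain ⟨C, N0, hC, hN0, hb⟩ := base hε
  set W : ℝ := Real.exp (2*π) with hW
  have hW1 : 1 ≤ W := Real.one_le_exp (by positivity)
  refine ⟨W^(36:ℝ) * (C * 2^(6+ε)), N0, ?_, hN0, ?_⟩
  · have h1 : 1 ≤ W^(36:ℝ) := Real.one_le_rpow hW1 (by norm_num)
    have h2 : (1:ℝ) ≤ 2^(6+ε) := Real.one_le_rpow (by norm_num) (by linarith)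
    exact one_le_mul_of_one_le_of_one_le h1 (one_le_mul_of_one_le_of_one_le hC h2)
  intro Ξ N ρ p hN hρ hρp hp1 hp hΞ hsep
  have hN1 : 1 ≤ N := by linarith
  have hNp : 0 < N := by linarith
  have hρ1 : 1 ≤ ρ := by nlinarith
  obtain ⟨L, τ, v, hL1, hL2, hv, hτ⟩ := tau_ex hρ1
  have hL0 : 0 < L := by linarith
  have hLi : 0 < L⁻¹ := inv_pos.2 hL0
  have hLN : 6*N*L⁻¹ ≤ 1 := by
    rw [← div_eq_mul_inv, div_le_one hL0]; nlinarith
  have hsepτ : ∀ ξ ∈ Ξ, ∀ η ∈ Ξ, ξ ≠ η → 1 ≤ 2*N*|τ ξ - τ η| := by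
    intro ξ hξ η hη hne
    have h1 := hsep ξ hξ η hη hne
    obtain ⟨-, -, h2, -⟩ := hτ ξ (hΞ ξ hξ).1 (hΞ ξ hξ).2
    obtain ⟨-, -, h3, -⟩ := hτ η (hΞ η hη).1 (hΞ η hη).2
    have h4 : |ξ - η| ≤ |ξ - τ ξ| + |τ ξ - τ η| + |η - τ η| := by
      have h5 : ξ - η = (ξ - τ ξ) + (τ ξ - τ η) - (η - τ η) := by ring
      calc |ξ - η| = |(ξ - τ ξ) + (τ ξ - τ η) - (η - τ η)| := by rw [← h5]
        _ ≤ |(ξ - τ ξ) + (τ ξ - τ η)| + |η - τ η| := abs_sub _ _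
        _ ≤ _ := by gcongr; exact abs_add_le _ _
    have h6 : N * |ξ - η| ≤ N * (L⁻¹ + |τ ξ - τ η| + L⁻¹) := by gcongr; linarith
    nlinarith
  have hinj : Set.InjOn τ Ξ := by
    intro ξ hξ η hη h
    by_contra hne
    have := hsepτ ξ hξ η hη hne
    rw [h, sub_self, abs_zero, mul_zero] at this
    linarith
  have hXm : ∀ t ∈ Ξ.image τ, ∃ ξ ∈ Ξ, τ ξ = t := fun t ht => Finset.mem_image.1 ht
  set A : ℝ := C * (2*N)^(p/2+ε) * ρ^3 with hA
  have hA0 : 0 ≤ A := by positivity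
  set g0 : ℝ → R3 → ℂ := fun ξ x => e (inner ℝ (om v (τ ξ)) x) with hg0
  have hbase : ∀ a : ℝ → ℂ, (∀ ξ ∈ Ξ, ‖a ξ‖ ≤ 1) → ∫ x in cube 0 ρ, ‖∑ ξ ∈ Ξ, a ξ * g0 ξ x‖^p ≤ A := by
    intro a ha
    set a' : ℝ → ℂ := fun t => a (Function.invFunOn τ Ξ t) with ha'
    have hinv : ∀ ξ ∈ Ξ, Function.invFunOn τ Ξ (τ ξ) = ξ := fun ξ hξ => hinj.leftInvOn_invFunOn hξ
    have h1 : ∀ x, ∑ ξ ∈ Ξ, a ξ * g0 ξ x = es a' v (Ξ.image τ) x := by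
      intro x
      unfold es
      rw [Finset.sum_image hinj]
      refine Finset.sum_congr rfl fun ξ hξ => ?_
      simp only [ha', hinv ξ hξ, hg0]
    simp only [h1]
    refine hb v (Ξ.image τ) (2*N) ρ L p (by linarith) hρ1 (by linarith) ?_ (by linarith) hp hL1 hL2 ?_ ?_ ?_ ?_ a' ?_
    · rw [Real.mul_rpow (by norm_num) hNp.le]
      have h2 : (2:ℝ)^(p/2-3) ≤ 2^(3:ℝ) := Real.rpow_le_rpow_of_exponent_le (by norm_num) (by linarith)
      have h3 : (2:ℝ)^(3:ℝ) = 8 := by norm_num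
      rw [h3] at h2
      gcongr
    · intro t ht
      obtain ⟨ξ, hξ, rfl⟩ := hXm t ht
      obtain ⟨h2, h3, -⟩ := hτ ξ (hΞ ξ hξ).1 (hΞ ξ hξ).2
      exact ⟨h2, h3⟩
    · intro t ht s hs hne
      obtain ⟨ξ, hξ, rfl⟩ := hXm t ht
      obtain ⟨η, hη, rfl⟩ := hXm s hs
      exact hsepτ ξ hξ η hη (fun h => hne (by rw [h]))
    · intro t _
      refine (hv t).1.trans ?_
      gcongr
      nlinarith
    · intro t ht
      obtain ⟨ξ, hξ, rfl⟩ := hXm t ht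
      obtain ⟨-, -, -, n1, h1⟩ := hτ ξ (hΞ ξ hξ).1 (hΞ ξ hξ).2
      obtain ⟨-, n2, h2⟩ := hv (τ ξ)
      exact ⟨n1, n2, h1, h2⟩
    · intro t ht
      obtain ⟨ξ, hξ, rfl⟩ := hXm t ht
      simp only [ha', hinv ξ hξ]
      exact ha ξ hξ
  have hρL : ρ * L⁻¹ ≤ 1/6 := by
    rw [← div_eq_mul_inv, div_le_div_iff₀ hL0 (by norm_num)]; linarith
  set d0 : ℝ → ℝ := fun ξ => ρ * (ξ - τ ξ) with hd0
  set d1 : ℝ → ℝ := fun ξ => ρ * (ξ^2 - ((τ ξ)^2 + v (τ ξ))) with hd1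
  set d2 : ℝ → ℝ := fun ξ => ρ * (ξ^3 - ((τ ξ)^3 + 3 * τ ξ * v (τ ξ))) with hd2
  have hρp : 0 < ρ := by linarith
  have hdall : ∀ ξ ∈ Ξ, |d0 ξ| ≤ 1 ∧ |d1 ξ| ≤ 1 ∧ |d2 ξ| ≤ 1 := by
    intro ξ hξ
    obtain ⟨hx0, hx1⟩ := hΞ ξ hξ
    obtain ⟨t0, t1, t2, -⟩ := hτ ξ hx0 hx1
    have hvv := (hv (τ ξ)).1
    set t := τ ξ
    have hkey : ∀ z K : ℝ, K ≤ 6 → |z| ≤ K * L⁻¹ → |ρ * z| ≤ 1 := by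
      intro z K hK hz
      rw [abs_mul, abs_of_pos hρp]
      calc ρ * |z| ≤ ρ * (6 * L⁻¹) := by
            gcongr
            exact hz.trans (by gcongr)
        _ = 6 * (ρ * L⁻¹) := by ring
        _ ≤ 1 := by linarith
    refine ⟨hkey _ 1 (by norm_num) (by linarith), hkey _ 3 (by norm_num) ?_, hkey _ 6 (by norm_num) ?_⟩
    · have h1 : ξ^2 - (t^2 + v t) = (ξ - t) * (ξ + t) - v t := by ring
      rw [h1]
      have h2 : |(ξ - t) * (ξ + t)| ≤ L⁻¹ * 2 := by
        rw [abs_mul, abs_of_nonneg (show 0 ≤ ξ + t by linarith)]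
        gcongr; linarith
      have := abs_sub ((ξ - t) * (ξ + t)) (v t)
      linarith
    · have h1 : ξ^3 - (t^3 + 3*t*v t) = (ξ - t) * (ξ^2+ξ*t+t^2) - 3*t*v t := by ring
      rw [h1]
      have h2 : |(ξ - t) * (ξ^2+ξ*t+t^2)| ≤ L⁻¹ * 3 := by
        rw [abs_mul, abs_of_nonneg (show 0 ≤ ξ^2+ξ*t+t^2 by positivity)]
        gcongr; nlinarith
      have h3 : |3*t*v t| ≤ 3 * L⁻¹ := by
        rw [abs_mul, abs_of_nonneg (show 0 ≤ 3*t by linarith)]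
        gcongr; linarith
      have := abs_sub ((ξ - t) * (ξ^2+ξ*t+t^2)) (3*t*v t)
      linarith
  have hy : ∀ i : Fin 3, ∀ x ∈ cube 0 ρ, |x i / ρ| ≤ 1 := by
    intro i x hx
    have h1 := hx i
    simp only [PiLp.zero_apply, Set.mem_Icc, zero_add] at h1
    rw [abs_of_nonneg (div_nonneg h1.1 hρp.le), div_le_one hρp]
    exact h1.2
  have hym : ∀ i : Fin 3, Measurable (fun x : R3 => x i / ρ) := fun i => by fun_prop
  have hem : ∀ (d : ℝ → ℝ) (i : Fin 3) (ξ : ℝ), Measurable (fun x : R3 => e (d ξ * (x i / ρ))) := fun d i ξ =>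
    measurable_e.comp ((hym i).const_mul _)
  have hg0m : ∀ ξ, Measurable (g0 ξ) := fun ξ => measurable_e.comp (by fun_prop)
  have hg0b : ∀ ξ x, ‖g0 ξ x‖ ≤ 1 := fun ξ x => (norm_e _).le
  have hb1 := pert (cube_meas 0 ρ) (cube_fin 0 ρ) hg0m hg0b (hym 0) (hy 0) (d := d0) (fun ξ hξ => (hdall ξ hξ).1) hp1 hbase
  set g1 : ℝ → R3 → ℂ := fun ξ x => g0 ξ x * e (d0 ξ * (x 0 / ρ)) with hg1
  have hg1m : ∀ ξ, Measurable (g1 ξ) := fun ξ => (hg0m ξ).mul (hem d0 0 ξ)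
  have hg1b : ∀ ξ x, ‖g1 ξ x‖ ≤ 1 := fun ξ x => by rw [hg1]; simp only [norm_mul, norm_e, mul_one]; exact hg0b ξ x
  have hb2 := pert (cube_meas 0 ρ) (cube_fin 0 ρ) hg1m hg1b (hym 1) (hy 1) (d := d1) (fun ξ hξ => (hdall ξ hξ).2.1) hp1 hb1
  set g2 : ℝ → R3 → ℂ := fun ξ x => g1 ξ x * e (d1 ξ * (x 1 / ρ)) with hg2
  have hg2m : ∀ ξ, Measurable (g2 ξ) := fun ξ => (hg1m ξ).mul (hem d1 1 ξ)
  have hg2b : ∀ ξ x, ‖g2 ξ x‖ ≤ 1 := fun ξ x => by rw [hg2]; simp only [norm_mul, norm_e, mul_one]; exact hg1b ξ x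
  have hb3 := pert (cube_meas 0 ρ) (cube_fin 0 ρ) hg2m hg2b (hym 2) (hy 2) (d := d2) (fun ξ hξ => (hdall ξ hξ).2.2) hp1 hb2
  intro a ha
  have h4 := hb3 a ha
  have h5 : ∀ ξ (x : R3), g2 ξ x * e (d2 ξ * (x 2 / ρ)) = e (x 0 * ξ + x 1 * ξ^2 + x 2 * ξ^3) := by
    intro ξ x
    simp only [hg2, hg1, hg0]
    rw [← e_add, ← e_add, ← e_add, inner3]
    congr 1
    simp only [om, mk3_0, mk3_1, mk3_2, hd0, hd1, hd2]
    field_simp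
    ring
  simp only [h5] at h4
  refine h4.trans ?_
  have hWp : W^p ≤ W^(12:ℝ) := Real.rpow_le_rpow_of_exponent_le hW1 hp
  have h2p : (2:ℝ)^(p/2+ε) ≤ 2^(6+ε) := Real.rpow_le_rpow_of_exponent_le (by norm_num) (by linarith)
  calc W^p * (W^p * (W^p * A)) ≤ W^(12:ℝ) * (W^(12:ℝ) * (W^(12:ℝ) * A)) := by gcongr
    _ = W^(36:ℝ) * A := by
      rw [← mul_assoc, ← mul_assoc, ← Real.rpow_add (by linarith), ← Real.rpow_add (by linarith)]
      norm_num
    _ = W^(36:ℝ) * (C * (2^(p/2+ε) * N^(p/2+ε)) * ρ^3) := by rw [hA, Real.mul_rpow (by norm_num) hNp.le]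
    _ ≤ W^(36:ℝ) * (C * (2^(6+ε) * N^(p/2+ε)) * ρ^3) := by gcongr
    _ = _ := by ring

/-! ### P28: conclusion -/
theorem cov {f : R3 → ℝ} (hf0 : ∀ x, 0 ≤ f x) (hfi : ∀ c r, IntegrableOn f (cube c r)) {ρ r B : ℝ} (hρ : 0 < ρ) (hr : ρ ≤ r)
    (hB : ∀ c, ∫ x in cube c ρ, f x ≤ B) (c : R3) : ∫ x in cube c r, f x ≤ 8*(r/ρ)^3 * B := by
  have hB0 : 0 ≤ B := le_trans (integral_nonneg hf0) (hB c)
  set n : ℕ := ⌈r/ρ⌉₊ with hn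
  have h1 : r/ρ ≤ n := Nat.le_ceil _
  have h1' : 1 ≤ r/ρ := by rwa [le_div_iff₀ hρ, one_mul]
  have h2 : (n:ℝ) ≤ 2*(r/ρ) := by
    have := Nat.ceil_lt_add_one (show 0 ≤ r/ρ by linarith)
    linarith
  have hn0 : 0 < n := by
    have : (0:ℝ) < n := by linarith
    exact_mod_cast this
  set I : Finset (ℕ × ℕ × ℕ) := (Finset.range n) ×ˢ (Finset.range n) ×ˢ (Finset.range n) with hI
  set cc : ℕ × ℕ × ℕ → R3 := fun q => mk3 (c 0 + q.1*ρ) (c 1 + q.2.1*ρ) (c 2 + q.2.2*ρ) with hcc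
  have hex : ∀ z w : ℝ, w ≤ z → z ≤ w + r → ∃ i ∈ Finset.range n, w + (i:ℕ)*ρ ≤ z ∧ z ≤ w + (i:ℕ)*ρ + ρ := by
    intro z w hz1 hz2
    have h3 : 0 ≤ (z-w)/ρ := div_nonneg (by linarith) hρ.le
    have h4 := Nat.floor_le h3
    have h5 := Nat.lt_floor_add_one ((z-w)/ρ)
    have h6 : (z-w)/ρ ≤ n := le_trans (by gcongr; linarith) h1
    rw [le_div_iff₀ hρ] at h4
    rw [div_lt_iff₀ hρ] at h5
    by_cases h : ⌊(z-w)/ρ⌋₊ < n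
    · exact ⟨_, Finset.mem_range.2 h, by linarith, by linarith⟩
    · push Not at h
      have h7 : (n:ℝ) ≤ ⌊(z-w)/ρ⌋₊ := by exact_mod_cast h
      rw [div_le_iff₀ hρ] at h6
      have h8 : ((n-1:ℕ):ℝ) = n - 1 := by
        rw [Nat.cast_sub (by omega)]; simp
      refine ⟨n-1, Finset.mem_range.2 (by omega), ?_, ?_⟩
      · rw [h8]; nlinarith
      · rw [h8]; nlinarith
  calc ∫ x in cube c r, f x = ∫ x, (cube c r).indicator f x := (integral_indicator (cube_meas _ _)).symm
    _ ≤ ∫ x, ∑ q ∈ I, (cube (cc q) ρ).indicator f x := by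
        refine integral_mono ((integrable_indicator_iff (cube_meas _ _)).2 (hfi _ _)) ?_ ?_
        · exact integrable_finsetSum _ fun q _ => (integrable_indicator_iff (cube_meas _ _)).2 (hfi _ _)
        · intro x
          show (cube c r).indicator f x ≤ ∑ q ∈ I, (cube (cc q) ρ).indicator f x
          have hnn : ∀ q ∈ I, 0 ≤ (cube (cc q) ρ).indicator f x := fun q _ => Set.indicator_nonneg (fun y _ => hf0 y) x
          by_cases hx : x ∈ cube c r
          · obtain ⟨i0, hi0, a0, b0⟩ := hex (x 0) (c 0) (hx 0).1 (hx 0).2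
            obtain ⟨i1, hi1, a1, b1⟩ := hex (x 1) (c 1) (hx 1).1 (hx 1).2
            obtain ⟨i2, hi2, a2, b2⟩ := hex (x 2) (c 2) (hx 2).1 (hx 2).2
            have hq : (i0, i1, i2) ∈ I := Finset.mem_product.2 ⟨hi0, Finset.mem_product.2 ⟨hi1, hi2⟩⟩
            have h9 := Finset.single_le_sum hnn hq
            have hxq : x ∈ cube (cc (i0, i1, i2)) ρ := by
              intro i
              fin_cases i
              · exact ⟨a0, b0⟩
              · exact ⟨a1, b1⟩
              · exact ⟨a2, b2⟩
            rw [Set.indicator_of_mem hxq] at h9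
            rw [Set.indicator_of_mem hx]
            exact h9
          · rw [Set.indicator_of_notMem hx]
            exact Finset.sum_nonneg hnn
    _ = ∑ q ∈ I, ∫ x in cube (cc q) ρ, f x := by
        rw [integral_finsetSum _ fun q _ => (integrable_indicator_iff (cube_meas _ _)).2 (hfi _ _)]
        exact Finset.sum_congr rfl fun q _ => integral_indicator (cube_meas _ _)
    _ ≤ ∑ q ∈ I, B := Finset.sum_le_sum fun q _ => hB _
    _ = (n:ℝ)^3 * B := by
        rw [Finset.sum_const, hI, Finset.card_product, Finset.card_product, Finset.card_range, nsmul_eq_mul]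
        push_cast; ring
    _ ≤ (2*(r/ρ))^3 * B := by gcongr
    _ = _ := by ring

theorem cube_tr (f : R3 → ℝ) (c : R3) (ρ : ℝ) : ∫ x in cube c ρ, f x = ∫ x in cube 0 ρ, f (x + c) := by
  have h := (measurePreserving_add_right (volume : Measure R3) c).setIntegral_preimage_emb (measurableEmbedding_addRight c) f (cube c ρ)
  rw [← h]
  congr 2
  ext x
  simp only [cube, Set.mem_preimage, Set.mem_ofPred_eq, PiLp.add_apply, PiLp.zero_apply, Set.mem_Icc, zero_add]
  refine forall_congr' fun i => ?_
  constructor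
  · rintro ⟨h1, h2⟩; constructor <;> linarith
  · rintro ⟨h1, h2⟩; constructor <;> linarith

set_option maxHeartbeats 1000000 in
/-- **Corollary 1.4.** For `1/3 ≤ β ≤ 1`, `2 ≤ p ≤ 6 + 2/β` and `r ≥ R^{max(2β,1)}`,
the normalized `L^p` average over any `r`-cube of an exponential sum over an
`R^{-β}`-separated set `Ξ ⊆ [0,1]` with `#Ξ ≤ R^β` and unimodular-bounded
coefficients is at most `C_ε R^{βp/2+ε}`. -/
theorem smallcap_exp_sum_cor :
    ∀ ε > (0:ℝ), ∃ C > (0:ℝ), ∀ R β p r : ℝ, 2 ≤ R → β ∈ Set.Icc (1/3 : ℝ) 1 →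
    2 ≤ p → p ≤ 6 + 2/β → R ^ (max (2*β) 1) ≤ r →
    ∀ c : R3, ∀ Ξ : Finset ℝ, (↑Ξ ⊆ Set.Icc (0:ℝ) 1) → ((Ξ.card : ℝ) ≤ R ^ β) →
    (∀ ξ ∈ Ξ, ∀ η ∈ Ξ, ξ ≠ η → R ^ (-β) ≤ |ξ - η|) →
    ∀ a : ℝ → ℂ, (∀ ξ ∈ Ξ, ‖a ξ‖ ≤ 1) →
    (r ^ 3)⁻¹ *
        (∫ x in cube c r, ‖∑ ξ ∈ Ξ, a ξ * e (x 0 * ξ + x 1 * ξ^2 + x 2 * ξ^3)‖ ^ p)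
      ≤ C * R ^ (β * p / 2 + ε) := by
  intro ε hε
  obtain ⟨C, N0, hC, hN0, ho⟩ := onecube hε
  refine ⟨8*C + N0^(12:ℝ), by positivity, ?_⟩
  intro R β p r hR hβ hp2 hpβ hr c Ξ hΞ hcard hsep a ha
  obtain ⟨hβ1, hβ2⟩ := hβ
  have hR0 : 0 < R := by linarith
  have hβ0 : 0 < β := by linarith
  set N : ℝ := R^β with hN
  have hN1 : 1 ≤ N := Real.one_le_rpow (by linarith) hβ0.le
  have hNp : 0 < N := by linarith
  set ρ : ℝ := R^(max (2*β) 1) with hρ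
  have hρN : N^2 ≤ ρ := by
    have : N^2 = R^(2*β) := by rw [hN, ← Real.rpow_natCast, ← Real.rpow_mul hR0.le]; congr 1; push_cast; ring
    rw [this]
    exact Real.rpow_le_rpow_of_exponent_le (by linarith) (le_max_left _ _)
  have hρR : R ≤ ρ := by
    calc R = R^(1:ℝ) := (Real.rpow_one R).symm
      _ ≤ _ := Real.rpow_le_rpow_of_exponent_le (by linarith) (le_max_right _ _)
  have hρ0 : 0 < ρ := by linarith
  have hr0 : 0 < r := by linarith
  have hp12 : p ≤ 12 := by
    have : 2/β ≤ 6 := by rw [div_le_iff₀ hβ0]; linarith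
    linarith
  have hρp : N^(p/2-3) ≤ ρ := by
    refine le_trans ?_ hρR
    calc N^(p/2-3) = R^(β*(p/2-3)) := by rw [hN, ← Real.rpow_mul hR0.le]
      _ ≤ R^(1:ℝ) := by
        refine Real.rpow_le_rpow_of_exponent_le (by linarith) ?_
        have h1 : β * p ≤ β * (6 + 2/β) := by gcongr
        have h2 : β * (6 + 2/β) = 6*β + 2 := by field_simp
        linarith
      _ = R := Real.rpow_one R
  have hΞ' : ∀ ξ ∈ Ξ, 0 ≤ ξ ∧ ξ ≤ 1 := fun ξ hξ => hΞ hξ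
  have hsep' : SepN N Ξ := by
    intro ξ hξ η hη hne
    have h1 := hsep ξ hξ η hη hne
    rw [Real.rpow_neg hR0.le, ← hN, inv_le_iff_one_le_mul₀ hNp] at h1
    linarith
  set F : (ℝ → ℂ) → R3 → ℂ := fun b x => ∑ ξ ∈ Ξ, b ξ * e (x 0 * ξ + x 1 * ξ^2 + x 2 * ξ^3) with hF
  have hFm : ∀ b, Measurable (F b) := fun b => Finset.measurable_sum _ fun ξ _ =>
    (measurable_e.comp (by fun_prop)).const_mul _
  have hFb : ∀ b : ℝ → ℂ, (∀ ξ ∈ Ξ, ‖b ξ‖ ≤ 1) → ∀ x, ‖F b x‖ ≤ N := by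
    intro b hb x
    refine le_trans ?_ hcard
    refine (norm_sum_le _ _).trans ?_
    rw [← nsmul_one, ← Finset.sum_const]
    refine Finset.sum_le_sum fun ξ hξ => ?_
    rw [norm_mul, norm_e, mul_one]
    exact hb ξ hξ
  have hRN : N^(p/2+ε) ≤ R^(β*p/2+ε) := by
    rw [hN, ← Real.rpow_mul hR0.le]
    refine Real.rpow_le_rpow_of_exponent_le (by linarith) ?_
    nlinarith
  have hR1 : 1 ≤ R^(β*p/2+ε) := Real.one_le_rpow (by linarith) (by positivity)
  have hfi : ∀ c r, IntegrableOn (fun x => ‖F a x‖^p) (cube c r) := fun c r =>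
    int_bdd (cube_fin c r) (hFm a) (fun x _ => hFb a ha x) (cube_meas c r) (by linarith)
  show (r^3)⁻¹ * (∫ x in cube c r, ‖F a x‖^p) ≤ _
  have hN012 : 0 ≤ N0^(12:ℝ) := by positivity
  by_cases hNN : N0 ≤ N
  · have hone : ∀ c, ∫ x in cube c ρ, ‖F a x‖^p ≤ C * N^(p/2+ε) * ρ^3 := by
      intro c
      rw [cube_tr (fun x => ‖F a x‖^p)]
      have h1 := ho Ξ N ρ p hNN hρN hρp (by linarith) hp12 hΞ' hsep' (fun ξ => a ξ * e (c 0 * ξ + c 1 * ξ^2 + c 2 * ξ^3)) (by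
        intro ξ hξ
        rw [norm_mul, norm_e, mul_one]; exact ha ξ hξ)
      refine le_trans (le_of_eq ?_) h1
      refine integral_congr_ae (Filter.Eventually.of_forall fun x => ?_)
      simp only [hF]
      congr 2
      refine Finset.sum_congr rfl fun ξ _ => ?_
      rw [mul_assoc, ← e_add]
      congr 2
      simp only [PiLp.add_apply]
      ring
    have h2 := cov (fun x => by positivity) hfi hρ0 hr hone c
    calc (r^3)⁻¹ * (∫ x in cube c r, ‖F a x‖^p) ≤ (r^3)⁻¹ * (8*(r/ρ)^3 * (C * N^(p/2+ε) * ρ^3)) := by gcongr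
      _ = 8 * C * N^(p/2+ε) := by field_simp
      _ ≤ 8 * C * R^(β*p/2+ε) := by gcongr
      _ ≤ _ := by gcongr; linarith
  · push Not at hNN
    have h1 : ∫ x in cube c r, ‖F a x‖^p ≤ ∫ x in cube c r, N0^(12:ℝ) := by
      refine setIntegral_mono_on (hfi c r) (integrableOn_const (cube_fin c r).ne) (cube_meas c r) ?_
      intro x _
      calc ‖F a x‖^p ≤ N0^p := Real.rpow_le_rpow (norm_nonneg _) ((hFb a ha x).trans hNN.le) (by linarith)
        _ ≤ N0^(12:ℝ) := Real.rpow_le_rpow_of_exponent_le hN0 hp12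
    rw [setIntegral_const, cube_vol c hr0.le, smul_eq_mul] at h1
    calc (r^3)⁻¹ * (∫ x in cube c r, ‖F a x‖^p) ≤ (r^3)⁻¹ * (r^3 * N0^(12:ℝ)) := by gcongr
      _ = N0^(12:ℝ) * 1 := by field_simp
      _ ≤ (8*C + N0^(12:ℝ)) * R^(β*p/2+ε) := by
        gcongr
        linarith
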